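/- If A ⊆ ℝ³ is a Borel set with dim A = t > 1 and H^t(A) > 0, then there is a set E ⊆ I with dim E ≤ (3 − t)/2, such that for every θ ∈ I ∖ E, the set {y ∈ span γ(θ) : dim(ρ_θ^{−1}(y) ∩ A) ≥ t − 1} has positive H¹ measure. -/

import Mathlib

open MeasureTheory Metric Set
open scoped ENNReal RealInnerProductSpace

noncomputable section

abbrev E3 : Type := EuclideanSpace ℝ (Fin 3)

/-- Orthogonal projection onto the line spanned by `γ θ`:  `ρ_θ x = ⟨x, γ θ⟩ γ θ`. -/
def lineProj (γ : ℝ → E3) (θ : ℝ) (x : E3) : E3 := ⟪x, γ θ⟫ • γ θ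

/-!
STATEMENT 4 (Corollary 1.4, second part): if `A ⊆ ℝ³` is Borel with
`dim A = t > 1` and `H^t(A) > 0`, then there is `E ⊆ I` with `dim E ≤ (3-t)/2`
such that for every `θ ∈ I \ E`, the set of points `y` of the line spanned by
`γ θ` with `dim (ρ_θ⁻¹(y) ∩ A) ≥ t - 1` has positive `H¹` measure.
-/

section BoundedMeasurable

variable {Ω : Type*} [MeasurableSpace Ω]

/-- Bounded measurable complex functions. -/
def BddMeas (h : Ω → ℂ) : Prop := Measurable h ∧ ∃ B : ℝ, ∀ ω, ‖h ω‖ ≤ B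

lemma BddMeas.sum {κ : Type*} (T : Finset κ) {h : κ → Ω → ℂ} (hh : ∀ k ∈ T, BddMeas (h k)) :
    BddMeas (fun ω => ∑ k ∈ T, h k ω) := by
  choose! B hB using fun k hk => (hh k hk).2
  refine ⟨Finset.measurable_fun_sum T fun k hk => (hh k hk).1, ∑ k ∈ T, B k, fun ω => ?_⟩
  exact (norm_sum_le _ _).trans (Finset.sum_le_sum fun k hk => hB k hk ω)

lemma BddMeas.mul {f g : Ω → ℂ} (hf : BddMeas f) (hg : BddMeas g) :
    BddMeas (fun ω => f ω * g ω) := by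
  obtain ⟨hf, B, hB⟩ := hf
  obtain ⟨hg, D, hD⟩ := hg
  refine ⟨hf.mul hg, B * D, fun ω => ?_⟩
  rw [norm_mul]
  exact mul_le_mul (hB ω) (hD ω) (norm_nonneg _) ((norm_nonneg _).trans (hB ω))

lemma BddMeas.star {f : Ω → ℂ} (hf : BddMeas f) :
    BddMeas (fun ω => (starRingEnd ℂ) (f ω)) := by
  obtain ⟨hf, B, hB⟩ := hf
  refine ⟨Complex.continuous_conj.measurable.comp hf, B, fun ω => ?_⟩
  simpa using hB ω

lemma BddMeas.integrable {f : Ω → ℂ} (hf : BddMeas f) (P : Measure Ω) [IsFiniteMeasure P] :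
    Integrable f P := by
  obtain ⟨hf, B, hB⟩ := hf
  exact Integrable.of_bound hf.aestronglyMeasurable B (Filter.Eventually.of_forall hB)

lemma BddMeas.integrable_normSq {f : Ω → ℂ} (hf : BddMeas f) (P : Measure Ω)
    [IsFiniteMeasure P] : Integrable (fun ω => ‖f ω‖ ^ 2) P := by
  have := (hf.mul hf).integrable P
  simpa [norm_mul, sq] using this.norm

lemma lintegral_enorm_sq_eq {f : Ω → ℂ} (hf : BddMeas f) (P : Measure Ω) [IsFiniteMeasure P] :
    ∫⁻ ω, ‖f ω‖ₑ ^ 2 ∂P = ENNReal.ofReal (∫ ω, ‖f ω‖ ^ 2 ∂P) := by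
  rw [ofReal_integral_eq_lintegral_ofReal (hf.integrable_normSq P)
    (Filter.Eventually.of_forall fun _ => by positivity)]
  refine lintegral_congr fun ω => ?_
  rw [ENNReal.ofReal_pow (norm_nonneg _), ofReal_norm]

/-- Almost orthogonality: if each function fails to be orthogonal to at most `N` members of a
finite family, then the square norm of the sum is at most `N` times the sum of square norms. -/
lemma lintegral_sq_sum_le_of_almost_orthogonal (P : Measure Ω) [IsFiniteMeasure P] {κ : Type*}
    (T : Finset κ) (h : κ → Ω → ℂ) (hh : ∀ k ∈ T, BddMeas (h k)) (R : κ → κ → Prop)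
    [DecidableRel R] (hsymm : ∀ j k, R j k → R k j) (N : ℕ)
    (hN : ∀ k ∈ T, (T.filter (R k)).card ≤ N)
    (horth : ∀ j ∈ T, ∀ k ∈ T, ¬ R j k → ∫ ω, h j ω * (starRingEnd ℂ) (h k ω) ∂P = 0) :
    ∫⁻ ω, ‖∑ k ∈ T, h k ω‖ₑ ^ 2 ∂P ≤ N * ∑ k ∈ T, ∫⁻ ω, ‖h k ω‖ₑ ^ 2 ∂P := by
  rw [lintegral_enorm_sq_eq (BddMeas.sum T hh)]
  set I : κ → ℝ := fun k => ∫ ω, ‖h k ω‖ ^ 2 ∂P with hI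
  have hI0 : ∀ k, 0 ≤ I k := fun k => integral_nonneg fun ω => by positivity
  have e1 : ∑ k ∈ T, ∫⁻ ω, ‖h k ω‖ₑ ^ 2 ∂P = ENNReal.ofReal (∑ k ∈ T, I k) := by
    rw [ENNReal.ofReal_sum_of_nonneg fun k _ => hI0 k]
    exact Finset.sum_congr rfl fun k hk => lintegral_enorm_sq_eq (hh k hk) P
  rw [e1, ← ENNReal.ofReal_natCast, ← ENNReal.ofReal_mul (by positivity)]
  apply ENNReal.ofReal_le_ofReal
  have hintg : ∀ j ∈ T, ∀ k ∈ T, Integrable (fun ω => h j ω * (starRingEnd ℂ) (h k ω)) P :=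
    fun j hj k hk => ((hh j hj).mul (hh k hk).star).integrable P
  have e2 : ((∫ ω, ‖∑ k ∈ T, h k ω‖ ^ 2 ∂P : ℝ) : ℂ) =
      ∑ j ∈ T, ∑ k ∈ T, ∫ ω, h j ω * (starRingEnd ℂ) (h k ω) ∂P := by
    rw [← integral_complex_ofReal]
    have : ∀ ω, ((‖∑ k ∈ T, h k ω‖ ^ 2 : ℝ) : ℂ) =
        ∑ j ∈ T, ∑ k ∈ T, h j ω * (starRingEnd ℂ) (h k ω) := by
      intro ω
      rw [Complex.ofReal_pow, ← Complex.mul_conj', map_sum, Finset.sum_mul_sum]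
    simp_rw [this]
    rw [integral_finsetSum _ fun j hj => integrable_finsetSum _ fun k hk => hintg j hj k hk]
    exact Finset.sum_congr rfl fun j hj => integral_finsetSum _ fun k hk => hintg j hj k hk
  have e3 : ∀ j ∈ T, ∀ k ∈ T, ‖∫ ω, h j ω * (starRingEnd ℂ) (h k ω) ∂P‖ ≤
      if R j k then (I j + I k) / 2 else 0 := by
    intro j hj k hk
    split_ifs with hR
    · refine (norm_integral_le_integral_norm _).trans ?_
      have : (I j + I k) / 2 = ∫ ω, (‖h j ω‖ ^ 2 + ‖h k ω‖ ^ 2) / 2 ∂P := by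
        rw [integral_div, integral_add ((hh j hj).integrable_normSq P)
          ((hh k hk).integrable_normSq P)]
      rw [this]
      refine integral_mono (hintg j hj k hk).norm ((((hh j hj).integrable_normSq P).add
        ((hh k hk).integrable_normSq P)).div_const 2) fun ω => ?_
      simp only [norm_mul, RCLike.norm_conj]
      nlinarith [sq_nonneg (‖h j ω‖ - ‖h k ω‖)]
    · rw [horth j hj k hk hR, norm_zero]
  have e4 : ∫ ω, ‖∑ k ∈ T, h k ω‖ ^ 2 ∂P ≤
      ∑ j ∈ T, ∑ k ∈ T, if R j k then (I j + I k) / 2 else 0 := by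
    have h0 : 0 ≤ ∫ ω, ‖∑ k ∈ T, h k ω‖ ^ 2 ∂P := integral_nonneg fun ω => by positivity
    rw [← abs_of_nonneg h0, ← Real.norm_eq_abs, ← Complex.norm_real, e2]
    refine (norm_sum_le _ _).trans (Finset.sum_le_sum fun j hj => ?_)
    exact (norm_sum_le _ _).trans (Finset.sum_le_sum fun k hk => e3 j hj k hk)
  refine e4.trans ?_
  have e5 : ∑ j ∈ T, ∑ k ∈ T, (if R j k then (I j + I k) / 2 else 0) =
      ∑ j ∈ T, ∑ k ∈ T, (if R j k then I j else 0) := by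
    have sw : ∑ j ∈ T, ∑ k ∈ T, (if R j k then I k else 0) =
        ∑ j ∈ T, ∑ k ∈ T, (if R j k then I j else 0) := by
      rw [Finset.sum_comm]
      refine Finset.sum_congr rfl fun j _ => Finset.sum_congr rfl fun k _ => ?_
      simp only [show R k j ↔ R j k from ⟨hsymm _ _, hsymm _ _⟩]
    have : ∀ j k, (if R j k then (I j + I k) / 2 else 0) =
        ((if R j k then I j else 0) + (if R j k then I k else 0)) / 2 := by
      intro j k; split_ifs <;> simp
    simp_rw [this, ← Finset.sum_div, Finset.sum_add_distrib]
    rw [sw]; ring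
  rw [e5, Finset.mul_sum]
  refine Finset.sum_le_sum fun j hj => ?_
  rw [← Finset.sum_filter, Finset.sum_const, nsmul_eq_mul]
  exact mul_le_mul_of_nonneg_right (by exact_mod_cast hN j hj) (hI0 j)

/-- Cauchy–Schwarz for the Lebesgue integral of extended nonnegative functions. -/
lemma lintegral_mul_sq_le (P : Measure Ω) {f g : Ω → ℝ≥0∞} (hf : AEMeasurable f P)
    (hg : AEMeasurable g P) :
    (∫⁻ ω, f ω * g ω ∂P) ^ 2 ≤ (∫⁻ ω, f ω ^ 2 ∂P) * ∫⁻ ω, g ω ^ 2 ∂P := by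
  have h := ENNReal.lintegral_mul_le_Lp_mul_Lq P Real.HolderConjugate.two_two hf hg
  simp only [Pi.mul_apply] at h
  calc _ ≤ _ := pow_le_pow_left' h 2
    _ = _ := by
      rw [mul_pow, ← ENNReal.rpow_natCast, ← ENNReal.rpow_natCast, ← ENNReal.rpow_mul,
        ← ENNReal.rpow_mul]
      norm_num

lemma enorm_sum_pow_six_le {κ : Type*} (T : Finset κ) (z : κ → ℂ) :
    ‖∑ k ∈ T, z k‖ₑ ^ 6 ≤ (T.card : ℝ≥0∞) ^ 5 * ∑ k ∈ T, ‖z k‖ₑ ^ 6 := by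
  have h := ENNReal.rpow_sum_le_const_mul_sum_rpow T (fun k => ‖z k‖ₑ) (p := 6) (by norm_num)
  calc _ ≤ (∑ k ∈ T, ‖z k‖ₑ) ^ 6 := pow_le_pow_left' (enorm_sum_le _ _) 6
    _ ≤ _ := by
      norm_num at h
      exact_mod_cast h

end BoundedMeasurable

section Decoupling

variable {Ω ι : Type*}

/-- `ψ` is uniformly convex and `C^{1,1}` on `[0,1]`, with generalised derivative `m`. -/
def QuadCurve (c : ℝ) (ψ m : ℝ → ℝ) : Prop :=
  ∀ x ∈ Icc (0 : ℝ) 1, ∀ y ∈ Icc (0 : ℝ) 1,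
    c * (y - x) ^ 2 ≤ ψ y - ψ x - m x * (y - x) ∧
    ψ y - ψ x - m x * (y - x) ≤ (y - x) ^ 2

lemma QuadCurve.slope_le {c : ℝ} {ψ m : ℝ → ℝ} (hQ : QuadCurve c ψ m) (hc : 0 ≤ c) {x y : ℝ}
    (hx : x ∈ Icc (0 : ℝ) 1) (hy : y ∈ Icc (0 : ℝ) 1) : |m y - m x| ≤ 2 * |y - x| := by
  have h1 := hQ x hx y hy
  have h2 := hQ y hy x hx
  have h3 : (m y - m x) * (y - x) ≤ 2 * (y - x) ^ 2 := by nlinarith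
  have h4 : 0 ≤ (m y - m x) * (y - x) := by nlinarith [mul_nonneg hc (sq_nonneg (y - x))]
  rcases eq_or_ne y x with rfl | hne
  · simp
  have h5 : 0 < |y - x| := abs_pos.mpr (sub_ne_zero.mpr hne)
  refine le_of_mul_le_mul_right ?_ h5
  rw [← abs_mul, abs_of_nonneg h4, mul_assoc, abs_mul_abs_self]
  nlinarith

/-- Slopes with respect to a tangent line are bounded below away from the point of tangency. -/
lemma QuadCurve.transversal {c : ℝ} {ψ m : ℝ → ℝ} (hQ : QuadCurve c ψ m) (hc : 0 ≤ c)
    {x y z ν : ℝ} (hx : x ∈ Icc (0 : ℝ) 1) (hy : y ∈ Icc (0 : ℝ) 1) (hz : z ∈ Icc (0 : ℝ) 1)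
    (hsep : (y + ν ≤ x ∧ z + ν ≤ x) ∨ (x + ν ≤ y ∧ x + ν ≤ z)) :
    2 * c * ν * |y - z| ≤ |ψ y - ψ z - m x * (y - z)| := by
  wlog hyz : y ≤ z generalizing y z
  · have := this hz hy (hsep.imp And.symm And.symm) (not_le.mp hyz).le
    rw [abs_sub_comm y z, ← abs_neg (ψ y - ψ z - m x * (y - z))]
    convert this using 2
    ring
  have mono : ∀ u ∈ Icc (0 : ℝ) 1, ∀ v ∈ Icc (0 : ℝ) 1, u ≤ v → 2 * c * (v - u) ≤ m v - m u := by
    intro u hu v hv huv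
    rcases huv.eq_or_lt with rfl | huv
    · simp
    have h1 := hQ u hu v hv
    have h2 := hQ v hv u hu
    have h3 : 2 * c * (v - u) * (v - u) ≤ (m v - m u) * (v - u) := by nlinarith
    exact le_of_mul_le_mul_right h3 (by linarith)
  rw [abs_sub_comm y z, abs_of_nonneg (sub_nonneg.mpr hyz)]
  rcases hsep with ⟨h1, h2⟩ | ⟨h1, h2⟩
  · have a1 := (hQ z hz y hy).1
    by_cases hν : 0 ≤ ν
    · have a2 := mono z hz x hx (by linarith)
      refine le_trans ?_ (le_abs_self _)
      have : 2 * c * ν * (z - y) ≤ (m x - m z) * (z - y) :=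
        mul_le_mul_of_nonneg_right (le_trans (by gcongr; linarith) a2) (by linarith)
      nlinarith [mul_nonneg hc (sq_nonneg (y - z))]
    · have : 2 * c * ν * (z - y) ≤ 0 := by
        have : 0 ≤ c * (-ν) * (z - y) := by
          apply mul_nonneg (mul_nonneg hc (by linarith)) (by linarith)
        nlinarith
      exact this.trans (abs_nonneg _)
  · have a1 := (hQ y hy z hz).1
    by_cases hν : 0 ≤ ν
    · have a2 := mono x hx y hy (by linarith)
      rw [← abs_neg]
      refine le_trans ?_ (le_abs_self _)
      have : 2 * c * ν * (z - y) ≤ (m y - m x) * (z - y) :=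
        mul_le_mul_of_nonneg_right (le_trans (by gcongr; linarith) a2) (by linarith)
      nlinarith [mul_nonneg hc (sq_nonneg (y - z))]
    · have : 2 * c * ν * (z - y) ≤ 0 := by
        have : 0 ≤ c * (-ν) * (z - y) := by
          apply mul_nonneg (mul_nonneg hc (by linarith)) (by linarith)
        nlinarith
      exact this.trans (abs_nonneg _)

lemma QuadCurve.rescale {c : ℝ} {ψ m : ℝ → ℝ} (hQ : QuadCurve c ψ m) {x₀ σ : ℝ} (hσ : 0 < σ)
    (hx₀ : 0 ≤ x₀) (hx₁ : x₀ + σ ≤ 1) :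
    QuadCurve c (fun x => (ψ (x₀ + σ * x) - ψ x₀ - m x₀ * (σ * x)) / σ ^ 2)
      (fun x => (m (x₀ + σ * x) - m x₀) / σ) := by
  have key : ∀ x ∈ Icc (0 : ℝ) 1, x₀ + σ * x ∈ Icc (0 : ℝ) 1 := fun x hx =>
    ⟨by nlinarith [hx.1], by nlinarith [hx.2]⟩
  intro x hx y hy
  have h := hQ _ (key x hx) _ (key y hy)
  have e : (ψ (x₀ + σ * y) - ψ x₀ - m x₀ * (σ * y)) / σ ^ 2 -
      (ψ (x₀ + σ * x) - ψ x₀ - m x₀ * (σ * x)) / σ ^ 2 -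
      (m (x₀ + σ * x) - m x₀) / σ * (y - x) =
      (ψ (x₀ + σ * y) - ψ (x₀ + σ * x) - m (x₀ + σ * x) * (x₀ + σ * y - (x₀ + σ * x))) / σ ^ 2 := by
    field_simp
    ring
  simp only []
  rw [e, le_div_iff₀ (by positivity), div_le_iff₀ (by positivity)]
  constructor
  · nlinarith [h.1]
  · nlinarith [h.2]

/-- The sum of the modes `g i`, `i ∈ S`. -/
def modeSum (g : ι → Ω → ℂ) (S : Finset ι) (ω : Ω) : ℂ := ∑ i ∈ S, g i ω

/-- The modes of `S` whose label lies in the `j`-th dyadic arc of level `k`. -/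
def dyadicArc (φ : ι → ℝ) (k : ℕ) (j : ℤ) (S : Finset ι) : Finset ι :=
  S.filter fun i => ⌊(2 : ℝ) ^ k * φ i⌋ = j

lemma mem_dyadicArc {φ : ι → ℝ} {k : ℕ} {j : ℤ} {S : Finset ι} {i : ι} :
    i ∈ dyadicArc φ k j S ↔ i ∈ S ∧ ⌊(2 : ℝ) ^ k * φ i⌋ = j := by
  simp [dyadicArc]

lemma modeSum_eq_sum_arcs (g : ι → Ω → ℂ) (φ : ι → ℝ) (k : ℕ) (S : Finset ι) (T : Finset ℤ)
    (hT : ∀ i ∈ S, ⌊(2 : ℝ) ^ k * φ i⌋ ∈ T) (ω : Ω) :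
    modeSum g S ω = ∑ j ∈ T, modeSum g (dyadicArc φ k j S) ω :=
  (Finset.sum_fiberwise_of_maps_to hT fun i => g i ω).symm

variable [MeasurableSpace Ω] (P : Measure Ω)

/-- The square of the `L⁶` norm of a sum of modes. -/
def sixNormSq (g : ι → Ω → ℂ) (S : Finset ι) : ℝ≥0∞ :=
  (∫⁻ ω, ‖modeSum g S ω‖ₑ ^ 6 ∂P) ^ (1 / 3 : ℝ)

/-- The sum over dyadic arcs of level `n` of the squares of the `L⁶` norms. -/
def arcSqSum (g : ι → Ω → ℂ) (φ : ι → ℝ) (n : ℕ) (S : Finset ι) : ℝ≥0∞ :=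
  ∑' j : ℤ, sixNormSq P g (dyadicArc φ n j S)

lemma sixNormSq_pow (g : ι → Ω → ℂ) (S : Finset ι) :
    sixNormSq P g S ^ 3 = ∫⁻ ω, ‖modeSum g S ω‖ₑ ^ 6 ∂P := by
  rw [sixNormSq, ← ENNReal.rpow_natCast, ← ENNReal.rpow_mul]
  norm_num

lemma sixNormSq_empty (g : ι → Ω → ℂ) : sixNormSq P g ∅ = 0 := by
  simp [sixNormSq, modeSum]

/-- `ι`-indexed modes adapted to the `4⁻ⁿ`-neighbourhood of the curve `ψ`. -/
structure CurveModes (n : ℕ) (ψ m : ℝ → ℝ) (g : ι → Ω → ℂ) (φ b d : ι → ℝ)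
    (S : Finset ι) : Prop where
  bddMeas : ∀ i ∈ S, BddMeas (g i)
  label : ∀ i ∈ S, φ i ∈ Ico (0 : ℝ) 1
  near_fst : ∀ i ∈ S, |b i - φ i| ≤ (1 / 4) ^ n
  near_snd : ∀ i ∈ S, |d i - ψ (φ i) - m (φ i) * (b i - φ i)| ≤ (1 / 4) ^ n
  orth : ∀ i ∈ S, ∀ k ∈ S, ∀ l ∈ S, ∀ i' ∈ S, ∀ k' ∈ S, ∀ l' ∈ S,
    ∫ ω, (g i ω * (g k ω * g l ω)) * (starRingEnd ℂ) (g i' ω * (g k' ω * g l' ω)) ∂P ≠ 0 →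
    |b i + b k + b l - (b i' + b k' + b l')| ≤ (1 / 4) ^ n ∧
    ∀ x ∈ Icc (0 : ℝ) 1, |d i + d k + d l - (d i' + d k' + d l') -
      m x * (b i + b k + b l - (b i' + b k' + b l'))| ≤ (1 / 4) ^ n

lemma CurveModes.mono {n : ℕ} {ψ m : ℝ → ℝ} {g : ι → Ω → ℂ} {φ b d : ι → ℝ} {S T : Finset ι}
    (h : CurveModes P n ψ m g φ b d S) (hT : T ⊆ S) : CurveModes P n ψ m g φ b d T where
  bddMeas i hi := h.bddMeas i (hT hi)
  label i hi := h.label i (hT hi)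
  near_fst i hi := h.near_fst i (hT hi)
  near_snd i hi := h.near_snd i (hT hi)
  orth i hi k hk l hl i' hi' k' hk' l' hl' :=
    h.orth i (hT hi) k (hT hk) l (hT hl) i' (hT hi') k' (hT hk') l' (hT hl')

variable (ι) in
/-- The decoupling inequality at scale `4⁻ⁿ` holds with constant `K`. -/
def DecouplingBound (c : ℝ) (n : ℕ) (K : ℝ≥0∞) : Prop :=
  ∀ (ψ m : ℝ → ℝ), QuadCurve c ψ m → ∀ (g : ι → Ω → ℂ) (φ b d : ι → ℝ) (S : Finset ι),
    CurveModes P n ψ m g φ b d S → ∫⁻ ω, ‖modeSum g S ω‖ₑ ^ 6 ∂P ≤ K * arcSqSum P g φ n S ^ 3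

/-- All labels of `S` lie in one dyadic arc of level `p`. -/
def InOneArc (φ : ι → ℝ) (p : ℕ) (S : Finset ι) : Prop :=
  ∃ j : ℤ, ∀ i ∈ S, ⌊(2 : ℝ) ^ p * φ i⌋ = j

/-- The labels of `S` and `T` are separated by at least `2⁻ᵘ`. -/
def LabelsSeparated (φ : ι → ℝ) (u : ℕ) (S T : Finset ι) : Prop :=
  (∀ i ∈ S, ∀ k ∈ T, φ i + (1 / 2) ^ u ≤ φ k) ∨ (∀ i ∈ S, ∀ k ∈ T, φ k + (1 / 2) ^ u ≤ φ i)

variable (ι) in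
/-- The asymmetric bilinear decoupling inequality holds with constant `M`. -/
def BilinearBound (c : ℝ) (n u p q : ℕ) (M : ℝ≥0∞) : Prop :=
  ∀ (ψ m : ℝ → ℝ), QuadCurve c ψ m → ∀ (g : ι → Ω → ℂ) (φ b d : ι → ℝ) (S T R : Finset ι),
    CurveModes P n ψ m g φ b d R → S ⊆ R → T ⊆ R → InOneArc φ p S → InOneArc φ q T →
    LabelsSeparated φ u S T →
    ∫⁻ ω, ‖modeSum g S ω‖ₑ ^ 2 * ‖modeSum g T ω‖ₑ ^ 4 ∂P ≤
      M * arcSqSum P g φ n S * arcSqSum P g φ n T ^ 2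

variable {P}

lemma bddMeas_modeSum {g : ι → Ω → ℂ} {S : Finset ι} (h : ∀ i ∈ S, BddMeas (g i)) :
    BddMeas (modeSum g S) :=
  BddMeas.sum S h

lemma floor_mem_range {k : ℕ} {x : ℝ} (hx : x ∈ Ico (0 : ℝ) 1) :
    ⌊(2 : ℝ) ^ k * x⌋ ∈ Finset.Ico (0 : ℤ) (2 ^ k) := by
  have h2 : (0 : ℝ) < 2 ^ k := by positivity
  rw [Finset.mem_Ico, Int.le_floor, Int.floor_lt]
  push_cast
  exact ⟨mul_nonneg h2.le hx.1, by nlinarith [hx.2]⟩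

lemma floor_two_pow_eq_of_le {k l : ℕ} (hkl : k ≤ l) {x y : ℝ}
    (h : ⌊(2 : ℝ) ^ l * x⌋ = ⌊(2 : ℝ) ^ l * y⌋) : ⌊(2 : ℝ) ^ k * x⌋ = ⌊(2 : ℝ) ^ k * y⌋ := by
  have key : ∀ z : ℝ, ⌊(2 : ℝ) ^ k * z⌋ = ⌊(2 : ℝ) ^ l * z⌋ / (2 ^ (l - k) : ℕ) := by
    intro z
    rw [← Int.floor_div_natCast]
    congr 1
    push_cast
    rw [eq_div_iff (by positivity)]
    have : (2 : ℝ) ^ l = 2 ^ k * 2 ^ (l - k) := by rw [← pow_add]; congr 1; omega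
    rw [this]; ring
  rw [key, key, h]

lemma dyadicArc_dyadicArc_of_le {φ : ι → ℝ} {k n : ℕ} (hk : k ≤ n) {a : ℤ} (S : Finset ι) {j : ℤ}
    {i₀ : ι} (hi₀ : i₀ ∈ dyadicArc φ n j S) (h : ⌊(2 : ℝ) ^ k * φ i₀⌋ = a) :
    dyadicArc φ n j (dyadicArc φ k a S) = dyadicArc φ n j S := by
  ext i
  simp only [mem_dyadicArc] at *
  constructor
  · rintro ⟨⟨h1, h2⟩, h3⟩; exact ⟨h1, h3⟩
  · rintro ⟨h1, h2⟩
    exact ⟨⟨h1, by rw [← h]; exact floor_two_pow_eq_of_le hk (by rw [h2, hi₀.2])⟩, h2⟩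

variable (P) in
/-- The arc sum splits over coarser arcs. -/
lemma tsum_arcSqSum (g : ι → Ω → ℂ) (φ : ι → ℝ) {k n : ℕ} (hk : k ≤ n) (S : Finset ι) :
    ∑' a : ℤ, arcSqSum P g φ n (dyadicArc φ k a S) = arcSqSum P g φ n S := by
  unfold arcSqSum
  rw [ENNReal.tsum_comm]
  refine tsum_congr fun j => ?_
  rcases (dyadicArc φ n j S).eq_empty_or_nonempty with h | ⟨i₀, hi₀⟩
  · rw [h, sixNormSq_empty, ENNReal.tsum_eq_zero]
    intro a
    have : dyadicArc φ n j (dyadicArc φ k a S) = ∅ := by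
      apply Finset.eq_empty_of_forall_notMem
      intro i hi
      simp only [mem_dyadicArc] at hi
      have : i ∈ dyadicArc φ n j S := mem_dyadicArc.mpr ⟨hi.1.1, hi.2⟩
      simp [h] at this
    rw [this, sixNormSq_empty]
  · rw [tsum_eq_single ⌊(2 : ℝ) ^ k * φ i₀⌋, dyadicArc_dyadicArc_of_le hk S hi₀ rfl]
    intro a ha
    have : dyadicArc φ n j (dyadicArc φ k a S) = ∅ := by
      apply Finset.eq_empty_of_forall_notMem
      intro i hi
      simp only [mem_dyadicArc] at hi hi₀
      apply ha
      rw [← hi.1.2]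
      exact floor_two_pow_eq_of_le hk (by rw [hi.2, hi₀.2])
    rw [this, sixNormSq_empty]

lemma measurable_enorm_modeSum_pow {g : ι → Ω → ℂ} {S : Finset ι} (h : ∀ i ∈ S, BddMeas (g i))
    (k : ℕ) : Measurable fun ω => ‖modeSum g S ω‖ₑ ^ k :=
  ((bddMeas_modeSum h).1.enorm).pow_const k

variable (P) in
lemma lintegral_six_modeSum_le_card (g : ι → Ω → ℂ) (φ : ι → ℝ) (n : ℕ) (S : Finset ι)
    (hg : ∀ i ∈ S, BddMeas (g i)) (hφ : ∀ i ∈ S, φ i ∈ Ico (0 : ℝ) 1) :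
    ∫⁻ ω, ‖modeSum g S ω‖ₑ ^ 6 ∂P ≤ 2 ^ (5 * n) * arcSqSum P g φ n S ^ 3 := by
  have hsub : ∀ j, ∀ i ∈ dyadicArc φ n j S, BddMeas (g i) := fun j i hi =>
    hg i (mem_dyadicArc.mp hi).1
  calc ∫⁻ ω, ‖modeSum g S ω‖ₑ ^ 6 ∂P
      ≤ ∫⁻ ω, 2 ^ (5 * n) * ∑ j ∈ Finset.Ico (0 : ℤ) (2 ^ n),
          ‖modeSum g (dyadicArc φ n j S) ω‖ₑ ^ 6 ∂P := by
        refine lintegral_mono fun ω => ?_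
        simp only []
        rw [modeSum_eq_sum_arcs g φ n S _ (fun i hi => floor_mem_range (hφ i hi))]
        refine (enorm_sum_pow_six_le _ _).trans (le_of_eq ?_)
        congr 1
        have h2 : ((2 : ℤ) ^ n).toNat = 2 ^ n := by
          rw [← Int.toNat_natCast (2 ^ n)]; norm_cast
        rw [Int.card_Ico, mul_comm, pow_mul, sub_zero, h2]
        simp
    _ = 2 ^ (5 * n) * ∑ j ∈ Finset.Ico (0 : ℤ) (2 ^ n),
          sixNormSq P g (dyadicArc φ n j S) ^ 3 := by
        rw [lintegral_const_mul, lintegral_finsetSum]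
        · simp_rw [sixNormSq_pow]
        · exact fun j _ => measurable_enorm_modeSum_pow (hsub j) 6
        · exact Finset.measurable_fun_sum _ fun j _ => measurable_enorm_modeSum_pow (hsub j) 6
    _ ≤ 2 ^ (5 * n) * arcSqSum P g φ n S ^ 3 := by
        gcongr
        have : ∀ j, sixNormSq P g (dyadicArc φ n j S) ≤ arcSqSum P g φ n S := fun j =>
          ENNReal.le_tsum j
        calc ∑ j ∈ Finset.Ico (0 : ℤ) (2 ^ n), sixNormSq P g (dyadicArc φ n j S) ^ 3
            ≤ ∑ j ∈ Finset.Ico (0 : ℤ) (2 ^ n),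
              sixNormSq P g (dyadicArc φ n j S) * arcSqSum P g φ n S ^ 2 := by
              refine Finset.sum_le_sum fun j _ => ?_
              rw [pow_succ']
              gcongr
              exact this j
          _ ≤ arcSqSum P g φ n S * arcSqSum P g φ n S ^ 2 := by
              rw [← Finset.sum_mul]
              gcongr
              exact ENNReal.sum_le_tsum _
          _ = _ := by ring

variable (P) in
lemma decouplingBound_trivial (c : ℝ) (n : ℕ) : DecouplingBound ι P c n (2 ^ (5 * n)) :=
  fun _ _ _ g φ _ _ S h => lintegral_six_modeSum_le_card P g φ n S h.bddMeas h.label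

/-- Decoupling inside one arc of level `q`, by affine rescaling. -/
lemma DecouplingBound.rescale {c : ℝ} {n q : ℕ} (hq : q ≤ n) {K : ℝ≥0∞}
    (hK : DecouplingBound ι P c (n - q) K) {ψ m : ℝ → ℝ} (hQ : QuadCurve c ψ m)
    {g : ι → Ω → ℂ} {φ b d : ι → ℝ} {S : Finset ι} (hS : CurveModes P n ψ m g φ b d S)
    (harc : InOneArc φ q S) :
    ∫⁻ ω, ‖modeSum g S ω‖ₑ ^ 6 ∂P ≤ K * arcSqSum P g φ n S ^ 3 := by
  obtain ⟨a, ha⟩ := harc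
  rcases S.eq_empty_or_nonempty with rfl | ⟨i₀, hi₀⟩
  · simp [modeSum]
  set σ : ℝ := (1 / 2) ^ q with hσ
  have hσ0 : 0 < σ := by positivity
  have hσ2 : (2 : ℝ) ^ q * σ = 1 := by rw [hσ, ← mul_pow]; norm_num
  have hσ1 : σ ≤ 1 := pow_le_one₀ (by norm_num) (by norm_num)
  have hσsq : (1 / 4 : ℝ) ^ (n - q) * σ ^ 2 = (1 / 4) ^ n := by
    rw [hσ, ← pow_mul, mul_comm q 2, pow_mul]
    norm_num [← pow_add]
    omega
  set x₀ : ℝ := σ * a with hx₀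
  have hmem := floor_mem_range (k := q) (hS.label i₀ hi₀)
  rw [ha i₀ hi₀, Finset.mem_Ico] at hmem
  have ha0 : (0 : ℝ) ≤ a := by exact_mod_cast hmem.1
  have ha1 : (a : ℝ) + 1 ≤ 2 ^ q := by exact_mod_cast hmem.2
  have hx0 : 0 ≤ x₀ := by positivity
  have hx1 : x₀ + σ ≤ 1 := by
    rw [← hσ2, hx₀]; nlinarith
  have hQ' := hQ.rescale hσ0 hx0 hx1
  set ψ' := (fun x => (ψ (x₀ + σ * x) - ψ x₀ - m x₀ * (σ * x)) / σ ^ 2) with hψ'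
  set m' := (fun x => (m (x₀ + σ * x) - m x₀) / σ) with hm'
  have hback : ∀ x, x₀ + σ * ((x - x₀) / σ) = x := fun x => by field_simp; ring
  have hmodes : CurveModes P (n - q) ψ' m' g (fun i => (φ i - x₀) / σ) (fun i => (b i - x₀) / σ)
      (fun i => (d i - ψ x₀ - m x₀ * (b i - x₀)) / σ ^ 2) S := by
    refine ⟨hS.bddMeas, fun i hi => ?_, fun i hi => ?_, fun i hi => ?_, ?_⟩
    · have hfl := Int.floor_eq_iff.mp (ha i hi)
      have e : φ i = σ * ((2 : ℝ) ^ q * φ i) := by rw [← mul_assoc, mul_comm σ, hσ2, one_mul]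
      constructor
      · apply div_nonneg _ hσ0.le
        rw [e, hx₀]; nlinarith
      · rw [div_lt_one hσ0, e, hx₀]; nlinarith
    · rw [← sub_div, abs_div, abs_of_pos hσ0, div_le_iff₀ hσ0]
      have h1 := hS.near_fst i hi
      rw [← hσsq] at h1
      have : b i - x₀ - (φ i - x₀) = b i - φ i := by ring
      rw [this]
      refine h1.trans ?_
      gcongr
      nlinarith
    · have h1 := hS.near_snd i hi
      have e : (d i - ψ x₀ - m x₀ * (b i - x₀)) / σ ^ 2 - ψ' ((φ i - x₀) / σ) -
          m' ((φ i - x₀) / σ) * ((b i - x₀) / σ - (φ i - x₀) / σ) =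
          (d i - ψ (φ i) - m (φ i) * (b i - φ i)) / σ ^ 2 := by
        simp only [hψ', hm', hback]
        field_simp
        ring
      rw [e, abs_div, abs_of_pos (by positivity : 0 < σ ^ 2), div_le_iff₀ (by positivity), hσsq]
      exact h1
    · intro i hi k hk l hl i' hi' k' hk' l' hl' hne
      obtain ⟨h1, h2⟩ := hS.orth i hi k hk l hl i' hi' k' hk' l' hl' hne
      have e1 : (b i - x₀) / σ + (b k - x₀) / σ + (b l - x₀) / σ -
          ((b i' - x₀) / σ + (b k' - x₀) / σ + (b l' - x₀) / σ) =
          (b i + b k + b l - (b i' + b k' + b l')) / σ := by field_simp; ring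
      refine ⟨?_, fun x hx => ?_⟩
      · rw [e1, abs_div, abs_of_pos hσ0, div_le_iff₀ hσ0]
        refine h1.trans ?_
        rw [← hσsq]
        gcongr
        nlinarith
      · have h3 := h2 (x₀ + σ * x) ⟨by nlinarith [hx.1], by nlinarith [hx.2]⟩
        rw [e1]
        have e2 : (d i - ψ x₀ - m x₀ * (b i - x₀)) / σ ^ 2 +
            (d k - ψ x₀ - m x₀ * (b k - x₀)) / σ ^ 2 + (d l - ψ x₀ - m x₀ * (b l - x₀)) / σ ^ 2 -
            ((d i' - ψ x₀ - m x₀ * (b i' - x₀)) / σ ^ 2 +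
            (d k' - ψ x₀ - m x₀ * (b k' - x₀)) / σ ^ 2 +
            (d l' - ψ x₀ - m x₀ * (b l' - x₀)) / σ ^ 2) -
            m' x * ((b i + b k + b l - (b i' + b k' + b l')) / σ) =
            (d i + d k + d l - (d i' + d k' + d l') -
              m (x₀ + σ * x) * (b i + b k + b l - (b i' + b k' + b l'))) / σ ^ 2 := by
          simp only [hm']
          field_simp
          ring
        rw [e2, abs_div, abs_of_pos (by positivity : 0 < σ ^ 2), div_le_iff₀ (by positivity), hσsq]
        exact h3
  have hmain := hK ψ' m' hQ' g _ _ _ S hmodes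
  have hsum : arcSqSum P g (fun i => (φ i - x₀) / σ) (n - q) S = arcSqSum P g φ n S := by
    unfold arcSqSum
    rw [← (Equiv.addRight (-(2 ^ (n - q) * a))).tsum_eq]
    refine tsum_congr fun j => ?_
    congr 1
    ext i
    simp only [mem_dyadicArc, Equiv.coe_addRight]
    have : (2 : ℝ) ^ (n - q) * ((φ i - x₀) / σ) =
        2 ^ n * φ i + ((-(2 ^ (n - q) * a) : ℤ) : ℝ) := by
      have : (2 : ℝ) ^ n = 2 ^ (n - q) * 2 ^ q := by rw [← pow_add]; congr 1; omega
      rw [this, hx₀]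
      push_cast
      have h2 : (2 : ℝ) ^ q = σ⁻¹ := eq_inv_of_mul_eq_one_left hσ2
      rw [h2]
      field_simp
      ring
    rw [this, Int.floor_add_intCast, add_left_inj]
  rwa [hsum] at hmain

end Decoupling

section Bilinear

variable {Ω ι : Type*} [MeasurableSpace Ω] {P : Measure Ω}

lemma integral_sum_mul_conj_sum_eq_zero [IsFiniteMeasure P] {κ : Type*} (A B : Finset κ)
    (G : κ → Ω → ℂ) (hA : ∀ x ∈ A, BddMeas (G x)) (hB : ∀ x ∈ B, BddMeas (G x))
    (h : ∀ x ∈ A, ∀ y ∈ B, ∫ ω, G x ω * (starRingEnd ℂ) (G y ω) ∂P = 0) :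
    ∫ ω, (∑ x ∈ A, G x ω) * (starRingEnd ℂ) (∑ y ∈ B, G y ω) ∂P = 0 := by
  have hintg : ∀ x ∈ A, ∀ y ∈ B, Integrable (fun ω => G x ω * (starRingEnd ℂ) (G y ω)) P :=
    fun j hj k hk => ((hA j hj).mul (hB k hk).star).integrable P
  simp_rw [map_sum, Finset.sum_mul_sum]
  rw [integral_finsetSum _ fun j hj => integrable_finsetSum _ fun k hk => hintg j hj k hk]
  refine Finset.sum_eq_zero fun x hx => ?_
  rw [integral_finsetSum _ fun k hk => hintg x hx k hk]
  exact Finset.sum_eq_zero fun y hy => h x hx y hy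

/-- Frequency analysis behind the bilinear orthogonality step. -/
lemma CurveModes.abs_label_sub_le {c : ℝ} (hc : 0 < c) {n q u : ℕ} (hqn : 2 * q ≤ n)
    {ψ m : ℝ → ℝ} (hQ : QuadCurve c ψ m) {g : ι → Ω → ℂ} {φ b d : ι → ℝ} {S T R : Finset ι}
    (hR : CurveModes P n ψ m g φ b d R) (hS : S ⊆ R) (hT : T ⊆ R) (hTarc : InOneArc φ q T)
    (hsep : LabelsSeparated φ u S T) {i i' k k' l l' : ι} (hi : i ∈ S) (hi' : i' ∈ S)
    (hk : k ∈ T) (hk' : k' ∈ T) (hl : l ∈ T) (hl' : l' ∈ T)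
    (hne : ∫ ω, (g i ω * (g k ω * g l ω)) *
      (starRingEnd ℂ) (g i' ω * (g k' ω * g l' ω)) ∂P ≠ 0) :
    |φ i - φ i'| ≤ 12 / c * 2 ^ u * (1 / 4) ^ q := by
  obtain ⟨-, h2⟩ := hR.orth i (hS hi) k (hT hk) l (hT hl) i' (hS hi') k' (hT hk') l' (hT hl') hne
  have mem : ∀ i ∈ R, φ i ∈ Icc (0 : ℝ) 1 := fun i hi =>
    ⟨(hR.label i hi).1, (hR.label i hi).2.le⟩
  set δ : ℝ := (1 / 4) ^ n with hδ
  set σ : ℝ := (1 / 4) ^ q with hσ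
  have hδσ : δ ≤ σ := pow_le_pow_of_le_one (by norm_num) (by norm_num) (by omega)
  have hδ0 : 0 < δ := by positivity
  set x := φ k with hx
  have hxm := mem k (hT hk)
  have h3 := h2 x hxm
  -- modes labelled close to `x` lie close to the tangent line at `x`
  have near : ∀ i ∈ T, |d i - ψ x - m x * (b i - x)| ≤ 4 * σ := by
    intro i hi
    have hclose : |φ i - x| ≤ (1 / 2) ^ q := by
      obtain ⟨a, ha⟩ := hTarc
      have e1 := Int.floor_eq_iff.mp (ha i hi)
      have e2 := Int.floor_eq_iff.mp (ha k hk)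
      have e3 : |(2 : ℝ) ^ q * φ i - 2 ^ q * x| ≤ 1 := by rw [abs_le]; constructor <;> linarith
      rw [← mul_sub, abs_mul, abs_of_pos (by positivity)] at e3
      rw [one_div_pow, le_div_iff₀ (by positivity)]
      linarith
    have hcl2 : (φ i - x) ^ 2 ≤ σ := by
      rw [← sq_abs]
      calc |φ i - x| ^ 2 ≤ ((1 / 2) ^ q) ^ 2 := by gcongr
        _ = σ := by rw [hσ, ← pow_mul, mul_comm q 2, pow_mul]; norm_num
    have q1 := hQ x hxm (φ i) (mem i (hT hi))
    have q2 := hQ.slope_le hc.le hxm (mem i (hT hi))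
    have n1 := hR.near_fst i (hT hi)
    have n2 := hR.near_snd i (hT hi)
    have hle1 : |φ i - x| ≤ 1 := hclose.trans (pow_le_one₀ (by norm_num) (by norm_num))
    have q3 : |(m (φ i) - m x) * (b i - φ i)| ≤ 2 * σ := by
      rw [abs_mul]
      calc _ ≤ 2 * δ := by
            refine mul_le_mul (q2.trans (by linarith)) n1 (abs_nonneg _) (by norm_num)
        _ ≤ _ := by linarith
    have q4 : 0 ≤ c * (φ i - x) ^ 2 := by positivity
    have e : d i - ψ x - m x * (b i - x) = (d i - ψ (φ i) - m (φ i) * (b i - φ i)) +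
      (ψ (φ i) - ψ x - m x * (φ i - x)) + (m (φ i) - m x) * (b i - φ i) := by ring
    rw [e, abs_le]
    rw [abs_le] at n2 q3
    constructor <;> linarith
  have far : ∀ i ∈ S, |d i - m x * b i - (ψ (φ i) - m x * φ i)| ≤ 3 * σ := by
    intro i hi
    have q2 := hQ.slope_le hc.le hxm (mem i (hS hi))
    have n1 := hR.near_fst i (hS hi)
    have n2 := hR.near_snd i (hS hi)
    have hle1 : |φ i - x| ≤ 1 := by
      have := mem i (hS hi)
      rw [abs_le]; constructor <;> linarith [hxm.1, hxm.2, this.1, this.2]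
    have q3 : |(m (φ i) - m x) * (b i - φ i)| ≤ 2 * σ := by
      rw [abs_mul]
      calc _ ≤ 2 * δ := by
            refine mul_le_mul (q2.trans (by linarith)) n1 (abs_nonneg _) (by norm_num)
        _ ≤ _ := by linarith
    have e : d i - m x * b i - (ψ (φ i) - m x * φ i) = (d i - ψ (φ i) - m (φ i) * (b i - φ i)) +
      (m (φ i) - m x) * (b i - φ i) := by ring
    rw [e, abs_le]
    rw [abs_le] at n2 q3
    constructor <;> linarith
  have hbig : |ψ (φ i) - ψ (φ i') - m x * (φ i - φ i')| ≤ 24 * σ := by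
    have a1 := near k hk
    have a2 := near l hl
    have a3 := near k' hk'
    have a4 := near l' hl'
    have a5 := far i hi
    have a6 := far i' hi'
    rw [abs_le] at *
    constructor <;> linarith
  have htr := hQ.transversal hc.le (ν := (1 / 2) ^ u) hxm (mem i (hS hi)) (mem i' (hS hi')) (by
    rcases hsep with h | h
    · exact Or.inl ⟨h i hi k hk, h i' hi' k hk⟩
    · exact Or.inr ⟨h i hi k hk, h i' hi' k hk⟩)
  have h6 := htr.trans hbig
  have hpos : 0 < 2 * c * (1 / 2) ^ u := by positivity
  rw [← le_div_iff₀' hpos] at h6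
  refine h6.trans (le_of_eq ?_)
  rw [one_div_pow]
  field_simp
  ring

/-- The constant in the bilinear orthogonality step. -/
def orthConst (c : ℝ) : ℕ := 3 * (⌈12 / c⌉₊ + 1)

lemma BilinearBound.of_orthogonality [IsFiniteMeasure P] {c : ℝ} (hc : 0 < c) {n u p q : ℕ}
    (hqn : 2 * q ≤ n) {M : ℝ≥0∞} (h : BilinearBound ι P c n u (2 * q) q M) :
    BilinearBound ι P c n u p q (orthConst c * 2 ^ u * M) := by
  intro ψ m hQ g φ b d S T R hR hS hT _ hTarc hsep
  set h' : ℤ → Ω → ℂ := fun j ω =>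
    modeSum g (dyadicArc φ (2 * q) j S) ω * (modeSum g T ω * modeSum g T ω) with hh'
  have hsubS : ∀ j, dyadicArc φ (2 * q) j S ⊆ S := fun j => Finset.filter_subset _ _
  have bS : ∀ j, ∀ i ∈ dyadicArc φ (2 * q) j S, BddMeas (g i) := fun j i hi =>
    hR.bddMeas i (hS (hsubS j hi))
  have bT : ∀ i ∈ T, BddMeas (g i) := fun i hi => hR.bddMeas i (hT hi)
  have bh : ∀ j, BddMeas (h' j) := fun j =>
    (bddMeas_modeSum (bS j)).mul ((bddMeas_modeSum bT).mul (bddMeas_modeSum bT))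
  set I : Finset ℤ := Finset.Ico (0 : ℤ) (2 ^ (2 * q)) with hI
  set L : ℕ := (⌈12 / c⌉₊ + 1) * 2 ^ u with hL
  have step := lintegral_sq_sum_le_of_almost_orthogonal P I h' (fun j _ => bh j)
    (fun j k => |j - k| ≤ (L : ℤ)) (fun j k hjk => by rwa [abs_sub_comm]) (orthConst c * 2 ^ u) ?_ ?_
  · calc ∫⁻ ω, ‖modeSum g S ω‖ₑ ^ 2 * ‖modeSum g T ω‖ₑ ^ 4 ∂P
        = ∫⁻ ω, ‖∑ j ∈ I, h' j ω‖ₑ ^ 2 ∂P := by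
          refine lintegral_congr fun ω => ?_
          rw [hh', ← Finset.sum_mul, ← modeSum_eq_sum_arcs g φ (2 * q) S I
            (fun i hi => floor_mem_range (hR.label i (hS hi))), enorm_mul, enorm_mul]
          ring
      _ ≤ _ := step
      _ ≤ (orthConst c * 2 ^ u) * ∑ j ∈ I, M * arcSqSum P g φ n (dyadicArc φ (2 * q) j S) *
            arcSqSum P g φ n T ^ 2 := by
          push_cast
          gcongr with j hj
          have := h ψ m hQ g φ b d (dyadicArc φ (2 * q) j S) T R hR ((hsubS j).trans hS) hT
            ⟨j, fun i hi => (mem_dyadicArc.mp hi).2⟩ hTarc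
            (hsep.imp (fun h i hi => h i (hsubS j hi)) (fun h i hi => h i (hsubS j hi)))
          refine le_trans (le_of_eq ?_) this
          refine lintegral_congr fun ω => ?_
          rw [hh', enorm_mul, enorm_mul]
          ring
      _ ≤ _ := by
          rw [← Finset.sum_mul, ← Finset.mul_sum]
          have : ∑ j ∈ I, arcSqSum P g φ n (dyadicArc φ (2 * q) j S) ≤ arcSqSum P g φ n S :=
            (ENNReal.sum_le_tsum _).trans (tsum_arcSqSum P g φ hqn S).le
          calc _ ≤ (orthConst c * 2 ^ u) * (M * arcSqSum P g φ n S *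
            arcSqSum P g φ n T ^ 2) := by gcongr
            _ = _ := by ring
  · intro j _
    have : (I.filter fun k => |j - k| ≤ (L : ℤ)) ⊆ Finset.Icc (j - L) (j + L) := by
      intro k hk
      rw [Finset.mem_filter, abs_le] at hk
      rw [Finset.mem_Icc]
      omega
    refine (Finset.card_le_card this).trans ?_
    rw [Int.card_Icc, orthConst]
    have : 1 ≤ L := Nat.one_le_iff_ne_zero.mpr (by positivity)
    have e : 3 * (⌈12 / c⌉₊ + 1) * 2 ^ u = 3 * L := by rw [hL]; ring
    rw [e]
    omega
  · intro j _ j' _ hjj'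
    have hexp : ∀ j ω, h' j ω = ∑ x ∈ dyadicArc φ (2 * q) j S ×ˢ T ×ˢ T,
        g x.1 ω * (g x.2.1 ω * g x.2.2 ω) := by
      intro j ω
      simp only [hh', modeSum, Finset.sum_product, ← Finset.mul_sum, Finset.sum_mul_sum]
    simp_rw [hexp]
    have bG : ∀ j, ∀ x ∈ dyadicArc φ (2 * q) j S ×ˢ T ×ˢ T,
        BddMeas (fun ω => g x.1 ω * (g x.2.1 ω * g x.2.2 ω)) := by
      intro j x hx
      simp only [Finset.mem_product] at hx
      exact (bS j _ hx.1).mul ((bT _ hx.2.1).mul (bT _ hx.2.2))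
    refine integral_sum_mul_conj_sum_eq_zero _ _
      (fun (x : ι × ι × ι) ω => g x.1 ω * (g x.2.1 ω * g x.2.2 ω)) (bG j) (bG j') ?_
    intro x hx y hy
    simp only [Finset.mem_product] at hx hy
    by_contra hne
    apply hjj'
    have hxS := mem_dyadicArc.mp hx.1
    have hyS := mem_dyadicArc.mp hy.1
    have hcl := hR.abs_label_sub_le hc hqn hQ hS hT hTarc hsep hxS.1 hyS.1 hx.2.1 hy.2.1 hx.2.2
      hy.2.2 hne
    have hcl2 : |(2 : ℝ) ^ (2 * q) * φ x.1 - 2 ^ (2 * q) * φ y.1| ≤ 12 / c * 2 ^ u := by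
      rw [← mul_sub, abs_mul, abs_of_pos (by positivity)]
      calc _ ≤ (2 : ℝ) ^ (2 * q) * (12 / c * 2 ^ u * (1 / 4) ^ q) := by gcongr
        _ = _ := by rw [pow_mul, one_div_pow]; norm_num; field_simp
    have f1 := Int.floor_eq_iff.mp hxS.2
    have f2 := Int.floor_eq_iff.mp hyS.2
    have hLr : 12 / c * 2 ^ u + 1 ≤ (L : ℝ) := by
      rw [hL]; push_cast
      have := Nat.le_ceil (12 / c)
      have h1 : (1 : ℝ) ≤ 2 ^ u := one_le_pow₀ (by norm_num)
      nlinarith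
    have : |(j : ℝ) - j'| ≤ L := by
      rw [abs_le] at hcl2 ⊢
      constructor <;> linarith
    exact_mod_cast this

lemma BilinearBound.of_holder {c : ℝ} {n u p q : ℕ} (hqn : q ≤ n) {M K M' : ℝ≥0∞}
    (h : BilinearBound ι P c n u q p M) (hK : DecouplingBound ι P c (n - q) K)
    (hM' : M * K ≤ M' ^ 2) : BilinearBound ι P c n u p q M' := by
  intro ψ m hQ g φ b d S T R hR hS hT hSarc hTarc hsep
  have bS : ∀ i ∈ S, BddMeas (g i) := fun i hi => hR.bddMeas i (hS hi)
  have bT : ∀ i ∈ T, BddMeas (g i) := fun i hi => hR.bddMeas i (hT hi)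
  have h1 := h ψ m hQ g φ b d T S R hR hT hS hTarc hSarc
    (hsep.elim (fun h => Or.inr fun i hi k hk => h k hk i hi)
      (fun h => Or.inl fun i hi k hk => h k hk i hi))
  have h2 := hK.rescale hqn hQ (hR.mono P hT) hTarc
  have h3 := lintegral_mul_sq_le P
    (f := fun ω => ‖modeSum g S ω‖ₑ ^ 2 * ‖modeSum g T ω‖ₑ) (g := fun ω => ‖modeSum g T ω‖ₑ ^ 3)
    ((measurable_enorm_modeSum_pow bS 2).mul
      (bddMeas_modeSum bT).1.enorm).aemeasurable
    (measurable_enorm_modeSum_pow bT 3).aemeasurable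
  have e1 : ∀ ω, (‖modeSum g S ω‖ₑ ^ 2 * ‖modeSum g T ω‖ₑ) * ‖modeSum g T ω‖ₑ ^ 3 =
    ‖modeSum g S ω‖ₑ ^ 2 * ‖modeSum g T ω‖ₑ ^ 4 := fun ω => by ring
  have e2 : ∀ ω, (‖modeSum g S ω‖ₑ ^ 2 * ‖modeSum g T ω‖ₑ) ^ 2 =
    ‖modeSum g T ω‖ₑ ^ 2 * ‖modeSum g S ω‖ₑ ^ 4 := fun ω => by ring
  have e3 : ∀ ω, (‖modeSum g T ω‖ₑ ^ 3) ^ 2 = ‖modeSum g T ω‖ₑ ^ 6 := fun ω => by ring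
  simp_rw [e1, e2, e3] at h3
  rw [← ENNReal.pow_le_pow_left_iff two_ne_zero]
  calc _ ≤ _ := h3
    _ ≤ _ := mul_le_mul' h1 h2
    _ = (M * K) * (arcSqSum P g φ n S * arcSqSum P g φ n T ^ 2) ^ 2 := by ring
    _ ≤ M' ^ 2 * (arcSqSum P g φ n S * arcSqSum P g φ n T ^ 2) ^ 2 := by gcongr
    _ = _ := by ring

lemma DecouplingBound.bilinear {c : ℝ} {n u p q : ℕ} {K : ℝ≥0∞}
    (hK : DecouplingBound ι P c n K) : BilinearBound ι P c n u p q K := by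
  intro ψ m hQ g φ b d S T R hR hS hT _ _ _
  have bS : ∀ i ∈ S, BddMeas (g i) := fun i hi => hR.bddMeas i (hS hi)
  have bT : ∀ i ∈ T, BddMeas (g i) := fun i hi => hR.bddMeas i (hT hi)
  have h1 := hK ψ m hQ g φ b d S (hR.mono P hS)
  have h2 := hK ψ m hQ g φ b d T (hR.mono P hT)
  have h3 := ENNReal.lintegral_mul_norm_pow_le (μ := P)
    (f := fun ω => ‖modeSum g S ω‖ₑ ^ 6) (g := fun ω => ‖modeSum g T ω‖ₑ ^ 6)
    (measurable_enorm_modeSum_pow bS 6).aemeasurable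
    (measurable_enorm_modeSum_pow bT 6).aemeasurable (p := 1 / 3) (q := 2 / 3)
    (by norm_num) (by norm_num) (by norm_num)
  have e1 : ∀ x : ℝ≥0∞, (x ^ 6) ^ (1 / 3 : ℝ) = x ^ 2 := fun x => by
    rw [← ENNReal.rpow_natCast, ← ENNReal.rpow_mul, ← ENNReal.rpow_natCast]; norm_num
  have e2 : ∀ x : ℝ≥0∞, (x ^ 6) ^ (2 / 3 : ℝ) = x ^ 4 := fun x => by
    rw [← ENNReal.rpow_natCast, ← ENNReal.rpow_mul, ← ENNReal.rpow_natCast]; norm_num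
  have e3 : ∀ x : ℝ≥0∞, (x ^ (1 / 3 : ℝ)) ^ 3 = x := fun x => by
    rw [← ENNReal.rpow_natCast, ← ENNReal.rpow_mul]; norm_num
  have e4 : ∀ x : ℝ≥0∞, (x ^ (2 / 3 : ℝ)) ^ 3 = x ^ 2 := fun x => by
    rw [← ENNReal.rpow_natCast, ← ENNReal.rpow_mul, ← ENNReal.rpow_natCast]; norm_num
  simp_rw [e1, e2] at h3
  rw [← ENNReal.pow_le_pow_left_iff (n := 3) (by norm_num)]
  calc _ ≤ _ := pow_le_pow_left' h3 3
    _ = (∫⁻ ω, ‖modeSum g S ω‖ₑ ^ 6 ∂P) * (∫⁻ ω, ‖modeSum g T ω‖ₑ ^ 6 ∂P) ^ 2 := by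
        rw [mul_pow, e3, e4]
    _ ≤ (K * arcSqSum P g φ n S ^ 3) * (K * arcSqSum P g φ n T ^ 3) ^ 2 := by gcongr
    _ = _ := by ring

end Bilinear

section Iteration

variable {Ω ι : Type*} [MeasurableSpace Ω] {P : Measure Ω}

variable (ι P) in
/-- The decoupling constants grow at most like `2 ^ (η n)`. -/
def DecouplingExponent (c η : ℝ) : Prop :=
  ∃ A : ℝ, 0 ≤ A ∧ ∀ n : ℕ, DecouplingBound ι P c n (ENNReal.ofReal (A * 2 ^ (η * n)))

lemma DecouplingBound.mono {c : ℝ} {n : ℕ} {K K' : ℝ≥0∞} (h : DecouplingBound ι P c n K)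
    (hK : K ≤ K') : DecouplingBound ι P c n K' :=
  fun ψ m hQ g φ b d S hS => (h ψ m hQ g φ b d S hS).trans (by gcongr)

lemma BilinearBound.mono {c : ℝ} {n u p q : ℕ} {K K' : ℝ≥0∞} (h : BilinearBound ι P c n u p q K)
    (hK : K ≤ K') : BilinearBound ι P c n u p q K' :=
  fun ψ m hQ g φ b d S T R h1 h2 h3 h4 h5 h6 =>
    (h ψ m hQ g φ b d S T R h1 h2 h3 h4 h5 h6).trans (by gcongr)

lemma DecouplingExponent.mono {c η η' : ℝ} (h : DecouplingExponent ι P c η) (hη : η ≤ η') :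
    DecouplingExponent ι P c η' := by
  obtain ⟨A, hA, h⟩ := h
  refine ⟨A, hA, fun n => (h n).mono (ENNReal.ofReal_le_ofReal ?_)⟩
  gcongr
  norm_num

lemma bilinearBound_gain [IsFiniteMeasure P] {c η A : ℝ} (hc : 0 < c) (hA : 0 ≤ A)
    (h : ∀ n : ℕ, DecouplingBound ι P c n (ENNReal.ofReal (A * 2 ^ (η * n)))) (n u : ℕ) :
    ∀ (k p q : ℕ), 2 ^ (k + 1) * q ≤ n → BilinearBound ι P c n u p q (ENNReal.ofReal
      (A * 2 ^ (η * n) * (orthConst c * 2 ^ u) ^ 2 * 2 ^ (-(η * k * q / 2)))) := by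
  have hC : (1 : ℝ) ≤ orthConst c * 2 ^ u := by
    have h1 : 1 ≤ orthConst c := by unfold orthConst; omega
    have h2 : 1 ≤ orthConst c * 2 ^ u := Nat.one_le_iff_ne_zero.mpr (by positivity)
    exact_mod_cast h2
  intro k
  induction k with
  | zero =>
    intro p q _
    refine (h n).bilinear.mono (ENNReal.ofReal_le_ofReal ?_)
    simp only [CharP.cast_eq_zero, mul_zero, zero_mul, zero_div, neg_zero, Real.rpow_zero, mul_one]
    have : 0 ≤ A * 2 ^ (η * n) := by positivity
    nlinarith [one_le_pow₀ hC (n := 2)]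
  | succ k ih =>
    intro p q hq
    have hq2 : 2 * q ≤ n := by
      refine le_trans ?_ hq
      gcongr
      exact Nat.le_self_pow (by omega) 2
    have h1 := ih q (2 * q) (by rw [← mul_assoc, ← pow_succ]; exact hq)
    have h2 : BilinearBound ι P c n u (2 * q) q (ENNReal.ofReal
        (A * 2 ^ (η * n) * (orthConst c * 2 ^ u) * 2 ^ (-(η * (k + 1) * q / 2)))) := by
      refine h1.of_holder (by omega) (h (n - q)) ?_
      rw [← ENNReal.ofReal_mul (by positivity), ← ENNReal.ofReal_pow (by positivity)]
      apply ENNReal.ofReal_le_ofReal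
      rw [Nat.cast_sub (by omega), mul_sub η, Real.rpow_sub (by norm_num)]
      have e : (2 : ℝ) ^ (-(η * (k + 1) * q / 2)) * 2 ^ (-(η * (k + 1) * q / 2)) =
          2 ^ (-(η * k * ((2 * q : ℕ) : ℝ) / 2)) / 2 ^ (η * q) := by
        rw [← Real.rpow_add (by norm_num), ← Real.rpow_sub (by norm_num)]
        congr 1
        push_cast
        ring
      rw [sq (A * _ * _ * _)]
      calc _ = (A * 2 ^ (η * n) * (orthConst c * 2 ^ u)) ^ 2 *
            (2 ^ (-(η * k * ((2 * q : ℕ) : ℝ) / 2)) / 2 ^ (η * q)) := by ring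
        _ = _ := by rw [← e]; ring
        _ ≤ _ := le_rfl
    refine (h2.of_orthogonality hc hq2).mono ?_
    have : ((orthConst c : ℝ≥0∞) * 2 ^ u) = ENNReal.ofReal (orthConst c * 2 ^ u) := by
      rw [ENNReal.ofReal_mul (by positivity), ENNReal.ofReal_pow (by norm_num)]
      simp
    rw [this, ← ENNReal.ofReal_mul (by positivity)]
    apply ENNReal.ofReal_le_ofReal
    push_cast
    apply le_of_eq
    ring

/-- The broad–narrow dichotomy for a finite sum. -/
lemma enorm_sum_pow_six_le_broad_narrow (T : Finset ℤ) (z : ℤ → ℂ) :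
    ‖∑ j ∈ T, z j‖ₑ ^ 6 ≤ 2 ^ 5 * (3 ^ 6 * ∑ j ∈ T, ‖z j‖ₑ ^ 6 + (T.card : ℝ≥0∞) ^ 6 *
      ∑ j ∈ T, ∑ k ∈ T with 2 ≤ |j - k|, ‖z j‖ₑ ^ 3 * ‖z k‖ₑ ^ 3) := by
  rcases T.eq_empty_or_nonempty with rfl | hT
  · simp
  obtain ⟨j, hj, hmax⟩ := T.exists_max_image (fun j => ‖z j‖ₑ) hT
  obtain ⟨w, hw1, hw2⟩ : ∃ w : ℝ≥0∞, (∀ k ∈ T, 2 ≤ |j - k| → ‖z k‖ₑ ≤ w) ∧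
      w ^ 6 ≤ ∑ j ∈ T, ∑ k ∈ T with 2 ≤ |j - k|, ‖z j‖ₑ ^ 3 * ‖z k‖ₑ ^ 3 := by
    rcases (T.filter fun k => 2 ≤ |j - k|).eq_empty_or_nonempty with hF | hF
    · refine ⟨0, fun k hk hjk => ?_, by simp⟩
      have : k ∈ T.filter fun k => 2 ≤ |j - k| := Finset.mem_filter.mpr ⟨hk, hjk⟩
      simp [hF] at this
    · obtain ⟨k, hk, hk'⟩ := Finset.exists_max_image _ (fun k => ‖z k‖ₑ) hF
      refine ⟨‖z k‖ₑ, fun l hl hjl => hk' l (Finset.mem_filter.mpr ⟨hl, hjl⟩), ?_⟩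
      calc ‖z k‖ₑ ^ 6 = ‖z k‖ₑ ^ 3 * ‖z k‖ₑ ^ 3 := by ring
        _ ≤ ‖z j‖ₑ ^ 3 * ‖z k‖ₑ ^ 3 := by
            gcongr
            exact hmax k (Finset.mem_filter.mp hk).1
        _ ≤ ∑ k ∈ T with 2 ≤ |j - k|, ‖z j‖ₑ ^ 3 * ‖z k‖ₑ ^ 3 :=
            Finset.single_le_sum (f := fun k => ‖z j‖ₑ ^ 3 * ‖z k‖ₑ ^ 3)
              (fun _ _ => zero_le) hk
        _ ≤ _ := Finset.single_le_sum
              (f := fun j => ∑ k ∈ T with 2 ≤ |j - k|, ‖z j‖ₑ ^ 3 * ‖z k‖ₑ ^ 3)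
              (fun _ _ => zero_le) hj
  have hle : ‖∑ j ∈ T, z j‖ₑ ≤ 3 * ‖z j‖ₑ + T.card * w := by
    calc ‖∑ j ∈ T, z j‖ₑ ≤ ∑ k ∈ T, ‖z k‖ₑ := enorm_sum_le _ _
      _ = ∑ k ∈ T with ¬ 2 ≤ |j - k|, ‖z k‖ₑ + ∑ k ∈ T with 2 ≤ |j - k|, ‖z k‖ₑ := by
          rw [add_comm, Finset.sum_filter_add_sum_filter_not]
      _ ≤ ∑ k ∈ Finset.Icc (j - 1) (j + 1), ‖z j‖ₑ + ∑ k ∈ T, w := by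
          refine add_le_add ?_ ?_
          · have hsub : (T.filter fun k => ¬ 2 ≤ |j - k|) ⊆ Finset.Icc (j - 1) (j + 1) := by
              intro k hk
              rw [Finset.mem_filter, not_le, abs_lt] at hk
              rw [Finset.mem_Icc]; omega
            calc _ ≤ ∑ k ∈ T with ¬ 2 ≤ |j - k|, ‖z j‖ₑ :=
                  Finset.sum_le_sum fun k hk => hmax k (Finset.mem_filter.mp hk).1
              _ ≤ _ := Finset.sum_le_sum_of_subset hsub
          · calc _ ≤ ∑ k ∈ T with 2 ≤ |j - k|, w := Finset.sum_le_sum fun k hk =>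
                  hw1 k (Finset.mem_filter.mp hk).1 (Finset.mem_filter.mp hk).2
              _ ≤ _ := Finset.sum_le_sum_of_subset (Finset.filter_subset _ _)
      _ = _ := by
          rw [Finset.sum_const, Finset.sum_const, Int.card_Icc, nsmul_eq_mul, nsmul_eq_mul]
          congr 2
          have : (j + 1 + 1 - (j - 1)).toNat = 3 := by omega
          rw [this]; norm_num
  calc ‖∑ j ∈ T, z j‖ₑ ^ 6 ≤ (3 * ‖z j‖ₑ + T.card * w) ^ 6 := pow_le_pow_left' hle 6
    _ ≤ 2 ^ 5 * ((3 * ‖z j‖ₑ) ^ 6 + (T.card * w) ^ 6) := by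
        have := ENNReal.rpow_add_le_mul_rpow_add_rpow (3 * ‖z j‖ₑ) (T.card * w) (p := 6)
          (by norm_num)
        norm_num at this
        norm_num
        exact_mod_cast this
    _ ≤ _ := by
        rw [mul_pow, mul_pow]
        gcongr
        exact Finset.single_le_sum (f := fun j => ‖z j‖ₑ ^ 6) (fun _ _ => zero_le) hj

lemma DecouplingBound.of_broad_narrow {c : ℝ} {n u : ℕ} (hu : u ≤ n)
    {K M : ℝ≥0∞} (hK : DecouplingBound ι P c (n - u) K) (hM : BilinearBound ι P c n u u u M) :
    DecouplingBound ι P c n (2 ^ 5 * 3 ^ 6 * K + 2 ^ 6 * 2 ^ (6 * u) * M) := by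
  intro ψ m hQ g φ b d S hS
  set T : Finset ℤ := Finset.Ico (0 : ℤ) (2 ^ u) with hT
  have hTc : (T.card : ℝ≥0∞) ^ 6 = 2 ^ (6 * u) := by
    have h2 : ((2 : ℤ) ^ u).toNat = 2 ^ u := by
      rw [← Int.toNat_natCast (2 ^ u)]; norm_cast
    rw [hT, Int.card_Ico, sub_zero, h2, mul_comm, pow_mul]
    simp
  set f : ℤ → Ω → ℂ := fun j => modeSum g (dyadicArc φ u j S) with hf
  set s : ℤ → ℝ≥0∞ := fun j => arcSqSum P g φ n (dyadicArc φ u j S) with hs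
  have hsub : ∀ j, dyadicArc φ u j S ⊆ S := fun j => Finset.filter_subset _ _
  have bf : ∀ j, ∀ i ∈ dyadicArc φ u j S, BddMeas (g i) := fun j i hi => hS.bddMeas i (hsub j hi)
  have hone : ∀ j, InOneArc φ u (dyadicArc φ u j S) := fun j =>
    ⟨j, fun i hi => (mem_dyadicArc.mp hi).2⟩
  have hsum : ∑ j ∈ T, s j ≤ arcSqSum P g φ n S :=
    (ENNReal.sum_le_tsum _).trans (tsum_arcSqSum P g φ hu S).le
  set X := arcSqSum P g φ n S with hX
  have hs1 : ∀ j, s j ≤ X := fun j => (ENNReal.le_tsum j).trans (tsum_arcSqSum P g φ hu S).le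
  have mf : ∀ j (k : ℕ), Measurable fun ω => ‖f j ω‖ₑ ^ k := fun j k =>
    measurable_enorm_modeSum_pow (bf j) k
  have h6 : ∀ j, ∫⁻ ω, ‖f j ω‖ₑ ^ 6 ∂P ≤ K * s j ^ 3 := fun j =>
    hK.rescale hu hQ (hS.mono P (hsub j)) (hone j)
  have hsep : ∀ j k : ℤ, 2 ≤ |j - k| →
      LabelsSeparated φ u (dyadicArc φ u j S) (dyadicArc φ u k S) := by
    intro j k hjk
    have h2 : (0 : ℝ) < 2 ^ u := by positivity
    have key : ∀ j k : ℤ, j + 2 ≤ k → ∀ i ∈ dyadicArc φ u j S, ∀ l ∈ dyadicArc φ u k S,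
        φ i + (1 / 2) ^ u ≤ φ l := by
      intro j k hjk i hi l hl
      have f1 := Int.floor_eq_iff.mp (mem_dyadicArc.mp hi).2
      have f2 := Int.floor_eq_iff.mp (mem_dyadicArc.mp hl).2
      have : (j : ℝ) + 2 ≤ k := by exact_mod_cast hjk
      refine le_of_mul_le_mul_left ?_ h2
      rw [mul_add, ← mul_pow]
      norm_num
      linarith
    rcases le_abs'.mp hjk with h | h
    · exact Or.inl fun i hi l hl => key j k (by omega) i hi l hl
    · exact Or.inr fun i hi l hl => key k j (by omega) l hl i hi
  have h33 : ∀ j k : ℤ, 2 ≤ |j - k| → ∫⁻ ω, ‖f j ω‖ₑ ^ 3 * ‖f k ω‖ₑ ^ 3 ∂P ≤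
      M * s j * s k * X + M * s j * s k * X := by
    intro j k hjk
    have a1 := hM ψ m hQ g φ b d _ _ S hS (hsub j) (hsub k) (hone j) (hone k) (hsep j k hjk)
    have a2 := hM ψ m hQ g φ b d _ _ S hS (hsub k) (hsub j) (hone k) (hone j)
      (hsep k j (by rwa [abs_sub_comm]))
    calc ∫⁻ ω, ‖f j ω‖ₑ ^ 3 * ‖f k ω‖ₑ ^ 3 ∂P
        ≤ ∫⁻ ω, ‖f j ω‖ₑ ^ 2 * ‖f k ω‖ₑ ^ 4 + ‖f k ω‖ₑ ^ 2 * ‖f j ω‖ₑ ^ 4 ∂P := by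
          refine lintegral_mono fun ω => ?_
          simp only []
          generalize ‖f j ω‖ₑ = x
          generalize ‖f k ω‖ₑ = y
          rcases le_total x y with h | h
          · refine le_trans ?_ le_self_add
            calc x ^ 3 * y ^ 3 = x ^ 2 * (x * y ^ 3) := by ring
              _ ≤ x ^ 2 * (y * y ^ 3) := by gcongr
              _ = _ := by ring
          · refine le_trans ?_ le_add_self
            calc x ^ 3 * y ^ 3 = y ^ 2 * (y * x ^ 3) := by ring
              _ ≤ y ^ 2 * (x * x ^ 3) := by gcongr
              _ = _ := by ring
      _ = _ := lintegral_add_left ((mf j 2).mul (mf k 4)) _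
      _ ≤ M * s j * s k ^ 2 + M * s k * s j ^ 2 := add_le_add a1 a2
      _ = M * s j * s k * s k + M * s j * s k * s j := by ring
      _ ≤ _ := by gcongr <;> exact hs1 _
  calc ∫⁻ ω, ‖modeSum g S ω‖ₑ ^ 6 ∂P
      ≤ ∫⁻ ω, 2 ^ 5 * (3 ^ 6 * ∑ j ∈ T, ‖f j ω‖ₑ ^ 6 + 2 ^ (6 * u) *
          ∑ j ∈ T, ∑ k ∈ T with 2 ≤ |j - k|, ‖f j ω‖ₑ ^ 3 * ‖f k ω‖ₑ ^ 3) ∂P := by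
        refine lintegral_mono fun ω => ?_
        simp only []
        rw [modeSum_eq_sum_arcs g φ u S T (fun i hi => floor_mem_range (hS.label i hi)), ← hTc]
        exact enorm_sum_pow_six_le_broad_narrow T fun j => f j ω
    _ = 2 ^ 5 * (3 ^ 6 * ∑ j ∈ T, ∫⁻ ω, ‖f j ω‖ₑ ^ 6 ∂P + 2 ^ (6 * u) *
          ∑ j ∈ T, ∑ k ∈ T with 2 ≤ |j - k|, ∫⁻ ω, ‖f j ω‖ₑ ^ 3 * ‖f k ω‖ₑ ^ 3 ∂P) := by
        have m1 : Measurable fun ω => ∑ j ∈ T, ‖f j ω‖ₑ ^ 6 :=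
          Finset.measurable_fun_sum _ fun j _ => mf j 6
        have m2 : ∀ j k, Measurable fun ω => ‖f j ω‖ₑ ^ 3 * ‖f k ω‖ₑ ^ 3 := fun j k =>
          (mf j 3).mul (mf k 3)
        have m3 : ∀ j, Measurable fun ω =>
            ∑ k ∈ T with 2 ≤ |j - k|, ‖f j ω‖ₑ ^ 3 * ‖f k ω‖ₑ ^ 3 :=
          fun j => Finset.measurable_fun_sum _ fun k _ => m2 j k
        have m4 : Measurable fun ω =>
            ∑ j ∈ T, ∑ k ∈ T with 2 ≤ |j - k|, ‖f j ω‖ₑ ^ 3 * ‖f k ω‖ₑ ^ 3 :=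
          Finset.measurable_fun_sum _ fun j _ => m3 j
        rw [lintegral_const_mul' _ _ (by finiteness),
          lintegral_add_left (m1.const_mul _), lintegral_const_mul _ m1,
          lintegral_const_mul _ m4, lintegral_finsetSum _ fun j _ => mf j 6,
          lintegral_finsetSum _ fun j _ => m3 j]
        congr 4
        exact funext fun j => lintegral_finsetSum _ fun k _ => m2 j k
    _ ≤ 2 ^ 5 * (3 ^ 6 * (K * X ^ 3) + 2 ^ (6 * u) * (2 * M * X ^ 3)) := by
        gcongr
        · calc _ ≤ ∑ j ∈ T, K * X ^ 2 * s j := by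
                refine Finset.sum_le_sum fun j _ => (h6 j).trans ?_
                calc K * s j ^ 3 = K * s j ^ 2 * s j := by ring
                  _ ≤ _ := by gcongr; exact hs1 j
            _ = K * X ^ 2 * ∑ j ∈ T, s j := by rw [Finset.mul_sum]
            _ ≤ K * X ^ 2 * X := by gcongr
            _ = _ := by ring
        · calc _ ≤ ∑ j ∈ T, ∑ k ∈ T with 2 ≤ |j - k|, 2 * M * X * s j * s k := by
                refine Finset.sum_le_sum fun j _ => Finset.sum_le_sum fun k hk => ?_
                refine (h33 j k (Finset.mem_filter.mp hk).2).trans (le_of_eq ?_)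
                ring
            _ ≤ ∑ j ∈ T, ∑ k ∈ T, 2 * M * X * s j * s k :=
                Finset.sum_le_sum fun j _ => Finset.sum_le_sum_of_subset (Finset.filter_subset _ _)
            _ = 2 * M * X * (∑ j ∈ T, s j) * ∑ k ∈ T, s k := by
                simp_rw [← Finset.mul_sum, ← Finset.sum_mul]
                rw [← Finset.mul_sum]
            _ ≤ 2 * M * X * X * X := by gcongr
            _ = _ := by ring
    _ = _ := by ring

lemma DecouplingExponent.improve [IsFiniteMeasure P] {c η η₀ : ℝ} (hc : 0 < c) (hη₀ : 0 < η₀)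
    (hη : η₀ ≤ η) {k : ℕ} (hk : 18 ≤ η₀ * k) (h : DecouplingExponent ι P c η) :
    DecouplingExponent ι P c (η - min η₀ 1 / 2 ^ (k + 1)) := by
  obtain ⟨A, hA, hdec⟩ := h
  set D : ℝ := 2 ^ 5 * 3 ^ 6 + 2 ^ 6 * (orthConst c) ^ 2 with hD
  set μ := min η₀ 1 with hμ
  have hμ0 : 0 < μ := lt_min hη₀ one_pos
  have hμ1 : μ ≤ 1 := min_le_right _ _
  refine ⟨2 * A * D, by positivity, fun n => ?_⟩
  set u := n / 2 ^ (k + 1) with hu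
  have hun : 2 ^ (k + 1) * u ≤ n := Nat.mul_div_le n _
  have hun' : u ≤ n := Nat.div_le_self _ _
  have hbn := (hdec (n - u)).of_broad_narrow hun' (bilinearBound_gain hc hA hdec n u k u u hun)
  refine hbn.mono ?_
  have e1 : (2 ^ 5 * 3 ^ 6 : ℝ≥0∞) = ENNReal.ofReal (2 ^ 5 * 3 ^ 6) := by
    rw [ENNReal.ofReal_mul (by positivity), ENNReal.ofReal_pow (by positivity),
      ENNReal.ofReal_pow (by positivity)]
    simp
  have e2 : (2 ^ 6 * 2 ^ (6 * u) : ℝ≥0∞) = ENNReal.ofReal (2 ^ 6 * 2 ^ (6 * u)) := by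
    rw [ENNReal.ofReal_mul (by positivity), ENNReal.ofReal_pow (by positivity),
      ENNReal.ofReal_pow (by positivity)]
    simp
  rw [e1, e2, ← ENNReal.ofReal_mul (by positivity), ← ENNReal.ofReal_mul (by positivity),
    ← ENNReal.ofReal_add (by positivity) (by positivity)]
  apply ENNReal.ofReal_le_ofReal
  have hu0 : (0 : ℝ) ≤ u := by positivity
  have t1 : (2 : ℝ) ^ (η * ((n - u : ℕ) : ℝ)) ≤ 2 ^ (η * n) * 2 ^ (-(μ * u)) := by
    rw [← Real.rpow_add (by norm_num), Nat.cast_sub hun']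
    apply Real.rpow_le_rpow_of_exponent_le (by norm_num)
    have : μ ≤ η := (min_le_left _ _).trans hη
    nlinarith
  have t2 : (2 : ℝ) ^ (6 * u) * ((2 ^ u) ^ 2 * 2 ^ (-(η * k * u / 2))) ≤ 2 ^ (-(μ * u)) := by
    rw [← pow_mul, ← Real.rpow_natCast, ← Real.rpow_natCast, ← Real.rpow_add (by norm_num),
      ← Real.rpow_add (by norm_num)]
    apply Real.rpow_le_rpow_of_exponent_le (by norm_num)
    push_cast
    have : 18 ≤ η * k := hk.trans (by gcongr)
    nlinarith
  have t3 : (2 : ℝ) ^ (η * n) * 2 ^ (-(μ * u)) ≤ 2 * 2 ^ ((η - μ / 2 ^ (k + 1)) * n) := by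
    nth_rewrite 3 [← Real.rpow_one 2]
    rw [← Real.rpow_add (by norm_num), ← Real.rpow_add (by norm_num)]
    apply Real.rpow_le_rpow_of_exponent_le (by norm_num)
    have hpos : (0 : ℝ) < 2 ^ (k + 1) := by positivity
    have hfl : (n : ℝ) / 2 ^ (k + 1) ≤ u + 1 := by
      rw [div_le_iff₀ hpos]
      have := Nat.lt_div_mul_add (a := n) (b := 2 ^ (k + 1)) (by positivity)
      have h' : n ≤ (u + 1) * 2 ^ (k + 1) := by rw [hu]; nlinarith
      exact_mod_cast h'
    have e : (η - μ / 2 ^ (k + 1)) * n = η * n - μ * (n / 2 ^ (k + 1)) := by ring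
    rw [e]
    nlinarith
  calc _ = 2 ^ 5 * 3 ^ 6 * A * 2 ^ (η * ((n - u : ℕ) : ℝ)) + 2 ^ 6 * (orthConst c) ^ 2 * A *
        2 ^ (η * n) * (2 ^ (6 * u) * ((2 ^ u) ^ 2 * 2 ^ (-(η * k * u / 2)))) := by ring
    _ ≤ 2 ^ 5 * 3 ^ 6 * A * (2 ^ (η * n) * 2 ^ (-(μ * u))) + 2 ^ 6 * (orthConst c) ^ 2 * A *
        2 ^ (η * n) * 2 ^ (-(μ * u)) := by gcongr
    _ = A * D * (2 ^ (η * n) * 2 ^ (-(μ * u))) := by rw [hD]; ring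
    _ ≤ A * D * (2 * 2 ^ ((η - μ / 2 ^ (k + 1)) * n)) := by gcongr
    _ = _ := by ring

variable (ι P) in
/-- `ℓ²` decoupling in `L⁶` for planar curves, up to an arbitrarily small power loss. -/
theorem decouplingExponent_of_pos [IsFiniteMeasure P] {c η : ℝ} (hc : 0 < c) (hη : 0 < η) :
    DecouplingExponent ι P c η := by
  obtain ⟨k, hk⟩ := exists_nat_ge (18 / η)
  have hk' : 18 ≤ η * k := by rwa [div_le_iff₀' hη] at hk
  set r := min η 1 / 2 ^ (k + 1) with hr
  have hr0 : 0 < r := by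
    have := lt_min hη one_pos
    positivity
  have main : ∀ j : ℕ, DecouplingExponent ι P c (max η (5 - j * r)) := by
    intro j
    induction j with
    | zero =>
      refine DecouplingExponent.mono (η := 5) ⟨1, zero_le_one, fun n => ?_⟩ (by simp)
      refine (decouplingBound_trivial P c n).mono ?_
      rw [one_mul]
      have : (2 : ℝ) ^ ((5 : ℝ) * n) = 2 ^ (5 * n) := by
        rw [← Real.rpow_natCast]; push_cast; rfl
      rw [this, ENNReal.ofReal_pow (by norm_num)]
      simp
    | succ j ih =>
      refine (ih.improve hc hη (le_max_left _ _) hk').mono ?_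
      rcases le_total η (5 - j * r) with h | h
      · rw [max_eq_right h]
        refine le_max_of_le_right ?_
        push_cast
        linarith
      · rw [max_eq_left h]
        exact le_max_of_le_left (by linarith)
  obtain ⟨j, hj⟩ := exists_nat_ge (5 / r)
  rw [div_le_iff₀ hr0] at hj
  have := main j
  rwa [max_eq_left (by linarith)] at this

end Iteration

section Cone

variable {Ω ι : Type*} [MeasurableSpace Ω] {P : Measure Ω}

variable (P) in
/-- Modes with frequencies `r i • (1, φ i, ψ (φ i))` on the cone over the curve `ψ`, such that
products of three of them are orthogonal when the sums of frequencies are at distance at least one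
in some coordinate. -/
structure ConeModes (ψ : ℝ → ℝ) (g : ι → Ω → ℂ) (φ r : ι → ℝ) (S : Finset ι) : Prop where
  bddMeas : ∀ i ∈ S, BddMeas (g i)
  label : ∀ i ∈ S, φ i ∈ Ico (0 : ℝ) 1
  orth : ∀ i ∈ S, ∀ k ∈ S, ∀ l ∈ S, ∀ i' ∈ S, ∀ k' ∈ S, ∀ l' ∈ S,
    ∫ ω, (g i ω * (g k ω * g l ω)) * (starRingEnd ℂ) (g i' ω * (g k' ω * g l' ω)) ∂P ≠ 0 →
    |r i + r k + r l - (r i' + r k' + r l')| ≤ 1 ∧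
    |r i * φ i + r k * φ k + r l * φ l - (r i' * φ i' + r k' * φ k' + r l' * φ l')| ≤ 1 ∧
    |r i * ψ (φ i) + r k * ψ (φ k) + r l * ψ (φ l) -
      (r i' * ψ (φ i') + r k' * ψ (φ k') + r l' * ψ (φ l'))| ≤ 1

lemma ConeModes.mono {ψ : ℝ → ℝ} {g : ι → Ω → ℂ} {φ r : ι → ℝ} {S T : Finset ι}
    (h : ConeModes P ψ g φ r S) (hT : T ⊆ S) : ConeModes P ψ g φ r T where
  bddMeas i hi := h.bddMeas i (hT hi)
  orth i hi k hk l hl i' hi' k' hk' l' hl' :=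
    h.orth i (hT hi) k (hT hk) l (hT hl) i' (hT hi') k' (hT hk') l' (hT hl')
  label i hi := h.label i (hT hi)

/-- Decoupling of a piece of the cone over one arc of level `l`, when the radial variable is
localized to relative width `4⁻ⁿ`. -/
lemma ConeModes.decouple_arc {c : ℝ} {n l : ℕ} {K : ℝ≥0∞} (hc : 0 ≤ c)
    (hK : DecouplingBound ι P c n K)
    {ψ m : ℝ → ℝ} (hQ : QuadCurve c ψ m) (hψ : ∀ x ∈ Icc (0 : ℝ) 1, |ψ x| ≤ 1)
    (hm : ∀ x ∈ Icc (0 : ℝ) 1, |m x| ≤ 1) {g : ι → Ω → ℂ} {φ r : ι → ℝ} {S : Finset ι}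
    (hS : ConeModes P ψ g φ r S) {w : ℝ} (hw : 4 * 4 ^ l * 4 ^ n ≤ |w|)
    (hr : ∀ i ∈ S, |r i / w - 1| ≤ (1 / 4) ^ n) (harc : InOneArc φ l S) :
    ∫⁻ ω, ‖modeSum g S ω‖ₑ ^ 6 ∂P ≤ K * arcSqSum P g φ (l + n) S ^ 3 := by
  obtain ⟨a, ha⟩ := harc
  rcases S.eq_empty_or_nonempty with rfl | ⟨i₀, hi₀⟩
  · simp [modeSum]
  set σ : ℝ := (1 / 2) ^ l with hσ
  have hσ0 : 0 < σ := by positivity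
  have hσ2 : (2 : ℝ) ^ l * σ = 1 := by rw [hσ, ← mul_pow]; norm_num
  have hσ1 : σ ≤ 1 := pow_le_one₀ (by norm_num) (by norm_num)
  have hwabs : 0 < |w| := lt_of_lt_of_le (by positivity) hw
  have hw0 : w ≠ 0 := abs_pos.mp hwabs
  have hwσ : 4 ≤ (1 / 4) ^ n * (|w| * σ ^ 2) := by
    have e : σ ^ 2 = (1 / 4) ^ l := by
      rw [hσ, ← pow_mul, mul_comm l 2, pow_mul]; norm_num
    rw [e]
    calc (4 : ℝ) = (1 / 4) ^ n * (4 * 4 ^ l * 4 ^ n * (1 / 4) ^ l) := by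
          rw [one_div_pow, one_div_pow]; field_simp
      _ ≤ _ := by gcongr
  set x₀ : ℝ := σ * a with hx₀
  have hmem := floor_mem_range (k := l) (hS.label i₀ hi₀)
  rw [ha i₀ hi₀, Finset.mem_Ico] at hmem
  have ha0 : (0 : ℝ) ≤ a := by exact_mod_cast hmem.1
  have ha1 : (a : ℝ) + 1 ≤ 2 ^ l := by exact_mod_cast hmem.2
  have hx0 : 0 ≤ x₀ := by positivity
  have hx1 : x₀ + σ ≤ 1 := by
    rw [← hσ2, hx₀]; nlinarith
  have hx₀m : x₀ ∈ Icc (0 : ℝ) 1 := ⟨hx0, by linarith⟩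
  have hQ' := hQ.rescale hσ0 hx0 hx1
  set ψ' := (fun x => (ψ (x₀ + σ * x) - ψ x₀ - m x₀ * (σ * x)) / σ ^ 2) with hψ'
  set m' := (fun x => (m (x₀ + σ * x) - m x₀) / σ) with hm'
  have hback : ∀ x, x₀ + σ * ((x - x₀) / σ) = x := fun x => by field_simp; ring
  have hlab : ∀ i ∈ S, (φ i - x₀) / σ ∈ Ico (0 : ℝ) 1 := by
    intro i hi
    have hfl := Int.floor_eq_iff.mp (ha i hi)
    have e : φ i = σ * ((2 : ℝ) ^ l * φ i) := by rw [← mul_assoc, mul_comm σ, hσ2, one_mul]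
    constructor
    · apply div_nonneg _ hσ0.le
      rw [e, hx₀]; nlinarith
    · rw [div_lt_one hσ0, e, hx₀]; nlinarith
  have hmodes : CurveModes P n ψ' m' g (fun i => (φ i - x₀) / σ)
      (fun i => r i * (φ i - x₀) / (w * σ))
      (fun i => r i * (ψ (φ i) - ψ x₀ - m x₀ * (φ i - x₀)) / (w * σ ^ 2)) S := by
    refine ⟨hS.bddMeas, hlab, fun i hi => ?_, fun i hi => ?_, ?_⟩
    · have e : r i * (φ i - x₀) / (w * σ) - (φ i - x₀) / σ =
          (r i / w - 1) * ((φ i - x₀) / σ) := by field_simp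
      rw [e, abs_mul]
      have h2 : |(φ i - x₀) / σ| ≤ 1 := by
        rw [abs_of_nonneg (hlab i hi).1]; exact (hlab i hi).2.le
      nlinarith [hr i hi, abs_nonneg (r i / w - 1), abs_nonneg ((φ i - x₀) / σ)]
    · have hmem' : (φ i - x₀) / σ ∈ Icc (0 : ℝ) 1 := Ico_subset_Icc_self (hlab i hi)
      have hq := hQ' _ hmem' 0 (by simp)
      have h0 : ψ' 0 = 0 := by simp [hψ']
      have e : r i * (ψ (φ i) - ψ x₀ - m x₀ * (φ i - x₀)) / (w * σ ^ 2) - ψ' ((φ i - x₀) / σ) -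
          m' ((φ i - x₀) / σ) * (r i * (φ i - x₀) / (w * σ) - (φ i - x₀) / σ) =
          (r i / w - 1) * -(ψ' 0 - ψ' ((φ i - x₀) / σ) -
            m' ((φ i - x₀) / σ) * (0 - (φ i - x₀) / σ)) := by
        rw [h0]
        simp only [hψ', hm', hback]
        field_simp
        ring
      rw [e, abs_mul, abs_neg]
      have hsq : (0 - (φ i - x₀) / σ) ^ 2 ≤ 1 := by nlinarith [hmem'.1, hmem'.2]
      have h2 : |ψ' 0 - ψ' ((φ i - x₀) / σ) -
            m' ((φ i - x₀) / σ) * (0 - (φ i - x₀) / σ)| ≤ 1 := by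
        rw [abs_le]
        have : 0 ≤ c * (0 - (φ i - x₀) / σ) ^ 2 := by positivity
        constructor <;> linarith [hq.1, hq.2]
      calc _ ≤ |r i / w - 1| * 1 := by gcongr
        _ ≤ _ := by rw [mul_one]; exact hr i hi
    · intro i hi k hk l hl i' hi' k' hk' l' hl' hne
      obtain ⟨h0, h1, h2⟩ := hS.orth i hi k hk l hl i' hi' k' hk' l' hl' hne
      have e1 : ∀ a b c a' b' c' : ι, r a * (φ a - x₀) / (w * σ) + r b * (φ b - x₀) / (w * σ) +
          r c * (φ c - x₀) / (w * σ) - (r a' * (φ a' - x₀) / (w * σ) +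
          r b' * (φ b' - x₀) / (w * σ) + r c' * (φ c' - x₀) / (w * σ)) =
          (r a * φ a + r b * φ b + r c * φ c - (r a' * φ a' + r b' * φ b' + r c' * φ c') -
            x₀ * (r a + r b + r c - (r a' + r b' + r c'))) / (w * σ) := by
        intros; ring
      have e2 : ∀ a b c a' b' c' : ι,
          r a * (ψ (φ a) - ψ x₀ - m x₀ * (φ a - x₀)) / (w * σ ^ 2) +
          r b * (ψ (φ b) - ψ x₀ - m x₀ * (φ b - x₀)) / (w * σ ^ 2) +
          r c * (ψ (φ c) - ψ x₀ - m x₀ * (φ c - x₀)) / (w * σ ^ 2) -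
          (r a' * (ψ (φ a') - ψ x₀ - m x₀ * (φ a' - x₀)) / (w * σ ^ 2) +
          r b' * (ψ (φ b') - ψ x₀ - m x₀ * (φ b' - x₀)) / (w * σ ^ 2) +
          r c' * (ψ (φ c') - ψ x₀ - m x₀ * (φ c' - x₀)) / (w * σ ^ 2)) =
          (r a * ψ (φ a) + r b * ψ (φ b) + r c * ψ (φ c) -
            (r a' * ψ (φ a') + r b' * ψ (φ b') + r c' * ψ (φ c')) -
            ψ x₀ * (r a + r b + r c - (r a' + r b' + r c')) -
            m x₀ * (r a * φ a + r b * φ b + r c * φ c - (r a' * φ a' + r b' * φ b' + r c' * φ c') -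
            x₀ * (r a + r b + r c - (r a' + r b' + r c')))) / (w * σ ^ 2) := by
        intros; ring
      rw [e1, e2]
      generalize r i + r k + r l - (r i' + r k' + r l') = z0 at h0 ⊢
      generalize r i * φ i + r k * φ k + r l * φ l -
        (r i' * φ i' + r k' * φ k' + r l' * φ l') = z1 at h1 ⊢
      generalize r i * ψ (φ i) + r k * ψ (φ k) + r l * ψ (φ l) -
        (r i' * ψ (φ i') + r k' * ψ (φ k') + r l' * ψ (φ l')) = z2 at h2 ⊢
      have b1 : |z1 - x₀ * z0| ≤ 2 := by
        calc |z1 - x₀ * z0| ≤ |z1| + |x₀ * z0| := abs_sub _ _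
          _ ≤ 1 + 1 * 1 := by
              rw [abs_mul, abs_of_nonneg hx0]
              exact add_le_add h1 (mul_le_mul hx₀m.2 h0 (abs_nonneg _) zero_le_one)
          _ = 2 := by norm_num
      generalize z1 - x₀ * z0 = z at b1 ⊢
      have hσσ : 0 < σ ^ 2 := by positivity
      refine ⟨?_, fun x hx => ?_⟩
      · rw [abs_div, abs_mul, abs_of_pos hσ0, div_le_iff₀ (mul_pos hwabs hσ0)]
        have h3 : |w| * σ ^ 2 ≤ |w| * σ :=
          mul_le_mul_of_nonneg_left (by nlinarith) hwabs.le
        have : (1 / 4 : ℝ) ^ n * (|w| * σ ^ 2) ≤ (1 / 4) ^ n * (|w| * σ) :=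
          mul_le_mul_of_nonneg_left h3 (by positivity)
        linarith
      · have hxm : x₀ + σ * x ∈ Icc (0 : ℝ) 1 :=
          ⟨by nlinarith [hx.1], by nlinarith [hx.2]⟩
        have e3 : (z2 - ψ x₀ * z0 - m x₀ * z) / (w * σ ^ 2) - m' x * (z / (w * σ)) =
            (z2 - ψ x₀ * z0 - m (x₀ + σ * x) * z) / (w * σ ^ 2) := by
          simp only [hm']
          field_simp
          ring
        rw [e3, abs_div, abs_mul, abs_of_pos hσσ, div_le_iff₀ (mul_pos hwabs hσσ)]
        refine le_trans ?_ hwσ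
        calc |z2 - ψ x₀ * z0 - m (x₀ + σ * x) * z|
            ≤ |z2| + |ψ x₀ * z0| + |m (x₀ + σ * x) * z| :=
              (abs_sub _ _).trans (by gcongr; exact abs_sub _ _)
          _ ≤ 1 + 1 * 1 + 1 * 2 := by
              rw [abs_mul, abs_mul]
              have p1 := hψ x₀ hx₀m
              have p2 := hm _ hxm
              gcongr
          _ = 4 := by norm_num
  have hmain := hK ψ' m' hQ' g _ _ _ S hmodes
  have hsum : arcSqSum P g (fun i => (φ i - x₀) / σ) n S = arcSqSum P g φ (l + n) S := by
    unfold arcSqSum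
    rw [← (Equiv.addRight (-(2 ^ n * a))).tsum_eq]
    refine tsum_congr fun j => ?_
    congr 1
    ext i
    simp only [mem_dyadicArc, Equiv.coe_addRight]
    have : (2 : ℝ) ^ n * ((φ i - x₀) / σ) =
        2 ^ (l + n) * φ i + ((-(2 ^ n * a) : ℤ) : ℝ) := by
      rw [pow_add, hx₀]
      push_cast
      have h2 : (2 : ℝ) ^ l = σ⁻¹ := eq_inv_of_mul_eq_one_left hσ2
      rw [h2]
      field_simp
      ring
    rw [this, Int.floor_add_intCast, add_left_inj]
  rwa [hsum] at hmain

variable (P) in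
lemma arcSqSum_zero (g : ι → Ω → ℂ) {φ : ι → ℝ} {S : Finset ι}
    (hφ : ∀ i ∈ S, φ i ∈ Ico (0 : ℝ) 1) : arcSqSum P g φ 0 S = sixNormSq P g S := by
  have h0 : ∀ i ∈ S, ⌊(2 : ℝ) ^ 0 * φ i⌋ = 0 := fun i hi => by
    simpa [Int.floor_eq_zero_iff] using hφ i hi
  unfold arcSqSum
  rw [tsum_eq_single 0]
  · congr 1
    exact Finset.filter_true_of_mem h0
  · intro j hj
    have : dyadicArc φ 0 j S = ∅ :=
      Finset.filter_false_of_mem fun i hi h => hj (by rw [← h, h0 i hi])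
    rw [this, sixNormSq_empty]

/-- Iterated decoupling of the truncated cone into arcs of level `q * n`. -/
lemma ConeModes.decouple {c : ℝ} {n : ℕ} {K : ℝ≥0∞} (hc : 0 ≤ c)
    (hK : DecouplingBound ι P c n K)
    {ψ m : ℝ → ℝ} (hQ : QuadCurve c ψ m) (hψ : ∀ x ∈ Icc (0 : ℝ) 1, |ψ x| ≤ 1)
    (hm : ∀ x ∈ Icc (0 : ℝ) 1, |m x| ≤ 1) {g : ι → Ω → ℂ} {φ r : ι → ℝ} {S : Finset ι}
    (hS : ConeModes P ψ g φ r S) {w : ℝ} (hr : ∀ i ∈ S, |r i / w - 1| ≤ (1 / 4) ^ n) (q : ℕ)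
    (hw : 4 * 4 ^ (q * n) ≤ |w|) :
    ∫⁻ ω, ‖modeSum g S ω‖ₑ ^ 6 ∂P ≤ K ^ q * arcSqSum P g φ (q * n) S ^ 3 := by
  have main : arcSqSum P g φ 0 S ≤ (K ^ (1 / 3 : ℝ)) ^ q * arcSqSum P g φ (q * n) S := by
    induction q with
    | zero => simp
    | succ q ih =>
      have hstep : arcSqSum P g φ (q * n) S ≤
          K ^ (1 / 3 : ℝ) * arcSqSum P g φ ((q + 1) * n) S := by
        rw [← tsum_arcSqSum P g φ (k := q * n) (n := (q + 1) * n) (by nlinarith) S,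
          ← ENNReal.tsum_mul_left]
        refine ENNReal.tsum_le_tsum fun j => ?_
        have hsub : dyadicArc φ (q * n) j S ⊆ S := Finset.filter_subset _ _
        have h := (hS.mono hsub).decouple_arc (l := q * n) hc hK hQ hψ hm (w := w) (by
          refine le_trans (le_of_eq ?_) hw
          rw [mul_assoc, ← pow_add]; ring_nf) (fun i hi => hr i (hsub hi))
          ⟨j, fun i hi => (mem_dyadicArc.mp hi).2⟩
        rw [← sixNormSq_pow] at h
        rw [← ENNReal.pow_le_pow_left_iff (n := 3) (by norm_num), mul_pow,
          ← ENNReal.rpow_natCast (K ^ (1 / 3 : ℝ)), ← ENNReal.rpow_mul]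
        norm_num
        convert h using 3
        ring_nf
      have hw' : 4 * 4 ^ (q * n) ≤ |w| := by
        refine le_trans ?_ hw
        gcongr
        · norm_num
        · omega
      calc _ ≤ _ := ih hw'
        _ ≤ (K ^ (1 / 3 : ℝ)) ^ q * (K ^ (1 / 3 : ℝ) * arcSqSum P g φ ((q + 1) * n) S) := by
            gcongr
        _ = _ := by ring
  rw [arcSqSum_zero P g hS.label] at main
  rw [← sixNormSq_pow]
  refine (pow_le_pow_left' main 3).trans (le_of_eq ?_)
  rw [mul_pow, ← pow_mul, mul_comm q 3, pow_mul, ← ENNReal.rpow_natCast (K ^ (1 / 3 : ℝ)),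
    ← ENNReal.rpow_mul]
  norm_num

end Cone

section Trig

open scoped FourierTransform

/-- The trigonometric polynomial with coefficients `a` on the frequency set `T`. -/
def trigSum (T : Finset ℤ) (a : ℤ → ℂ) (u : ℝ) : ℂ := ∑ n ∈ T, a n * 𝐞 (n * u)

lemma continuous_trigSum (T : Finset ℤ) (a : ℤ → ℂ) : Continuous (trigSum T a) := by
  unfold trigSum
  have := Real.continuous_fourierChar
  fun_prop

lemma integral_fourierChar_int_mul (n : ℤ) :
    ∫ v in (0 : ℝ)..1, (𝐞 (n * v) : ℂ) = if n = 0 then 1 else 0 := by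
  split_ifs with h
  · simp [h]
  · have hc : (2 * Real.pi * n * Complex.I : ℂ) ≠ 0 := by
      simp [h, Real.pi_ne_zero]
    have e : ∀ v : ℝ, (𝐞 (n * v) : ℂ) = Complex.exp (2 * Real.pi * n * Complex.I * v) := by
      intro v
      rw [Real.fourierChar_apply]
      push_cast
      ring_nf
    simp_rw [e]
    rw [integral_exp_mul_complex hc]
    have : Complex.exp (2 * Real.pi * n * Complex.I * ((1 : ℝ) : ℂ)) = 1 := by
      rw [Complex.exp_eq_one_iff]
      exact ⟨n, by push_cast; ring⟩
    rw [this]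
    simp

/-- The hat function of half-width `D`. -/
def hat (D : ℕ) (n : ℤ) : ℝ := max 0 (1 - |(n : ℝ)| / D)

lemma hat_nonneg (D : ℕ) (n : ℤ) : 0 ≤ hat D n := le_max_left _ _

lemma hat_le_one (D : ℕ) (n : ℤ) : hat D n ≤ 1 := by
  unfold hat
  have : 0 ≤ |(n : ℝ)| / D := by positivity
  exact max_le zero_le_one (by linarith)

/-- The Fejér kernel. -/
def fejer (D : ℕ) (v : ℝ) : ℝ := ‖∑ j ∈ Finset.range D, (𝐞 (j * v) : ℂ)‖ ^ 2 / D

lemma fejer_nonneg (D : ℕ) (v : ℝ) : 0 ≤ fejer D v := by unfold fejer; positivity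

lemma continuous_fejer (D : ℕ) : Continuous (fejer D) := by
  unfold fejer
  have := Real.continuous_fourierChar
  fun_prop

lemma conj_fourierChar (x : ℝ) : (starRingEnd ℂ) (𝐞 x : ℂ) = 𝐞 (-x) := by
  rw [AddChar.map_neg_eq_inv, Circle.coe_inv_eq_conj]

lemma fejer_eq_sum (D : ℕ) (v : ℝ) : (fejer D v : ℂ) =
    (∑ i ∈ Finset.range D, ∑ j ∈ Finset.range D, (𝐞 (((i : ℤ) - (j : ℤ) : ℤ) * v) : ℂ)) / D := by
  unfold fejer
  push_cast
  rw [← Complex.mul_conj', map_sum, Finset.sum_mul_sum]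
  congr 1
  refine Finset.sum_congr rfl fun i _ => Finset.sum_congr rfl fun j _ => ?_
  rw [conj_fourierChar, ← Circle.coe_mul, ← AddChar.map_add_eq_mul]
  congr 2
  ring

lemma card_diff_eq (D : ℕ) (m : ℤ) :
    ∑ i ∈ Finset.range D, ∑ j ∈ Finset.range D, (if (i : ℤ) - (j : ℤ) = m then (1 : ℝ) else 0) =
      max 0 (D - |(m : ℝ)|) := by
  have e : ∀ j ∈ Finset.range D, ∑ i ∈ Finset.range D,
      (if (i : ℤ) - (j : ℤ) = m then (1 : ℝ) else 0) =
      if 0 ≤ (j : ℤ) + m ∧ (j : ℤ) + m < D then 1 else 0 := by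
    intro j _
    split_ifs with h
    · rw [Finset.sum_eq_single ((j : ℤ) + m).toNat]
      · rw [if_pos]; omega
      · intro b _ hb; rw [if_neg]; omega
      · intro hb; rw [Finset.mem_range] at hb; omega
    · refine Finset.sum_eq_zero fun i hi => ?_
      rw [Finset.mem_range] at hi
      rw [if_neg]; omega
  rw [Finset.sum_comm, Finset.sum_congr rfl e, Finset.sum_boole]
  have hcard : ((Finset.range D).filter fun j : ℕ => 0 ≤ (j : ℤ) + m ∧ (j : ℤ) + m < D) =
      Finset.Ico (max 0 (-m)).toNat (min (D : ℤ) (D - m)).toNat := by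
    ext j
    simp only [Finset.mem_filter, Finset.mem_range, Finset.mem_Ico]
    omega
  rw [hcard, Nat.card_Ico]
  have h2 : (((min (D : ℤ) (D - m)).toNat - (max 0 (-m)).toNat : ℕ) : ℤ) = max 0 (D - |m|) := by
    rcases abs_cases m with ⟨h, _⟩ | ⟨h, _⟩ <;> rw [h] <;> omega
  exact_mod_cast h2

lemma integral_fejer_mul (D : ℕ) (hD : 0 < D) (m : ℤ) :
    ∫ v in (0 : ℝ)..1, (fejer D v : ℂ) * 𝐞 (m * v) = hat D m := by
  have hc := Real.continuous_fourierChar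
  have e : ∀ v : ℝ, (fejer D v : ℂ) * 𝐞 (m * v) = ∑ i ∈ Finset.range D, ∑ j ∈ Finset.range D,
      (𝐞 (((i : ℤ) - (j : ℤ) + m : ℤ) * v) : ℂ) / D := by
    intro v
    rw [fejer_eq_sum, div_mul_eq_mul_div, Finset.sum_mul, Finset.sum_div]
    refine Finset.sum_congr rfl fun i _ => ?_
    rw [Finset.sum_mul, Finset.sum_div]
    refine Finset.sum_congr rfl fun j _ => ?_
    rw [← Circle.coe_mul, ← AddChar.map_add_eq_mul]
    congr 3
    push_cast
    ring
  simp_rw [e]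
  rw [intervalIntegral.integral_finsetSum fun i _ =>
    Continuous.intervalIntegrable (by fun_prop) _ _]
  have e2 : ∀ i j : ℕ, ∫ v in (0 : ℝ)..1, (𝐞 (((i : ℤ) - (j : ℤ) + m : ℤ) * v) : ℂ) / D =
      (((if (i : ℤ) - (j : ℤ) = -m then (1 : ℝ) else 0) : ℝ) : ℂ) / D := by
    intro i j
    rw [intervalIntegral.integral_div, integral_fourierChar_int_mul]
    congr 1
    by_cases h : (i : ℤ) - (j : ℤ) = -m
    · rw [if_pos h, if_pos (by omega)]; simp
    · rw [if_neg h, if_neg (by omega)]; simp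
  have e3 : ∀ i ∈ Finset.range D, ∫ v in (0 : ℝ)..1, ∑ j ∈ Finset.range D,
      (𝐞 (((i : ℤ) - (j : ℤ) + m : ℤ) * v) : ℂ) / D = ∑ j ∈ Finset.range D,
      (((if (i : ℤ) - (j : ℤ) = -m then (1 : ℝ) else 0) : ℝ) : ℂ) / D := by
    intro i _
    rw [intervalIntegral.integral_finsetSum fun i _ =>
      Continuous.intervalIntegrable (by fun_prop) _ _]
    exact Finset.sum_congr rfl fun j _ => e2 i j
  rw [Finset.sum_congr rfl e3]
  have := card_diff_eq D (-m)
  simp_rw [← Finset.sum_div, ← Complex.ofReal_sum]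
  rw [this, hat]
  have hD' : (0 : ℝ) < D := by exact_mod_cast hD
  rw [← Complex.ofReal_natCast, ← Complex.ofReal_div]
  congr 1
  rw [← max_div_div_right hD'.le]
  push_cast
  rw [abs_neg, zero_div, sub_div, div_self hD'.ne']

lemma integral_fejer (D : ℕ) (hD : 0 < D) : ∫ v in (0 : ℝ)..1, fejer D v = 1 := by
  have := integral_fejer_mul D hD 0
  simp only [Int.cast_zero, zero_mul, AddChar.map_zero_eq_one, Circle.coe_one, mul_one, hat,
    abs_zero, zero_div, sub_zero, intervalIntegral.integral_ofReal] at this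
  have h2 : (∫ v in (0 : ℝ)..1, fejer D v) = max 0 1 := by exact_mod_cast this
  rw [h2]; simp

/-- Modulated hat multipliers as averages of translates. -/
lemma trigSum_hat_eq (T : Finset ℤ) (a : ℤ → ℂ) (D : ℕ) (hD : 0 < D) (b : ℤ) (u : ℝ) :
    trigSum T (fun n => hat D (n - b) * a n) u =
      ∫ v in (0 : ℝ)..1, ((fejer D v : ℂ) * 𝐞 (-b * v)) * trigSum T a (u + v) := by
  have hc := Real.continuous_fourierChar
  have hf := continuous_fejer D
  unfold trigSum
  simp_rw [Finset.mul_sum]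
  rw [intervalIntegral.integral_finsetSum fun i _ =>
    Continuous.intervalIntegrable (by fun_prop) _ _]
  refine Finset.sum_congr rfl fun n _ => ?_
  have e : ∀ v : ℝ, ((fejer D v : ℂ) * 𝐞 (-b * v)) * (a n * 𝐞 (n * (u + v))) =
      (a n * 𝐞 (n * u)) * ((fejer D v : ℂ) * 𝐞 ((n - b : ℤ) * v)) := by
    intro v
    have h1 : n * (u + v) = n * u + n * v := by ring
    have h2 : ((n - b : ℤ) : ℝ) * v = n * v + -b * v := by push_cast; ring
    rw [h1, h2, AddChar.map_add_eq_mul, AddChar.map_add_eq_mul]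
    push_cast
    ring
  simp_rw [e]
  rw [intervalIntegral.integral_const_mul, integral_fejer_mul D hD]
  ring

/-- Modulated hat multipliers are contractions in the supremum norm. -/
lemma norm_trigSum_hat_le {T : Finset ℤ} {a : ℤ → ℂ} {B : ℝ} (hB : ∀ u, ‖trigSum T a u‖ ≤ B)
    {D : ℕ} (hD : 0 < D) (b : ℤ) (u : ℝ) :
    ‖trigSum T (fun n => hat D (n - b) * a n) u‖ ≤ B := by
  rw [trigSum_hat_eq T a D hD]
  calc _ ≤ ∫ v in (0 : ℝ)..1, fejer D v * B := by
        apply intervalIntegral.norm_integral_le_of_norm_le zero_le_one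
        · refine Filter.Eventually.of_forall fun v _ => ?_
          rw [norm_mul, norm_mul, Circle.norm_coe, mul_one, Complex.norm_real,
            Real.norm_of_nonneg (fejer_nonneg D v)]
          exact mul_le_mul_of_nonneg_left (hB _) (fejer_nonneg D v)
        · exact ((continuous_fejer D).mul continuous_const).intervalIntegrable _ _
    _ = B := by rw [intervalIntegral.integral_mul_const, integral_fejer D hD, one_mul]

lemma hat_eq_zero {D : ℕ} (hD : 0 < D) {n : ℤ} (h : (D : ℤ) ≤ |n|) : hat D n = 0 := by
  unfold hat
  have hD' : (0 : ℝ) < D := by exact_mod_cast hD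
  have : (D : ℝ) ≤ |(n : ℝ)| := by exact_mod_cast h
  rw [max_eq_left]
  have : 1 ≤ |(n : ℝ)| / D := by rwa [one_le_div hD']
  linarith

lemma hat_of_abs_le {D : ℕ} (hD : 0 < D) {n : ℤ} (h : |n| ≤ (D : ℤ)) :
    hat D n = 1 - |(n : ℝ)| / D := by
  unfold hat
  have hD' : (0 : ℝ) < D := by exact_mod_cast hD
  have : |(n : ℝ)| ≤ (D : ℝ) := by exact_mod_cast h
  rw [max_eq_right]
  have : |(n : ℝ)| / D ≤ 1 := by rwa [div_le_one hD']
  linarith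

/-- The translates of a hat function form a partition of unity. -/
lemma sum_hat_sub_mul {D : ℕ} (hD : 0 < D) {N : ℕ} {n : ℤ} (hn : |n| ≤ (N * D : ℕ)) :
    ∑ k ∈ Finset.Icc (-(N : ℤ)) N, hat D (n - k * D) = 1 := by
  have hD' : (0 : ℝ) < D := by exact_mod_cast hD
  have hDz : (0 : ℤ) < D := by exact_mod_cast hD
  obtain ⟨k, r, hr0, hrD, hkr⟩ : ∃ k r : ℤ, 0 ≤ r ∧ r < D ∧ n = k * D + r :=
    ⟨n / D, n % D, Int.emod_nonneg _ hDz.ne', Int.emod_lt_of_pos _ hDz, by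
      rw [mul_comm]; exact (Int.mul_ediv_add_emod n D).symm⟩
  rw [abs_le] at hn
  push_cast at hn
  have hk1 : -(N : ℤ) ≤ k := by
    by_contra! hlt
    have : k + 1 ≤ -N := hlt
    nlinarith
  have hk2 : k ≤ N := by
    by_contra! hlt
    have : (N : ℤ) + 1 ≤ k := hlt
    nlinarith
  have other : ∀ j : ℤ, j ≠ k → j ≠ k + 1 → hat D (n - j * D) = 0 := by
    intro j h1 h2
    apply hat_eq_zero hD
    rw [hkr, show k * (D : ℤ) + r - j * D = (k - j) * D + r by ring, le_abs]
    rcases lt_or_gt_of_ne h1 with h | h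
    · left; nlinarith [show (1 : ℤ) ≤ k - j by omega]
    · right; nlinarith [show k - j ≤ (-2 : ℤ) by omega]
  have v1 : hat D (n - k * D) = 1 - (r : ℝ) / D := by
    have e : n - k * D = r := by rw [hkr]; ring
    rw [e, hat_of_abs_le hD (by rw [abs_of_nonneg hr0]; exact hrD.le), abs_of_nonneg]
    exact_mod_cast hr0
  have v2 : hat D (n - (k + 1) * D) = (r : ℝ) / D := by
    have e : n - (k + 1) * D = r - D := by rw [hkr]; ring
    have h1 : |r - (D : ℤ)| = D - r := by rw [abs_of_nonpos (by omega)]; ring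
    rw [e, hat_of_abs_le hD (by rw [h1]; omega), ← Int.cast_abs, h1]
    push_cast
    field_simp
    ring
  rcases hk2.eq_or_lt with rfl | hk2
  · rw [Finset.sum_eq_single (N : ℤ)]
    · rw [v1]
      have : r = 0 := by nlinarith
      simp [this]
    · intro j hj hne
      rw [Finset.mem_Icc] at hj
      exact other j hne (by omega)
    · intro h; simp at h
  · rw [Finset.sum_eq_add_of_mem k (k + 1) (by simp; omega) (by simp; omega) (by omega), v1, v2]
    · ring
    · intro j _ hne
      exact other j hne.1 hne.2

end Trig

section ConeWaves

open scoped FourierTransform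

/-- The linear functional `v ↦ v₀ + φ v₁ + ψ(φ) v₂`. -/
def coneLin (ψ : ℝ → ℝ) (φ : ℝ) (v : Fin 3 → ℝ) : ℝ := v 0 + φ * v 1 + ψ φ * v 2

lemma continuous_coneLin (ψ : ℝ → ℝ) (φ : ℝ) : Continuous (coneLin ψ φ) := by
  unfold coneLin; fun_prop

/-- Weighted superposition of plane waves with profiles `trigSum T (a φ)`. -/
def superpose (ψ : ℝ → ℝ) (X : Finset ℝ) (ν : ℝ → ℝ) (T : Finset ℤ) (a : ℝ → ℤ → ℂ)
    (v : Fin 3 → ℝ) : ℂ :=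
  ∑ φ ∈ X, (ν φ : ℂ) * trigSum T (a φ) (coneLin ψ φ v)

/-- The plane waves making up a superposition. -/
def coneMode (ψ : ℝ → ℝ) (ν : ℝ → ℝ) (a : ℝ → ℤ → ℂ) (i : ℝ × ℤ) (v : Fin 3 → ℝ) : ℂ :=
  (ν i.1 * a i.1 i.2) * 𝐞 (i.2 * coneLin ψ i.1 v)

lemma modeSum_coneMode (ψ : ℝ → ℝ) (X : Finset ℝ) (ν : ℝ → ℝ) (T : Finset ℤ) (a : ℝ → ℤ → ℂ) :
    modeSum (coneMode ψ ν a) (X ×ˢ T) = superpose ψ X ν T a := by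
  ext v
  simp only [modeSum, superpose, trigSum, coneMode, Finset.sum_product, Finset.mul_sum, mul_assoc]

lemma continuous_coneMode (ψ : ℝ → ℝ) (ν : ℝ → ℝ) (a : ℝ → ℤ → ℂ) (i : ℝ × ℤ) :
    Continuous (coneMode ψ ν a i) := by
  unfold coneMode
  have := Real.continuous_fourierChar
  have := continuous_coneLin ψ i.1
  fun_prop

lemma bddMeas_coneMode (ψ : ℝ → ℝ) (ν : ℝ → ℝ) (a : ℝ → ℤ → ℂ) (i : ℝ × ℤ) :
    BddMeas (coneMode ψ ν a i) :=
  ⟨(continuous_coneMode ψ ν a i).measurable, ‖(ν i.1 * a i.1 i.2 : ℂ)‖, fun v => by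
    rw [coneMode, norm_mul, Circle.norm_coe, mul_one]⟩

lemma continuous_superpose (ψ : ℝ → ℝ) (X : Finset ℝ) (ν : ℝ → ℝ) (T : Finset ℤ)
    (a : ℝ → ℤ → ℂ) : Continuous (superpose ψ X ν T a) := by
  unfold superpose
  exact continuous_finsetSum _ fun φ _ => continuous_const.mul
    ((continuous_trigSum T (a φ)).comp (continuous_coneLin ψ φ))

lemma norm_superpose_le {ψ : ℝ → ℝ} {X : Finset ℝ} {ν : ℝ → ℝ} (hν : ∀ φ ∈ X, 0 ≤ ν φ)
    {T : Finset ℤ} {a : ℝ → ℤ → ℂ} {B : ℝ} (hB : ∀ φ ∈ X, ∀ u, ‖trigSum T (a φ) u‖ ≤ B)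
    (v : Fin 3 → ℝ) : ‖superpose ψ X ν T a v‖ ≤ B * ∑ φ ∈ X, ν φ := by
  rw [Finset.mul_sum]
  refine (norm_sum_le _ _).trans (Finset.sum_le_sum fun φ hφ => ?_)
  rw [norm_mul, Complex.norm_real, Real.norm_of_nonneg (hν φ hφ), mul_comm]
  exact mul_le_mul_of_nonneg_right (hB φ hφ _) (hν φ hφ)

/-- Characters whose frequency is at least one in some coordinate have mean zero. -/
def SpectralGap (P : Measure (Fin 3 → ℝ)) : Prop :=
  ∀ ζ : Fin 3 → ℝ, (∃ j, 1 ≤ |ζ j|) → ∫ v, (𝐞 (∑ j, ζ j * v j) : ℂ) ∂P = 0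

lemma SpectralGap.abs_lt {P : Measure (Fin 3 → ℝ)} (hP : SpectralGap P) {C : ℂ} {x y z : ℝ}
    (h : ∫ v, C * 𝐞 (x * v 0 + y * v 1 + z * v 2) ∂P ≠ 0) : |x| < 1 ∧ |y| < 1 ∧ |z| < 1 := by
  by_contra hcon
  apply h
  rw [integral_const_mul]
  have := hP ![x, y, z] (by
    by_contra! hall
    have h0 := hall 0
    have h1 := hall 1
    have h2 := hall 2
    simp at h0 h1 h2
    exact hcon ⟨h0, h1, h2⟩)
  simp only [Fin.sum_univ_three] at this
  simp only [Matrix.cons_val_zero, Matrix.cons_val_one, Matrix.cons_val_two] at this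
  simp at this
  rw [this, mul_zero]

lemma coneModes_coneMode {P : Measure (Fin 3 → ℝ)} (hP : SpectralGap P) (ψ : ℝ → ℝ)
    {X : Finset ℝ} (hX : ∀ φ ∈ X, φ ∈ Ico (0 : ℝ) 1) (ν : ℝ → ℝ) (T : Finset ℤ)
    (a : ℝ → ℤ → ℂ) :
    ConeModes P ψ (coneMode ψ ν a) Prod.fst (fun i => (i.2 : ℝ)) (X ×ˢ T) where
  bddMeas i _ := bddMeas_coneMode ψ ν a i
  label i hi := hX _ (Finset.mem_product.mp hi).1
  orth i _ k _ l _ i' _ k' _ l' _ hne := by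
    set C : (ℝ × ℤ) → ℂ := fun i => ν i.1 * a i.1 i.2
    have h := hP.abs_lt (C := (C i * (C k * C l)) * (starRingEnd ℂ) (C i' * (C k' * C l')))
      (x := i.2 + k.2 + l.2 - (i'.2 + k'.2 + l'.2))
      (y := i.2 * i.1 + k.2 * k.1 + l.2 * l.1 - (i'.2 * i'.1 + k'.2 * k'.1 + l'.2 * l'.1))
      (z := i.2 * ψ i.1 + k.2 * ψ k.1 + l.2 * ψ l.1 -
        (i'.2 * ψ i'.1 + k'.2 * ψ k'.1 + l'.2 * ψ l'.1)) (by
        refine fun h0 => hne (Eq.trans (integral_congr_ae (Filter.Eventually.of_forall ?_)) h0)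
        intro v
        have e : ∀ p q r p' q' r' : ℂ, ∀ e1 e2 e3 e4 e5 e6 : ℂ,
          p * e1 * (q * e2 * (r * e3)) * (p' * e4 * (q' * e5 * (r' * e6))) =
          (p * (q * r) * (p' * (q' * r'))) * (e1 * (e2 * (e3 * (e4 * (e5 * e6))))) := by
            intros; ring
        have e2 : ((i.2 : ℝ) + k.2 + l.2 - (i'.2 + k'.2 + l'.2)) * v 0 +
            (i.2 * i.1 + k.2 * k.1 + l.2 * l.1 - (i'.2 * i'.1 + k'.2 * k'.1 + l'.2 * l'.1)) * v 1 +
            (i.2 * ψ i.1 + k.2 * ψ k.1 + l.2 * ψ l.1 -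
              (i'.2 * ψ i'.1 + k'.2 * ψ k'.1 + l'.2 * ψ l'.1)) * v 2 =
            i.2 * coneLin ψ i.1 v + (k.2 * coneLin ψ k.1 v + (l.2 * coneLin ψ l.1 v +
            (-(i'.2 * coneLin ψ i'.1 v) + (-(k'.2 * coneLin ψ k'.1 v) +
              -(l'.2 * coneLin ψ l'.1 v))))) := by
          simp only [coneLin]; ring
        simp only [e2, AddChar.map_add_eq_mul, Circle.coe_mul, ← conj_fourierChar, coneMode,
          map_mul, C]
        exact e _ _ _ _ _ _ _ _ _ _ _ _)
    exact ⟨h.1.le, h.2.1.le, h.2.2.le⟩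

/-- The `L²` bound for superpositions, from almost orthogonality. -/
lemma lintegral_sq_superpose_le {P : Measure (Fin 3 → ℝ)} [IsProbabilityMeasure P]
    (hP : SpectralGap P) (ψ : ℝ → ℝ) {X : Finset ℝ} {ν : ℝ → ℝ} (hν : ∀ φ ∈ X, 0 ≤ ν φ)
    {T : Finset ℤ} {a : ℝ → ℤ → ℂ} {β M W : ℝ} (hW : 0 < W) (hT : ∀ n ∈ T, W ≤ |(n : ℝ)|)
    (hβ : ∀ φ ∈ X, ∑ n ∈ T, ‖a φ n‖ ^ 2 ≤ β)
    (hM : ∀ φ ∈ X, ∑ φ' ∈ X with |φ - φ'| * W < 1, ν φ' ≤ M) :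
    ∫⁻ v, ‖superpose ψ X ν T a v‖ₑ ^ 2 ∂P ≤ ENNReal.ofReal (M * β * ∑ φ ∈ X, ν φ) := by
  classical
  rw [← modeSum_coneMode]
  have hg : ∀ i, BddMeas (coneMode ψ ν a i) := bddMeas_coneMode ψ ν a
  have hgs : BddMeas (modeSum (coneMode ψ ν a) (X ×ˢ T)) := bddMeas_modeSum fun i _ => hg i
  rw [lintegral_enorm_sq_eq hgs]
  apply ENNReal.ofReal_le_ofReal
  set Y := X ×ˢ T with hY
  set C : (ℝ × ℤ) → ℂ := fun i => ν i.1 * a i.1 i.2 with hC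
  have hexp : ((∫ v, ‖modeSum (coneMode ψ ν a) Y v‖ ^ 2 ∂P : ℝ) : ℂ) =
      ∑ i ∈ Y, ∑ k ∈ Y, ∫ v, coneMode ψ ν a i v * (starRingEnd ℂ) (coneMode ψ ν a k v) ∂P := by
    rw [← integral_complex_ofReal]
    have : ∀ v, ((‖modeSum (coneMode ψ ν a) Y v‖ ^ 2 : ℝ) : ℂ) = ∑ i ∈ Y, ∑ k ∈ Y,
        coneMode ψ ν a i v * (starRingEnd ℂ) (coneMode ψ ν a k v) := by
      intro v
      push_cast
      rw [← Complex.mul_conj', modeSum, map_sum, Finset.sum_mul_sum]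
    simp_rw [this]
    rw [integral_finsetSum _ fun i _ =>
      (BddMeas.sum Y fun k _ => (hg i).mul (hg k).star).integrable P]
    refine Finset.sum_congr rfl fun i _ => ?_
    rw [integral_finsetSum _ fun k _ => ((hg i).mul (hg k).star).integrable P]
  have hpair : ∀ i ∈ Y, ∀ k ∈ Y,
      ‖∫ v, coneMode ψ ν a i v * (starRingEnd ℂ) (coneMode ψ ν a k v) ∂P‖ ≤
      if i.2 = k.2 ∧ |i.1 - k.1| * W < 1 then ‖C i‖ * ‖C k‖ else 0 := by
    intro i hi k hk
    have e : ∀ v, coneMode ψ ν a i v * (starRingEnd ℂ) (coneMode ψ ν a k v) =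
        (C i * (starRingEnd ℂ) (C k)) * 𝐞 (((i.2 : ℝ) - k.2) * v 0 +
          (i.2 * i.1 - k.2 * k.1) * v 1 + (i.2 * ψ i.1 - k.2 * ψ k.1) * v 2) := by
      intro v
      have e2 : ((i.2 : ℝ) - k.2) * v 0 +
          (i.2 * i.1 - k.2 * k.1) * v 1 + (i.2 * ψ i.1 - k.2 * ψ k.1) * v 2 =
          i.2 * coneLin ψ i.1 v + -(k.2 * coneLin ψ k.1 v) := by simp only [coneLin]; ring
      rw [e2, AddChar.map_add_eq_mul, Circle.coe_mul, ← conj_fourierChar]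
      simp only [coneMode, hC, map_mul]
      ring
    simp_rw [e]
    split_ifs with hnear
    · refine (norm_integral_le_of_norm_le_const (C := ‖C i‖ * ‖C k‖)
        (Filter.Eventually.of_forall fun v => ?_)).trans (le_of_eq ?_)
      · rw [norm_mul, norm_mul, Circle.norm_coe, mul_one, RCLike.norm_conj]
      · simp
    · rw [norm_le_zero_iff]
      by_contra hne
      obtain ⟨h0, h1, -⟩ := hP.abs_lt hne
      have heq : i.2 = k.2 := by
        have : |i.2 - k.2| < 1 := by exact_mod_cast h0
        have := Int.abs_lt_one_iff.mp this
        omega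
      refine hnear ⟨heq, ?_⟩
      rw [← heq, ← mul_sub, abs_mul] at h1
      have := hT _ (Finset.mem_product.mp hi).2
      nlinarith [abs_nonneg (i.1 - k.1)]
  have hνY : ∀ i ∈ Y, 0 ≤ ν i.1 := fun i hi => hν _ (Finset.mem_product.mp hi).1
  set A : (ℝ × ℤ) → (ℝ × ℤ) → ℝ := fun i k =>
    if i.2 = k.2 ∧ |i.1 - k.1| * W < 1 then ν i.1 * ν k.1 * ‖a i.1 i.2‖ ^ 2 else 0 with hA
  have hnorm : ∀ i ∈ Y, ‖C i‖ = ν i.1 * ‖a i.1 i.2‖ := fun i hi => by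
    rw [hC]
    simp only [norm_mul, Complex.norm_real]
    rw [Real.norm_of_nonneg (hνY i hi)]
  have hsym : ∀ i ∈ Y, ∀ k ∈ Y,
      (if i.2 = k.2 ∧ |i.1 - k.1| * W < 1 then ‖C i‖ * ‖C k‖ else 0) ≤ (A i k + A k i) / 2 := by
    intro i hi k hk
    simp only [hA]
    by_cases h : i.2 = k.2 ∧ |i.1 - k.1| * W < 1
    · rw [if_pos h, if_pos h, if_pos ⟨h.1.symm, by rw [abs_sub_comm]; exact h.2⟩, hnorm i hi,
        hnorm k hk]
      have := mul_nonneg (mul_nonneg (hνY i hi) (hνY k hk))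
        (sq_nonneg (‖a i.1 i.2‖ - ‖a k.1 k.2‖))
      nlinarith
    · rw [if_neg h, if_neg h, if_neg (fun h' => h ⟨h'.1.symm, by
        rw [abs_sub_comm]; exact h'.2⟩)]
      simp
  have hrow : ∀ i ∈ Y, ∑ k ∈ Y, A i k ≤ M * (ν i.1 * ‖a i.1 i.2‖ ^ 2) := by
    intro i hi
    have hiX := (Finset.mem_product.mp hi).1
    have hi2 := (Finset.mem_product.mp hi).2
    have h1 : ∑ k ∈ Y, A i k = ν i.1 * ‖a i.1 i.2‖ ^ 2 *
        ∑ φ' ∈ X with |i.1 - φ'| * W < 1, ν φ' := by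
      rw [hY, Finset.sum_product, Finset.mul_sum, Finset.sum_filter]
      refine Finset.sum_congr rfl fun φ' _ => ?_
      rw [Finset.sum_eq_single i.2]
      · simp only [hA, true_and]
        split_ifs <;> ring
      · intro n _ hn
        simp only [hA]
        rw [if_neg fun h => hn h.1.symm]
      · exact fun h => absurd hi2 h
    rw [h1, mul_comm]
    exact mul_le_mul_of_nonneg_right (hM _ hiX) (mul_nonneg (hνY i hi) (sq_nonneg _))
  have hnn : 0 ≤ ∫ v, ‖modeSum (coneMode ψ ν a) Y v‖ ^ 2 ∂P :=
    integral_nonneg fun _ => by positivity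
  calc ∫ v, ‖modeSum (coneMode ψ ν a) Y v‖ ^ 2 ∂P
      = ‖((∫ v, ‖modeSum (coneMode ψ ν a) Y v‖ ^ 2 ∂P : ℝ) : ℂ)‖ := by
        rw [Complex.norm_real, Real.norm_of_nonneg hnn]
    _ ≤ ∑ i ∈ Y, ∑ k ∈ Y, (A i k + A k i) / 2 := by
        rw [hexp]
        refine (norm_sum_le _ _).trans (Finset.sum_le_sum fun i hi => ?_)
        exact (norm_sum_le _ _).trans (Finset.sum_le_sum fun k hk =>
          (hpair i hi k hk).trans (hsym i hi k hk))
    _ = ∑ i ∈ Y, ∑ k ∈ Y, A i k := by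
        have h1 : ∑ i ∈ Y, ∑ k ∈ Y, A k i = ∑ i ∈ Y, ∑ k ∈ Y, A i k := Finset.sum_comm
        simp_rw [← Finset.sum_div, Finset.sum_add_distrib]
        rw [h1]
        ring
    _ ≤ ∑ i ∈ Y, M * (ν i.1 * ‖a i.1 i.2‖ ^ 2) := Finset.sum_le_sum hrow
    _ = M * ∑ φ ∈ X, ν φ * ∑ n ∈ T, ‖a φ n‖ ^ 2 := by
        rw [← Finset.mul_sum, hY, Finset.sum_product]
        simp_rw [Finset.mul_sum]
    _ ≤ M * ∑ φ ∈ X, ν φ * β := by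
        rcases X.eq_empty_or_nonempty with rfl | ⟨φ, hφ⟩
        · simp
        · have hM0 : 0 ≤ M := le_trans (Finset.sum_nonneg fun φ' h =>
            hν φ' (Finset.mem_filter.mp h).1) (hM φ hφ)
          exact mul_le_mul_of_nonneg_left (Finset.sum_le_sum fun φ hφ =>
            mul_le_mul_of_nonneg_left (hβ φ hφ) (hν φ hφ)) hM0
    _ = M * β * ∑ φ ∈ X, ν φ := by rw [← Finset.sum_mul]; ring

end ConeWaves

section ConeSix

/-- A uniformly convex curve with normalized values and slopes. -/
structure NormCurve (c : ℝ) (ψ m : ℝ → ℝ) : Prop where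
  quad : QuadCurve c ψ m
  abs_le : ∀ x ∈ Icc (0 : ℝ) 1, |ψ x| ≤ 1
  slope_le : ∀ x ∈ Icc (0 : ℝ) 1, |m x| ≤ 1

/-- Nonnegative weights `ν` on a finite set of labels in `[0,1)`, giving mass at most `2 ^ (-s l)`
to dyadic intervals of level `l ≤ J`. -/
structure FrostmanWeights (X : Finset ℝ) (ν : ℝ → ℝ) (s : ℝ) (J : ℕ) : Prop where
  mem : ∀ φ ∈ X, φ ∈ Ico (0 : ℝ) 1
  nonneg : ∀ φ ∈ X, 0 ≤ ν φ
  ball : ∀ l ≤ J, ∀ j : ℤ, ∑ φ ∈ X with ⌊(2 : ℝ) ^ l * φ⌋ = j, ν φ ≤ 2 ^ (-(s * l))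

lemma FrostmanWeights.sum_le_one {X : Finset ℝ} {ν : ℝ → ℝ} {s : ℝ} {J : ℕ}
    (h : FrostmanWeights X ν s J) : ∑ φ ∈ X, ν φ ≤ 1 := by
  have h0 := h.ball 0 (Nat.zero_le _) 0
  rw [Finset.filter_true_of_mem] at h0
  · simpa using h0
  · intro φ hφ
    simpa [Int.floor_eq_zero_iff] using h.mem φ hφ

lemma FrostmanWeights.sum_near_le {X : Finset ℝ} {ν : ℝ → ℝ} {s : ℝ} {J : ℕ}
    (h : FrostmanWeights X ν s J) {l : ℕ} (hl : l ≤ J) (φ : ℝ) :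
    ∑ φ' ∈ X with |φ - φ'| * 2 ^ l < 1, ν φ' ≤ 3 * 2 ^ (-(s * l)) := by
  classical
  set j := ⌊(2 : ℝ) ^ l * φ⌋ with hj
  have hsub : X.filter (fun φ' => |φ - φ'| * 2 ^ l < 1) ⊆
      (Finset.Icc (j - 1) (j + 1)).biUnion fun i => X.filter fun φ' => ⌊(2 : ℝ) ^ l * φ'⌋ = i := by
    intro φ' hφ'
    rw [Finset.mem_filter] at hφ'
    simp only [Finset.mem_biUnion, Finset.mem_filter, Finset.mem_Icc]
    refine ⟨_, ?_, hφ'.1, rfl⟩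
    have h2 : |(2 : ℝ) ^ l * φ - 2 ^ l * φ'| < 1 := by
      rw [← mul_sub, abs_mul, abs_of_pos (by positivity), mul_comm]; exact hφ'.2
    rw [abs_lt] at h2
    have a1 := Int.floor_le ((2 : ℝ) ^ l * φ)
    have a2 := Int.lt_floor_add_one ((2 : ℝ) ^ l * φ)
    have a3 := Int.floor_le ((2 : ℝ) ^ l * φ')
    have a4 := Int.lt_floor_add_one ((2 : ℝ) ^ l * φ')
    constructor
    · have : (j : ℝ) < ⌊(2 : ℝ) ^ l * φ'⌋ + 1 + 1 := by linarith
      have : j < ⌊(2 : ℝ) ^ l * φ'⌋ + 1 + 1 := by exact_mod_cast this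
      omega
    · have : (⌊(2 : ℝ) ^ l * φ'⌋ : ℝ) < j + 1 + 1 := by linarith
      have : ⌊(2 : ℝ) ^ l * φ'⌋ < j + 1 + 1 := by exact_mod_cast this
      omega
  calc ∑ φ' ∈ X with |φ - φ'| * 2 ^ l < 1, ν φ'
      ≤ ∑ φ' ∈ (Finset.Icc (j - 1) (j + 1)).biUnion fun i =>
          X.filter fun φ' => ⌊(2 : ℝ) ^ l * φ'⌋ = i, ν φ' := by
        refine Finset.sum_le_sum_of_subset_of_nonneg hsub fun φ' hφ' _ => ?_
        simp only [Finset.mem_biUnion, Finset.mem_filter] at hφ'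
        obtain ⟨_, _, h', _⟩ := hφ'
        exact h.nonneg _ h'
    _ = ∑ i ∈ Finset.Icc (j - 1) (j + 1), ∑ φ' ∈ X with ⌊(2 : ℝ) ^ l * φ'⌋ = i, ν φ' := by
        refine Finset.sum_biUnion fun i _ k _ hik => ?_
        rw [Function.onFun, Finset.disjoint_left]
        intro x hx hx'
        exact hik ((Finset.mem_filter.mp hx).2.symm.trans (Finset.mem_filter.mp hx').2)
    _ ≤ ∑ _i ∈ Finset.Icc (j - 1) (j + 1), (2 : ℝ) ^ (-(s * l)) :=
        Finset.sum_le_sum fun i _ => h.ball l hl i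
    _ = 3 * 2 ^ (-(s * l)) := by
        rw [Finset.sum_const, Int.card_Icc, nsmul_eq_mul]
        congr 1
        have : (j + 1 + 1 - (j - 1)).toNat = 3 := by omega
        rw [this]; norm_num

/-- The sixth moment of a superposition whose frequencies lie in a narrow window. -/
lemma lintegral_six_superpose_window_le {P : Measure (Fin 3 → ℝ)} [IsProbabilityMeasure P]
    (hP : SpectralGap P) {c : ℝ} (hc : 0 ≤ c) {n : ℕ} {K : ℝ≥0∞}
    (hK : DecouplingBound (ℝ × ℤ) P c n K) {ψ m : ℝ → ℝ} (hψ : NormCurve c ψ m)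
    {X : Finset ℝ} {ν : ℝ → ℝ} (hX : ∀ φ ∈ X, φ ∈ Ico (0 : ℝ) 1) (hν : ∀ φ ∈ X, 0 ≤ ν φ)
    {T : Finset ℤ} {a : ℝ → ℤ → ℂ} {w : ℝ} {q : ℕ}
    (hTw : ∀ k ∈ T, |(k : ℝ) / w - 1| ≤ (1 / 4) ^ n) (hw : 4 * 4 ^ (q * n) ≤ |w|)
    {β M M' B W : ℝ} (hW : 0 < W) (hT : ∀ n ∈ T, W ≤ |(n : ℝ)|)
    (hβ : ∀ φ ∈ X, ∑ n ∈ T, ‖a φ n‖ ^ 2 ≤ β)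
    (hM : ∀ φ ∈ X, ∑ φ' ∈ X with |φ - φ'| * W < 1, ν φ' ≤ M)
    (hM' : ∀ j : ℤ, ∑ φ ∈ X with ⌊(2 : ℝ) ^ (q * n) * φ⌋ = j, ν φ ≤ M')
    (hB : ∀ φ ∈ X, ∀ u, ‖trigSum T (a φ) u‖ ≤ B) (hV : ∑ φ ∈ X, ν φ ≤ 1) :
    ∫⁻ v, ‖superpose ψ X ν T a v‖ₑ ^ 6 ∂P ≤ K ^ q * ENNReal.ofReal (M * β * B ^ 4 * M' ^ 2) := by
  classical
  rcases X.eq_empty_or_nonempty with rfl | ⟨φ₀, hφ₀⟩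
  · simp [superpose]
  have hB0 : 0 ≤ B := (norm_nonneg _).trans (hB φ₀ hφ₀ 0)
  have hβ0 : 0 ≤ β := le_trans (Finset.sum_nonneg fun _ _ => by positivity) (hβ φ₀ hφ₀)
  have hM0 : 0 ≤ M := le_trans (Finset.sum_nonneg fun φ' h =>
    hν φ' (Finset.mem_filter.mp h).1) (hM φ₀ hφ₀)
  have hdec := (coneModes_coneMode hP ψ hX ν T a).decouple hc hK hψ.quad hψ.abs_le hψ.slope_le
    (fun i hi => hTw i.2 (Finset.mem_product.mp hi).2) q hw
  rw [modeSum_coneMode] at hdec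
  refine hdec.trans ?_
  gcongr
  set D := M * β * B ^ 4 * M' ^ 2 with hD
  have hD0 : 0 ≤ D := by positivity
  set mass : ℤ → ℝ := fun j => ∑ φ ∈ X with ⌊(2 : ℝ) ^ (q * n) * φ⌋ = j, ν φ with hmass
  have hmass0 : ∀ j, 0 ≤ mass j := fun j => Finset.sum_nonneg fun φ' h =>
    hν φ' (Finset.mem_filter.mp h).1
  have hκ : (ENNReal.ofReal D ^ (1 / 3 : ℝ)) ^ 3 = ENNReal.ofReal D := by
    rw [← ENNReal.rpow_natCast, ← ENNReal.rpow_mul]; norm_num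
  have hpiece : ∀ j : ℤ, sixNormSq P (coneMode ψ ν a) (dyadicArc Prod.fst (q * n) j (X ×ˢ T)) ≤
      ENNReal.ofReal D ^ (1 / 3 : ℝ) * ENNReal.ofReal (mass j) := by
    intro j
    set Xj := X.filter fun φ => ⌊(2 : ℝ) ^ (q * n) * φ⌋ = j with hXj
    have hsub : Xj ⊆ X := Finset.filter_subset _ _
    have harc : dyadicArc Prod.fst (q * n) j (X ×ˢ T) = Xj ×ˢ T := by
      ext i
      simp only [mem_dyadicArc, Finset.mem_product, hXj, Finset.mem_filter]
      tauto
    rw [harc, ← ENNReal.pow_le_pow_left_iff (n := 3) (by norm_num), sixNormSq_pow,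
      modeSum_coneMode, mul_pow, hκ, ← ENNReal.ofReal_pow (hmass0 j), ← ENNReal.ofReal_mul hD0]
    have hL2 := lintegral_sq_superpose_le hP ψ (X := Xj) (fun φ hφ => hν φ (hsub hφ)) hW hT
      (fun φ hφ => hβ φ (hsub hφ)) (M := M) (fun φ hφ => le_trans
        (Finset.sum_le_sum_of_subset_of_nonneg (Finset.filter_subset_filter _ hsub)
          fun φ' h _ => hν φ' (Finset.mem_filter.mp h).1) (hM φ (hsub hφ)))
    have hsup : ∀ v, ‖superpose ψ Xj ν T a v‖ₑ ≤ ENNReal.ofReal (B * mass j) := fun v => by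
      rw [← ofReal_norm]
      exact ENNReal.ofReal_le_ofReal (norm_superpose_le (fun φ hφ => hν φ (hsub hφ))
        (fun φ hφ => hB φ (hsub hφ)) v)
    calc ∫⁻ v, ‖superpose ψ Xj ν T a v‖ₑ ^ 6 ∂P
        ≤ ∫⁻ v, ENNReal.ofReal (B * mass j) ^ 4 * ‖superpose ψ Xj ν T a v‖ₑ ^ 2 ∂P := by
          refine lintegral_mono fun v => ?_
          calc ‖superpose ψ Xj ν T a v‖ₑ ^ 6
              = ‖superpose ψ Xj ν T a v‖ₑ ^ 4 * ‖superpose ψ Xj ν T a v‖ₑ ^ 2 := by ring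
            _ ≤ _ := by gcongr; exact hsup v
      _ = ENNReal.ofReal (B * mass j) ^ 4 * ∫⁻ v, ‖superpose ψ Xj ν T a v‖ₑ ^ 2 ∂P :=
          lintegral_const_mul' _ _ (by finiteness)
      _ ≤ ENNReal.ofReal (B * mass j) ^ 4 * ENNReal.ofReal (M * β * mass j) := by
          gcongr
      _ = ENNReal.ofReal ((B * mass j) ^ 4 * (M * β * mass j)) := by
          rw [← ENNReal.ofReal_pow (mul_nonneg hB0 (hmass0 j)), ← ENNReal.ofReal_mul]
          positivity
      _ ≤ ENNReal.ofReal (D * mass j ^ 3) := by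
          apply ENNReal.ofReal_le_ofReal
          have h1 : mass j ^ 2 ≤ M' ^ 2 := pow_le_pow_left₀ (hmass0 j) (hM' j) 2
          have h2 : 0 ≤ M * β * B ^ 4 * mass j ^ 3 := by
            have := hmass0 j
            positivity
          calc (B * mass j) ^ 4 * (M * β * mass j)
              = M * β * B ^ 4 * mass j ^ 3 * mass j ^ 2 := by ring
            _ ≤ M * β * B ^ 4 * mass j ^ 3 * M' ^ 2 := mul_le_mul_of_nonneg_left h1 h2
            _ = _ := by rw [hD]; ring
  have hsum : ∑' j : ℤ, ENNReal.ofReal (mass j) ≤ 1 := by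
    have hfin : ∀ j ∉ X.image (fun φ => ⌊(2 : ℝ) ^ (q * n) * φ⌋), ENNReal.ofReal (mass j) = 0 := by
      intro j hj
      have : X.filter (fun φ => ⌊(2 : ℝ) ^ (q * n) * φ⌋ = j) = ∅ :=
        Finset.filter_false_of_mem fun φ hφ h => hj (Finset.mem_image.mpr ⟨φ, hφ, h⟩)
      simp [hmass, this]
    rw [tsum_eq_sum hfin, ← ENNReal.ofReal_sum_of_nonneg fun j _ => hmass0 j]
    simp only [hmass]
    rw [Finset.sum_fiberwise_of_maps_to fun φ hφ => Finset.mem_image_of_mem _ hφ]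
    simpa using hV
  calc arcSqSum P (coneMode ψ ν a) Prod.fst (q * n) (X ×ˢ T) ^ 3
      ≤ (ENNReal.ofReal D ^ (1 / 3 : ℝ) * 1) ^ 3 := by
        gcongr
        unfold arcSqSum
        calc _ ≤ ∑' j, ENNReal.ofReal D ^ (1 / 3 : ℝ) * ENNReal.ofReal (mass j) :=
              ENNReal.tsum_le_tsum hpiece
          _ ≤ _ := by rw [ENNReal.tsum_mul_left]; gcongr
    _ = ENNReal.ofReal D := by rw [mul_one, hκ]

end ConeSix

section ConeSixMoment

lemma superpose_eq_sum_windows {ψ : ℝ → ℝ} {X : Finset ℝ} {ν : ℝ → ℝ} {a : ℝ → ℤ → ℂ} {D N : ℕ}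
    (hD : 0 < D) (v : Fin 3 → ℝ) :
    superpose ψ X ν (Finset.Icc (-(N * D : ℕ) : ℤ) (N * D : ℕ)) a v =
      ∑ k ∈ Finset.Icc (-(N : ℤ)) N, superpose ψ X ν (Finset.Icc (-(N * D : ℕ) : ℤ) (N * D : ℕ))
        (fun φ n => hat D (n - k * D) * a φ n) v := by
  unfold superpose trigSum
  rw [Finset.sum_comm]
  refine Finset.sum_congr rfl fun φ _ => ?_
  rw [← Finset.mul_sum, Finset.sum_comm]
  congr 1
  refine Finset.sum_congr rfl fun n hn => ?_
  rw [← Finset.sum_mul, ← Finset.sum_mul, ← Complex.ofReal_sum, sum_hat_sub_mul hD, Complex.ofReal_one,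
    one_mul]
  rw [Finset.mem_Icc] at hn
  rw [abs_le]; exact hn

lemma trigSum_filter (T : Finset ℤ) (a : ℤ → ℂ) (p : ℤ → Prop) [DecidablePred p]
    (h : ∀ n ∈ T, ¬ p n → a n = 0) : trigSum (T.filter p) a = trigSum T a := by
  ext u
  unfold trigSum
  refine Finset.sum_subset (Finset.filter_subset _ _) fun n hn hn' => ?_
  rw [h n hn fun hp => hn' (Finset.mem_filter.mpr ⟨hn, hp⟩), zero_mul]

/-- The sixth moment of one window of a superposition with frequencies comparable to `2 ^ l`. -/
lemma lintegral_six_superpose_hat_le {P : Measure (Fin 3 → ℝ)} [IsProbabilityMeasure P]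
    (hP : SpectralGap P) {c : ℝ} (hc : 0 ≤ c) {n l q : ℕ} (hl : 3 + 2 * (q * n) ≤ l)
    (hnl : 2 * n + 1 ≤ l) {K : ℝ≥0∞}
    (hK : DecouplingBound (ℝ × ℤ) P c n K) {ψ m : ℝ → ℝ} (hψ : NormCurve c ψ m)
    {X : Finset ℝ} {ν : ℝ → ℝ} {s : ℝ} (hX : FrostmanWeights X ν s l)
    {T : Finset ℤ} {a : ℝ → ℤ → ℂ} {β B : ℝ}
    (hsupp : ∀ φ ∈ X, ∀ k ∈ T, |k| < 2 ^ l → a φ k = 0)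
    (hβ : ∀ φ ∈ X, ∑ n ∈ T, ‖a φ n‖ ^ 2 ≤ β)
    (hB : ∀ φ ∈ X, ∀ u, ‖trigSum T (a φ) u‖ ≤ B) (k : ℤ) :
    ∫⁻ v, ‖superpose ψ X ν T (fun φ j =>
      hat (2 ^ (l - 1 - 2 * n)) (j - k * (2 ^ (l - 1 - 2 * n) : ℕ)) * a φ j) v‖ₑ ^ 6 ∂P ≤
      K ^ q * ENNReal.ofReal (3 * 2 ^ (-(s * l)) * β * B ^ 4 * (2 ^ (-(s * (q * n : ℕ)))) ^ 2) := by
  classical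
  set D : ℕ := 2 ^ (l - 1 - 2 * n) with hD
  have hD0 : 0 < D := by positivity
  have hDn : (4 : ℝ) ^ n * D * 2 = 2 ^ l := by
    rw [hD]
    push_cast
    rw [show (4 : ℝ) = 2 ^ 2 by norm_num, ← pow_mul, ← pow_add, ← pow_succ]
    congr 1
    omega
  have hD2 : (2 : ℝ) * D ≤ 2 ^ l := by
    have : (1 : ℝ) ≤ 4 ^ n := one_le_pow₀ (by norm_num)
    nlinarith [(Nat.cast_pos (α := ℝ)).mpr hD0]
  set T' := T.filter fun j => |j - k * D| < D ∧ 2 ^ l ≤ |j| with hT'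
  set a' : ℝ → ℤ → ℂ := fun φ j => hat D (j - k * D) * a φ j with ha'
  have htrig : ∀ φ ∈ X, trigSum T' (a' φ) = trigSum T (a' φ) := by
    intro φ hφ
    refine trigSum_filter T (a' φ) _ fun j hj hnot => ?_
    simp only [ha']
    rw [not_and_or, not_lt, not_le] at hnot
    rcases hnot with h | h
    · rw [hat_eq_zero hD0 h]; simp
    · rw [hsupp φ hφ j hj h]; simp
  have hsup : superpose ψ X ν T a' = superpose ψ X ν T' a' := by
    ext v
    unfold superpose
    exact Finset.sum_congr rfl fun φ hφ => by rw [htrig φ hφ]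
  rw [hsup]
  by_cases hk : (2 : ℝ) ^ l ≤ 2 * |(k * D : ℝ)|
  · have hkpos : 0 < |(k * D : ℝ)| := by
      have : (0 : ℝ) < 2 ^ l := by positivity
      linarith
    refine lintegral_six_superpose_window_le hP hc hK hψ hX.mem hX.nonneg (w := k * D) ?_ ?_
      (W := 2 ^ l) (by positivity) ?_ ?_ (fun φ _ => hX.sum_near_le le_rfl φ)
      (fun j => hX.ball _ (by omega) j) ?_ hX.sum_le_one
    · intro j hj
      rw [hT', Finset.mem_filter] at hj
      have h1 : |((j : ℝ) - k * D)| ≤ D := by exact_mod_cast hj.2.1.le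
      have hne : (k * D : ℝ) ≠ 0 := abs_pos.mp hkpos
      have e : (j : ℝ) / (k * D) - 1 = (j - k * D) / (k * D) := by
        rw [sub_div, div_self hne]
      rw [e, abs_div, div_le_iff₀ hkpos, one_div_pow]
      have h4 : (0 : ℝ) < 4 ^ n := by positivity
      rw [one_div, ← div_eq_inv_mul, le_div_iff₀ h4]
      nlinarith
    · have : (4 : ℝ) * 4 ^ (q * n) * 2 ≤ 2 ^ l := by
        rw [show (4 : ℝ) = 2 ^ 2 by norm_num, ← pow_mul, ← pow_add, ← pow_succ]
        exact pow_le_pow_right₀ (by norm_num) (by omega)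
      linarith
    · intro j hj
      rw [hT', Finset.mem_filter] at hj
      exact_mod_cast hj.2.2
    · intro φ hφ
      refine le_trans ?_ (hβ φ hφ)
      refine (Finset.sum_le_sum fun j _ => ?_).trans
        (Finset.sum_le_sum_of_subset_of_nonneg (Finset.filter_subset _ T) fun _ _ _ => by positivity)
      simp only [ha', norm_mul, Complex.norm_real, Real.norm_of_nonneg (hat_nonneg _ _), mul_pow]
      have : hat D (j - k * D) ^ 2 ≤ 1 := pow_le_one₀ (hat_nonneg _ _) (hat_le_one _ _)
      nlinarith [sq_nonneg ‖a φ j‖]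
    · intro φ hφ u
      rw [htrig φ hφ]
      exact norm_trigSum_hat_le (hB φ hφ) hD0 (k * D) u
  · have hempty : T' = ∅ := by
      apply Finset.filter_false_of_mem
      rintro j - ⟨h1, h2⟩
      have h1' : |((j : ℝ) - k * D)| < D := by exact_mod_cast h1
      have h2' : (2 : ℝ) ^ l ≤ |(j : ℝ)| := by exact_mod_cast h2
      have h3 : |(j : ℝ)| ≤ |((j : ℝ) - k * D)| + |(k * D : ℝ)| := by
        simpa using abs_add_le ((j : ℝ) - k * D) (k * D)
      linarith
    simp [hempty, superpose, trigSum]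

/-- The sixth moment of a superposition with frequencies comparable to `2 ^ l`. -/
theorem exists_lintegral_six_superpose_le {P : Measure (Fin 3 → ℝ)} [IsProbabilityMeasure P]
    (hP : SpectralGap P) {c η : ℝ} (hc : 0 < c) (hη : 0 < η) :
    ∃ C : ℝ, 0 ≤ C ∧ ∃ l₀ : ℕ, ∀ l ≥ l₀, ∀ ψ m, NormCurve c ψ m → ∀ X ν s,
      s ≤ 1 → FrostmanWeights X ν s l → ∀ (a : ℝ → ℤ → ℂ) (B β : ℝ),
      (∀ φ ∈ X, ∀ k : ℤ, |k| < 2 ^ l → a φ k = 0) →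
      (∀ φ ∈ X, ∑ n ∈ Finset.Icc (-(4 * 2 ^ l) : ℤ) (4 * 2 ^ l), ‖a φ n‖ ^ 2 ≤ β) →
      (∀ φ ∈ X, ∀ u, ‖trigSum (Finset.Icc (-(4 * 2 ^ l) : ℤ) (4 * 2 ^ l)) (a φ) u‖ ≤ B) →
      ∫⁻ v, ‖superpose ψ X ν (Finset.Icc (-(4 * 2 ^ l) : ℤ) (4 * 2 ^ l)) a v‖ₑ ^ 6 ∂P ≤
        ENNReal.ofReal (C * B ^ 4 * β * 2 ^ ((η - 2 * s) * l)) := by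
  obtain ⟨q, hq⟩ := exists_nat_ge (14 / η)
  obtain ⟨A, hA0, hA⟩ := decouplingExponent_of_pos (ℝ × ℤ) P hc hη
  refine ⟨17 ^ 6 * 3 * A ^ q * 2 ^ (2 * q + 2), by positivity, 4 * (q + 1), ?_⟩
  intro l hl ψ m hψ X ν s hs1 hX a B β hsupp hβ hB
  set n := l / (2 * (q + 1)) with hn
  have hn1 : n * (2 * (q + 1)) ≤ l := Nat.div_mul_le_self _ _
  have hn2 : l < (n + 1) * (2 * (q + 1)) := by
    rw [add_mul, one_mul]
    exact Nat.lt_div_mul_add (by omega)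
  have hn3 : 2 ≤ n := by
    rw [hn, Nat.le_div_iff_mul_le (by omega)]; omega
  have hl1 : 3 + 2 * (q * n) ≤ l := by nlinarith
  have hq0 : 0 < q := by
    have : (0 : ℝ) < q := lt_of_lt_of_le (by positivity) hq
    exact_mod_cast this
  have hl2 : 2 * n + 1 ≤ l := by nlinarith
  rcases X.eq_empty_or_nonempty with rfl | ⟨φ₀, hφ₀⟩
  · simp [superpose]
  have hB0 : 0 ≤ B := (norm_nonneg _).trans (hB φ₀ hφ₀ 0)
  have hβ0 : 0 ≤ β := le_trans (Finset.sum_nonneg fun _ _ => by positivity) (hβ φ₀ hφ₀)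
  set D : ℕ := 2 ^ (l - 1 - 2 * n) with hD
  set N : ℕ := 8 * 4 ^ n with hN
  have hND : N * D = 4 * 2 ^ l := by
    rw [hN, hD, show (4 : ℕ) = 2 ^ 2 by norm_num, show (8 : ℕ) = 2 ^ 3 by norm_num, ← pow_mul,
      ← pow_add, ← pow_add, ← pow_add]
    congr 1
    omega
  have hNDz : ((N * D : ℕ) : ℤ) = 4 * 2 ^ l := by exact_mod_cast hND
  have hwin := fun v => superpose_eq_sum_windows (ψ := ψ) (X := X) (ν := ν) (a := a) (D := D)
    (N := N) (by positivity) v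
  rw [hNDz] at hwin
  set T := Finset.Icc (-(4 * 2 ^ l) : ℤ) (4 * 2 ^ l) with hT
  set R := 3 * 2 ^ (-(s * l)) * β * B ^ 4 * ((2 : ℝ) ^ (-(s * (q * n : ℕ)))) ^ 2 with hR
  have hR0 : 0 ≤ R := by positivity
  have hcard : (Finset.Icc (-(N : ℤ)) N).card = 2 * N + 1 := by
    rw [Int.card_Icc]; omega
  have h17 : ((2 * N + 1 : ℕ) : ℝ) ≤ 17 * 4 ^ n := by
    rw [hN]; push_cast
    have : (1 : ℝ) ≤ 4 ^ n := one_le_pow₀ (by norm_num)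
    linarith
  have hcs := continuous_superpose ψ X ν T
  calc ∫⁻ v, ‖superpose ψ X ν T a v‖ₑ ^ 6 ∂P
      ≤ ∫⁻ v, ((2 * N + 1 : ℕ) : ℝ≥0∞) ^ 5 * ∑ k ∈ Finset.Icc (-(N : ℤ)) N,
          ‖superpose ψ X ν T (fun φ j => hat D (j - k * D) * a φ j) v‖ₑ ^ 6 ∂P := by
        refine lintegral_mono fun v => ?_
        simp only []
        rw [hwin v, ← hcard]
        exact enorm_sum_pow_six_le _ _
    _ = ((2 * N + 1 : ℕ) : ℝ≥0∞) ^ 5 * ∑ k ∈ Finset.Icc (-(N : ℤ)) N,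
          ∫⁻ v, ‖superpose ψ X ν T (fun φ j => hat D (j - k * D) * a φ j) v‖ₑ ^ 6 ∂P := by
        rw [lintegral_const_mul' _ _ (by finiteness), lintegral_finsetSum]
        intro k _
        exact ((hcs _).measurable.enorm).pow_const 6
    _ ≤ ((2 * N + 1 : ℕ) : ℝ≥0∞) ^ 5 * ∑ k ∈ Finset.Icc (-(N : ℤ)) N,
          ENNReal.ofReal (A * 2 ^ (η * n)) ^ q * ENNReal.ofReal R := by
        gcongr with k hk
        exact lintegral_six_superpose_hat_le hP hc.le hl1 hl2 (hA n) hψ hX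
          (fun φ hφ k _ => hsupp φ hφ k) hβ hB k
    _ = ENNReal.ofReal (((2 * N + 1 : ℕ) : ℝ) ^ 6 * ((A * 2 ^ (η * n)) ^ q * R)) := by
        rw [Finset.sum_const, hcard, nsmul_eq_mul, ← mul_assoc, ← pow_succ,
          ← ENNReal.ofReal_pow (by positivity), ← ENNReal.ofReal_mul (by positivity),
          ← ENNReal.ofReal_natCast, ← ENNReal.ofReal_pow (by positivity),
          ← ENNReal.ofReal_mul (by positivity)]
    _ ≤ _ := by
        apply ENNReal.ofReal_le_ofReal
        have hηq : 14 ≤ η * (q + 1) := by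
          rw [div_le_iff₀' hη] at hq; nlinarith
        have hnr1 : (n : ℝ) * (2 * (q + 1)) ≤ l := by exact_mod_cast hn1
        have hnr2 : (l : ℝ) ≤ (n + 1) * (2 * (q + 1)) := by exact_mod_cast hn2.le
        have hn0 : (0 : ℝ) ≤ n := by positivity
        have hq0 : (0 : ℝ) ≤ q := by positivity
        have e1 : ((17 : ℝ) * 4 ^ n) ^ 6 = 17 ^ 6 * 2 ^ (12 * n : ℝ) := by
          rw [mul_pow, ← pow_mul, show (4 : ℝ) = 2 ^ 2 by norm_num, ← pow_mul,
            ← Real.rpow_natCast 2]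
          congr 2
          push_cast; ring
        have e2 : (A * 2 ^ (η * n)) ^ q = A ^ q * (2 : ℝ) ^ (η * n * q) := by
          rw [mul_pow, ← Real.rpow_natCast (2 ^ (η * n) : ℝ) q, ← Real.rpow_mul (by norm_num)]
        have e3 : ((2 : ℝ) ^ (-(s * (q * n : ℕ)))) ^ 2 = 2 ^ (-(2 * s * (q * n))) := by
          rw [← Real.rpow_natCast, ← Real.rpow_mul (by norm_num)]
          congr 1
          push_cast; ring
        have e4 : (2 : ℝ) ^ (2 * q + 2) = 2 ^ (2 * q + 2 : ℝ) := by
          rw [← Real.rpow_natCast]; congr 1; push_cast; ring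
        have key : (2 : ℝ) ^ (12 * n : ℝ) * 2 ^ (η * n * q) * 2 ^ (-(s * l)) *
            2 ^ (-(2 * s * (q * n))) ≤ 2 ^ (2 * q + 2 : ℝ) * 2 ^ ((η - 2 * s) * l) := by
          rw [← Real.rpow_add (by norm_num), ← Real.rpow_add (by norm_num),
            ← Real.rpow_add (by norm_num), ← Real.rpow_add (by norm_num)]
          apply Real.rpow_le_rpow_of_exponent_le (by norm_num)
          have h1 : s * (l - 2 * (q * n)) ≤ 2 * n + 2 * (q + 1) := by
            have h2 : (0 : ℝ) ≤ l - 2 * (q * n) := by nlinarith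
            nlinarith
          have h2 : 14 * n ≤ η * (q + 1) * n := mul_le_mul_of_nonneg_right hηq hn0
          have h3 : η * (n * (2 * (q + 1))) ≤ η * l := mul_le_mul_of_nonneg_left hnr1 hη.le
          have h4 : 0 ≤ η * n := by positivity
          nlinarith
        calc ((2 * N + 1 : ℕ) : ℝ) ^ 6 * ((A * 2 ^ (η * n)) ^ q * R)
            ≤ ((17 : ℝ) * 4 ^ n) ^ 6 * ((A * 2 ^ (η * n)) ^ q * R) := by gcongr
          _ = (17 ^ 6 * 3 * A ^ q * B ^ 4 * β) * ((2 : ℝ) ^ (12 * n : ℝ) * 2 ^ (η * n * q) *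
                2 ^ (-(s * l)) * 2 ^ (-(2 * s * (q * n)))) := by
              rw [e1, e2, hR, e3]; ring
          _ ≤ (17 ^ 6 * 3 * A ^ q * B ^ 4 * β) *
                (2 ^ (2 * q + 2 : ℝ) * 2 ^ ((η - 2 * s) * l)) := by gcongr
          _ = _ := by rw [e4]; ring

end ConeSixMoment

section Tent

open scoped FourierTransform

/-- The tent function of width one. -/
def tent (x : ℝ) : ℝ := max 0 (1 - |x|)

lemma continuous_tent : Continuous tent := by unfold tent; fun_prop

lemma tent_eq_zero {x : ℝ} (h : 1 ≤ |x|) : tent x = 0 := max_eq_left (by linarith)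

lemma tent_of_abs_le {x : ℝ} (h : |x| ≤ 1) : tent x = 1 - |x| := max_eq_right (by linarith)

lemma integral_right_half_tent {c : ℂ} (hc : c ≠ 0) :
    ∫ x in (0 : ℝ)..1, (1 - (x : ℂ)) * Complex.exp (c * x) =
      Complex.exp c / c ^ 2 - (1 / c + 1 / c ^ 2) := by
  have hd : ∀ x : ℝ, HasDerivAt (fun x : ℝ => (1 - (x : ℂ)) * Complex.exp (c * x) / c +
      Complex.exp (c * x) / c ^ 2) ((1 - (x : ℂ)) * Complex.exp (c * x)) x := by
    intro x
    have h1 : HasDerivAt (fun x : ℝ => (x : ℂ)) 1 x := Complex.ofRealCLM.hasDerivAt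
    have h2 : HasDerivAt (fun x : ℝ => Complex.exp (c * x)) (Complex.exp (c * x) * (c * 1)) x :=
      (h1.const_mul c).cexp
    have h3 := (((h1.const_sub 1).mul h2).div_const c).add (h2.div_const (c ^ 2))
    refine h3.congr_deriv ?_
    field_simp
    ring
  rw [intervalIntegral.integral_eq_sub_of_hasDerivAt (fun x _ => hd x)
    (by apply Continuous.intervalIntegrable; fun_prop)]
  simp

lemma integral_left_half_tent {c : ℂ} (hc : c ≠ 0) :
    ∫ x in (-1 : ℝ)..0, (1 + (x : ℂ)) * Complex.exp (c * x) =
      1 / c - 1 / c ^ 2 + Complex.exp (-c) / c ^ 2 := by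
  have hd : ∀ x : ℝ, HasDerivAt (fun x : ℝ => (1 + (x : ℂ)) * Complex.exp (c * x) / c -
      Complex.exp (c * x) / c ^ 2) ((1 + (x : ℂ)) * Complex.exp (c * x)) x := by
    intro x
    have h1 : HasDerivAt (fun x : ℝ => (x : ℂ)) 1 x := Complex.ofRealCLM.hasDerivAt
    have h2 : HasDerivAt (fun x : ℝ => Complex.exp (c * x)) (Complex.exp (c * x) * (c * 1)) x :=
      (h1.const_mul c).cexp
    have h3 := (((h1.const_add 1).mul h2).div_const c).sub (h2.div_const (c ^ 2))
    refine h3.congr_deriv ?_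
    field_simp
    ring
  rw [intervalIntegral.integral_eq_sub_of_hasDerivAt (fun x _ => hd x)
    (by apply Continuous.intervalIntegrable; fun_prop)]
  simp

lemma integral_tent_mul (f : ℝ → ℂ) (hf : Continuous f) :
    ∫ x, f x * (tent x : ℂ) =
      (∫ x in (-1 : ℝ)..0, (1 + (x : ℂ)) * f x) + ∫ x in (0 : ℝ)..1, (1 - (x : ℂ)) * f x := by
  have e1 : ∫ x in (-1 : ℝ)..0, (1 + (x : ℂ)) * f x = ∫ x in (-1 : ℝ)..0, f x * (tent x : ℂ) := by
    refine intervalIntegral.integral_congr fun x hx => ?_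
    rw [uIcc_of_le (by norm_num)] at hx
    rw [tent_of_abs_le (abs_le.mpr ⟨hx.1, by linarith [hx.2]⟩), abs_of_nonpos hx.2]
    push_cast
    ring
  have e2 : ∫ x in (0 : ℝ)..1, (1 - (x : ℂ)) * f x = ∫ x in (0 : ℝ)..1, f x * (tent x : ℂ) := by
    refine intervalIntegral.integral_congr fun x hx => ?_
    rw [uIcc_of_le (by norm_num)] at hx
    rw [tent_of_abs_le (abs_le.mpr ⟨by linarith [hx.1], hx.2⟩), abs_of_nonneg hx.1]
    push_cast
    ring
  have hc : Continuous fun x => f x * (tent x : ℂ) := by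
    have := continuous_tent
    fun_prop
  rw [e1, e2, intervalIntegral.integral_add_adjacent_intervals (hc.intervalIntegrable _ _)
    (hc.intervalIntegrable _ _), intervalIntegral.integral_of_le (by norm_num)]
  refine (setIntegral_eq_integral_of_forall_compl_eq_zero fun x hx => ?_).symm
  rw [tent_eq_zero]
  · simp
  · rw [mem_Ioc, not_and_or, not_lt, not_le] at hx
    rcases hx with hx | hx
    · rw [abs_of_nonpos (by linarith)]; linarith
    · rw [abs_of_nonneg (by linarith)]; linarith

lemma fourierIntegral_tent (w : ℝ) :
    𝓕 (fun x => (tent x : ℂ)) w = ((Real.sinc (Real.pi * w) ^ 2 : ℝ) : ℂ) := by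
  rw [Real.fourier_real_eq_integral_exp_smul]
  simp only [smul_eq_mul]
  set c : ℂ := ((-2 * Real.pi * w : ℝ) : ℂ) * Complex.I with hcdef
  have e : ∀ v : ℝ, Complex.exp (↑(-2 * Real.pi * v * w) * Complex.I) = Complex.exp (c * v) := by
    intro v; rw [hcdef]; push_cast; ring_nf
  simp only [e]
  rw [integral_tent_mul _ (by fun_prop)]
  rcases eq_or_ne w 0 with rfl | hw
  · have hc : c = 0 := by simp [hcdef]
    simp only [hc, zero_mul, Complex.exp_zero, mul_one, mul_zero, Real.sinc_zero]
    have i1 : ∫ x in (-1 : ℝ)..0, (1 + (x : ℂ)) = ((∫ x in (-1 : ℝ)..0, (1 + x) : ℝ) : ℂ) := by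
      rw [← intervalIntegral.integral_ofReal]; push_cast; rfl
    have i2 : ∫ x in (0 : ℝ)..1, (1 - (x : ℂ)) = ((∫ x in (0 : ℝ)..1, (1 - x) : ℝ) : ℂ) := by
      rw [← intervalIntegral.integral_ofReal]; push_cast; rfl
    rw [i1, i2, ← Complex.ofReal_add]
    congr 1
    rw [intervalIntegral.integral_add (by simp) (by simp),
      intervalIntegral.integral_sub (by simp) (by simp)]
    simp
    norm_num
  · have hpw : Real.pi * w ≠ 0 := by positivity
    have hc : c ≠ 0 := by
      rw [hcdef]
      refine mul_ne_zero ?_ Complex.I_ne_zero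
      exact_mod_cast (by simpa using hw : (-2 * Real.pi * w) ≠ 0)
    rw [integral_left_half_tent hc, integral_right_half_tent hc, Real.sinc_of_ne_zero hpw]
    have hcc : c ^ 2 = ((-(2 * Real.pi * w) ^ 2 : ℝ) : ℂ) := by
      rw [hcdef, mul_pow, Complex.I_sq]; push_cast; ring
    have hcos : Complex.exp c + Complex.exp (-c) = ((2 * Real.cos (2 * (Real.pi * w)) : ℝ) : ℂ) := by
      push_cast
      rw [Complex.cos, hcdef, add_comm]
      push_cast
      ring_nf
    have : 1 / c - 1 / c ^ 2 + Complex.exp (-c) / c ^ 2 +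
        (Complex.exp c / c ^ 2 - (1 / c + 1 / c ^ 2)) =
        (Complex.exp c + Complex.exp (-c) - 2) / c ^ 2 := by ring
    rw [this, hcc, hcos]
    norm_cast
    rw [Real.cos_two_mul, Real.cos_sq']
    rw [div_pow, div_eq_div_iff (by simpa using hw) (by positivity)]
    ring

lemma sinc_sq_le (x : ℝ) : Real.sinc (Real.pi * x) ^ 2 ≤ 2 / (1 + x ^ 2) := by
  rw [le_div_iff₀ (by positivity)]
  have h1 : Real.sinc (Real.pi * x) ^ 2 ≤ 1 := by
    rw [sq_le_one_iff_abs_le_one]; exact Real.abs_sinc_le_one _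
  have h2 : Real.sinc (Real.pi * x) ^ 2 * x ^ 2 ≤ 1 := by
    rcases eq_or_ne x 0 with rfl | hx
    · simp
    have hpx : Real.pi * x ≠ 0 := by positivity
    rw [Real.sinc_of_ne_zero hpx, div_pow, mul_pow, div_mul_eq_mul_div,
      mul_div_mul_right _ _ (by positivity), div_le_one (by positivity)]
    have := Real.sin_sq_le_one (Real.pi * x)
    nlinarith [Real.pi_gt_three]
  nlinarith

lemma integrable_sinc_sq : Integrable fun x : ℝ => Real.sinc (Real.pi * x) ^ 2 := by
  refine (integrable_inv_one_add_sq.const_mul 2).mono' ?_ (Filter.Eventually.of_forall fun x => ?_)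
  · have := Real.continuous_sinc
    exact Continuous.aestronglyMeasurable (by fun_prop)
  · rw [Real.norm_of_nonneg (by positivity)]
    exact (sinc_sq_le x).trans_eq (div_eq_mul_inv _ _)

lemma integrable_tent : Integrable fun x => (tent x : ℂ) := by
  have := continuous_tent
  refine Continuous.integrable_of_hasCompactSupport (by fun_prop)
    (HasCompactSupport.intro (isCompact_Icc (a := (-1 : ℝ)) (b := 1)) fun x hx => ?_)
  rw [tent_eq_zero, Complex.ofReal_zero]
  rw [mem_Icc, ← abs_le, not_le] at hx
  exact hx.le

lemma integral_sinc_sq_mul (ζ : ℝ) :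
    ∫ v : ℝ, ((Real.sinc (Real.pi * v) ^ 2 : ℝ) : ℂ) * 𝐞 (ζ * v) = tent ζ := by
  have hF : 𝓕 (fun x => (tent x : ℂ)) = fun w => ((Real.sinc (Real.pi * w) ^ 2 : ℝ) : ℂ) :=
    funext fourierIntegral_tent
  have h := Continuous.fourierInv_fourier_eq
    (by have := continuous_tent; fun_prop : Continuous fun x => (tent x : ℂ)) integrable_tent
    (by rw [hF]; exact integrable_sinc_sq.ofReal)
  have h' := congrFun h ζ
  rw [hF, Real.fourierInv_eq] at h'
  rw [← h']
  refine integral_congr_ae (Filter.Eventually.of_forall fun v => ?_)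
  simp only [Circle.smul_def, smul_eq_mul]
  rw [mul_comm]
  rfl

lemma integral_sinc_sq : ∫ v : ℝ, Real.sinc (Real.pi * v) ^ 2 = 1 := by
  have h := integral_sinc_sq_mul 0
  simp only [zero_mul, AddChar.map_zero_eq_one, Circle.coe_one, mul_one] at h
  rw [integral_complex_ofReal] at h
  have h0 : tent 0 = 1 := by simp [tent]
  rw [h0] at h
  exact_mod_cast h

end Tent

section Sieve

open scoped FourierTransform

/-- A probability density comparable to `1 / (1 + v ^ 2)` from below, with Fourier transform
supported in `[-1, 1]`. -/
def sieveDensity (v : ℝ) : ℝ :=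
  (Real.sinc (Real.pi * v) ^ 2 + Real.sinc (Real.pi * (v - 1 / 2)) ^ 2) / 2

lemma continuous_sieveDensity : Continuous sieveDensity := by
  have := Real.continuous_sinc
  unfold sieveDensity
  fun_prop

lemma sieveDensity_nonneg (v : ℝ) : 0 ≤ sieveDensity v := by unfold sieveDensity; positivity

lemma le_sieveDensity (v : ℝ) : 1 / (4 * Real.pi ^ 2) / (1 + v ^ 2) ≤ sieveDensity v := by
  have key : ∀ x : ℝ, Real.sin x ^ 2 = Real.sinc x ^ 2 * x ^ 2 := by
    intro x
    rcases eq_or_ne x 0 with rfl | hx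
    · simp
    · rw [Real.sinc_of_ne_zero hx]; field_simp
  have h1 := key (Real.pi * v)
  have h2 := key (Real.pi * (v - 1 / 2))
  have h3 : Real.sin (Real.pi * (v - 1 / 2)) ^ 2 = Real.cos (Real.pi * v) ^ 2 := by
    rw [show Real.pi * (v - 1 / 2) = Real.pi * v - Real.pi / 2 by ring, Real.sin_sub_pi_div_two]
    ring
  have h4 := Real.sin_sq_add_cos_sq (Real.pi * v)
  rw [← h3, h1, h2] at h4
  unfold sieveDensity
  rw [div_le_iff₀ (by positivity), div_le_iff₀ (by positivity)]
  set p := Real.sinc (Real.pi * v) ^ 2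
  set q := Real.sinc (Real.pi * (v - 1 / 2)) ^ 2
  have hp : 0 ≤ p := by positivity
  have hq : 0 ≤ q := by positivity
  have e1 : p * (Real.pi * v) ^ 2 ≤ p * (2 * Real.pi ^ 2 * (1 + v ^ 2)) := by
    gcongr
    nlinarith [Real.pi_pos, sq_nonneg (Real.pi * v), sq_nonneg Real.pi]
  have e2 : q * (Real.pi * (v - 1 / 2)) ^ 2 ≤ q * (2 * Real.pi ^ 2 * (1 + v ^ 2)) := by
    gcongr
    rw [mul_pow, show 2 * Real.pi ^ 2 * (1 + v ^ 2) = Real.pi ^ 2 * (2 * (1 + v ^ 2)) by ring]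
    gcongr
    nlinarith [sq_nonneg (v + 1 / 2)]
  calc (1 : ℝ) ≤ p * (2 * Real.pi ^ 2 * (1 + v ^ 2)) + q * (2 * Real.pi ^ 2 * (1 + v ^ 2)) := by
        linarith
    _ = _ := by ring

lemma integrable_sieveDensity : Integrable sieveDensity := by
  unfold sieveDensity
  exact (integrable_sinc_sq.add (integrable_sinc_sq.comp_sub_right (1 / 2))).div_const 2

lemma integral_sieveDensity : ∫ v, sieveDensity v = 1 := by
  unfold sieveDensity
  rw [integral_div, integral_add integrable_sinc_sq (integrable_sinc_sq.comp_sub_right (1 / 2)),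
    integral_sub_right_eq_self (fun v => Real.sinc (Real.pi * v) ^ 2), integral_sinc_sq]
  norm_num

lemma Integrable.mul_fourierChar {f : ℝ → ℝ} (hf : Integrable f) (ζ : ℝ) :
    Integrable fun v => (f v : ℂ) * 𝐞 (ζ * v) := by
  refine hf.ofReal.mul_bdd (c := 1) ?_ (Filter.Eventually.of_forall fun v =>
    (Circle.norm_coe (𝐞 (ζ * v))).le)
  have := Real.continuous_fourierChar
  exact Continuous.aestronglyMeasurable (by fun_prop)

lemma integral_sieveDensity_mul {ζ : ℝ} (hζ : 1 ≤ |ζ|) :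
    ∫ v, (sieveDensity v : ℂ) * 𝐞 (ζ * v) = 0 := by
  have h0 : ∫ v : ℝ, ((Real.sinc (Real.pi * v) ^ 2 : ℝ) : ℂ) * 𝐞 (ζ * v) = 0 := by
    rw [integral_sinc_sq_mul, tent_eq_zero hζ, Complex.ofReal_zero]
  have h1 : ∫ v : ℝ, ((Real.sinc (Real.pi * (v - 1 / 2)) ^ 2 : ℝ) : ℂ) * 𝐞 (ζ * v) = 0 := by
    rw [← integral_sub_right_eq_self _ (1 / 2 : ℝ)] at h0
    have : ∀ v : ℝ, ((Real.sinc (Real.pi * (v - 1 / 2)) ^ 2 : ℝ) : ℂ) * 𝐞 (ζ * v) =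
        (𝐞 (ζ * (1 / 2)) : ℂ) *
          (((Real.sinc (Real.pi * (v - 1 / 2)) ^ 2 : ℝ) : ℂ) * 𝐞 (ζ * (v - 1 / 2))) := by
      intro v
      rw [show ζ * v = ζ * (1 / 2) + ζ * (v - 1 / 2) by ring, AddChar.map_add_eq_mul,
        Circle.coe_mul]
      ring
    simp_rw [this]
    rw [integral_const_mul, h0, mul_zero]
  have e : ∀ v, (sieveDensity v : ℂ) * 𝐞 (ζ * v) =
      (((Real.sinc (Real.pi * v) ^ 2 : ℝ) : ℂ) * 𝐞 (ζ * v) +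
        ((Real.sinc (Real.pi * (v - 1 / 2)) ^ 2 : ℝ) : ℂ) * 𝐞 (ζ * v)) / 2 := by
    intro v; unfold sieveDensity; push_cast; ring
  simp_rw [e]
  rw [integral_div, integral_add (Integrable.mul_fourierChar integrable_sinc_sq ζ)
    (Integrable.mul_fourierChar (integrable_sinc_sq.comp_sub_right (1 / 2)) ζ), h0, h1]
  simp

/-- The product measure with density `sieveDensity` in each coordinate. -/
def sieveMeasure : Measure (Fin 3 → ℝ) :=
  volume.withDensity fun v => ENNReal.ofReal (∏ j, sieveDensity (v j))

instance : IsProbabilityMeasure sieveMeasure := by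
  constructor
  rw [sieveMeasure, withDensity_apply _ MeasurableSet.univ, setLIntegral_univ,
    ← ofReal_integral_eq_lintegral_ofReal, integral_fintype_prod_volume_eq_prod]
  · simp [integral_sieveDensity]
  · exact Integrable.fintype_prod fun _ => integrable_sieveDensity
  · exact Filter.Eventually.of_forall fun v => Finset.prod_nonneg fun j _ => sieveDensity_nonneg _

lemma fourierChar_sum (ζ v : Fin 3 → ℝ) :
    (𝐞 (∑ j, ζ j * v j) : ℂ) = ∏ j, (𝐞 (ζ j * v j) : ℂ) := by
  simp only [Fin.sum_univ_three, Fin.prod_univ_three, AddChar.map_add_eq_mul, Circle.coe_mul]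

lemma measurable_prod_comp {f : ℝ → ℝ} (hf : Continuous f) :
    Measurable fun v : Fin 3 → ℝ => ENNReal.ofReal (∏ j, f (v j)) := by
  refine ENNReal.measurable_ofReal.comp (Continuous.measurable ?_)
  fun_prop

lemma spectralGap_sieveMeasure : SpectralGap sieveMeasure := by
  rintro ζ ⟨j, hj⟩
  rw [sieveMeasure, integral_withDensity_eq_integral_toReal_smul
    (measurable_prod_comp continuous_sieveDensity) (by simp)]
  have e : ∀ v : Fin 3 → ℝ, (ENNReal.ofReal (∏ j, sieveDensity (v j))).toReal •
      (𝐞 (∑ j, ζ j * v j) : ℂ) = ∏ j, (sieveDensity (v j) : ℂ) * 𝐞 (ζ j * v j) := by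
    intro v
    rw [ENNReal.toReal_ofReal (Finset.prod_nonneg fun j _ => sieveDensity_nonneg _),
      fourierChar_sum, Complex.real_smul, Complex.ofReal_prod, Finset.prod_mul_distrib]
  simp_rw [e]
  rw [integral_fintype_prod_volume_eq_prod
    (fun j => fun x : ℝ => (sieveDensity x : ℂ) * 𝐞 (ζ j * x))]
  exact Finset.prod_eq_zero (Finset.mem_univ j) (integral_sieveDensity_mul hj)

/-- The de la Vallée Poussin kernel, whose Fourier transform is `1` on `[-a, a]`. -/
def vpKernel (a u : ℝ) : ℝ :=
  4 * a * Real.sinc (Real.pi * (2 * a * u)) ^ 2 - a * Real.sinc (Real.pi * (a * u)) ^ 2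

/-- A pointwise majorant of the de la Vallée Poussin kernel. -/
def vpMajorant (a u : ℝ) : ℝ := 10 * a / (1 + (a * u) ^ 2)

lemma vpMajorant_nonneg {a : ℝ} (ha : 0 < a) (u : ℝ) : 0 ≤ vpMajorant a u := by
  unfold vpMajorant; positivity

lemma continuous_vpMajorant (a : ℝ) : Continuous (vpMajorant a) := by
  unfold vpMajorant
  refine Continuous.div (by fun_prop) (by fun_prop) fun u => by positivity

lemma abs_vpKernel_le {a : ℝ} (ha : 0 < a) (u : ℝ) : |vpKernel a u| ≤ vpMajorant a u := by
  have h1 := sinc_sq_le (2 * a * u)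
  have h2 := sinc_sq_le (a * u)
  have h3 : 2 / (1 + (2 * a * u) ^ 2) ≤ 2 / (1 + (a * u) ^ 2) := by
    gcongr 2 / (1 + ?_)
    nlinarith [sq_nonneg (a * u)]
  unfold vpKernel vpMajorant
  refine (abs_sub _ _).trans ?_
  rw [abs_of_nonneg (by positivity), abs_of_nonneg (by positivity)]
  calc _ ≤ 4 * a * (2 / (1 + (a * u) ^ 2)) + a * (2 / (1 + (a * u) ^ 2)) := by gcongr; linarith
    _ = _ := by ring

lemma integrable_vpMajorant {a : ℝ} (ha : 0 < a) : Integrable (vpMajorant a) := by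
  have := (integrable_inv_one_add_sq.comp_mul_left' ha.ne').const_mul (10 * a)
  exact this

lemma integral_vpMajorant {a : ℝ} (ha : 0 < a) : ∫ u, vpMajorant a u = 10 * Real.pi := by
  have : ∀ u, vpMajorant a u = (10 * a) * (fun x : ℝ => (1 + x ^ 2)⁻¹) (a * u) := fun u => rfl
  rw [funext this, integral_const_mul,
    Measure.integral_comp_mul_left (fun x : ℝ => (1 + x ^ 2)⁻¹), integral_univ_inv_one_add_sq,
    abs_of_pos (inv_pos.mpr ha), smul_eq_mul]
  field_simp

lemma integral_dilated_sinc_sq_mul {a : ℝ} (ha : 0 < a) (ζ : ℝ) :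
    ∫ u : ℝ, ((a * Real.sinc (Real.pi * (a * u)) ^ 2 : ℝ) : ℂ) * 𝐞 (ζ * u) = tent (ζ / a) := by
  have h := Measure.integral_comp_mul_left
    (fun v : ℝ => ((Real.sinc (Real.pi * v) ^ 2 : ℝ) : ℂ) * 𝐞 (ζ / a * v)) a
  rw [integral_sinc_sq_mul, abs_of_pos (inv_pos.mpr ha)] at h
  have e : ∀ u : ℝ, ((a * Real.sinc (Real.pi * (a * u)) ^ 2 : ℝ) : ℂ) * 𝐞 (ζ * u) =
      (a : ℂ) * (((Real.sinc (Real.pi * (a * u)) ^ 2 : ℝ) : ℂ) * 𝐞 (ζ / a * (a * u))) := by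
    intro u
    rw [show ζ / a * (a * u) = ζ * u by field_simp]
    push_cast; ring
  simp_rw [e]
  rw [integral_const_mul, h, Complex.real_smul, ← mul_assoc, ← Complex.ofReal_mul,
    mul_inv_cancel₀ ha.ne']
  simp

lemma integrable_dilated_sinc_sq {a : ℝ} (ha : 0 < a) :
    Integrable fun u => a * Real.sinc (Real.pi * (a * u)) ^ 2 :=
  (integrable_sinc_sq.comp_mul_left' ha.ne').const_mul a

lemma integral_vpKernel_mul {a : ℝ} (ha : 0 < a) {ζ : ℝ} (hζ : |ζ| ≤ a) :
    ∫ u, (vpKernel a u : ℂ) * 𝐞 (ζ * u) = 1 := by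
  have e : ∀ u, (vpKernel a u : ℂ) * 𝐞 (ζ * u) =
      2 * (((2 * a * Real.sinc (Real.pi * (2 * a * u)) ^ 2 : ℝ) : ℂ) * 𝐞 (ζ * u)) -
        ((a * Real.sinc (Real.pi * (a * u)) ^ 2 : ℝ) : ℂ) * 𝐞 (ζ * u) := by
    intro u; unfold vpKernel; push_cast; ring
  simp_rw [e]
  have i1 := Integrable.mul_fourierChar
    (integrable_dilated_sinc_sq (by positivity : 0 < 2 * a)) ζ
  have i2 := Integrable.mul_fourierChar (integrable_dilated_sinc_sq ha) ζ
  rw [integral_sub (i1.const_mul 2) i2, integral_const_mul,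
    integral_dilated_sinc_sq_mul (by positivity : 0 < 2 * a), integral_dilated_sinc_sq_mul ha,
    tent_of_abs_le, tent_of_abs_le, abs_div, abs_div, abs_of_pos ha,
    abs_of_pos (by positivity : 0 < 2 * a)]
  · have : 2 * (1 - |ζ| / (2 * a)) - (1 - |ζ| / a) = 1 := by field_simp; ring
    exact_mod_cast congrArg (fun x : ℝ => (x : ℂ)) this
  · rw [abs_div, abs_of_pos ha]; exact div_le_one_of_le₀ hζ ha.le
  · rw [abs_div, abs_of_pos (by positivity : 0 < 2 * a)]
    exact div_le_one_of_le₀ (by linarith) (by positivity)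

lemma continuous_vpKernel (a : ℝ) : Continuous (vpKernel a) := by
  have := Real.continuous_sinc
  unfold vpKernel
  fun_prop

lemma integrable_vpKernel {a : ℝ} (ha : 0 < a) : Integrable (vpKernel a) :=
  (integrable_vpMajorant ha).mono' (continuous_vpKernel a).aestronglyMeasurable
    (Filter.Eventually.of_forall fun u => abs_vpKernel_le ha u)

/-- A finite sum of characters of `ℝ³`. -/
def charSum {ι : Type*} (I : Finset ι) (C : ι → ℂ) (ζ : ι → Fin 3 → ℝ) (x : Fin 3 → ℝ) : ℂ :=
  ∑ i ∈ I, C i * 𝐞 (∑ j, ζ i j * x j)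

lemma continuous_charSum {ι : Type*} (I : Finset ι) (C : ι → ℂ) (ζ : ι → Fin 3 → ℝ) :
    Continuous (charSum I C ζ) := by
  have := Real.continuous_fourierChar
  unfold charSum
  fun_prop

lemma charSum_reproducing {ι : Type*} {I : Finset ι} {C : ι → ℂ} {ζ : ι → Fin 3 → ℝ} {a : ℝ}
    (ha : 0 < a) (hζ : ∀ i ∈ I, ∀ j, |ζ i j| ≤ a) (x : Fin 3 → ℝ) :
    charSum I C ζ x = ∫ u : Fin 3 → ℝ, ((∏ j, vpKernel a (u j) : ℝ) : ℂ) *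
      charSum I C ζ (x + u) := by
  have e : ∀ u : Fin 3 → ℝ, ((∏ j, vpKernel a (u j) : ℝ) : ℂ) * charSum I C ζ (x + u) =
      ∑ i ∈ I, (C i * 𝐞 (∑ j, ζ i j * x j)) *
        ∏ j, ((vpKernel a (u j) : ℂ) * 𝐞 (ζ i j * u j)) := by
    intro u
    unfold charSum
    rw [Finset.mul_sum]
    refine Finset.sum_congr rfl fun i _ => ?_
    rw [show ∑ j, ζ i j * (x + u) j = ∑ j, ζ i j * x j + ∑ j, ζ i j * u j by
      rw [← Finset.sum_add_distrib]; exact Finset.sum_congr rfl fun j _ => by simp; ring,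
      AddChar.map_add_eq_mul, Circle.coe_mul, fourierChar_sum _ u, Finset.prod_mul_distrib]
    push_cast
    ring
  simp_rw [e]
  rw [integral_finsetSum]
  · unfold charSum
    refine Finset.sum_congr rfl fun i hi => ?_
    rw [integral_const_mul, integral_fintype_prod_volume_eq_prod
      (fun j => fun y : ℝ => (vpKernel a y : ℂ) * 𝐞 (ζ i j * y)),
      Finset.prod_eq_one fun j _ => integral_vpKernel_mul ha (hζ i hi j), mul_one]
  · intro i _
    refine Integrable.const_mul ?_ _
    exact Integrable.fintype_prod (f := fun j => fun y : ℝ => (vpKernel a y : ℂ) * 𝐞 (ζ i j * y))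
      fun j => Integrable.mul_fourierChar (integrable_vpKernel ha) _

end Sieve

section LargeSieve

open scoped FourierTransform

lemma enorm_sq_charSum_le {ι : Type*} {I : Finset ι} {C : ι → ℂ} {ζ : ι → Fin 3 → ℝ} {a : ℝ}
    (ha : 0 < a) (hζ : ∀ i ∈ I, ∀ j, |ζ i j| ≤ a) (x : Fin 3 → ℝ) :
    ‖charSum I C ζ x‖ₑ ^ 2 ≤ ENNReal.ofReal ((10 * Real.pi) ^ 3) *
      ∫⁻ y : Fin 3 → ℝ, ENNReal.ofReal (∏ j, vpMajorant a (y j - x j)) *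
        ‖charSum I C ζ y‖ₑ ^ 2 := by
  set F := charSum I C ζ with hF
  have hFc : Continuous F := continuous_charSum I C ζ
  set w : (Fin 3 → ℝ) → ℝ := fun u => ∏ j, vpMajorant a (u j) with hw
  have hw0 : ∀ u, 0 ≤ w u := fun u => Finset.prod_nonneg fun j _ => vpMajorant_nonneg ha _
  have hwc : Continuous w := by
    have := continuous_vpMajorant a
    fun_prop
  have h1 : ‖F x‖ₑ ≤ ∫⁻ u, ENNReal.ofReal (√(w u)) * (ENNReal.ofReal (√(w u)) * ‖F (x + u)‖ₑ) := by
    rw [hF, charSum_reproducing ha hζ x]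
    refine (enorm_integral_le_lintegral_enorm _).trans (lintegral_mono fun u => ?_)
    rw [enorm_mul, ← mul_assoc, ← ENNReal.ofReal_mul (Real.sqrt_nonneg _),
      Real.mul_self_sqrt (hw0 u)]
    gcongr
    rw [← ofReal_norm]
    refine ENNReal.ofReal_le_ofReal ?_
    rw [Complex.norm_real, Real.norm_eq_abs, Finset.abs_prod]
    exact Finset.prod_le_prod (fun j _ => abs_nonneg _) fun j _ => abs_vpKernel_le ha _
  have hsq : ∀ u, ENNReal.ofReal (√(w u)) ^ 2 = ENNReal.ofReal (w u) := fun u => by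
    rw [← ENNReal.ofReal_pow (Real.sqrt_nonneg _), Real.sq_sqrt (hw0 u)]
  have h2 := lintegral_mul_sq_le (volume : Measure (Fin 3 → ℝ))
    (f := fun u => ENNReal.ofReal (√(w u)))
    (g := fun u => ENNReal.ofReal (√(w u)) * ‖F (x + u)‖ₑ)
    hwc.measurable.sqrt.ennreal_ofReal.aemeasurable
    (hwc.measurable.sqrt.ennreal_ofReal.mul
      (hFc.comp (continuous_const.add continuous_id)).measurable.enorm).aemeasurable
  simp only [mul_pow, hsq] at h2
  have h3 : ∫⁻ u, ENNReal.ofReal (w u) = ENNReal.ofReal ((10 * Real.pi) ^ 3) := by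
    have hi : Integrable w := Integrable.fintype_prod fun _ => integrable_vpMajorant ha
    rw [← ofReal_integral_eq_lintegral_ofReal hi (Filter.Eventually.of_forall hw0), hw,
      integral_fintype_prod_volume_eq_prod]
    simp [integral_vpMajorant ha]
  rw [h3] at h2
  refine (pow_le_pow_left₀ (by positivity) h1 2).trans (h2.trans_eq ?_)
  congr 1
  rw [← lintegral_add_left_eq_self
    (fun y : Fin 3 → ℝ => ENNReal.ofReal (∏ j, vpMajorant a (y j - x j)) * ‖F y‖ₑ ^ 2) x]
  simp [hw]

lemma vpMajorant_le_of_close {a W x y z : ℝ} (ha : 0 < a) (hW : 0 < W) (haW : a ≤ 12 * W)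
    (hxz : |x - z| ≤ 1 / W) : vpMajorant a (y - x) ≤ 289 * vpMajorant a (y - z) := by
  unfold vpMajorant
  rw [← mul_div_assoc, div_le_div_iff₀ (by positivity) (by positivity)]
  have h1 : (a * (x - z)) ^ 2 ≤ 144 := by
    have h : a * |x - z| ≤ 12 := by
      calc a * |x - z| ≤ (12 * W) * (1 / W) := by gcongr
        _ = 12 := by field_simp
    calc (a * (x - z)) ^ 2 = (a * |x - z|) ^ 2 := by rw [mul_pow, mul_pow, sq_abs]
      _ ≤ 12 ^ 2 := by gcongr
      _ = 144 := by norm_num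
  have h2 : 1 + (a * (y - z)) ^ 2 ≤ 289 * (1 + (a * (y - x)) ^ 2) := by
    nlinarith [sq_nonneg (a * (y - x) - a * (x - z)), sq_nonneg (a * (y - x))]
  nlinarith

lemma integral_indicator_vpMajorant_le {a : ℝ} (ha : 1 ≤ a) (y : ℝ) :
    ∫ z, (Ico (0 : ℝ) 1).indicator (fun z => vpMajorant a (y - z)) z ≤ 200 / (1 + y ^ 2) := by
  have ha0 : 0 < a := by linarith
  have hintg : Integrable fun z => vpMajorant a (y - z) := (integrable_vpMajorant ha0).comp_sub_left y
  rw [integral_indicator measurableSet_Ico]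
  rcases le_total 2 |y| with hy | hy
  · have hb : ∀ z ∈ Ico (0 : ℝ) 1, ‖vpMajorant a (y - z)‖ ≤ 200 / (1 + y ^ 2) := by
      intro z hz
      rw [Real.norm_of_nonneg (vpMajorant_nonneg ha0 _)]
      unfold vpMajorant
      have h1 : |y| / 2 ≤ |y - z| := by
        have := abs_sub_abs_le_abs_sub y z
        rw [abs_of_nonneg hz.1] at this
        linarith [hz.2]
      have h2 : y ^ 2 / 4 ≤ (y - z) ^ 2 := by
        rw [← sq_abs y, ← sq_abs (y - z)]
        nlinarith [abs_nonneg y]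
      have h3 : 4 ≤ y ^ 2 := by rw [← sq_abs]; nlinarith
      rw [div_le_div_iff₀ (by positivity) (by positivity), mul_pow]
      have h4 : a * (y ^ 2 / 4) ≤ a ^ 2 * (y - z) ^ 2 := by
        have : a ≤ a ^ 2 := by nlinarith
        gcongr
      nlinarith
    have := norm_setIntegral_le_of_norm_le_const (μ := volume) (by simp) hb
    simp only [measureReal_def, Real.volume_Ico, sub_zero, ENNReal.ofReal_one,
      ENNReal.toReal_one, mul_one] at this
    exact (le_abs_self _).trans this
  · calc ∫ z in Ico (0 : ℝ) 1, vpMajorant a (y - z) ≤ ∫ z, vpMajorant a (y - z) :=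
          setIntegral_le_integral hintg
            (Filter.Eventually.of_forall fun z => vpMajorant_nonneg ha0 _)
      _ = 10 * Real.pi := by rw [integral_sub_left_eq_self, integral_vpMajorant ha0]
      _ ≤ 40 := by nlinarith [Real.pi_lt_four]
      _ ≤ 200 / (1 + y ^ 2) := by
        rw [le_div_iff₀ (by positivity), ← sq_abs]
        nlinarith [abs_nonneg y]

/-- The index of the dyadic cube of side `2⁻ⁿ` containing a point. -/
def cubeCode (n : ℕ) (x : Fin 3 → ℝ) : Fin 3 → ℤ := fun j => ⌊2 ^ n * x j⌋

lemma measurable_cubeCode (n : ℕ) : Measurable (cubeCode n) := by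
  unfold cubeCode
  fun_prop

lemma abs_sub_le_of_cubeCode_eq {n : ℕ} {x z : Fin 3 → ℝ} (h : cubeCode n x = cubeCode n z)
    (j : Fin 3) : |x j - z j| ≤ 1 / 2 ^ n := by
  have h1 := Int.abs_sub_lt_one_of_floor_eq_floor (congrFun h j)
  rw [← mul_sub, abs_mul, abs_of_pos (by positivity)] at h1
  rw [le_div_iff₀ (by positivity), mul_comm]
  exact h1.le

lemma volume_cubeCode_eq (n : ℕ) (i : Fin 3 → ℤ) :
    volume {z | cubeCode n z = i} = ENNReal.ofReal ((1 / 2 ^ n) ^ 3) := by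
  have : {z | cubeCode n z = i} =
      univ.pi fun j => Ico ((i j : ℝ) / 2 ^ n) ((i j + 1 : ℝ) / 2 ^ n) := by
    ext z
    simp only [cubeCode, mem_ofPred_eq, funext_iff, mem_pi, mem_univ, true_implies, mem_Ico,
      Int.floor_eq_iff]
    refine forall_congr' fun j => ?_
    rw [div_le_iff₀ (by positivity), lt_div_iff₀ (by positivity), mul_comm]
  rw [this, Real.volume_pi_Ico, ← ENNReal.ofReal_prod_of_nonneg]
  · congr 1
    rw [Finset.prod_congr rfl fun j _ => show (i j + 1 : ℝ) / 2 ^ n - i j / 2 ^ n = 1 / 2 ^ n by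
      ring]
    simp
  · intro j _
    rw [← sub_div, add_sub_cancel_left]
    positivity

lemma mem_Ico_of_cubeCode_eq {n : ℕ} {x z : Fin 3 → ℝ} (h : cubeCode n x = cubeCode n z)
    (hx : ∀ j, x j ∈ Ico (0 : ℝ) 1) (j : Fin 3) : z j ∈ Ico (0 : ℝ) 1 := by
  have h0 := floor_two_pow_eq_of_le (Nat.zero_le n) (congrFun h j)
  simp only [pow_zero, one_mul] at h0
  have hx0 : ⌊x j⌋ = 0 := Int.floor_eq_zero_iff.mpr (hx j)
  exact Int.floor_eq_zero_iff.mp (h0 ▸ hx0)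

lemma lintegral_vpMajorant_le {a : ℝ} (ha : 1 ≤ a) {l : ℕ} (hal : a ≤ 12 * 2 ^ l)
    {μ : Measure (Fin 3 → ℝ)} [IsFiniteMeasure μ] (hμ : ∀ᵐ x ∂μ, ∀ j, x j ∈ Ico (0 : ℝ) 1)
    {M : ℝ≥0∞} (hM : ∀ i, μ {x | cubeCode l x = i} ≤ M) (y : Fin 3 → ℝ) :
    ∫⁻ x, ENNReal.ofReal (∏ j, vpMajorant a (y j - x j)) ∂μ ≤
      ENNReal.ofReal (289 ^ 3 * (2 ^ l) ^ 3 * ∏ j, (200 / (1 + y j ^ 2))) * M := by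
  have ha0 : 0 < a := by linarith
  set g : (Fin 3 → ℝ) → ℝ≥0∞ := fun z => ENNReal.ofReal
    (∏ j, (Ico (0 : ℝ) 1).indicator (fun z => vpMajorant a (y j - z)) (z j)) with hg
  have hgm : Measurable g := by
    have := (continuous_vpMajorant a).measurable
    refine ENNReal.measurable_ofReal.comp (Finset.measurable_prod _ fun j _ => ?_)
    have h : Measurable ((Ico (0 : ℝ) 1).indicator fun z => vpMajorant a (y j - z)) :=
      Measurable.indicator (this.comp (measurable_const.sub measurable_id)) measurableSet_Ico
    exact h.comp (measurable_pi_apply j)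
  set K : ℝ≥0∞ := ENNReal.ofReal (289 ^ 3 * (2 ^ l) ^ 3) with hK
  have hset : MeasurableSet {p : (Fin 3 → ℝ) × (Fin 3 → ℝ) | cubeCode l p.1 = cubeCode l p.2} :=
    measurableSet_eq_fun ((measurable_cubeCode l).comp measurable_fst)
      ((measurable_cubeCode l).comp measurable_snd)
  have hpt : ∀ x : Fin 3 → ℝ, (∀ j, x j ∈ Ico (0 : ℝ) 1) →
      ENNReal.ofReal (∏ j, vpMajorant a (y j - x j)) ≤
        ∫⁻ z, K * {p : (Fin 3 → ℝ) × (Fin 3 → ℝ) | cubeCode l p.1 = cubeCode l p.2}.indicator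
          (fun p => g p.2) (x, z) := by
    intro x hx
    have hb : ∀ z, ENNReal.ofReal (∏ j, vpMajorant a (y j - x j)) * ENNReal.ofReal ((2 ^ l) ^ 3) *
        {z | cubeCode l z = cubeCode l x}.indicator 1 z ≤
        K * {p : (Fin 3 → ℝ) × (Fin 3 → ℝ) | cubeCode l p.1 = cubeCode l p.2}.indicator
          (fun p => g p.2) (x, z) := by
      intro z
      by_cases hz : cubeCode l x = cubeCode l z
      · rw [indicator_of_mem (show z ∈ {z | cubeCode l z = cubeCode l x} from hz.symm),
          indicator_of_mem (by exact hz), Pi.one_apply, mul_one, hK, hg,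
          ← ENNReal.ofReal_mul (Finset.prod_nonneg fun j _ => vpMajorant_nonneg ha0 _),
          ← ENNReal.ofReal_mul (by positivity)]
        refine ENNReal.ofReal_le_ofReal ?_
        have : ∏ j, vpMajorant a (y j - x j) ≤ ∏ j : Fin 3, 289 *
            (Ico (0 : ℝ) 1).indicator (fun z => vpMajorant a (y j - z)) (z j) := by
          refine Finset.prod_le_prod (fun j _ => vpMajorant_nonneg ha0 _) fun j _ => ?_
          rw [indicator_of_mem (mem_Ico_of_cubeCode_eq hz hx j)]
          exact vpMajorant_le_of_close ha0 (by positivity) hal (abs_sub_le_of_cubeCode_eq hz j)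
        rw [Finset.prod_mul_distrib] at this
        simp only [Finset.prod_const, Finset.card_univ, Fintype.card_fin] at this
        calc _ ≤ (289 ^ 3 * ∏ j : Fin 3, (Ico (0 : ℝ) 1).indicator
              (fun z => vpMajorant a (y j - z)) (z j)) * (2 ^ l) ^ 3 := by gcongr
          _ = _ := by ring
      · rw [indicator_of_notMem (show z ∉ {z | cubeCode l z = cubeCode l x} from
          fun h => hz h.symm)]
        simp
    refine le_trans (le_of_eq ?_) (lintegral_mono hb)
    rw [lintegral_const_mul _ (measurable_one.indicator
      (measurableSet_eq_fun (measurable_cubeCode l) measurable_const)),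
      lintegral_indicator_one
      (measurableSet_eq_fun (measurable_cubeCode l) measurable_const), volume_cubeCode_eq, mul_assoc,
      ← ENNReal.ofReal_mul (by positivity)]
    simp
  calc ∫⁻ x, ENNReal.ofReal (∏ j, vpMajorant a (y j - x j)) ∂μ
      ≤ ∫⁻ x, (∫⁻ z, K *
          {p : (Fin 3 → ℝ) × (Fin 3 → ℝ) | cubeCode l p.1 = cubeCode l p.2}.indicator
          (fun p => g p.2) (x, z)) ∂μ := lintegral_mono_ae (hμ.mono hpt)
    _ = ∫⁻ z, ∫⁻ x, K * {p : (Fin 3 → ℝ) × (Fin 3 → ℝ) | cubeCode l p.1 = cubeCode l p.2}.indicator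
          (fun p => g p.2) (x, z) ∂μ := lintegral_lintegral_swap
        (((hgm.comp measurable_snd).indicator hset).const_mul K).aemeasurable
    _ ≤ ∫⁻ z, K * M * g z := by
        refine lintegral_mono fun z => ?_
        have e : ∀ x, K * {p : (Fin 3 → ℝ) × (Fin 3 → ℝ) | cubeCode l p.1 = cubeCode l p.2}.indicator
            (fun p => g p.2) (x, z) = K * g z * {x | cubeCode l x = cubeCode l z}.indicator 1 x := by
          intro x
          by_cases hz : cubeCode l x = cubeCode l z
          · rw [indicator_of_mem (by exact hz), indicator_of_mem (by exact hz)]; simp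
          · rw [indicator_of_notMem (by exact hz), indicator_of_notMem (by exact hz)]; simp
        simp_rw [e]
        have hm : MeasurableSet {x | cubeCode l x = cubeCode l z} :=
          measurableSet_eq_fun (measurable_cubeCode l) measurable_const
        rw [lintegral_const_mul _ (measurable_one.indicator hm), lintegral_indicator_one hm,
          mul_right_comm]
        gcongr
        exact hM _
    _ = K * M * ∫⁻ z, g z := lintegral_const_mul _ hgm
    _ ≤ K * M * ENNReal.ofReal (∏ j, (200 / (1 + y j ^ 2))) := by
        gcongr
        have hi : ∀ j, Integrable ((Ico (0 : ℝ) 1).indicator (fun z => vpMajorant a (y j - z))) :=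
          fun j => ((integrable_vpMajorant ha0).comp_sub_left _).indicator measurableSet_Ico
        have h0 : ∀ j z, 0 ≤ (Ico (0 : ℝ) 1).indicator (fun z => vpMajorant a (y j - z)) z :=
          fun j z => indicator_nonneg (fun z _ => vpMajorant_nonneg ha0 _) z
        have hip : Integrable fun z : Fin 3 → ℝ =>
            ∏ j, (Ico (0 : ℝ) 1).indicator (fun z => vpMajorant a (y j - z)) (z j) :=
          Integrable.fintype_prod hi
        rw [hg, ← ofReal_integral_eq_lintegral_ofReal hip
          (Filter.Eventually.of_forall fun z => Finset.prod_nonneg fun j _ => h0 j _),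
          integral_fintype_prod_volume_eq_prod
            (fun j => (Ico (0 : ℝ) 1).indicator (fun z => vpMajorant a (y j - z)))]
        refine ENNReal.ofReal_le_ofReal (Finset.prod_le_prod
          (fun j _ => integral_nonneg (h0 j)) fun j _ => integral_indicator_vpMajorant_le ha _)
    _ = _ := by
        rw [mul_right_comm, hK, ← ENNReal.ofReal_mul (by positivity)]

/-- The constant of the large sieve inequality below. -/
def sieveConst : ℝ := (10 * Real.pi) ^ 3 * 289 ^ 3 * (800 * Real.pi ^ 2) ^ 3

lemma sieveConst_nonneg : 0 ≤ sieveConst := by unfold sieveConst; positivity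

/-- A large sieve inequality for measures with bounded mass on the dyadic cubes of one level. -/
theorem lintegral_sq_charSum_le {ι : Type*} {I : Finset ι} {C : ι → ℂ} {ζ : ι → Fin 3 → ℝ} {l : ℕ}
    (hζ : ∀ i ∈ I, ∀ j, |ζ i j| ≤ 12 * 2 ^ l)
    {μ : Measure (Fin 3 → ℝ)} [IsFiniteMeasure μ] (hμ : ∀ᵐ x ∂μ, ∀ j, x j ∈ Ico (0 : ℝ) 1)
    {M : ℝ≥0∞} (hM : ∀ i, μ {x | cubeCode l x = i} ≤ M) :
    ∫⁻ x, ‖charSum I C ζ x‖ₑ ^ 2 ∂μ ≤ ENNReal.ofReal (sieveConst * (2 ^ l) ^ 3) * M *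
      ∫⁻ y, ‖charSum I C ζ y‖ₑ ^ 2 ∂sieveMeasure := by
  set a : ℝ := 12 * 2 ^ l with ha
  have ha1 : 1 ≤ a := by
    have : (1 : ℝ) ≤ 2 ^ l := one_le_pow₀ (by norm_num)
    linarith
  set F := charSum I C ζ with hF
  have hFc : Continuous F := continuous_charSum I C ζ
  have hw : Continuous fun p : (Fin 3 → ℝ) × (Fin 3 → ℝ) => ∏ j, vpMajorant a (p.2 j - p.1 j) := by
    have := continuous_vpMajorant a
    fun_prop
  have hm : Measurable fun p : (Fin 3 → ℝ) × (Fin 3 → ℝ) =>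
      ENNReal.ofReal (∏ j, vpMajorant a (p.2 j - p.1 j)) * ‖F p.2‖ₑ ^ 2 :=
    hw.measurable.ennreal_ofReal.mul ((hFc.comp continuous_snd).measurable.enorm.pow_const 2)
  calc ∫⁻ x, ‖F x‖ₑ ^ 2 ∂μ
      ≤ ∫⁻ x, (ENNReal.ofReal ((10 * Real.pi) ^ 3) * ∫⁻ y : Fin 3 → ℝ,
          ENNReal.ofReal (∏ j, vpMajorant a (y j - x j)) * ‖F y‖ₑ ^ 2) ∂μ :=
        lintegral_mono fun x => enorm_sq_charSum_le (by linarith) hζ x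
    _ = ENNReal.ofReal ((10 * Real.pi) ^ 3) * ∫⁻ y : Fin 3 → ℝ,
          (∫⁻ x, ENNReal.ofReal (∏ j, vpMajorant a (y j - x j)) ∂μ) * ‖F y‖ₑ ^ 2 := by
        rw [lintegral_const_mul' _ _ (by finiteness), lintegral_lintegral_swap hm.aemeasurable]
        congr 1
        refine lintegral_congr fun y => lintegral_mul_const' _ _ (by finiteness)
    _ ≤ ENNReal.ofReal ((10 * Real.pi) ^ 3) * ∫⁻ y : Fin 3 → ℝ,
          (ENNReal.ofReal (289 ^ 3 * (2 ^ l) ^ 3 * (800 * Real.pi ^ 2) ^ 3) * M) *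
            (ENNReal.ofReal (∏ j, sieveDensity (y j)) * ‖F y‖ₑ ^ 2) := by
        refine mul_le_mul_right (lintegral_mono fun y => ?_) _
        simp only
        rw [← mul_assoc]
        refine mul_le_mul_left ?_ _
        refine (lintegral_vpMajorant_le ha1 le_rfl hμ hM y).trans ?_
        rw [mul_right_comm _ M, ← ENNReal.ofReal_mul (by positivity)]
        refine mul_le_mul_left (ENNReal.ofReal_le_ofReal ?_) _
        rw [mul_assoc _ ((800 * Real.pi ^ 2) ^ 3)]
        refine mul_le_mul_of_nonneg_left ?_ (by positivity)
        have : ∏ j, (200 / (1 + y j ^ 2)) ≤ ∏ j : Fin 3, (800 * Real.pi ^ 2) * sieveDensity (y j) := by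
          refine Finset.prod_le_prod (fun j _ => by positivity) fun j _ => ?_
          calc 200 / (1 + y j ^ 2)
              = (800 * Real.pi ^ 2) * (1 / (4 * Real.pi ^ 2) / (1 + y j ^ 2)) := by
                field_simp; norm_num
            _ ≤ _ := by gcongr; exact le_sieveDensity _
        rw [Finset.prod_mul_distrib] at this
        simpa using this
    _ = _ := by
        have hd := measurable_prod_comp continuous_sieveDensity
        rw [lintegral_const_mul _ (by fun_prop), sieveMeasure,
          lintegral_withDensity_eq_lintegral_mul _ hd (by fun_prop)]
        simp only [Pi.mul_apply]
        rw [← mul_assoc, ← mul_assoc, ← ENNReal.ofReal_mul (by positivity)]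
        congr 3
        unfold sieveConst
        ring

end LargeSieve

section SixMomentSieve

open scoped FourierTransform

lemma superpose_cube_eq_charSum (ψ : ℝ → ℝ) (X : Finset ℝ) (ν : ℝ → ℝ) (T : Finset ℤ)
    (a : ℝ → ℤ → ℂ) (v : Fin 3 → ℝ) :
    superpose ψ X ν T a v ^ 3 = charSum ((X ×ˢ T) ×ˢ ((X ×ˢ T) ×ˢ (X ×ˢ T)))
      (fun i => (ν i.1.1 * a i.1.1 i.1.2) * ((ν i.2.1.1 * a i.2.1.1 i.2.1.2) *
        (ν i.2.2.1 * a i.2.2.1 i.2.2.2)))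
      (fun i => ![(i.1.2 + i.2.1.2 + i.2.2.2 : ℝ),
        i.1.2 * i.1.1 + i.2.1.2 * i.2.1.1 + i.2.2.2 * i.2.2.1,
        i.1.2 * ψ i.1.1 + i.2.1.2 * ψ i.2.1.1 + i.2.2.2 * ψ i.2.2.1]) v := by
  rw [← modeSum_coneMode, pow_three, modeSum, Finset.sum_mul_sum, ← Finset.sum_product',
    Finset.sum_mul_sum, ← Finset.sum_product', charSum]
  refine Finset.sum_congr rfl fun i _ => ?_
  simp only [coneMode, coneLin, Fin.sum_univ_three, Matrix.cons_val_zero, Matrix.cons_val_one,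
    Matrix.cons_val_two]
  rw [show ((i.1.2 : ℝ) + i.2.1.2 + i.2.2.2) * v 0 +
      (i.1.2 * i.1.1 + i.2.1.2 * i.2.1.1 + i.2.2.2 * i.2.2.1) * v 1 +
      Matrix.vecHead (Matrix.vecTail ![(i.1.2 * i.1.1 + i.2.1.2 * i.2.1.1 + i.2.2.2 * i.2.2.1 : ℝ),
        i.1.2 * ψ i.1.1 + i.2.1.2 * ψ i.2.1.1 + i.2.2.2 * ψ i.2.2.1]) * v 2 =
      i.1.2 * (v 0 + i.1.1 * v 1 + ψ i.1.1 * v 2) +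
      (i.2.1.2 * (v 0 + i.2.1.1 * v 1 + ψ i.2.1.1 * v 2) +
      i.2.2.2 * (v 0 + i.2.2.1 * v 1 + ψ i.2.2.1 * v 2)) by
        simp only [Matrix.tail_cons, Matrix.head_cons]; ring, AddChar.map_add_eq_mul,
      AddChar.map_add_eq_mul, Circle.coe_mul, Circle.coe_mul]
  ring

lemma lintegral_six_superpose_le_sieve {c : ℝ} {ψ m : ℝ → ℝ} (hψ : NormCurve c ψ m)
    {X : Finset ℝ} (hX : ∀ φ ∈ X, φ ∈ Ico (0 : ℝ) 1) (ν : ℝ → ℝ) (a : ℝ → ℤ → ℂ) (l : ℕ)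
    {μ : Measure (Fin 3 → ℝ)} [IsFiniteMeasure μ] (hμ : ∀ᵐ x ∂μ, ∀ j, x j ∈ Ico (0 : ℝ) 1)
    {M : ℝ≥0∞} (hM : ∀ i, μ {x | cubeCode l x = i} ≤ M) :
    ∫⁻ v, ‖superpose ψ X ν (Finset.Icc (-(4 * 2 ^ l) : ℤ) (4 * 2 ^ l)) a v‖ₑ ^ 6 ∂μ ≤
      ENNReal.ofReal (sieveConst * (2 ^ l) ^ 3) * M *
      ∫⁻ v, ‖superpose ψ X ν (Finset.Icc (-(4 * 2 ^ l) : ℤ) (4 * 2 ^ l)) a v‖ₑ ^ 6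
        ∂sieveMeasure := by
  have e : ∀ v, ‖superpose ψ X ν (Finset.Icc (-(4 * 2 ^ l) : ℤ) (4 * 2 ^ l)) a v‖ₑ ^ 6 =
      ‖superpose ψ X ν (Finset.Icc (-(4 * 2 ^ l) : ℤ) (4 * 2 ^ l)) a v ^ 3‖ₑ ^ 2 := by
    intro v; rw [enorm_pow, ← pow_mul]
  simp_rw [e, superpose_cube_eq_charSum]
  refine lintegral_sq_charSum_le ?_ hμ hM
  have key : ∀ k ∈ Finset.Icc (-(4 * 2 ^ l) : ℤ) (4 * 2 ^ l), ∀ y : ℝ, |y| ≤ 1 →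
      |(k : ℝ) * y| ≤ 4 * 2 ^ l := by
    intro k hk y hy
    rw [Finset.mem_Icc] at hk
    have hk' : |(k : ℝ)| ≤ 4 * 2 ^ l := by
      rw [abs_le]; exact_mod_cast hk
    rw [abs_mul]
    calc |(k : ℝ)| * |y| ≤ (4 * 2 ^ l) * 1 := by gcongr
      _ = _ := mul_one _
  have tri : ∀ p q r : ℝ, |p| ≤ 4 * 2 ^ l → |q| ≤ 4 * 2 ^ l → |r| ≤ 4 * 2 ^ l →
      |p + q + r| ≤ 12 * 2 ^ l := by
    intro p q r hp hq hr
    have := abs_add_three p q r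
    linarith
  have hφ : ∀ φ ∈ X, |φ| ≤ 1 := fun φ h => by
    rw [abs_of_nonneg (hX φ h).1]; exact (hX φ h).2.le
  have hψφ : ∀ φ ∈ X, |ψ φ| ≤ 1 := fun φ h => hψ.abs_le φ (Ico_subset_Icc_self (hX φ h))
  rintro ⟨i, k, j⟩ hi
  simp only [Finset.mem_product] at hi
  obtain ⟨⟨hi1, hi2⟩, ⟨hk1, hk2⟩, hj1, hj2⟩ := hi
  intro n
  fin_cases n
  · have := fun k hk => key k hk 1 (by simp)
    simp only [mul_one] at this
    exact tri _ _ _ (this _ hi2) (this _ hk2) (this _ hj2)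
  · exact tri _ _ _ (key _ hi2 _ (hφ _ hi1)) (key _ hk2 _ (hφ _ hk1)) (key _ hj2 _ (hφ _ hj1))
  · exact tri _ _ _ (key _ hi2 _ (hψφ _ hi1)) (key _ hk2 _ (hψφ _ hk1)) (key _ hj2 _ (hψφ _ hj1))

/-- Sixth moments of superpositions of plane waves against a measure with bounded mass on
dyadic cubes. -/
theorem exists_lintegral_six_superpose_le_of_cubes {c η : ℝ} (hc : 0 < c) (hη : 0 < η) :
    ∃ C : ℝ, 0 ≤ C ∧ ∃ l₀ : ℕ, ∀ l ≥ l₀, ∀ ψ m, NormCurve c ψ m → ∀ X ν s,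
      s ≤ 1 → FrostmanWeights X ν s l → ∀ (a : ℝ → ℤ → ℂ) (B β : ℝ),
      (∀ φ ∈ X, ∀ k : ℤ, |k| < 2 ^ l → a φ k = 0) →
      (∀ φ ∈ X, ∑ n ∈ Finset.Icc (-(4 * 2 ^ l) : ℤ) (4 * 2 ^ l), ‖a φ n‖ ^ 2 ≤ β) →
      (∀ φ ∈ X, ∀ u, ‖trigSum (Finset.Icc (-(4 * 2 ^ l) : ℤ) (4 * 2 ^ l)) (a φ) u‖ ≤ B) →
      ∀ (μ : Measure (Fin 3 → ℝ)) [IsFiniteMeasure μ], (∀ᵐ x ∂μ, ∀ j, x j ∈ Ico (0 : ℝ) 1) →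
      ∀ M : ℝ≥0∞, (∀ i, μ {x | cubeCode l x = i} ≤ M) →
      ∫⁻ v, ‖superpose ψ X ν (Finset.Icc (-(4 * 2 ^ l) : ℤ) (4 * 2 ^ l)) a v‖ₑ ^ 6 ∂μ ≤
        ENNReal.ofReal (C * B ^ 4 * β * 2 ^ ((3 + η - 2 * s) * l)) * M := by
  obtain ⟨C, hC0, l₀, h⟩ := exists_lintegral_six_superpose_le spectralGap_sieveMeasure hc hη
  refine ⟨sieveConst * C, mul_nonneg sieveConst_nonneg hC0, l₀, ?_⟩
  intro l hl ψ m hψ X ν s hs hX a B β hsupp hβ hB μ _ hμ M hM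
  refine (lintegral_six_superpose_le_sieve hψ hX.mem ν a l hμ hM).trans ?_
  refine (mul_le_mul_right (h l hl ψ m hψ X ν s hs hX a B β hsupp hβ hB) _).trans_eq ?_
  rw [mul_right_comm, ← ENNReal.ofReal_mul (mul_nonneg sieveConst_nonneg (by positivity))]
  congr 2
  have : (2 : ℝ) ^ ((3 + η - 2 * s) * l) = (2 ^ l) ^ 3 * 2 ^ ((η - 2 * s) * l) := by
    rw [← pow_mul, ← Real.rpow_natCast, ← Real.rpow_add (by norm_num)]
    congr 1
    push_cast
    ring
  rw [this]
  ring

end SixMomentSieve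

section TrigOfSets

open scoped FourierTransform

lemma fejer_eq_sum_hat {D : ℕ} (hD : 0 < D) (w : ℝ) :
    (fejer D w : ℂ) = ∑ n ∈ Finset.Icc (-D : ℤ) D, (hat D n : ℂ) * 𝐞 (n * w) := by
  have hD' : (0 : ℝ) < D := by exact_mod_cast hD
  have e : ∀ i ∈ Finset.range D, ∀ j ∈ Finset.range D,
      (𝐞 (((i : ℤ) - (j : ℤ) : ℤ) * w) : ℂ) = ∑ n ∈ Finset.Icc (-D : ℤ) D,
        ((if (i : ℤ) - (j : ℤ) = n then (1 : ℝ) else 0 : ℝ) : ℂ) * 𝐞 (n * w) := by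
    intro i hi j hj
    rw [Finset.mem_range] at hi hj
    rw [Finset.sum_eq_single ((i : ℤ) - j)]
    · simp
    · intro n _ hn
      rw [if_neg (Ne.symm hn)]; simp
    · intro h; rw [Finset.mem_Icc] at h; omega
  rw [fejer_eq_sum, Finset.sum_congr rfl fun i hi => Finset.sum_congr rfl (e i hi)]
  rw [Finset.sum_congr rfl fun i _ => Finset.sum_comm, Finset.sum_comm, Finset.sum_div]
  refine Finset.sum_congr rfl fun n _ => ?_
  simp_rw [← Finset.sum_mul]
  have := card_diff_eq D n
  simp_rw [← Complex.ofReal_sum]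
  rw [this, mul_div_right_comm, hat, ← Complex.ofReal_natCast, ← Complex.ofReal_div]
  congr 3
  rw [← max_div_div_right hD'.le, zero_div, sub_div, div_self hD'.ne']

lemma fejer_periodic (D : ℕ) : Function.Periodic (fejer D) 1 := by
  intro w
  unfold fejer
  congr 3
  refine Finset.sum_congr rfl fun j _ => ?_
  have : (𝐞 ((j : ℝ) * 1) : ℂ) = 1 := by
    rw [Real.fourierChar_apply, Complex.exp_eq_one_iff]
    exact ⟨j, by push_cast; ring⟩
  rw [mul_add, AddChar.map_add_eq_mul, Circle.coe_mul, this, mul_one]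

lemma integral_fejer_sub {D : ℕ} (hD : 0 < D) (u c : ℝ) :
    ∫ v in c..(c + 1), fejer D (u - v) = 1 := by
  rw [intervalIntegral.integral_comp_sub_left (fun w => fejer D w) u]
  have h := (fejer_periodic D).intervalIntegral_add_eq (u - (c + 1)) 0
  rw [show u - (c + 1) + 1 = u - c by ring, zero_add] at h
  rw [h, integral_fejer D hD]

lemma half_le_fejer {D : ℕ} (hD : 0 < D) {w : ℝ} (hw : |w| ≤ 1 / (8 * D)) :
    (D : ℝ) / 2 ≤ fejer D w := by
  have hD' : (0 : ℝ) < D := by exact_mod_cast hD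
  have hre : ∀ j ∈ Finset.range D, √2 / 2 ≤ (𝐞 (j * w) : ℂ).re := by
    intro j hj
    rw [Finset.mem_range] at hj
    rw [Real.fourierChar_apply, Complex.exp_ofReal_mul_I_re, ← Real.cos_pi_div_four,
      ← Real.cos_abs (2 * Real.pi * _)]
    have hjD : (j : ℝ) ≤ D := by exact_mod_cast hj.le
    have hjw : |(j : ℝ) * w| ≤ 1 / 8 := by
      rw [abs_mul, Nat.abs_cast]
      calc (j : ℝ) * |w| ≤ D * (1 / (8 * D)) := by gcongr
        _ = 1 / 8 := by field_simp
    have hpi := Real.pi_pos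
    have h2 : |2 * Real.pi * (j * w)| ≤ Real.pi / 4 := by
      rw [abs_mul, abs_of_pos (by positivity)]
      nlinarith
    exact Real.cos_le_cos_of_nonneg_of_le_pi (abs_nonneg _) (by linarith) h2
  have hsum : (D : ℝ) * (√2 / 2) ≤ ‖∑ j ∈ Finset.range D, (𝐞 (j * w) : ℂ)‖ := by
    refine le_trans ?_ (Complex.re_le_norm _)
    rw [Complex.re_sum]
    calc (D : ℝ) * (√2 / 2) = ∑ _j ∈ Finset.range D, √2 / 2 := by simp
      _ ≤ _ := Finset.sum_le_sum hre
  unfold fejer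
  rw [le_div_iff₀ hD']
  calc (D : ℝ) / 2 * D = ((D : ℝ) * (√2 / 2)) ^ 2 := by
        rw [mul_pow, div_pow, Real.sq_sqrt (by norm_num)]; ring
    _ ≤ _ := by gcongr

/-- The Fourier coefficients of the indicator function of a set. -/
def setCoeff (Y : Set ℝ) (n : ℤ) : ℂ := ∫ v in Y, (𝐞 (-(n * v)) : ℂ)

/-- The Fejér mean of the indicator function of a set. -/
def fejerMean (D : ℕ) (Y : Set ℝ) (u : ℝ) : ℝ := ∫ v in Y, fejer D (u - v)

lemma norm_setCoeff_le {Y : Set ℝ} (hY : volume Y ≠ ⊤) (n : ℤ) :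
    ‖setCoeff Y n‖ ≤ volume.real Y := by
  have := norm_setIntegral_le_of_norm_le_const (μ := volume) (s := Y)
    (f := fun v : ℝ => (𝐞 (-(n * v)) : ℂ)) (C := 1) (lt_top_iff_ne_top.2 hY)
    (fun v _ => (Circle.norm_coe _).le)
  simpa [setCoeff] using this

lemma integrableOn_of_continuous_of_subset {E : Type*} [NormedAddCommGroup E] {f : ℝ → E}
    (hf : Continuous f) {Y : Set ℝ} {c : ℝ} (hY : Y ⊆ Ico c (c + 1)) : IntegrableOn f Y :=
  ((hf.integrableOn_Icc (a := c) (b := c + 1))).mono_set (hY.trans Ico_subset_Icc_self)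

lemma trigSum_hat_setCoeff {D : ℕ} (hD : 0 < D) {Y : Set ℝ} {c : ℝ} (hY : Y ⊆ Ico c (c + 1))
    (u : ℝ) : trigSum (Finset.Icc (-D : ℤ) D) (fun n => (hat D n : ℂ) * setCoeff Y n) u =
      fejerMean D Y u := by
  have hc := Real.continuous_fourierChar
  unfold trigSum fejerMean
  rw [← integral_complex_ofReal]
  simp_rw [fejer_eq_sum_hat hD]
  rw [integral_finsetSum _ fun n _ =>
    integrableOn_of_continuous_of_subset (by fun_prop) hY]
  refine Finset.sum_congr rfl fun n _ => ?_
  unfold setCoeff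
  rw [mul_right_comm, ← integral_const_mul]
  congr 1
  ext v
  rw [mul_sub, sub_eq_add_neg, AddChar.map_add_eq_mul, Circle.coe_mul, mul_assoc]

lemma fejerMean_nonneg (D : ℕ) (Y : Set ℝ) (u : ℝ) : 0 ≤ fejerMean D Y u :=
  integral_nonneg fun _ => fejer_nonneg _ _

lemma fejerMean_le_one {D : ℕ} (hD : 0 < D) {Y : Set ℝ} {c : ℝ} (hY : Y ⊆ Ico c (c + 1))
    (u : ℝ) : fejerMean D Y u ≤ 1 := by
  have hf := continuous_fejer D
  rw [← integral_fejer_sub hD u c, intervalIntegral.integral_of_le (by linarith),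
    ← integral_Ico_eq_integral_Ioc]
  refine setIntegral_mono_set (integrableOn_of_continuous_of_subset (by fun_prop) subset_rfl)
    (Filter.Eventually.of_forall fun v => fejer_nonneg _ _) ?_
  exact Filter.Eventually.of_forall fun v hv => hY hv

lemma le_fejerMean {D : ℕ} (hD : 0 < D) {Y : Set ℝ} {c : ℝ} (hY : Y ⊆ Ico c (c + 1))
    {p q u : ℝ} (hpq : Ico p q ⊆ Y) (hu : u ∈ Ico p q) (hlen : 1 / (4 * D) ≤ q - p) :
    1 / 16 ≤ fejerMean D Y u := by
  have hf := continuous_fejer D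
  have hD' : (0 : ℝ) < D := by exact_mod_cast hD
  set r : ℝ := 1 / (8 * D) with hr
  have hr0 : 0 < r := by positivity
  have hr2 : 1 / (4 * (D : ℝ)) = 2 * r := by rw [hr]; field_simp; norm_num
  obtain ⟨e, he, hue⟩ : ∃ e, Ico e (e + r) ⊆ Ico p q ∧ (e = u ∨ e + r = u) := by
    by_cases h : u + r ≤ q
    · exact ⟨u, Ico_subset_Ico hu.1 h, Or.inl rfl⟩
    · exact ⟨u - r, Ico_subset_Ico (by linarith) (by linarith [hu.2]), Or.inr (by ring)⟩
  have h1 : ∫ v in Ico e (e + r), fejer D (u - v) ≤ fejerMean D Y u :=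
    setIntegral_mono_set (integrableOn_of_continuous_of_subset (by fun_prop) hY)
      (Filter.Eventually.of_forall fun v => fejer_nonneg _ _)
      (Filter.Eventually.of_forall fun v hv => hpq (he hv))
  have h2 : ∫ _v in Ico e (e + r), (D : ℝ) / 2 ≤ ∫ v in Ico e (e + r), fejer D (u - v) := by
    refine setIntegral_mono_on (integrableOn_const (by simp)) ?_ measurableSet_Ico ?_
    · exact integrableOn_of_continuous_of_subset (by fun_prop) ((hpq.trans' he).trans hY)
    · intro v hv
      refine half_le_fejer hD ?_
      rw [abs_le]
      rcases hue with h | h <;> constructor <;> linarith [hv.1, hv.2]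
  have h3 : ∫ _v in Ico e (e + r), (D : ℝ) / 2 = 1 / 16 := by
    rw [setIntegral_const, Real.volume_real_Ico_of_le (by linarith), smul_eq_mul, hr]
    field_simp
    norm_num
  linarith

lemma sum_norm_sq_setCoeff_le (T : Finset ℤ) {Y : Set ℝ} (hYm : MeasurableSet Y) {c : ℝ}
    (hY : Y ⊆ Ico c (c + 1)) : ∑ n ∈ T, ‖setCoeff Y n‖ ^ 2 ≤ volume.real Y := by
  have hc := Real.continuous_fourierChar
  set S : ℝ → ℂ := trigSum T (setCoeff Y) with hS
  have hSc : Continuous S := continuous_trigSum _ _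
  set A : ℝ := ∑ n ∈ T, ‖setCoeff Y n‖ ^ 2 with hA
  -- the mean square of `S` over a period
  have hper : Function.Periodic (fun v => ‖S v‖ ^ 2) 1 := by
    intro w
    simp only [hS, trigSum]
    congr 3
    ext n
    have : (𝐞 ((n : ℝ) * 1) : ℂ) = 1 := by
      rw [Real.fourierChar_apply, Complex.exp_eq_one_iff]
      exact ⟨n, by push_cast; ring⟩
    rw [mul_add, AddChar.map_add_eq_mul, Circle.coe_mul, this, mul_one]
  have hmean : ∫ v in Ico c (c + 1), ‖S v‖ ^ 2 = A := by
    rw [integral_Ico_eq_integral_Ioc, ← intervalIntegral.integral_of_le (by linarith),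
      hper.intervalIntegral_add_eq c 0, zero_add]
    have e : ∀ v : ℝ, ((‖S v‖ ^ 2 : ℝ) : ℂ) = ∑ n ∈ T, ∑ k ∈ T,
        (setCoeff Y n * (starRingEnd ℂ) (setCoeff Y k)) * 𝐞 ((n - k : ℤ) * v) := by
      intro v
      push_cast
      rw [← Complex.mul_conj', hS, trigSum, map_sum, Finset.sum_mul_sum]
      refine Finset.sum_congr rfl fun n _ => Finset.sum_congr rfl fun k _ => ?_
      rw [map_mul (starRingEnd ℂ), conj_fourierChar]
      have : ((n : ℝ) - k) * v = n * v + -(k * v) := by ring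
      rw [this, AddChar.map_add_eq_mul]
      push_cast
      ring
    have : ((∫ v in (0 : ℝ)..1, ‖S v‖ ^ 2 : ℝ) : ℂ) = A := by
      rw [← intervalIntegral.integral_ofReal]
      simp_rw [e]
      rw [intervalIntegral.integral_finsetSum fun i _ =>
        Continuous.intervalIntegrable (by fun_prop) _ _, hA, Complex.ofReal_sum]
      refine Finset.sum_congr rfl fun n hn => ?_
      rw [intervalIntegral.integral_finsetSum fun i _ =>
        Continuous.intervalIntegrable (by fun_prop) _ _, Finset.sum_eq_single n]
      · rw [intervalIntegral.integral_const_mul, integral_fourierChar_int_mul]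
        simp [Complex.mul_conj']
      · intro k _ hk
        rw [intervalIntegral.integral_const_mul, integral_fourierChar_int_mul,
          if_neg (by omega), mul_zero]
      · exact fun h => absurd hn h
    exact_mod_cast this
  have hcross : ∫ v in Y, (S v).re = A := by
    have : ∫ v in Y, (starRingEnd ℂ) (S v) = A := by
      have e : ∀ v, (starRingEnd ℂ) (S v) = ∑ n ∈ T, (starRingEnd ℂ) (setCoeff Y n) *
          𝐞 (-(n * v)) := by
        intro v
        rw [hS, trigSum, map_sum]
        refine Finset.sum_congr rfl fun n _ => ?_
        rw [map_mul (starRingEnd ℂ), conj_fourierChar]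
      simp_rw [e]
      rw [integral_finsetSum _ fun n _ =>
        integrableOn_of_continuous_of_subset (by fun_prop) hY, hA]
      push_cast
      refine Finset.sum_congr rfl fun n _ => ?_
      rw [integral_const_mul]
      change (starRingEnd ℂ) (setCoeff Y n) * setCoeff Y n = _
      rw [Complex.conj_mul']
    have h2 := congrArg Complex.re this
    have hi : Integrable (fun v => (starRingEnd ℂ) (S v)) (volume.restrict Y) :=
      integrableOn_of_continuous_of_subset (by fun_prop) hY
    rw [← RCLike.re_eq_complex_re, ← integral_re hi] at h2
    simpa using h2
  have hsub : ∫ v in Y, ‖S v‖ ^ 2 ≤ A := by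
    rw [← hmean]
    exact setIntegral_mono_set (integrableOn_of_continuous_of_subset (by fun_prop) subset_rfl)
      (Filter.Eventually.of_forall fun v => by positivity)
      (Filter.Eventually.of_forall fun v hv => hY hv)
  have hle : ∫ v in Y, (2 * (S v).re - ‖S v‖ ^ 2) ≤ ∫ _v in Y, (1 : ℝ) := by
    refine setIntegral_mono_on ?_ ?_ hYm ?_
    · exact integrableOn_of_continuous_of_subset (by fun_prop) hY
    · exact integrableOn_of_continuous_of_subset continuous_const hY
    · intro v _
      have := Complex.re_le_norm (S v)
      nlinarith [sq_nonneg (‖S v‖ - 1)]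
  rw [integral_sub (integrableOn_of_continuous_of_subset (by fun_prop) hY)
    (integrableOn_of_continuous_of_subset (by fun_prop) hY), integral_const_mul, hcross,
    setIntegral_const] at hle
  simp only [smul_eq_mul, mul_one] at hle
  linarith

end TrigOfSets

section LittlewoodPaley

open scoped FourierTransform

/-- The de la Vallée Poussin multiplier: equal to `1` for `|n| ≤ 2 ^ l` and to `0` for
`|n| ≥ 2 ^ (l + 1)`. -/
def vpMult (l : ℕ) (n : ℤ) : ℝ := 2 * hat (2 ^ (l + 1)) n - hat (2 ^ l) n

lemma vpMult_eq_one {l : ℕ} {n : ℤ} (h : |n| ≤ 2 ^ l) : vpMult l n = 1 := by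
  have h1 : |n| ≤ 2 ^ (l + 1) := h.trans (by rw [pow_succ]; linarith [pow_pos (two_pos (α := ℤ)) l])
  unfold vpMult
  rw [hat_of_abs_le (by positivity) (by exact_mod_cast h1),
    hat_of_abs_le (by positivity) (by exact_mod_cast h)]
  push_cast
  rw [pow_succ]
  have : (2 : ℝ) ^ l ≠ 0 := by positivity
  field_simp
  ring

lemma vpMult_eq_zero {l : ℕ} {n : ℤ} (h : 2 ^ (l + 1) ≤ |n|) : vpMult l n = 0 := by
  have h1 : 2 ^ l ≤ |n| := h.trans' (by rw [pow_succ]; linarith [pow_pos (two_pos (α := ℤ)) l])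
  unfold vpMult
  rw [hat_eq_zero (by positivity) (by exact_mod_cast h),
    hat_eq_zero (by positivity) (by exact_mod_cast h1)]
  ring

lemma abs_vpMult_le (l : ℕ) (n : ℤ) : |vpMult l n| ≤ 2 := by
  unfold vpMult
  have := hat_nonneg (2 ^ (l + 1)) n
  have := hat_nonneg (2 ^ l) n
  have := hat_le_one (2 ^ (l + 1)) n
  have := hat_le_one (2 ^ l) n
  rw [abs_le]; constructor <;> linarith

lemma trigSum_eq_of_subset {T T' : Finset ℤ} {a : ℤ → ℂ} (h : T ⊆ T')
    (h0 : ∀ n ∈ T', n ∉ T → a n = 0) (u : ℝ) : trigSum T a u = trigSum T' a u :=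
  Finset.sum_subset h fun n hn hn' => by rw [h0 n hn hn', zero_mul]

lemma norm_trigSum_vpMult_le {T : Finset ℤ} {a : ℤ → ℂ} {B : ℝ}
    (hB : ∀ u, ‖trigSum T a u‖ ≤ B) (l : ℕ) (u : ℝ) :
    ‖trigSum T (fun n => vpMult l n * a n) u‖ ≤ 3 * B := by
  have e : trigSum T (fun n => vpMult l n * a n) u =
      2 * trigSum T (fun n => hat (2 ^ (l + 1)) (n - 0) * a n) u -
        trigSum T (fun n => hat (2 ^ l) (n - 0) * a n) u := by
    unfold trigSum
    rw [Finset.mul_sum, ← Finset.sum_sub_distrib]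
    refine Finset.sum_congr rfl fun n _ => ?_
    simp only [sub_zero, vpMult]
    push_cast
    ring
  have h1 := norm_trigSum_hat_le hB (D := 2 ^ (l + 1)) (by positivity) 0 u
  have h2 := norm_trigSum_hat_le hB (D := 2 ^ l) (by positivity) 0 u
  rw [e]
  refine (norm_sub_le _ _).trans ?_
  rw [norm_mul, RCLike.norm_ofNat]
  linarith

/-- The coefficients of the low-frequency part of a Fejér mean of order `2 ^ L`. -/
def lowCoeff (Y : Set ℝ) (L l : ℕ) (n : ℤ) : ℂ := vpMult l n * (hat (2 ^ L) n * setCoeff Y n)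

/-- The coefficients of the Littlewood–Paley pieces of a Fejér mean of order `2 ^ L`. -/
def pieceCoeff (Y : Set ℝ) (L l : ℕ) (n : ℤ) : ℂ := lowCoeff Y L (l + 1) n - lowCoeff Y L l n

lemma pieceCoeff_eq_zero_of_lt {Y : Set ℝ} {L l : ℕ} {n : ℤ} (h : |n| < 2 ^ l) :
    pieceCoeff Y L l n = 0 := by
  unfold pieceCoeff lowCoeff
  rw [vpMult_eq_one h.le, vpMult_eq_one (h.le.trans
    (by rw [pow_succ]; linarith [pow_pos (two_pos (α := ℤ)) l])), sub_self]

lemma lowCoeff_eq_zero {Y : Set ℝ} {L l : ℕ} {n : ℤ} (h : 2 ^ (l + 1) ≤ |n|) :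
    lowCoeff Y L l n = 0 := by
  unfold lowCoeff
  rw [vpMult_eq_zero h, Complex.ofReal_zero, zero_mul]

lemma pieceCoeff_eq_zero_of_le {Y : Set ℝ} {L l : ℕ} {n : ℤ} (h : 4 * 2 ^ l ≤ |n|) :
    pieceCoeff Y L l n = 0 := by
  have h0 := pow_pos (two_pos (α := ℤ)) l
  unfold pieceCoeff
  rw [lowCoeff_eq_zero (by rw [pow_succ, pow_succ]; linarith),
    lowCoeff_eq_zero (by rw [pow_succ]; linarith), sub_self]

lemma norm_lowCoeff_le (Y : Set ℝ) (L l : ℕ) (n : ℤ) :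
    ‖lowCoeff Y L l n‖ ≤ 2 * ‖setCoeff Y n‖ := by
  unfold lowCoeff
  rw [norm_mul, norm_mul, Complex.norm_real, Complex.norm_real, Real.norm_eq_abs,
    Real.norm_of_nonneg (hat_nonneg _ _)]
  have h1 := abs_vpMult_le l n
  have h2 := hat_le_one (2 ^ L) n
  have h3 := hat_nonneg (2 ^ L) n
  have h4 : hat (2 ^ L) n * ‖setCoeff Y n‖ ≤ 1 * ‖setCoeff Y n‖ := by gcongr
  rw [one_mul] at h4
  gcongr

lemma sum_norm_sq_pieceCoeff_le (T : Finset ℤ) {Y : Set ℝ} (hYm : MeasurableSet Y) {c : ℝ}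
    (hY : Y ⊆ Ico c (c + 1)) (L l : ℕ) :
    ∑ n ∈ T, ‖pieceCoeff Y L l n‖ ^ 2 ≤ 16 * volume.real Y := by
  refine le_trans ?_ (mul_le_mul_of_nonneg_left (sum_norm_sq_setCoeff_le T hYm hY) (by norm_num))
  rw [Finset.mul_sum]
  refine Finset.sum_le_sum fun n _ => ?_
  have h1 := norm_lowCoeff_le Y L l n
  have h2 := norm_lowCoeff_le Y L (l + 1) n
  have h3 : ‖pieceCoeff Y L l n‖ ≤ 4 * ‖setCoeff Y n‖ := (norm_sub_le _ _).trans (by linarith)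
  calc _ ≤ (4 * ‖setCoeff Y n‖) ^ 2 := by gcongr
    _ = _ := by ring

lemma norm_trigSum_lowCoeff_le (T : Finset ℤ) {Y : Set ℝ} (hY : volume Y ≠ ⊤) (L l : ℕ)
    (u : ℝ) : ‖trigSum T (lowCoeff Y L l) u‖ ≤ T.card * (2 * volume.real Y) := by
  unfold trigSum
  refine (norm_sum_le _ _).trans ?_
  rw [← nsmul_eq_mul]
  refine Finset.sum_le_card_nsmul _ _ _ fun n _ => ?_
  rw [norm_mul, Circle.norm_coe, mul_one]
  linarith [norm_lowCoeff_le Y L l n, norm_setCoeff_le hY n]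

lemma norm_fejerMean_le {Y : Set ℝ} {c : ℝ} (hY : Y ⊆ Ico c (c + 1)) (L : ℕ) (u : ℝ) :
    ‖trigSum (Finset.Icc (-(2 ^ L : ℕ) : ℤ) (2 ^ L : ℕ))
      (fun n => (hat (2 ^ L) n : ℂ) * setCoeff Y n) u‖ ≤ 1 := by
  rw [trigSum_hat_setCoeff (by positivity) hY, Complex.norm_real,
    Real.norm_of_nonneg (fejerMean_nonneg _ _ _)]
  exact fejerMean_le_one (by positivity) hY u

lemma norm_trigSum_pieceCoeff_le {Y : Set ℝ} {c : ℝ} (hY : Y ⊆ Ico c (c + 1)) {L l : ℕ} (u : ℝ) :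
    ‖trigSum (Finset.Icc (-(4 * 2 ^ l) : ℤ) (4 * 2 ^ l)) (pieceCoeff Y L l) u‖ ≤ 6 := by
  have e : trigSum (Finset.Icc (-(4 * 2 ^ l) : ℤ) (4 * 2 ^ l)) (pieceCoeff Y L l) u =
      trigSum (Finset.Icc (-(2 ^ L : ℕ) : ℤ) (2 ^ L : ℕ)) (pieceCoeff Y L l) u := by
    have h0 : ∀ n : ℤ, ¬ |n| ≤ (2 ^ L : ℕ) → pieceCoeff Y L l n = 0 := by
      intro n hn
      unfold pieceCoeff lowCoeff
      rw [hat_eq_zero (n := n) (by positivity) (by omega)]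
      simp
    have h1 := trigSum_eq_of_subset (T := Finset.Icc (-(4 * 2 ^ l) : ℤ) (4 * 2 ^ l))
      (T' := Finset.Icc (-(4 * 2 ^ l) : ℤ) (4 * 2 ^ l) ∪
        Finset.Icc (-(2 ^ L : ℕ) : ℤ) (2 ^ L : ℕ)) (a := pieceCoeff Y L l)
      Finset.subset_union_left (fun n _ hn => pieceCoeff_eq_zero_of_le (by
        rw [Finset.mem_Icc, ← abs_le] at hn; exact (not_le.1 hn).le)) u
    have h2 := trigSum_eq_of_subset (T := Finset.Icc (-(2 ^ L : ℕ) : ℤ) (2 ^ L : ℕ))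
      (T' := Finset.Icc (-(4 * 2 ^ l) : ℤ) (4 * 2 ^ l) ∪
        Finset.Icc (-(2 ^ L : ℕ) : ℤ) (2 ^ L : ℕ)) (a := pieceCoeff Y L l)
      Finset.subset_union_right (fun n _ hn => h0 n (by
        rwa [Finset.mem_Icc, ← abs_le] at hn)) u
    rw [h1, h2]
  have e2 : trigSum (Finset.Icc (-(2 ^ L : ℕ) : ℤ) (2 ^ L : ℕ)) (pieceCoeff Y L l) u =
      trigSum (Finset.Icc (-(2 ^ L : ℕ) : ℤ) (2 ^ L : ℕ)) (lowCoeff Y L (l + 1)) u -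
        trigSum (Finset.Icc (-(2 ^ L : ℕ) : ℤ) (2 ^ L : ℕ)) (lowCoeff Y L l) u := by
    unfold trigSum pieceCoeff
    rw [← Finset.sum_sub_distrib]
    exact Finset.sum_congr rfl fun n _ => sub_mul _ _ _
  rw [e, e2]
  refine (norm_sub_le _ _).trans ?_
  have := norm_trigSum_vpMult_le (norm_fejerMean_le hY L) (l + 1) u
  have := norm_trigSum_vpMult_le (norm_fejerMean_le hY L) l u
  unfold lowCoeff
  linarith

lemma fejerMean_eq_sum_pieces {Y : Set ℝ} {c : ℝ} (hY : Y ⊆ Ico c (c + 1)) {k L : ℕ} (hkL : k ≤ L)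
    (u : ℝ) : (fejerMean (2 ^ L) Y u : ℂ) =
      trigSum (Finset.Icc (-(4 * 2 ^ k) : ℤ) (4 * 2 ^ k)) (lowCoeff Y L k) u +
        ∑ l ∈ Finset.Ico k L,
          trigSum (Finset.Icc (-(4 * 2 ^ l) : ℤ) (4 * 2 ^ l)) (pieceCoeff Y L l) u := by
  have hmono : ∀ {l : ℕ}, l ≤ L → (Finset.Icc (-(4 * 2 ^ l) : ℤ) (4 * 2 ^ l)) ⊆
      Finset.Icc (-(4 * 2 ^ L) : ℤ) (4 * 2 ^ L) := by
    intro l hl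
    have : (2 : ℤ) ^ l ≤ 2 ^ L := pow_le_pow_right₀ (by norm_num) hl
    exact Finset.Icc_subset_Icc (by linarith) (by linarith)
  have h1 := trigSum_eq_of_subset (a := lowCoeff Y L k) (hmono hkL) (fun n _ hn =>
    lowCoeff_eq_zero (by
      rw [Finset.mem_Icc, ← abs_le, not_le] at hn
      rw [pow_succ]; linarith [pow_pos (two_pos (α := ℤ)) k])) u
  have h2 : ∀ l ∈ Finset.Ico k L, _ := fun l hl =>
    trigSum_eq_of_subset (a := pieceCoeff Y L l) (hmono (Finset.mem_Ico.1 hl).2.le)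
      (fun n _ hn => pieceCoeff_eq_zero_of_le (by
        rw [Finset.mem_Icc, ← abs_le, not_le] at hn; exact hn.le)) u
  rw [h1, Finset.sum_congr rfl h2, ← trigSum_hat_setCoeff (by positivity) hY]
  have h3 := trigSum_eq_of_subset (T := Finset.Icc (-(2 ^ L : ℕ) : ℤ) (2 ^ L : ℕ))
    (T' := Finset.Icc (-(4 * 2 ^ L) : ℤ) (4 * 2 ^ L))
    (a := fun n => (hat (2 ^ L) n : ℂ) * setCoeff Y n)
    (Finset.Icc_subset_Icc (by push_cast; linarith [pow_pos (two_pos (α := ℤ)) L])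
      (by push_cast; linarith [pow_pos (two_pos (α := ℤ)) L]))
    (fun n _ hn => by
      rw [Finset.mem_Icc, ← abs_le] at hn
      rw [hat_eq_zero (n := n) (by positivity) (by omega)]; simp) u
  rw [h3]
  unfold trigSum
  rw [Finset.sum_comm, ← Finset.sum_add_distrib]
  refine Finset.sum_congr rfl fun n _ => ?_
  rw [← Finset.sum_mul, ← add_mul]
  congr 1
  unfold pieceCoeff
  rw [Finset.sum_Ico_sub (fun l => lowCoeff Y L l n) hkL, add_sub_cancel, lowCoeff]
  by_cases h : |n| ≤ (2 ^ L : ℕ)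
  · rw [vpMult_eq_one (by exact_mod_cast h)]; simp
  · simp [hat_eq_zero (D := 2 ^ L) (n := n) (by positivity) (by omega)]

end LittlewoodPaley

section WeightedIncidence

lemma lintegral_pow_six_le {α : Type*} [MeasurableSpace α] (μ : Measure α) {f : α → ℝ≥0∞}
    (hf : AEMeasurable f μ) : (∫⁻ x, f x ∂μ) ^ 6 ≤ (∫⁻ x, f x ^ 6 ∂μ) * μ univ ^ 5 := by
  have hpq : (6 : ℝ).HolderConjugate (6 / 5) := by
    rw [Real.holderConjugate_iff]; norm_num
  have h := ENNReal.lintegral_mul_le_Lp_mul_Lq μ hpq hf (aemeasurable_const (b := (1 : ℝ≥0∞)))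
  simp only [Pi.mul_apply, mul_one, ENNReal.one_rpow, lintegral_const, one_mul] at h
  have e1 : ∀ x, f x ^ (6 : ℝ) = f x ^ 6 := fun x => by
    rw [← ENNReal.rpow_natCast]; norm_num
  simp_rw [e1] at h
  calc (∫⁻ x, f x ∂μ) ^ 6 ≤ _ := pow_le_pow_left₀ zero_le h 6
    _ = _ := by
      rw [mul_pow, ← ENNReal.rpow_natCast, ← ENNReal.rpow_mul, ← ENNReal.rpow_natCast,
        ← ENNReal.rpow_mul, ← ENNReal.rpow_natCast (μ univ)]
      norm_num

lemma FrostmanWeights.mono {X : Finset ℝ} {ν : ℝ → ℝ} {s : ℝ} {J l : ℕ}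
    (h : FrostmanWeights X ν s J) (hl : l ≤ J) : FrostmanWeights X ν s l :=
  ⟨h.mem, h.nonneg, fun k hk => h.ball k (hk.trans hl)⟩

/-- Weighted incidence bound: the average over a Frostman family of directions `φ` of the mass of
the preimage under `coneLin ψ φ` of a set of small length. -/
lemma exists_weighted_measure_preimage_le {c t s : ℝ} (hc : 0 < c) (hst : 3 - 2 * s < t)
    (hs : s ≤ 1) : ∃ K : ℝ, 0 ≤ K ∧ ∃ l₀ : ℕ, 3 ≤ l₀ ∧ ∀ ψ m, NormCurve c ψ m → ∀ X ν L, l₀ ≤ L →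
      FrostmanWeights X ν s L → ∀ Y : ℝ → Set ℝ, (∀ φ ∈ X, MeasurableSet (Y φ)) →
      (∀ φ ∈ X, Y φ ⊆ Ico (-1 / 4) (-1 / 4 + 1)) →
      (∀ φ ∈ X, ∀ u ∈ Y φ, ∃ p q, Ico p q ⊆ Y φ ∧ u ∈ Ico p q ∧ 1 / (4 * 2 ^ L) ≤ q - p) →
      ∀ μ : Measure (Fin 3 → ℝ), IsFiniteMeasure μ → (∀ᵐ x ∂μ, ∀ j, x j ∈ Ico (0 : ℝ) 1) →
      ∀ R, 0 ≤ R → (∀ l ≥ l₀, ∀ i, μ {x | cubeCode l x = i} ≤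
        ENNReal.ofReal (R * 2 ^ (-(t * l)))) →
      ∀ β δ, 0 ≤ δ → (∀ φ ∈ X, volume.real (Y φ) ≤ β) → β ≤ δ → β * R ≤ δ * μ.real univ →
      ∑ φ ∈ X, ν φ * μ.real {v | coneLin ψ φ v ∈ Y φ} ≤
        K * (δ + δ ^ (1 / 6 : ℝ)) * μ.real univ := by
  classical
  set η : ℝ := (t + 2 * s - 3) / 2 with hη
  have hη0 : 0 < η := by rw [hη]; linarith
  obtain ⟨C, hC, l₁, hmain⟩ := exists_lintegral_six_superpose_le_of_cubes hc hη0
  set l₀ : ℕ := max l₁ 3 with hl₀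
  set q : ℝ := 2 ^ (-(η / 6)) with hq
  have hq0 : 0 < q := by positivity
  have hq1 : q < 1 := Real.rpow_lt_one_of_one_lt_of_neg (by norm_num) (by linarith)
  set N : ℝ := ((Finset.Icc (-(4 * 2 ^ l₀) : ℤ) (4 * 2 ^ l₀)).card : ℝ) with hN
  set C' : ℝ := C * 6 ^ 4 * 16 with hC'
  have hC'0 : 0 ≤ C' := by positivity
  set G : ℝ := (1 - q)⁻¹ with hG
  have hG0 : 0 ≤ G := inv_nonneg.2 (by linarith)
  refine ⟨16 * (N * 2 + C' ^ (1 / 6 : ℝ) * G), by positivity, l₀, le_max_right _ _, ?_⟩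
  intro ψ m hψ X ν L hL hX Y hYm hY hYint μ hμ hsupp R hR hball β δ hδ hβ hβδ hβR
  set M : ℝ := μ.real univ with hM
  have hM0 : 0 ≤ M := measureReal_nonneg
  have hμM : μ univ = ENNReal.ofReal M := by rw [hM, ofReal_measureReal]
  set T : ℕ → Finset ℤ := fun l => Finset.Icc (-(4 * 2 ^ l) : ℤ) (4 * 2 ^ l) with hT
  set F : ℕ → (Fin 3 → ℝ) → ℂ := fun l =>
    superpose ψ X ν (T l) (fun φ => pieceCoeff (Y φ) L l) with hF
  -- the six moment bound for each piece
  have hpiece : ∀ l ∈ Finset.Ico l₀ L, ∫⁻ v, ‖F l v‖ₑ ∂μ ≤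
      ENNReal.ofReal ((C' * δ) ^ (1 / 6 : ℝ) * q ^ l * M) := by
    intro l hl
    rw [Finset.mem_Ico] at hl
    have h6 := hmain l ((le_max_left _ _).trans hl.1) ψ m hψ X ν s hs (hX.mono hl.2.le)
      (fun φ => pieceCoeff (Y φ) L l) 6
      (16 * β) (fun φ _ k hk => pieceCoeff_eq_zero_of_lt hk)
      (fun φ hφ => (sum_norm_sq_pieceCoeff_le _ (hYm φ hφ) (hY φ hφ) L l).trans
        (by linarith [hβ φ hφ]))
      (fun φ hφ u => norm_trigSum_pieceCoeff_le (hY φ hφ) u) μ hsupp _ (hball l hl.1)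
    have hle : C * 6 ^ 4 * (16 * β) * 2 ^ ((3 + η - 2 * s) * l) * (R * 2 ^ (-(t * l))) ≤
        C' * δ * M * (q ^ l) ^ 6 := by
      have e1 : (q ^ l) ^ 6 = (2 : ℝ) ^ (-(η * l)) := by
        rw [hq, ← pow_mul, ← Real.rpow_natCast, ← Real.rpow_mul (by norm_num)]
        congr 1; push_cast; ring
      have e2 : (2 : ℝ) ^ ((3 + η - 2 * s) * l) * 2 ^ (-(t * l)) = 2 ^ (-(η * l)) := by
        rw [← Real.rpow_add (by norm_num)]
        congr 1; rw [hη]; ring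
      rw [e1, ← e2]
      calc _ = C' * (β * R) * (2 ^ ((3 + η - 2 * s) * l) * 2 ^ (-(t * l))) := by rw [hC']; ring
        _ ≤ C' * (δ * M) * (2 ^ ((3 + η - 2 * s) * l) * 2 ^ (-(t * l))) := by gcongr
        _ = _ := by ring
    have hFm : AEMeasurable (fun v => ‖F l v‖ₑ) μ :=
      (continuous_superpose ψ X ν (T l) _).measurable.enorm.aemeasurable
    have h1 := lintegral_pow_six_le μ hFm
    rw [← ENNReal.pow_le_pow_left_iff (n := 6) (by norm_num)]
    refine h1.trans ((mul_le_mul_left h6 _).trans ?_)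
    by_cases hβ0 : 0 ≤ β
    · rw [hμM, ← ENNReal.ofReal_pow hM0, ← ENNReal.ofReal_mul (by positivity),
        ← ENNReal.ofReal_mul (by positivity), ← ENNReal.ofReal_pow (by positivity)]
      refine ENNReal.ofReal_le_ofReal ?_
      calc _ ≤ C' * δ * M * (q ^ l) ^ 6 * M ^ 5 := by gcongr
        _ = ((C' * δ) ^ (1 / 6 : ℝ)) ^ 6 * (q ^ l) ^ 6 * M ^ 6 := by
          rw [← Real.rpow_natCast ((C' * δ) ^ (1 / 6 : ℝ)), ← Real.rpow_mul (by positivity)]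
          norm_num
          ring
        _ = _ := by ring
    · have : C * 6 ^ 4 * (16 * β) * 2 ^ ((3 + η - 2 * s) * l) ≤ 0 := by
        have : C * 6 ^ 4 * (16 * β) * 2 ^ ((3 + η - 2 * s) * l) =
          C * 6 ^ 4 * 16 * 2 ^ ((3 + η - 2 * s) * l) * β := by ring
        rw [this]
        exact mul_nonpos_of_nonneg_of_nonpos (by positivity) (not_le.1 hβ0).le
      rw [ENNReal.ofReal_of_nonpos this]; simp
  -- pointwise domination
  have hpt : ∀ v, ∑ φ ∈ X, ν φ * (if coneLin ψ φ v ∈ Y φ then 1 else 0) ≤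
      16 * (N * (2 * δ) + ∑ l ∈ Finset.Ico l₀ L, ‖F l v‖) := by
    intro v
    have h1 : ∑ φ ∈ X, ν φ * (if coneLin ψ φ v ∈ Y φ then 1 else 0) ≤
        16 * ∑ φ ∈ X, ν φ * fejerMean (2 ^ L) (Y φ) (coneLin ψ φ v) := by
      rw [Finset.mul_sum]
      refine Finset.sum_le_sum fun φ hφ => ?_
      rw [mul_left_comm]
      refine mul_le_mul_of_nonneg_left ?_ (hX.nonneg φ hφ)
      split_ifs with h
      · obtain ⟨p, q, hpq, hu, hlen⟩ := hYint φ hφ _ h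
        have := le_fejerMean (D := 2 ^ L) (by positivity) (hY φ hφ) hpq hu (by exact_mod_cast hlen)
        linarith
      · have := fejerMean_nonneg (2 ^ L) (Y φ) (coneLin ψ φ v)
        linarith
    have h2 : ((∑ φ ∈ X, ν φ * fejerMean (2 ^ L) (Y φ) (coneLin ψ φ v) : ℝ) : ℂ) =
        superpose ψ X ν (T l₀) (fun φ => lowCoeff (Y φ) L l₀) v +
          ∑ l ∈ Finset.Ico l₀ L, F l v := by
      simp only [hF, superpose]
      rw [Finset.sum_comm, ← Finset.sum_add_distrib]
      push_cast
      refine Finset.sum_congr rfl fun φ hφ => ?_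
      rw [fejerMean_eq_sum_pieces (hY φ hφ) hL, mul_add, Finset.mul_sum]
    have h3 : ‖superpose ψ X ν (T l₀) (fun φ => lowCoeff (Y φ) L l₀) v‖ ≤ N * (2 * δ) := by
      refine (norm_superpose_le hX.nonneg (B := N * (2 * δ)) ?_ v).trans ?_
      · intro φ hφ u
        have hfin : volume (Y φ) ≠ ⊤ := ((measure_mono (hY φ hφ)).trans_lt (by simp)).ne
        refine (norm_trigSum_lowCoeff_le (T l₀) hfin L l₀ u).trans ?_
        have := (hβ φ hφ).trans hβδ
        gcongr
      · have : 0 ≤ N * (2 * δ) := by positivity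
        exact mul_le_of_le_one_right this hX.sum_le_one
    refine h1.trans ?_
    gcongr
    refine (le_abs_self _).trans ?_
    rw [← Real.norm_eq_abs, ← Complex.norm_real, h2]
    exact (norm_add_le _ _).trans (add_le_add h3 (norm_sum_le _ _))
  -- integration
  have hFi : ∀ l, Integrable (fun v => ‖F l v‖) μ := by
    intro l
    have hB : ∀ φ ∈ X, ∀ u, ‖trigSum (T l) (pieceCoeff (Y φ) L l) u‖ ≤ 6 :=
      fun φ hφ u => norm_trigSum_pieceCoeff_le (hY φ hφ) u
    refine Integrable.norm (Integrable.of_bound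
      (continuous_superpose ψ X ν (T l) _).aestronglyMeasurable (6 * ∑ φ ∈ X, ν φ) ?_)
    exact Filter.Eventually.of_forall fun v => norm_superpose_le hX.nonneg hB v
  have hpieceR : ∀ l ∈ Finset.Ico l₀ L, ∫ v, ‖F l v‖ ∂μ ≤
      (C' * δ) ^ (1 / 6 : ℝ) * q ^ l * M := by
    intro l hl
    rw [integral_norm_eq_lintegral_enorm
      (continuous_superpose ψ X ν (T l) _).aestronglyMeasurable]
    exact ENNReal.toReal_le_of_le_ofReal (by positivity) (hpiece l hl)
  have hms : ∀ φ ∈ X, MeasurableSet {v | coneLin ψ φ v ∈ Y φ} := fun φ hφ =>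
    (continuous_coneLin ψ φ).measurable (hYm φ hφ)
  have hind : ∀ φ ∈ X, μ.real {v | coneLin ψ φ v ∈ Y φ} =
      ∫ v, (if coneLin ψ φ v ∈ Y φ then (1 : ℝ) else 0) ∂μ := by
    intro φ hφ
    rw [← integral_indicator_one (hms φ hφ)]
    rfl
  have hindi : ∀ φ ∈ X, Integrable (fun v => if coneLin ψ φ v ∈ Y φ then (1 : ℝ) else 0) μ :=
    fun φ hφ => (integrable_const (1 : ℝ)).indicator (hms φ hφ)
  calc ∑ φ ∈ X, ν φ * μ.real {v | coneLin ψ φ v ∈ Y φ}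
      = ∫ v, ∑ φ ∈ X, ν φ * (if coneLin ψ φ v ∈ Y φ then 1 else 0) ∂μ := by
        rw [integral_finsetSum _ fun φ hφ => (hindi φ hφ).const_mul _]
        refine Finset.sum_congr rfl fun φ hφ => ?_
        rw [integral_const_mul, hind φ hφ]
    _ ≤ ∫ v, 16 * (N * (2 * δ) + ∑ l ∈ Finset.Ico l₀ L, ‖F l v‖) ∂μ := by
        refine integral_mono (integrable_finsetSum _ fun φ hφ => (hindi φ hφ).const_mul _) ?_ hpt
        exact ((integrable_const _).add (integrable_finsetSum _ fun l _ => hFi l)).const_mul _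
    _ = 16 * (N * (2 * δ) * M + ∑ l ∈ Finset.Ico l₀ L, ∫ v, ‖F l v‖ ∂μ) := by
        rw [integral_const_mul, integral_add (integrable_const _)
          (integrable_finsetSum _ fun l _ => hFi l), integral_const,
          integral_finsetSum _ fun l _ => hFi l, smul_eq_mul, mul_comm M]
    _ ≤ 16 * (N * (2 * δ) * M + (C' * δ) ^ (1 / 6 : ℝ) * G * M) := by
        gcongr
        calc _ ≤ ∑ l ∈ Finset.Ico l₀ L, (C' * δ) ^ (1 / 6 : ℝ) * q ^ l * M :=
              Finset.sum_le_sum hpieceR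
          _ = (C' * δ) ^ (1 / 6 : ℝ) * (∑ l ∈ Finset.Ico l₀ L, q ^ l) * M := by
              rw [Finset.mul_sum, Finset.sum_mul]
          _ ≤ _ := by
              gcongr
              rw [hG, ← tsum_geometric_of_lt_one hq0.le hq1]
              exact (summable_geometric_of_lt_one hq0.le hq1).sum_le_tsum _
                fun _ _ => by positivity
    _ ≤ _ := by
        have hd6 : 0 ≤ δ ^ (1 / 6 : ℝ) := by positivity
        have hc6 : 0 ≤ C' ^ (1 / 6 : ℝ) := by positivity
        rw [Real.mul_rpow hC'0 hδ]
        have hN0 : 0 ≤ N := by positivity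
        have : N * (2 * δ) + C' ^ (1 / 6 : ℝ) * δ ^ (1 / 6 : ℝ) * G ≤
            (N * 2 + C' ^ (1 / 6 : ℝ) * G) * (δ + δ ^ (1 / 6 : ℝ)) := by
          have h1 := mul_nonneg hN0 hd6
          have h2 := mul_nonneg (mul_nonneg hc6 hG0) hδ
          nlinarith
        nlinarith [mul_le_mul_of_nonneg_right this hM0]

end WeightedIncidence

section HeavySets

lemma floor_two_pow_mul_eq_iff (j : ℕ) (n : ℤ) (y : ℝ) :
    ⌊(2 : ℝ) ^ j * y⌋ = n ↔ y ∈ Ico ((n : ℝ) / 2 ^ j) ((n + 1) / 2 ^ j) := by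
  have h : (0 : ℝ) < 2 ^ j := by positivity
  rw [Int.floor_eq_iff, mem_Ico, div_le_iff₀' h, lt_div_iff₀' h]

lemma volume_floor_eq (j : ℕ) (n : ℤ) :
    volume {y : ℝ | ⌊(2 : ℝ) ^ j * y⌋ = n} = ENNReal.ofReal (1 / 2 ^ j) := by
  have : {y : ℝ | ⌊(2 : ℝ) ^ j * y⌋ = n} = Ico ((n : ℝ) / 2 ^ j) ((n + 1) / 2 ^ j) := by
    ext y; exact floor_two_pow_mul_eq_iff j n y
  rw [this, Real.volume_Ico]
  congr 1; ring

lemma measurable_floor_two_pow (j : ℕ) : Measurable fun y : ℝ => ⌊(2 : ℝ) ^ j * y⌋ :=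
  Int.measurable_floor.comp (measurable_const.mul measurable_id)

/-- The points with a dyadic interval of level between `k` and `J` around them whose `m`-mass
exceeds `τ` times its length. -/
def heavyLine (m : Measure ℝ) (k J : ℕ) (τ : ℝ) : Set ℝ :=
  {y | ∃ j, k ≤ j ∧ j ≤ J ∧
    ENNReal.ofReal (τ * (1 / 2 ^ j)) < m {z | ⌊(2 : ℝ) ^ j * z⌋ = ⌊(2 : ℝ) ^ j * y⌋}}

lemma measurableSet_heavyLine (m : Measure ℝ) (k J : ℕ) (τ : ℝ) :
    MeasurableSet (heavyLine m k J τ) := by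
  have : heavyLine m k J τ = ⋃ j, ⋃ (_ : k ≤ j ∧ j ≤ J), (fun y : ℝ => ⌊(2 : ℝ) ^ j * y⌋) ⁻¹'
      {n : ℤ | ENNReal.ofReal (τ * (1 / 2 ^ j)) < m {z | ⌊(2 : ℝ) ^ j * z⌋ = n}} := by
    ext y
    simp [heavyLine, and_assoc]
  rw [this]
  exact MeasurableSet.iUnion fun j => MeasurableSet.iUnion fun _ =>
    measurable_floor_two_pow j (MeasurableSet.of_discrete)

lemma ofReal_mul_volume_heavyLine_le (m : Measure ℝ) (k J : ℕ) {τ : ℝ} (hτ : 0 ≤ τ) :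
    ENNReal.ofReal τ * volume (heavyLine m k J τ) ≤ m univ := by
  set S : ℕ → Set ℝ := fun j =>
    {y | ENNReal.ofReal (τ * (1 / 2 ^ j)) < m {z | ⌊(2 : ℝ) ^ j * z⌋ = ⌊(2 : ℝ) ^ j * y⌋}} with hS
  set W : ℕ → Set ℝ := fun j => {y | k ≤ j ∧ y ∈ S j ∧ ∀ i, k ≤ i → i < j → y ∉ S i} with hW
  have hSdep : ∀ i j, i ≤ j → ∀ y y' : ℝ, ⌊(2 : ℝ) ^ j * y⌋ = ⌊(2 : ℝ) ^ j * y'⌋ →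
      (y ∈ S i ↔ y' ∈ S i) := by
    intro i j hij y y' h
    simp only [hS, Set.mem_ofPred_eq]
    rw [floor_two_pow_eq_of_le hij h]
  have hWdep : ∀ j, W j = (fun y : ℝ => ⌊(2 : ℝ) ^ j * y⌋) ⁻¹'
      ((fun y : ℝ => ⌊(2 : ℝ) ^ j * y⌋) '' W j) := by
    intro j
    refine Subset.antisymm (subset_preimage_image _ _) ?_
    rintro y ⟨y', ⟨h1, h2, h3⟩, hyy'⟩
    exact ⟨h1, (hSdep j j le_rfl _ _ hyy').1 h2, fun i hki hij hy =>
      h3 i hki hij ((hSdep i j hij.le _ _ hyy').2 hy)⟩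
  have hWm : ∀ j, MeasurableSet (W j) := by
    intro j
    rw [hWdep j]
    exact measurable_floor_two_pow j MeasurableSet.of_discrete
  have hWle : ∀ j, ENNReal.ofReal τ * volume (W j) ≤ m (W j) := by
    intro j
    set N := (fun y : ℝ => ⌊(2 : ℝ) ^ j * y⌋) '' W j with hN
    have hU : W j = ⋃ n ∈ N, {y : ℝ | ⌊(2 : ℝ) ^ j * y⌋ = n} := by
      rw [hWdep j]; ext y; simp [← hN]
    have hm : ∀ n ∈ N, MeasurableSet {y : ℝ | ⌊(2 : ℝ) ^ j * y⌋ = n} := fun n _ =>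
      measurable_floor_two_pow j (measurableSet_singleton n)
    have hd : N.PairwiseDisjoint fun n => {y : ℝ | ⌊(2 : ℝ) ^ j * y⌋ = n} := by
      intro n _ n' _ hnn'
      rw [Function.onFun, Set.disjoint_left]
      intro y hy hy'
      exact hnn' (hy.symm.trans hy')
    rw [hU, measure_biUnion N.to_countable hd hm, measure_biUnion N.to_countable hd hm,
      ← ENNReal.tsum_mul_left]
    refine ENNReal.tsum_le_tsum fun n => ?_
    obtain ⟨n, y, hy, rfl⟩ := n
    dsimp only
    rw [volume_floor_eq, ← ENNReal.ofReal_mul hτ]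
    exact hy.2.1.le
  have hWd : Pairwise (Function.onFun Disjoint W) := by
    intro i j hij
    rw [Function.onFun, Set.disjoint_left]
    rintro y ⟨h1, h2, h3⟩ ⟨h1', h2', h3'⟩
    rcases lt_or_gt_of_ne hij with h | h
    · exact h3' i h1 h h2
    · exact h3 j h1' h h2'
  have hsub : heavyLine m k J τ ⊆ ⋃ j, W j := by
    classical
    rintro y ⟨j, hkj, _, hj⟩
    have hex : ∃ j, k ≤ j ∧ y ∈ S j := ⟨j, hkj, hj⟩
    refine mem_iUnion.2 ⟨Nat.find hex, (Nat.find_spec hex).1, (Nat.find_spec hex).2, ?_⟩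
    exact fun i hki hi hyi => Nat.find_min hex hi ⟨hki, hyi⟩
  calc _ ≤ ENNReal.ofReal τ * volume (⋃ j, W j) := by gcongr
    _ = ∑' j, ENNReal.ofReal τ * volume (W j) := by
      rw [measure_iUnion hWd hWm, ENNReal.tsum_mul_left]
    _ ≤ ∑' j, m (W j) := ENNReal.tsum_le_tsum hWle
    _ = m (⋃ j, W j) := (measure_iUnion hWd hWm).symm
    _ ≤ m univ := measure_mono (subset_univ _)

lemma exists_Ico_subset_heavyLine {m : Measure ℝ} {k J : ℕ} {τ y : ℝ}
    (hy : y ∈ heavyLine m k J τ) :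
    ∃ p q, Ico p q ⊆ heavyLine m k J τ ∧ y ∈ Ico p q ∧ 1 / 2 ^ J ≤ q - p := by
  obtain ⟨j, hkj, hjJ, hj⟩ := hy
  refine ⟨(⌊(2 : ℝ) ^ j * y⌋ : ℝ) / 2 ^ j, (⌊(2 : ℝ) ^ j * y⌋ + 1) / 2 ^ j, ?_,
    (floor_two_pow_mul_eq_iff j _ y).1 rfl, ?_⟩
  · intro y' hy'
    rw [← floor_two_pow_mul_eq_iff] at hy'
    exact ⟨j, hkj, hjJ, by rwa [hy']⟩
  · rw [← sub_div, add_sub_cancel_left]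
    exact one_div_le_one_div_of_le (by positivity) (pow_le_pow_right₀ (by norm_num) hjJ)

lemma exists_near_of_mem_heavyLine {m : Measure ℝ} {k J : ℕ} {τ y : ℝ} {S : Set ℝ}
    (hS : m Sᶜ = 0) (hy : y ∈ heavyLine m k J τ) : ∃ z ∈ S, |z - y| ≤ 1 / 2 ^ k := by
  obtain ⟨j, hkj, hjJ, hj⟩ := hy
  have h0 : m ({z | ⌊(2 : ℝ) ^ j * z⌋ = ⌊(2 : ℝ) ^ j * y⌋} ∩ S) ≠ 0 := by
    rw [measure_inter_conull hS]
    exact (zero_le.trans_lt hj).ne'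
  obtain ⟨z, hz, hzS⟩ := nonempty_of_measure_ne_zero h0
  refine ⟨z, hzS, ?_⟩
  have h1 := (floor_two_pow_mul_eq_iff j _ z).1 hz
  have h2 := (floor_two_pow_mul_eq_iff j _ y).1 rfl
  have h3 : (1 : ℝ) / 2 ^ j ≤ 1 / 2 ^ k :=
    one_div_le_one_div_of_le (by positivity) (pow_le_pow_right₀ (by norm_num) hkj)
  rw [add_div] at h1 h2
  rw [abs_le]
  constructor <;> linarith [h1.1, h1.2, h2.1, h2.2]

/-- The points whose level-`k` cube carries, at some level between `k` and `J`, a dyadic slab in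
direction `p` around the point of mass exceeding `2 ^ (-a k)` times its width. -/
def heavySet (μ : Measure (Fin 3 → ℝ)) (p : (Fin 3 → ℝ) → ℝ) (a : ℝ) (k J : ℕ) :
    Set (Fin 3 → ℝ) :=
  {x | ∃ j, k ≤ j ∧ j ≤ J ∧ ENNReal.ofReal (2 ^ (-(a * k)) * (1 / 2 ^ j)) <
    μ {z | cubeCode k z = cubeCode k x ∧ ⌊(2 : ℝ) ^ j * p z⌋ = ⌊(2 : ℝ) ^ j * p x⌋}}

lemma mem_heavySet_iff {μ : Measure (Fin 3 → ℝ)} {p : (Fin 3 → ℝ) → ℝ} (hp : Measurable p)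
    {a : ℝ} {k J : ℕ} {x : Fin 3 → ℝ} {i : Fin 3 → ℤ} (hx : cubeCode k x = i) :
    x ∈ heavySet μ p a k J ↔
      p x ∈ heavyLine ((μ.restrict {z | cubeCode k z = i}).map p) k J (2 ^ (-(a * k))) := by
  unfold heavySet heavyLine
  simp only [Set.mem_ofPred_eq]
  refine exists_congr fun j => and_congr_right fun _ => and_congr_right fun _ => ?_
  have hm : MeasurableSet {z : ℝ | ⌊(2 : ℝ) ^ j * z⌋ = ⌊(2 : ℝ) ^ j * p x⌋} :=
    measurable_floor_two_pow j (measurableSet_singleton _)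
  rw [Measure.map_apply hp hm, Measure.restrict_apply (hp hm), hx]
  have : {z | cubeCode k z = i ∧ ⌊(2 : ℝ) ^ j * p z⌋ = ⌊(2 : ℝ) ^ j * p x⌋} =
      p ⁻¹' {z : ℝ | ⌊(2 : ℝ) ^ j * z⌋ = ⌊(2 : ℝ) ^ j * p x⌋} ∩ {z | cubeCode k z = i} := by
    ext z; simp [and_comm]
  rw [this]

lemma measurableSet_cubeCode_eq (k : ℕ) (i : Fin 3 → ℤ) :
    MeasurableSet {z : Fin 3 → ℝ | cubeCode k z = i} :=
  measurable_cubeCode k (measurableSet_singleton i)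

lemma measurableSet_heavySet (μ : Measure (Fin 3 → ℝ)) {p : (Fin 3 → ℝ) → ℝ} (hp : Measurable p)
    (a : ℝ) (k J : ℕ) : MeasurableSet (heavySet μ p a k J) := by
  have : heavySet μ p a k J = ⋃ i : Fin 3 → ℤ, ({z | cubeCode k z = i} ∩
      p ⁻¹' heavyLine ((μ.restrict {z | cubeCode k z = i}).map p) k J (2 ^ (-(a * k)))) := by
    ext x
    simp only [mem_iUnion, mem_inter_iff, Set.mem_ofPred_eq, mem_preimage, exists_eq_left']
    exact mem_heavySet_iff hp rfl
  rw [this]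
  exact MeasurableSet.iUnion fun i => (measurableSet_cubeCode_eq k i).inter
    (hp (measurableSet_heavyLine _ _ _ _))

end HeavySets

section HeavyCells

/-- The affine map taking the level-`k` dyadic cube with code `i` onto `[0, 1/8)³`. -/
def cellMap (k : ℕ) (i : Fin 3 → ℤ) (x : Fin 3 → ℝ) : Fin 3 → ℝ :=
  fun j => (2 ^ k * x j - i j) / 8

lemma measurable_cellMap (k : ℕ) (i : Fin 3 → ℤ) : Measurable (cellMap k i) := by
  unfold cellMap
  exact measurable_pi_lambda _ fun j =>
    ((measurable_const.mul (measurable_pi_apply j)).sub_const _).div_const _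

lemma cellMap_mem {k : ℕ} {i : Fin 3 → ℤ} {x : Fin 3 → ℝ} (hx : cubeCode k x = i) (j : Fin 3) :
    cellMap k i x j ∈ Ico (0 : ℝ) (1 / 8) := by
  have h := congrFun hx j
  simp only [cubeCode, Int.floor_eq_iff] at h
  unfold cellMap
  constructor <;> linarith [h.1, h.2]

lemma cubeCode_cellMap {k l : ℕ} (hl : 3 ≤ l) {i i' : Fin 3 → ℤ} {x : Fin 3 → ℝ}
    (h : cubeCode l (cellMap k i x) = i') :
    cubeCode (k + (l - 3)) x = fun j => i' j + 2 ^ (l - 3) * i j := by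
  obtain ⟨n, rfl⟩ := Nat.exists_eq_add_of_le hl
  ext j
  have h := congrFun h j
  simp only [cubeCode, cellMap, add_tsub_cancel_left] at h ⊢
  rw [← h, ← Int.floor_add_intCast]
  congr 1
  push_cast
  rw [pow_add, pow_add]
  ring

lemma coneLin_cellMap (ψ : ℝ → ℝ) (φ : ℝ) (k : ℕ) (i : Fin 3 → ℤ) (x : Fin 3 → ℝ) :
    coneLin ψ φ (cellMap k i x) = (2 ^ k * coneLin ψ φ x - coneLin ψ φ fun j => i j) / 8 := by
  unfold coneLin cellMap
  ring

lemma volume_preimage_affine {r : ℝ} (hr : 0 < r) (b : ℝ) (S : Set ℝ) :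
    volume ((fun u => r * u + b) ⁻¹' S) = ENNReal.ofReal r⁻¹ * volume S := by
  have e : (fun u => r * u + b) ⁻¹' S = (fun u => r * u) ⁻¹' ((fun u => u + b) ⁻¹' S) := rfl
  rw [e, Real.volume_preimage_mul_left hr.ne', measure_preimage_add_right,
    abs_of_pos (inv_pos.2 hr)]

/-- The incidence bound of `exists_weighted_measure_preimage_le` inside one dyadic cube. -/
lemma exists_weighted_measure_heavySet_inter_le {c t s ε C : ℝ} (hc : 0 < c)
    (hst : 3 - 2 * s < t) (ht : 0 ≤ t) (hs : s ≤ 1) (hC : 0 ≤ C) : ∃ K : ℝ, 0 ≤ K ∧ ∃ l₀ : ℕ,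
      ∀ ψ m, NormCurve c ψ m → ∀ μ : Measure (Fin 3 → ℝ), IsFiniteMeasure μ →
      (∀ n i, μ {x | cubeCode n x = i} ≤ ENNReal.ofReal (C * 2 ^ (-(t * n)))) →
      ∀ k J X ν, FrostmanWeights X ν s (J + l₀) → ∀ i,
      ∑ φ ∈ X, ν φ * μ.real (heavySet μ (coneLin ψ φ) (t - 1 - ε) k J ∩ {x | cubeCode k x = i}) ≤
        K * (C * 2 ^ (3 * t) * 2 ^ (-(ε * k)) +
          (C * 2 ^ (3 * t) * 2 ^ (-(ε * k))) ^ (1 / 6 : ℝ)) * μ.real {x | cubeCode k x = i} := by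
  obtain ⟨K, hK, l₀, hl₀, hmain⟩ := exists_weighted_measure_preimage_le hc hst hs
  refine ⟨K, hK, l₀ + 1, ?_⟩
  intro ψ m hψ μ hμ hball k J X ν hX i
  set a : ℝ := t - 1 - ε with ha
  set Q : Set (Fin 3 → ℝ) := {x | cubeCode k x = i} with hQ
  have hQm : MeasurableSet Q := measurableSet_cubeCode_eq k i
  set b : ℝ → ℝ := fun φ => coneLin ψ φ fun j => i j with hb
  set Z : ℝ → Set ℝ := fun φ => heavyLine ((μ.restrict Q).map (coneLin ψ φ)) k J (2 ^ (-(a * k)))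
    with hZ
  have hr : (0 : ℝ) < 8 / 2 ^ k := by positivity
  set Y : ℝ → Set ℝ := fun φ => (fun u => 8 / 2 ^ k * u + b φ / 2 ^ k) ⁻¹' Z φ with hY
  set μ' : Measure (Fin 3 → ℝ) := (μ.restrict Q).map (cellMap k i) with hμ'
  have hcell := measurable_cellMap k i
  have hfin : IsFiniteMeasure μ' := by rw [hμ']; infer_instance
  have huniv : μ'.real univ = μ.real Q := by
    rw [hμ', measureReal_def, Measure.map_apply hcell MeasurableSet.univ, preimage_univ,
      Measure.restrict_apply_univ, measureReal_def]
  have hcone : ∀ φ, Measurable (coneLin ψ φ) := fun φ => (continuous_coneLin ψ φ).measurable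
  have h2k : (0 : ℝ) < 2 ^ k := by positivity
  have hYm : ∀ φ, MeasurableSet (Y φ) := fun φ =>
    ((measurable_const_mul (8 / 2 ^ k : ℝ)).add_const (b φ / 2 ^ k))
      (measurableSet_heavyLine _ _ _ _)
  have hpre : ∀ φ x, coneLin ψ φ (cellMap k i x) ∈ Y φ ↔ coneLin ψ φ x ∈ Z φ := by
    intro φ x
    rw [hY]
    simp only [mem_preimage]
    rw [coneLin_cellMap]
    have : 8 / 2 ^ k * ((2 ^ k * coneLin ψ φ x - coneLin ψ φ fun j => i j) / 8) + b φ / 2 ^ k =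
        coneLin ψ φ x := by
      rw [hb]; field_simp; ring
    rw [this]
  have hmass : ∀ φ, μ'.real {v | coneLin ψ φ v ∈ Y φ} =
      μ.real (heavySet μ (coneLin ψ φ) a k J ∩ Q) := by
    intro φ
    have hm : MeasurableSet {v | coneLin ψ φ v ∈ Y φ} := by
      exact hcone φ (hYm φ)
    rw [hμ', measureReal_def, Measure.map_apply hcell hm, Measure.restrict_apply (hcell hm),
      measureReal_def]
    congr 2
    ext x
    simp only [mem_inter_iff, mem_preimage, Set.mem_ofPred_eq]
    refine and_congr_left fun hx => ?_
    rw [hpre, mem_heavySet_iff (hcone φ) hx]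
  simp_rw [← hmass, ← huniv]
  have h2t : (0 : ℝ) < 2 ^ (3 * t) := by positivity
  set R : ℝ := C * 2 ^ (3 * t) * 2 ^ (-(t * k)) with hR
  have hR0 : 0 ≤ R := by positivity
  refine hmain ψ m hψ X ν (J + (l₀ + 1)) (by omega) hX Y ?_ ?_ ?_ μ' hfin ?_ R hR0 ?_
    (2 ^ k / 8 * (2 ^ (a * k) * μ.real Q)) _ (by positivity) ?_ ?_ ?_
  · intro φ _
    exact hYm φ
  · -- the heavy sets lie in a fixed period
    intro φ hφ u hu
    have hφ01 := hX.mem φ hφ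
    have hψφ := abs_le.1 (hψ.abs_le φ ⟨hφ01.1, hφ01.2.le⟩)
    have hw : ∀ x ∈ Q, -(1 / 8) < (2 ^ k * coneLin ψ φ x - b φ) / 8 ∧
        (2 ^ k * coneLin ψ φ x - b φ) / 8 < 3 / 8 := by
      intro x hx
      have h0 := cellMap_mem (i := i) hx 0
      have h1 := cellMap_mem (i := i) hx 1
      have h2 := cellMap_mem (i := i) hx 2
      rw [hb, ← coneLin_cellMap]
      set w := cellMap k i x
      unfold coneLin
      have g1 : 0 ≤ φ * w 1 := mul_nonneg hφ01.1 h1.1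
      have g2 : φ * w 1 < 1 / 8 := by nlinarith [hφ01.1, hφ01.2, h1.1, h1.2]
      have g3 : ψ φ * w 2 < 1 / 8 := by nlinarith [h2.1, h2.2, hψφ.1, hψφ.2]
      have g4 : -(1 / 8) < ψ φ * w 2 := by nlinarith [h2.1, h2.2, hψφ.1, hψφ.2]
      constructor <;> linarith [h0.1, h0.2]
    have hnull : ((μ.restrict Q).map (coneLin ψ φ))
        {y | -(1 / 8) < (2 ^ k * y - b φ) / 8 ∧ (2 ^ k * y - b φ) / 8 < 3 / 8}ᶜ = 0 := by
      have hop : MeasurableSet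
          {y | -(1 / 8) < (2 ^ k * y - b φ) / 8 ∧ (2 ^ k * y - b φ) / 8 < 3 / 8} :=
        ((isOpen_Ioo (a := (-(1 / 8) : ℝ)) (b := 3 / 8)).preimage
          (f := fun y : ℝ => (2 ^ k * y - b φ) / 8) (by fun_prop)).measurableSet
      refine (ae_map_iff (hcone φ).aemeasurable hop).2 ?_
      filter_upwards [ae_restrict_mem hQm] with x hx using hw x hx
    obtain ⟨z, hzS, hz⟩ := exists_near_of_mem_heavyLine hnull hu
    have hz' : |2 ^ k * (z - (8 / 2 ^ k * u + b φ / 2 ^ k))| ≤ 1 := by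
      rw [abs_mul, abs_of_pos h2k]
      calc _ ≤ (2 : ℝ) ^ k * (1 / 2 ^ k) := by gcongr
        _ = 1 := by field_simp
    have e2 : 2 ^ k * (z - (8 / 2 ^ k * u + b φ / 2 ^ k)) =
        8 * ((2 ^ k * z - b φ) / 8 - u) := by
      field_simp
      ring
    rw [e2, abs_le] at hz'
    constructor <;> linarith [hz'.1, hz'.2, hzS.1, hzS.2]
  · intro φ _ u hu
    obtain ⟨p, q, hpq, hupq, hlen⟩ := exists_Ico_subset_heavyLine hu
    have hiff : ∀ u', u' ∈ Ico ((p - b φ / 2 ^ k) / (8 / 2 ^ k)) ((q - b φ / 2 ^ k) / (8 / 2 ^ k)) ↔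
        8 / 2 ^ k * u' + b φ / 2 ^ k ∈ Ico p q := by
      intro u'
      rw [mem_Ico, mem_Ico, div_le_iff₀' hr, lt_div_iff₀' hr, sub_le_iff_le_add, lt_sub_iff_add_lt]
    refine ⟨_, _, fun u' hu' => hpq ((hiff u').1 hu'), (hiff u).2 hupq, ?_⟩
    rw [← sub_div, sub_sub_sub_cancel_right, le_div_iff₀ hr]
    refine le_trans ?_ hlen
    rw [div_mul_div_comm, div_le_div_iff₀ (by positivity) (by positivity)]
    have h1 : (1 : ℝ) ≤ 2 ^ k := one_le_pow₀ (by norm_num)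
    have h2 : (1 : ℝ) ≤ 2 ^ l₀ := one_le_pow₀ (by norm_num)
    have h3 : (1 : ℝ) ≤ 2 ^ l₀ * 2 ^ k := one_le_mul_of_one_le_of_one_le h2 h1
    rw [pow_add, pow_succ]
    have : (0 : ℝ) < 2 ^ J := by positivity
    nlinarith
  · rw [hμ', ae_map_iff hcell.aemeasurable]
    · filter_upwards [ae_restrict_mem hQm] with x hx j
      have := cellMap_mem hx j
      exact ⟨this.1, by linarith [this.2]⟩
    · rw [Set.ofPred_forall]
      exact MeasurableSet.iInter fun j => measurable_pi_apply j measurableSet_Ico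
  · intro l hl i'
    have hl3 : 3 ≤ l := hl₀.trans hl
    rw [hμ', Measure.map_apply hcell (measurableSet_cubeCode_eq l i'),
      Measure.restrict_apply (hcell (measurableSet_cubeCode_eq l i'))]
    refine (measure_mono (t := {x | cubeCode (k + (l - 3)) x = fun j => i' j + 2 ^ (l - 3) * i j})
      fun x hx => cubeCode_cellMap hl3 hx.1).trans ((hball _ _).trans (le_of_eq ?_))
    rw [hR]
    congr 1
    rw [mul_assoc C, mul_assoc C, ← Real.rpow_add (by norm_num), ← Real.rpow_add (by norm_num)]
    congr 2
    push_cast [Nat.cast_sub hl3]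
    ring
  · intro φ _
    have h1 := ofReal_mul_volume_heavyLine_le ((μ.restrict Q).map (coneLin ψ φ)) k J
      (τ := 2 ^ (-(a * k))) (by positivity)
    rw [Measure.map_apply (hcone φ) MeasurableSet.univ, preimage_univ,
      Measure.restrict_apply_univ] at h1
    have h2 := ENNReal.toReal_mono (measure_ne_top μ Q) h1
    rw [ENNReal.toReal_mul, ENNReal.toReal_ofReal (by positivity)] at h2
    rw [measureReal_def, hY]
    simp only
    rw [volume_preimage_affine hr, ENNReal.toReal_mul, ENNReal.toReal_ofReal (by positivity),
      inv_div]
    gcongr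
    change _ * (volume (Z φ)).toReal ≤ _ at h2
    rwa [Real.rpow_neg (by norm_num), inv_mul_le_iff₀ (by positivity)] at h2
  · have hQle : μ.real Q ≤ C * 2 ^ (-(t * k)) :=
      ENNReal.toReal_le_of_le_ofReal (by positivity) (hball k i)
    have e : (2 : ℝ) ^ k * (2 ^ (a * k) * 2 ^ (-(t * k))) = 2 ^ (-(ε * k)) := by
      rw [← Real.rpow_natCast, ← Real.rpow_add (by norm_num), ← Real.rpow_add (by norm_num), ha]
      congr 1; ring
    have h3 : (1 : ℝ) ≤ 2 ^ (3 * t) := Real.one_le_rpow (by norm_num) (by positivity)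
    have hx0 : 0 ≤ C * (2 : ℝ) ^ (-(ε * k)) := by positivity
    calc 2 ^ k / 8 * (2 ^ (a * k) * μ.real Q) ≤ 2 ^ k / 8 * (2 ^ (a * k) * (C * 2 ^ (-(t * k)))) := by
          gcongr
      _ = C * 2 ^ (-(ε * k)) / 8 := by rw [← e]; ring
      _ ≤ _ := by nlinarith
  · have e : (2 : ℝ) ^ k * (2 ^ (a * k) * 2 ^ (-(t * k))) = 2 ^ (-(ε * k)) := by
      rw [← Real.rpow_natCast, ← Real.rpow_add (by norm_num), ← Real.rpow_add (by norm_num), ha]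
      congr 1; ring
    have hx0 : 0 ≤ C * (2 : ℝ) ^ (3 * t) * 2 ^ (-(ε * k)) * μ.real Q := by positivity
    rw [huniv]
    calc _ = C * 2 ^ (3 * t) * 2 ^ (-(ε * k)) * μ.real Q / 8 := by rw [← e, hR]; ring
      _ ≤ _ := by linarith

lemma measure_eq_tsum_cubes (μ : Measure (Fin 3 → ℝ)) (k : ℕ) {S : Set (Fin 3 → ℝ)}
    (hS : MeasurableSet S) : μ S = ∑' i, μ (S ∩ {x | cubeCode k x = i}) := by
  rw [← measure_iUnion]
  · congr 1
    ext x
    simp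
  · intro i i' hii'
    rw [Function.onFun, Set.disjoint_left]
    rintro x ⟨_, hx⟩ ⟨_, hx'⟩
    exact hii' (hx.symm.trans hx')
  · exact fun i => hS.inter (measurableSet_cubeCode_eq k i)

/-- The average mass of the heavy sets of level `k` decays exponentially in `k`, uniformly over
Frostman families of directions. -/
lemma exists_weighted_measure_heavySet_le {c t s ε C : ℝ} (hc : 0 < c) (hst : 3 - 2 * s < t)
    (ht : 0 ≤ t) (hs : s ≤ 1) (hC : 0 ≤ C) (hε : 0 ≤ ε) : ∃ K : ℝ, 0 ≤ K ∧ ∃ l₀ : ℕ,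
      ∀ ψ m, NormCurve c ψ m → ∀ μ : Measure (Fin 3 → ℝ), IsFiniteMeasure μ →
      (∀ n i, μ {x | cubeCode n x = i} ≤ ENNReal.ofReal (C * 2 ^ (-(t * n)))) →
      ∀ k J X ν, FrostmanWeights X ν s (J + l₀) →
      ∑ φ ∈ X, ENNReal.ofReal (ν φ) * μ (heavySet μ (coneLin ψ φ) (t - 1 - ε) k J) ≤
        ENNReal.ofReal (K * 2 ^ (-(ε / 6 * k))) * μ univ := by
  obtain ⟨K, hK, l₀, hmain⟩ :=
    exists_weighted_measure_heavySet_inter_le (ε := ε) hc hst ht hs hC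
  set B : ℝ := C * 2 ^ (3 * t) with hB
  have hB0 : 0 ≤ B := by positivity
  refine ⟨K * (B + B ^ (1 / 6 : ℝ)), by positivity, l₀, ?_⟩
  intro ψ m hψ μ hμ hball k J X ν hX
  have hm : ∀ φ, MeasurableSet (heavySet μ (coneLin ψ φ) (t - 1 - ε) k J) := fun φ =>
    measurableSet_heavySet μ (continuous_coneLin ψ φ).measurable _ _ _
  have hcell : ∀ i, ∑ φ ∈ X, ENNReal.ofReal (ν φ) *
      μ (heavySet μ (coneLin ψ φ) (t - 1 - ε) k J ∩ {x | cubeCode k x = i}) ≤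
      ENNReal.ofReal (K * (B + B ^ (1 / 6 : ℝ)) * 2 ^ (-(ε / 6 * k))) *
        μ (univ ∩ {x | cubeCode k x = i}) := by
    intro i
    have h := hmain ψ m hψ μ hμ hball k J X ν hX i
    rw [univ_inter, ← ofReal_measureReal (μ := μ) (s := {x | cubeCode k x = i}),
      ← ENNReal.ofReal_mul (by positivity)]
    have e : ∀ φ ∈ X, ENNReal.ofReal (ν φ) *
        μ (heavySet μ (coneLin ψ φ) (t - 1 - ε) k J ∩ {x | cubeCode k x = i}) =
        ENNReal.ofReal (ν φ *
          μ.real (heavySet μ (coneLin ψ φ) (t - 1 - ε) k J ∩ {x | cubeCode k x = i})) := by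
      intro φ hφ
      rw [ENNReal.ofReal_mul (hX.nonneg φ hφ), ofReal_measureReal]
    rw [Finset.sum_congr rfl e, ← ENNReal.ofReal_sum_of_nonneg fun φ hφ =>
      mul_nonneg (hX.nonneg φ hφ) measureReal_nonneg]
    refine ENNReal.ofReal_le_ofReal (h.trans ?_)
    rw [mul_assoc K (B + _)]
    gcongr
    have hpos : (0 : ℝ) < 2 ^ (-(ε * k)) := by positivity
    have e1 : ((2 : ℝ) ^ (-(ε * k))) ^ (1 / 6 : ℝ) = 2 ^ (-(ε / 6 * k)) := by
      rw [← Real.rpow_mul (by norm_num)]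
      congr 1; ring
    have e2 : (2 : ℝ) ^ (-(ε * k)) ≤ 2 ^ (-(ε / 6 * k)) := by
      refine Real.rpow_le_rpow_of_exponent_le (by norm_num) ?_
      have : 0 ≤ ε * k := by positivity
      linarith
    rw [Real.mul_rpow hB0 hpos.le, e1, add_mul]
    gcongr
  rw [measure_eq_tsum_cubes μ k MeasurableSet.univ, ← ENNReal.tsum_mul_left]
  refine le_trans (le_of_eq ?_) (ENNReal.tsum_le_tsum hcell)
  rw [Summable.tsum_finsetSum fun _ _ => ENNReal.summable]
  refine Finset.sum_congr rfl fun φ _ => ?_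
  rw [ENNReal.tsum_mul_left, ← measure_eq_tsum_cubes μ k (hm φ)]

end HeavyCells

section DyadicContent

variable {α ι : Type*}

/-- The weight of a cell of level `n` in dimension `s`. -/
def cellWeight (s : ℝ) (n : ℕ) : ℝ≥0∞ := ENNReal.ofReal (2 ^ (-(s * n)))

/-- The total weight of a system of cells. -/
def systemWeight (s : ℝ) (U : Set (ℕ × ι)) : ℝ≥0∞ := ∑' c, U.indicator (fun c => cellWeight s c.1) c

/-- The union of the cells of a system. -/
def systemUnion (code : ℕ → α → ι) (U : Set (ℕ × ι)) : Set α := {x | ∃ n, (n, code n x) ∈ U}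

/-- The `s`-dimensional content associated with the cells `{x | code n x = i}`. -/
def cellContent (code : ℕ → α → ι) (s : ℝ) (A : Set α) : ℝ≥0∞ :=
  ⨅ (U : Set (ℕ × ι)) (_ : A ⊆ systemUnion code U), systemWeight s U

/-- Cells of a common level are unions of cells of the next level. -/
def RefiningCode (code : ℕ → α → ι) : Prop :=
  ∀ n x y, code (n + 1) x = code (n + 1) y → code n x = code n y

variable {code : ℕ → α → ι} {s : ℝ}

lemma RefiningCode.eq_of_le (h : RefiningCode code) {k l : ℕ} (hkl : k ≤ l) {x y : α}
    (hxy : code l x = code l y) : code k x = code k y := by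
  induction l, hkl using Nat.le_induction with
  | base => exact hxy
  | succ n _ ih => exact ih (h n x y hxy)

lemma cellContent_le_systemWeight {A : Set α} {U : Set (ℕ × ι)} (h : A ⊆ systemUnion code U) :
    cellContent code s A ≤ systemWeight s U := iInf₂_le U h

lemma exists_system_lt {A : Set α} {r : ℝ≥0∞} (h : cellContent code s A < r) :
    ∃ U : Set (ℕ × ι), A ⊆ systemUnion code U ∧ systemWeight s U < r := by
  simpa [cellContent, iInf_lt_iff] using h

lemma cellContent_mono {A B : Set α} (h : A ⊆ B) : cellContent code s A ≤ cellContent code s B :=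
  le_iInf₂ fun _ hU => cellContent_le_systemWeight (h.trans hU)

lemma cellContent_empty : cellContent code s (∅ : Set α) = 0 := by
  refine le_antisymm ((cellContent_le_systemWeight (U := ∅) (empty_subset _)).trans ?_) zero_le
  simp [systemWeight]

lemma systemWeight_singleton (c : ℕ × ι) : systemWeight s {c} = cellWeight s c.1 := by
  classical
  unfold systemWeight
  rw [tsum_eq_single c]
  · simp
  · intro b hb
    simp [hb]

lemma cellContent_le_cellWeight {A : Set α} {n : ℕ} {i : ι} (h : A ⊆ {x | code n x = i}) :
    cellContent code s A ≤ cellWeight s n := by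
  rw [← systemWeight_singleton (s := s) (n, i)]
  refine cellContent_le_systemWeight fun x hx => ⟨n, ?_⟩
  rw [h hx]
  rfl

lemma systemWeight_iUnion_le {β : Type*} (U : β → Set (ℕ × ι)) :
    systemWeight s (⋃ b, U b) ≤ ∑' b, systemWeight s (U b) := by
  unfold systemWeight
  rw [ENNReal.tsum_comm]
  refine ENNReal.tsum_le_tsum fun c => ?_
  by_cases hc : c ∈ ⋃ b, U b
  · obtain ⟨b, hb⟩ := mem_iUnion.1 hc
    rw [indicator_of_mem hc]
    refine le_trans ?_ (ENNReal.le_tsum b)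
    rw [indicator_of_mem hb]
  · rw [indicator_of_notMem hc]; exact zero_le

lemma cellContent_iUnion_le {β : Type*} [Countable β] (A : β → Set α) :
    cellContent code s (⋃ b, A b) ≤ ∑' b, cellContent code s (A b) := by
  refine ENNReal.le_of_forall_pos_le_add fun ε hε hfin => ?_
  obtain ⟨ε', hε', hsum⟩ := ENNReal.exists_pos_sum_of_countable
    (ENNReal.coe_pos.2 hε).ne' β
  have hne : ∀ b, cellContent code s (A b) ≠ ⊤ := fun b =>
    ((ENNReal.le_tsum b).trans_lt hfin).ne
  choose U hU hUw using fun b => exists_system_lt (code := code) (s := s) (A := A b)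
    (ENNReal.lt_add_right (hne b) (ENNReal.coe_pos.2 (hε' b)).ne')
  calc _ ≤ systemWeight s (⋃ b, U b) := by
        refine cellContent_le_systemWeight (iUnion_subset fun b x hx => ?_)
        obtain ⟨n, hn⟩ := hU b hx
        exact ⟨n, mem_iUnion.2 ⟨b, hn⟩⟩
    _ ≤ ∑' b, systemWeight s (U b) := systemWeight_iUnion_le U
    _ ≤ ∑' b, (cellContent code s (A b) + ε' b) := ENNReal.tsum_le_tsum fun b => (hUw b).le
    _ ≤ _ := by
        rw [ENNReal.tsum_add]
        gcongr

lemma cellContent_biUnion_finset_le {β : Type*} (F : Finset β) (A : β → Set α) :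
    cellContent code s (⋃ b ∈ F, A b) ≤ ∑ b ∈ F, cellContent code s (A b) := by
  have e : (⋃ b ∈ F, A b) = ⋃ b : F, A b := by ext; simp
  rw [e]
  refine (cellContent_iUnion_le _).trans ?_
  rw [tsum_fintype, Finset.sum_coe_sort F fun b => cellContent code s (A b)]

variable (code) in
/-- `c` is contained in a cell of smaller level of the system `V`. -/
def BelowSystem (V : Set (ℕ × ι)) (c : ℕ × ι) : Prop :=
  ∃ d ∈ V, d.1 < c.1 ∧ ∀ x, code c.1 x = c.2 → code d.1 x = d.2

variable (code) in
/-- The cells of `U ∪ V` that are not contained in larger cells of the other system. -/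
def outerCells (U V : Set (ℕ × ι)) : Set (ℕ × ι) :=
  {c | (c ∈ U ∧ ¬ BelowSystem code V c) ∨ (c ∈ V ∧ ¬ BelowSystem code U c)}

variable (code) in
/-- The cells of `U ∪ V` that are contained in cells of the other system. -/
def innerCells (U V : Set (ℕ × ι)) : Set (ℕ × ι) :=
  {c | (c ∈ U ∧ c ∈ V) ∨ (c ∈ U ∧ BelowSystem code V c) ∨ (c ∈ V ∧ BelowSystem code U c)}

lemma systemWeight_outerCells_add_innerCells_le (U V : Set (ℕ × ι)) :
    systemWeight s (outerCells code U V) + systemWeight s (innerCells code U V) ≤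
      systemWeight s U + systemWeight s V := by
  classical
  unfold systemWeight
  rw [← ENNReal.tsum_add, ← ENNReal.tsum_add]
  refine ENNReal.tsum_le_tsum fun c => ?_
  simp only [indicator_apply, outerCells, innerCells, Set.mem_ofPred_eq]
  by_cases hU : c ∈ U <;> by_cases hV : c ∈ V <;>
    by_cases hU' : BelowSystem code U c <;> by_cases hV' : BelowSystem code V c <;>
    simp [hU, hV, hU', hV']

lemma exists_outerCells_of_mem {U V : Set (ℕ × ι)} {x : α} {n : ℕ} (h : (n, code n x) ∈ U ∪ V) :
    ∃ m ≤ n, (m, code m x) ∈ outerCells code U V := by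
  classical
  have hex : ∃ m, (m, code m x) ∈ U ∪ V := ⟨n, h⟩
  refine ⟨Nat.find hex, Nat.find_min' hex h, ?_⟩
  have hnot : ∀ W ⊆ U ∪ V, ¬ BelowSystem code W (Nat.find hex, code (Nat.find hex) x) := by
    rintro W hW ⟨d, hd, hlt, hsub⟩
    refine Nat.find_min hex hlt (hW ?_)
    rw [hsub x rfl]
    exact hd
  rcases Nat.find_spec hex with h | h
  · exact Or.inl ⟨h, hnot V subset_union_right⟩
  · exact Or.inr ⟨h, hnot U subset_union_left⟩

lemma inter_subset_systemUnion_innerCells (hcode : RefiningCode code) (U V : Set (ℕ × ι)) :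
    systemUnion code U ∩ systemUnion code V ⊆ systemUnion code (innerCells code U V) := by
  rintro x ⟨⟨n, hn⟩, ⟨m, hm⟩⟩
  rcases lt_trichotomy n m with h | rfl | h
  · exact ⟨m, Or.inr (Or.inr ⟨hm, _, hn, h, fun y hy => hcode.eq_of_le h.le hy⟩)⟩
  · exact ⟨n, Or.inl ⟨hn, hm⟩⟩
  · exact ⟨n, Or.inr (Or.inl ⟨hn, _, hm, h, fun y hy => hcode.eq_of_le h.le hy⟩)⟩

/-- The content is continuous along increasing unions of arbitrary sets. -/
lemma cellContent_iUnion_of_monotone (hcode : RefiningCode code) {A : ℕ → Set α}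
    (hA : Monotone A) : cellContent code s (⋃ n, A n) ≤ ⨆ n, cellContent code s (A n) := by
  refine ENNReal.le_of_forall_pos_le_add fun ε hε hfin => ?_
  obtain ⟨ε', hε', hsum⟩ := ENNReal.exists_pos_sum_of_countable
    (ENNReal.coe_pos.2 hε).ne' ℕ
  have hne : ∀ n, cellContent code s (A n) ≠ ⊤ := fun n =>
    ((le_iSup (fun n => cellContent code s (A n)) n).trans_lt hfin).ne
  choose U hU hUw using fun n => exists_system_lt (code := code) (s := s) (A := A n)
    (ENNReal.lt_add_right (hne n) (ENNReal.coe_pos.2 (hε' n)).ne')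
  obtain ⟨W, hW0, hWs⟩ : ∃ W : ℕ → Set (ℕ × ι), W 0 = U 0 ∧
      ∀ n, W (n + 1) = outerCells code (W n) (U (n + 1)) :=
    ⟨fun n => Nat.rec (U 0) (fun n V => outerCells code V (U (n + 1))) n, rfl, fun _ => rfl⟩
  -- the systems `W n` cover `A n`, with cells around each point growing with `n`
  have hgrow : ∀ n x k, (k, code k x) ∈ W n → ∃ m ≤ k, (m, code m x) ∈ W (n + 1) := by
    intro n x k h
    rw [hWs]
    exact exists_outerCells_of_mem (Or.inl h)
  have hcov : ∀ n, A n ⊆ systemUnion code (W n) := by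
    intro n
    cases n with
    | zero => rw [hW0]; exact hU 0
    | succ n =>
      intro x hx
      obtain ⟨k, hk⟩ := hU (n + 1) hx
      rw [hWs]
      obtain ⟨m, -, hm⟩ := exists_outerCells_of_mem (U := W n) (Or.inr hk)
      exact ⟨m, hm⟩
  have hwt : ∀ n, systemWeight s (W n) ≤
      cellContent code s (A n) + ∑ k ∈ Finset.range (n + 1), (ε' k : ℝ≥0∞) := by
    intro n
    induction n with
    | zero => simpa [hW0] using (hUw 0).le
    | succ n ih =>
      have h1 : cellContent code s (A n) ≤ systemWeight s (innerCells code (W n) (U (n + 1))) :=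
        cellContent_le_systemWeight (Subset.trans (subset_inter (hcov n)
          ((hA n.le_succ).trans (hU _))) (inter_subset_systemUnion_innerCells hcode _ _))
      have h2 := systemWeight_outerCells_add_innerCells_le (code := code) (s := s) (W n) (U (n + 1))
      rw [← hWs] at h2
      refine (ENNReal.add_le_add_iff_right (hne n)).1 ?_
      calc systemWeight s (W (n + 1)) + cellContent code s (A n) ≤ _ :=
            (by gcongr : _ ≤ systemWeight s (W (n + 1)) +
              systemWeight s (innerCells code (W n) (U (n + 1)))).trans h2
        _ ≤ (cellContent code s (A n) + ∑ k ∈ Finset.range (n + 1), (ε' k : ℝ≥0∞)) +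
            (cellContent code s (A (n + 1)) + ε' (n + 1)) := add_le_add ih (hUw _).le
        _ = _ := by rw [Finset.sum_range_succ _ (n + 1)]; ring
  set T : ℝ≥0∞ := (⨆ n, cellContent code s (A n)) + ε with hT
  have hwtT : ∀ n, systemWeight s (W n) ≤ T := fun n => (hwt n).trans
    (add_le_add (le_iSup (fun n => cellContent code s (A n)) n)
      ((ENNReal.sum_le_tsum _).trans hsum.le))
  set V : Set (ℕ × ι) := {c | ∃ N, ∀ n ≥ N, c ∈ W n} with hV
  have hVcov : (⋃ n, A n) ⊆ systemUnion code V := by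
    classical
    intro x hx
    obtain ⟨n, hn⟩ := mem_iUnion.1 hx
    have hex : ∃ k, ∃ n, (k, code k x) ∈ W n := by
      obtain ⟨k, hk⟩ := hcov n hn
      exact ⟨k, n, hk⟩
    obtain ⟨k, ⟨N, hN⟩, hmin⟩ : ∃ k, (∃ n, (k, code k x) ∈ W n) ∧
        ∀ m, (∃ n, (m, code m x) ∈ W n) → k ≤ m :=
      ⟨Nat.find hex, Nat.find_spec hex, fun m hm => Nat.find_min' hex hm⟩
    refine ⟨k, N, fun n hn => ?_⟩
    induction n, hn using Nat.le_induction with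
    | base => exact hN
    | succ n _ ih =>
      obtain ⟨m, hm, hmW⟩ := hgrow n x _ ih
      have := hmin m ⟨n + 1, hmW⟩
      rw [le_antisymm hm this] at hmW
      exact hmW
  refine (cellContent_le_systemWeight hVcov).trans ?_
  unfold systemWeight
  rw [ENNReal.tsum_eq_iSup_sum]
  refine iSup_le fun F => ?_
  classical
  obtain ⟨N, hN⟩ : ∃ N, ∀ c ∈ F, c ∈ V → c ∈ W N := by
    have : ∀ c ∈ F, ∃ N, c ∈ V → ∀ n ≥ N, c ∈ W n := by
      intro c _
      by_cases hc : c ∈ V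
      · obtain ⟨N, hN⟩ := hc
        exact ⟨N, fun _ => hN⟩
      · exact ⟨0, fun h => absurd h hc⟩
    choose! g hg using this
    exact ⟨F.sup g, fun c hc hcV => hg c hc hcV _ (Finset.le_sup hc)⟩
  refine le_trans (Finset.sum_le_sum fun c hc => ?_)
    ((ENNReal.sum_le_tsum F).trans (hwtT N))
  by_cases hcV : c ∈ V
  · rw [indicator_of_mem hcV, indicator_of_mem (hN c hc hcV)]
  · rw [indicator_of_notMem hcV]; exact zero_le

/-- Finite-scale Frostman lemma: a set inside one cell carries a finitely supported mass
distribution dominated by the cell weights down to level `J`, of total mass at least the content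
of the set. -/
lemma exists_finite_frostman (hcode : RefiningCode code)
    (hfin : ∀ n i, (code (n + 1) '' {x | code n x = i}).Finite)
    (S : Set α) {l J : ℕ} (hl : l ≤ J) (i : ι) : ∃ f : α → ℝ≥0∞, f.support.Finite ∧
      f.support ⊆ S ∩ {x | code l x = i} ∧
      (∀ k, l ≤ k → k ≤ J → ∀ j, ∑' x, {x | code k x = j}.indicator f x ≤ cellWeight s k) ∧
      cellContent code s (S ∩ {x | code l x = i}) ≤ ∑' x, f x := by
  classical
  obtain ⟨d, rfl⟩ := Nat.exists_eq_add_of_le hl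
  clear hl
  induction d generalizing l i with
  | zero =>
    by_cases hne : (S ∩ {x | code l x = i}).Nonempty
    · obtain ⟨x, hx⟩ := hne
      refine ⟨Pi.single x (cellWeight s l), (Set.finite_singleton x).subset
        Pi.support_single_subset, Pi.support_single_subset.trans (by simpa using hx), ?_, ?_⟩
      · intro k hk hk' j
        obtain rfl := le_antisymm hk hk'
        refine (ENNReal.tsum_le_tsum fun y => indicator_le_self _ _ y).trans ?_
        rw [tsum_pi_single]
      · rw [tsum_pi_single]
        exact cellContent_le_cellWeight inter_subset_right
    · rw [not_nonempty_iff_eq_empty] at hne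
      refine ⟨0, by simp, by simp, by simp, ?_⟩
      rw [hne, cellContent_empty]; exact zero_le
  | succ d ih =>
    choose g hgfin hgsub hgw hgc using fun j => ih (l := l + 1) j
    rw [show l + 1 + d = l + (d + 1) by ring] at hgw
    set F : Finset ι := (hfin l i).toFinset with hF
    have hFmem : ∀ x, code l x = i → code (l + 1) x ∈ F := by
      intro x hx
      rw [hF, Set.Finite.mem_toFinset]
      exact ⟨x, hx, rfl⟩
    set f : α → ℝ≥0∞ := fun x => if code l x = i then g (code (l + 1) x) x else 0 with hf
    have hfle : ∀ x, f x ≤ g (code (l + 1) x) x := by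
      intro x
      simp only [hf]
      split_ifs
      · exact le_rfl
      · exact zero_le
    have hgzero : ∀ j x, code (l + 1) x ≠ j → g j x = 0 := by
      intro j x hx
      by_contra h
      exact hx (hgsub j h).2
    have hfeq : ∀ x, f x = ∑ j ∈ F, {x | code l x = i}.indicator (g j) x := by
      intro x
      by_cases hx : code l x = i
      · rw [Finset.sum_eq_single (code (l + 1) x)]
        · simp [hf, hx]
        · intro j _ hj
          rw [indicator_apply]
          split_ifs
          · exact hgzero j x (Ne.symm hj)
          · rfl
        · intro h; exact absurd (hFmem x hx) h
      · simp [hf, hx]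
    have hffin : f.support.Finite := by
      refine ((F.finite_toSet.biUnion fun j _ => hgfin j)).subset fun x hx => ?_
      have hxi : code l x = i := by
        by_contra h; exact hx (by simp [hf, h])
      refine mem_biUnion (x := code (l + 1) x) (hFmem x hxi) ?_
      simpa [hf, hxi] using hx
    have hfsub : f.support ⊆ S ∩ {x | code l x = i} := by
      intro x hx
      have hxi : code l x = i := by
        by_contra h; exact hx (by simp [hf, h])
      refine ⟨(hgsub (code (l + 1) x) (a := x) ?_).1, hxi⟩
      simpa [hf, hxi] using hx
    have hfw : ∀ k, l < k → k ≤ l + (d + 1) → ∀ j,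
        ∑' x, {x | code k x = j}.indicator f x ≤ cellWeight s k := by
      intro k hk hkJ j
      by_cases hne : ∃ x, code k x = j
      · obtain ⟨x₀, hx₀⟩ := hne
        refine le_trans (ENNReal.tsum_le_tsum fun x => ?_) (hgw (code (l + 1) x₀) k hk hkJ j)
        simp only [indicator_apply, Set.mem_ofPred_eq]
        split_ifs with hx
        · rw [← hcode.eq_of_le hk (hx.trans hx₀.symm)]
          exact hfle x
        · exact le_rfl
      · push Not at hne
        have : ∀ x, {x | code k x = j}.indicator f x = 0 := fun x => by
          simp [hne x]
        simp [this]
    have hgl : ∀ j ∈ F, ∀ x, {x | code l x = i}.indicator (g j) x = g j x := by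
      intro j hj x
      rw [hF, Set.Finite.mem_toFinset] at hj
      obtain ⟨x₀, hx₀, rfl⟩ := hj
      by_cases hx : code (l + 1) x = code (l + 1) x₀
      · have hxi : x ∈ {x | code l x = i} := (hcode l x x₀ hx).trans hx₀
        rw [indicator_of_mem hxi]
      · rw [indicator_apply, hgzero _ x hx, ite_self]
    have htot : ∑' x, f x = ∑ j ∈ F, ∑' x, g j x := by
      rw [← Summable.tsum_finsetSum fun _ _ => ENNReal.summable]
      refine tsum_congr fun x => ?_
      rw [hfeq]
      exact Finset.sum_congr rfl fun j hj => hgl j hj x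
    have hcont : cellContent code s (S ∩ {x | code l x = i}) ≤ ∑' x, f x := by
      rw [htot]
      refine le_trans ?_ (Finset.sum_le_sum fun j _ => hgc j)
      refine le_trans (cellContent_mono fun x hx => ?_) (cellContent_biUnion_finset_le F _)
      exact mem_biUnion (x := code (l + 1) x) (hFmem x hx.2) ⟨hx.1, rfl⟩
    rcases le_total (∑' x, f x) (cellWeight s l) with hT | hT
    · refine ⟨f, hffin, hfsub, fun k hk hkJ j => ?_, hcont⟩
      rcases hk.eq_or_lt with rfl | hk
      · exact (ENNReal.tsum_le_tsum fun y => indicator_le_self _ _ y).trans hT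
      · exact hfw k hk hkJ j
    · have hw0 : 0 < cellWeight s l := ENNReal.ofReal_pos.2 (by positivity)
      have hT0 : ∑' x, f x ≠ 0 := (hw0.trans_le hT).ne'
      have hTtop : ∑' x, f x ≠ ⊤ := by
        rw [htot]
        refine ENNReal.sum_ne_top.2 fun j _ => ?_
        have h := hgw j (l + 1) le_rfl (by omega) j
        have e : ∀ x, {x | code (l + 1) x = j}.indicator (g j) x = g j x := by
          intro x
          by_cases hx : code (l + 1) x = j
          · simp [hx]
          · rw [indicator_apply, hgzero _ x hx, ite_self]
        simp only [e] at h
        exact (h.trans_lt ENNReal.ofReal_lt_top).ne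
      set r : ℝ≥0∞ := cellWeight s l / ∑' x, f x with hr
      have hr1 : r ≤ 1 := ENNReal.div_le_of_le_mul (by rwa [one_mul])
      have hrT : ∑' x, r * f x = cellWeight s l := by
        rw [ENNReal.tsum_mul_left, hr, ENNReal.div_mul_cancel hT0 hTtop]
      have hle : ∀ x, r * f x ≤ f x := fun x => mul_le_of_le_one_left zero_le hr1
      have hsupp : (fun x => r * f x).support ⊆ f.support := fun x hx h => hx (by simp [h])
      refine ⟨fun x => r * f x, hffin.subset hsupp, hsupp.trans hfsub, fun k hk hkJ j => ?_, ?_⟩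
      · rcases hk.eq_or_lt with rfl | hk
        · exact (ENNReal.tsum_le_tsum fun y => indicator_le_self _ _ y).trans hrT.le
        · exact (ENNReal.tsum_le_tsum fun y =>
            indicator_le_indicator (hle y)).trans (hfw k hk hkJ j)
      · rw [hrT]
        exact cellContent_le_cellWeight inter_subset_right

end DyadicContent

section DyadicHausdorff

/-- The index of the dyadic interval of length `2⁻ⁿ` containing a real number. -/
def lineCode (n : ℕ) (x : ℝ) : ℤ := ⌊(2 : ℝ) ^ n * x⌋

/-- Cells of level `n` have diameter at most `2⁻ⁿ`. -/
def FineCode {α ι : Type*} [EDist α] (code : ℕ → α → ι) : Prop :=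
  ∀ n x y, code n x = code n y → edist x y ≤ ENNReal.ofReal (1 / 2 ^ n)

lemma refiningCode_lineCode : RefiningCode lineCode := fun n _ _ h =>
  floor_two_pow_eq_of_le n.le_succ h

lemma refiningCode_cubeCode : RefiningCode cubeCode := fun n _ _ h =>
  funext fun j => floor_two_pow_eq_of_le n.le_succ (congrFun h j)

lemma floor_two_pow_succ_mem_Icc (n : ℕ) (x : ℝ) :
    ⌊(2 : ℝ) ^ (n + 1) * x⌋ ∈ Icc (2 * ⌊(2 : ℝ) ^ n * x⌋) (2 * ⌊(2 : ℝ) ^ n * x⌋ + 1) := by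
  have h1 := Int.floor_le ((2 : ℝ) ^ n * x)
  have h2 := Int.lt_floor_add_one ((2 : ℝ) ^ n * x)
  constructor
  · rw [Int.le_floor]
    push_cast
    rw [pow_succ]
    linarith
  · rw [← Int.lt_add_one_iff, Int.floor_lt]
    push_cast
    rw [pow_succ]
    linarith

lemma finite_image_lineCode (n : ℕ) (i : ℤ) : (lineCode (n + 1) '' {x | lineCode n x = i}).Finite := by
  refine (Set.finite_Icc (2 * i) (2 * i + 1)).subset ?_
  rintro _ ⟨x, rfl, rfl⟩
  exact floor_two_pow_succ_mem_Icc n x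

lemma finite_image_cubeCode (n : ℕ) (i : Fin 3 → ℤ) :
    (cubeCode (n + 1) '' {x | cubeCode n x = i}).Finite := by
  refine (Set.finite_Icc (2 * i) (2 * i + 1)).subset ?_
  rintro _ ⟨x, rfl, rfl⟩
  exact ⟨fun j => (floor_two_pow_succ_mem_Icc n (x j)).1,
    fun j => (floor_two_pow_succ_mem_Icc n (x j)).2⟩

lemma fineCode_lineCode : FineCode lineCode := by
  intro n x y h
  have h1 := Int.abs_sub_lt_one_of_floor_eq_floor h
  rw [← mul_sub, abs_mul, abs_of_pos (by positivity)] at h1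
  rw [edist_dist, Real.dist_eq]
  refine ENNReal.ofReal_le_ofReal ?_
  rw [le_div_iff₀ (by positivity), mul_comm]
  exact h1.le

lemma fineCode_cubeCode : FineCode cubeCode := by
  intro n x y h
  rw [edist_dist]
  refine ENNReal.ofReal_le_ofReal ((dist_pi_le_iff (by positivity)).2 fun j => ?_)
  rw [Real.dist_eq]
  exact abs_sub_le_of_cubeCode_eq h j

lemma ofReal_one_div_two_pow_rpow {s : ℝ} (hs : 0 ≤ s) (n : ℕ) :
    ENNReal.ofReal (1 / 2 ^ n) ^ s = cellWeight s n := by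
  rw [cellWeight, ENNReal.ofReal_rpow_of_nonneg (by positivity) hs]
  congr 1
  rw [one_div, ← Real.rpow_natCast, ← Real.rpow_neg (by norm_num), ← Real.rpow_mul (by norm_num)]
  ring_nf

lemma cellWeight_anti {s : ℝ} (hs : 0 ≤ s) {m n : ℕ} (h : m ≤ n) :
    cellWeight s n ≤ cellWeight s m := by
  refine ENNReal.ofReal_le_ofReal (Real.rpow_le_rpow_of_exponent_le (by norm_num) ?_)
  have : (m : ℝ) ≤ n := by exact_mod_cast h
  nlinarith

lemma tendsto_ofReal_one_div_two_pow :
    Filter.Tendsto (fun n : ℕ => ENNReal.ofReal (1 / 2 ^ n)) Filter.atTop (nhds 0) := by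
  rw [← ENNReal.ofReal_zero]
  refine ENNReal.tendsto_ofReal ?_
  simpa [one_div] using tendsto_pow_atTop_nhds_zero_of_lt_one (r := (1 / 2 : ℝ))
    (by norm_num) (by norm_num)

lemma tendsto_cellWeight {s : ℝ} (hs : 0 < s) :
    Filter.Tendsto (cellWeight s) Filter.atTop (nhds 0) := by
  have h := tendsto_ofReal_one_div_two_pow.ennrpow_const s
  simpa only [ofReal_one_div_two_pow_rpow hs.le, ENNReal.zero_rpow_of_pos hs] using h

/-- Sets of vanishing dyadic content are null for the Hausdorff measure. -/
lemma hausdorffMeasure_eq_zero_of_cellContent_eq_zero {α ι : Type*} [EMetricSpace α]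
    [MeasurableSpace α] [BorelSpace α] [Countable ι] {code : ℕ → α → ι} (hcode : FineCode code)
    {s : ℝ} (hs : 0 < s) {A : Set α} (hA : cellContent code s A = 0) : μH[s] A = 0 := by
  classical
  have hpos : ∀ n, 0 < cellWeight s n := fun n => ENNReal.ofReal_pos.2 (by positivity)
  choose U hU hUw using fun n => exists_system_lt (code := code) (s := s) (A := A)
    (hA ▸ hpos n)
  have hlev : ∀ n, ∀ c ∈ U n, n ≤ c.1 := by
    intro n c hc
    by_contra! hlt
    refine (hUw n).not_ge ((cellWeight_anti hs.le hlt.le).trans ?_)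
    refine le_trans ?_ (ENNReal.le_tsum c)
    rw [indicator_of_mem hc]
  let T : ∀ _ : ℕ, ℕ × ι → Set α := fun n c => if c ∈ U n then {x | code c.1 x = c.2} else ∅
  have hT : ∀ n c, ediam (T n c) ≤ ENNReal.ofReal (1 / 2 ^ c.1) := by
    intro n c
    simp only [T]
    split_ifs
    · exact ediam_le fun x hx y hy => hcode c.1 x y (hx.trans hy.symm)
    · simp
  have key := Measure.hausdorffMeasure_le_liminf_tsum s A (fun n : ℕ => ENNReal.ofReal (1 / 2 ^ n))
    tendsto_ofReal_one_div_two_pow T (Filter.Eventually.of_forall fun n c => ?_)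
    (Filter.Eventually.of_forall fun n x hx => ?_)
  · refine le_antisymm (key.trans ?_) zero_le
    have hlim := (tendsto_cellWeight hs).liminf_eq
    rw [← hlim]
    refine Filter.liminf_le_liminf (Filter.Eventually.of_forall fun n => ?_)
    refine le_trans (ENNReal.tsum_le_tsum fun c => ?_) (hUw n).le
    by_cases hc : c ∈ U n
    · rw [indicator_of_mem hc, ← ofReal_one_div_two_pow_rpow hs.le]
      exact ENNReal.rpow_le_rpow (hT n c) hs.le
    · simp [T, hc, hs]
  · by_cases hc : c ∈ U n
    · refine (hT n c).trans (ENNReal.ofReal_le_ofReal ?_)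
      have := hlev n c hc
      gcongr
      norm_num
    · simp [T, hc]
  · obtain ⟨k, hk⟩ := hU n hx
    exact mem_iUnion.2 ⟨(k, code k x), by simp [T, hk]⟩

/-- Finite-scale Frostman lemma on the unit interval. -/
lemma exists_frostmanWeights {S : Set ℝ} (hS : S ⊆ Ico 0 1) (s : ℝ) (J : ℕ) :
    ∃ (X : Finset ℝ) (ν : ℝ → ℝ), FrostmanWeights X ν s J ∧ ↑X ⊆ S ∧
      cellContent lineCode s S ≤ ∑ φ ∈ X, ENNReal.ofReal (ν φ) := by
  classical
  obtain ⟨f, hfin, hsub, hw, hc⟩ := exists_finite_frostman (s := s) refiningCode_lineCode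
    finite_image_lineCode S (Nat.zero_le J) 0
  have hS0 : S ∩ {x | lineCode 0 x = 0} = S := by
    refine inter_eq_left.2 fun x hx => ?_
    simpa [lineCode, Int.floor_eq_zero_iff] using hS hx
  rw [hS0] at hsub hc
  have hmem : ∀ {φ}, φ ∈ hfin.toFinset ↔ f φ ≠ 0 := by simp
  have hsum : ∀ g : ℝ → ℝ≥0∞, g.support ⊆ f.support → ∑' x, g x = ∑ x ∈ hfin.toFinset, g x := by
    intro g hg
    refine tsum_eq_sum fun x hx => ?_
    by_contra h
    exact hx (by simpa using hg h)
  have hne : ∀ φ, f φ ≠ ⊤ := by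
    intro φ
    refine ne_of_lt (lt_of_le_of_lt ?_ (lt_of_le_of_lt (hw 0 le_rfl (Nat.zero_le J) (lineCode 0 φ))
      ENNReal.ofReal_lt_top))
    refine le_trans ?_ (ENNReal.le_tsum φ)
    simp
  refine ⟨hfin.toFinset, fun φ => (f φ).toReal, ⟨fun φ hφ => ?_, fun _ _ => ENNReal.toReal_nonneg,
    fun l hl j => ?_⟩, ?_, ?_⟩
  · exact hS (hsub (by simpa using hφ))
  · have h := hw l (Nat.zero_le l) hl j
    rw [hsum _ (by simp)] at h
    rw [cellWeight] at h
    rw [← ENNReal.ofReal_le_ofReal_iff (by positivity),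
      ENNReal.ofReal_sum_of_nonneg fun _ _ => ENNReal.toReal_nonneg, Finset.sum_filter]
    refine le_trans (Finset.sum_le_sum fun φ _ => ?_) h
    rw [indicator_apply]
    by_cases hφ : ⌊(2 : ℝ) ^ l * φ⌋ = j
    · simp [hφ, lineCode, ENNReal.ofReal_toReal (hne φ)]
    · simp [hφ]
  · simpa using hsub
  · rw [hsum f le_rfl] at hc
    simpa [ENNReal.ofReal_toReal (hne _)] using hc

end DyadicHausdorff

section Capacitability

variable {α ι : Type*} {code : ℕ → α → ι} {s : ℝ}

/-- A set of positive content which is a continuous image of the Baire space contains the image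
of a box whose finite-level approximations all have content bounded below. -/
lemma exists_box_content_lt (hcode : RefiningCode code) (f : (ℕ → ℕ) → α) {r : ℝ≥0∞}
    (hr : r < cellContent code s (range f)) :
    ∃ b : ℕ → ℕ, ∀ n, r < cellContent code s (f '' {σ | ∀ i < n, σ i ≤ b i}) := by
  have step : ∀ (n : ℕ) (T : Set (ℕ → ℕ)), r < cellContent code s (f '' T) →
      ∃ m, r < cellContent code s (f '' (T ∩ {σ | σ n ≤ m})) := by
    intro n T hT
    have hmono : Monotone fun m : ℕ => f '' (T ∩ {σ | σ n ≤ m}) := fun m m' h =>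
      image_mono (inter_subset_inter_right _ fun σ hσ => le_trans hσ h)
    have hU : f '' T ⊆ ⋃ m : ℕ, f '' (T ∩ {σ | σ n ≤ m}) := by
      rintro _ ⟨σ, hσ, rfl⟩
      exact mem_iUnion.2 ⟨σ n, σ, ⟨hσ, le_refl (σ n)⟩, rfl⟩
    exact lt_iSup_iff.1 (hT.trans_le ((cellContent_mono hU).trans
      (cellContent_iUnion_of_monotone hcode hmono)))
  choose! m hm using step
  obtain ⟨T, hT0, hTs⟩ : ∃ T : ℕ → Set (ℕ → ℕ), T 0 = univ ∧
      ∀ n, T (n + 1) = T n ∩ {σ | σ n ≤ m n (T n)} :=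
    ⟨fun n => Nat.rec univ (fun n V => V ∩ {σ | σ n ≤ m n V}) n, rfl, fun _ => rfl⟩
  have hT : ∀ n, r < cellContent code s (f '' T n) := by
    intro n
    induction n with
    | zero => rwa [hT0, image_univ]
    | succ n ih => rw [hTs]; exact hm n _ ih
  refine ⟨fun n => m n (T n), fun n => ?_⟩
  have e : {σ : ℕ → ℕ | ∀ i < n, σ i ≤ m i (T i)} = T n := by
    clear hT hr
    induction n with
    | zero => simp [hT0]
    | succ n ih =>
      rw [hTs]
      ext σ
      have hσ := Set.ext_iff.1 ih σ
      simp only [Set.mem_ofPred_eq] at hσ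
      rw [mem_inter_iff, ← hσ]
      simp only [Set.mem_ofPred_eq, Nat.lt_succ_iff_lt_or_eq, or_imp, forall_and,
        forall_eq]
  rw [e]
  exact hT n

/-- Finite-level approximations of a compact box in the Baire space enter any neighbourhood of the
image of the box. -/
lemma exists_image_subset_of_isOpen [TopologicalSpace α] {f : (ℕ → ℕ) → α} (hf : Continuous f)
    (b : ℕ → ℕ) {O : Set α} (hO : IsOpen O) (hb : f '' {σ | ∀ i, σ i ≤ b i} ⊆ O) :
    ∃ n, f '' {σ | ∀ i < n, σ i ≤ b i} ⊆ O := by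
  by_contra! hcon
  have hcon' : ∀ n, ∃ σ : ℕ → ℕ, (∀ i < n, σ i ≤ b i) ∧ f σ ∉ O := by
    intro n
    obtain ⟨_, ⟨σ, hσ, rfl⟩, h⟩ := not_subset.1 (hcon n)
    exact ⟨σ, hσ, h⟩
  choose σ hσ hσO using hcon'
  have hK : IsCompact (univ.pi fun i => Iic (b i)) := isCompact_univ_pi fun i =>
    (Set.finite_Iic (b i)).isCompact
  obtain ⟨τ, hτ, φ, hφ, hlim⟩ := hK.tendsto_subseq (x := fun n i => min (σ n i) (b i))
    (fun n i _ => mem_Iic.2 (min_le_right _ _))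
  have hlim' : Filter.Tendsto (fun n => σ (φ n)) Filter.atTop (nhds τ) := by
    rw [tendsto_pi_nhds] at hlim ⊢
    intro i
    refine (hlim i).congr' ?_
    filter_upwards [Filter.eventually_gt_atTop i] with n hn
    exact min_eq_left (hσ (φ n) i (hn.trans_le hφ.le_apply))
  have h1 : ∀ᶠ n in Filter.atTop, f (σ (φ n)) ∈ O :=
    (hf.tendsto τ).comp hlim' |>.eventually_mem
      (hO.mem_nhds (hb ⟨τ, fun i => hτ i (mem_univ i), rfl⟩))
  obtain ⟨n, hn⟩ := h1.exists
  exact hσO _ hn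

end Capacitability

section CubeNeighbourhoods

/-- An open neighbourhood of a dyadic cube. -/
def cubeNhd (n : ℕ) (i : Fin 3 → ℤ) : Set (Fin 3 → ℝ) :=
  {x | ∀ j, 2 ^ n * x j ∈ Ioo ((i j : ℝ) - 1) (i j + 2)}

lemma isOpen_cubeNhd (n : ℕ) (i : Fin 3 → ℤ) : IsOpen (cubeNhd n i) := by
  have : cubeNhd n i = ⋂ j, (fun x : Fin 3 → ℝ => 2 ^ n * x j) ⁻¹' Ioo ((i j : ℝ) - 1) (i j + 2) := by
    ext x; simp [cubeNhd]
  rw [this]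
  exact isOpen_iInter_of_finite fun j => isOpen_Ioo.preimage (by fun_prop)

lemma subset_cubeNhd (n : ℕ) (i : Fin 3 → ℤ) : {x | cubeCode n x = i} ⊆ cubeNhd n i := by
  rintro x rfl j
  have h1 := Int.floor_le ((2 : ℝ) ^ n * x j)
  have h2 := Int.lt_floor_add_one ((2 : ℝ) ^ n * x j)
  exact ⟨by simp only [cubeCode]; linarith, by simp only [cubeCode]; linarith⟩

lemma cubeNhd_subset (n : ℕ) (i : Fin 3 → ℤ) :
    cubeNhd n i ⊆ ⋃ e ∈ Finset.Icc (-1 : Fin 3 → ℤ) 1, {x | cubeCode n x = i + e} := by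
  intro x hx
  refine mem_biUnion (x := cubeCode n x - i) ?_ (by simp)
  rw [Finset.mem_coe, Finset.mem_Icc]
  refine ⟨fun j => ?_, fun j => ?_⟩
  · have h : i j - 1 ≤ ⌊(2 : ℝ) ^ n * x j⌋ := Int.le_floor.2 (by push_cast; exact (hx j).1.le)
    simp only [cubeCode, Pi.neg_apply, Pi.one_apply, Pi.sub_apply]
    linarith
  · have h : ⌊(2 : ℝ) ^ n * x j⌋ < i j + 2 := Int.floor_lt.2 (by push_cast; exact (hx j).2)
    simp only [cubeCode, Pi.one_apply, Pi.sub_apply]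
    omega

/-- The number of dyadic cubes meeting a neighbourhood of a given one. -/
lemma card_neighbours : (Finset.Icc (-1 : Fin 3 → ℤ) 1).card = 27 := by
  rw [Pi.card_Icc]
  simp

/-- A set of positive content which is a continuous image of the Baire space has a compact subset
of positive content. -/
lemma exists_isCompact_cellContent_pos {s : ℝ} {A : Set (Fin 3 → ℝ)} (hA : AnalyticSet A)
    (hpos : 0 < cellContent cubeCode s A) :
    ∃ K ⊆ A, IsCompact K ∧ 0 < cellContent cubeCode s K := by
  rw [AnalyticSet] at hA
  obtain rfl | ⟨f, hf, rfl⟩ := hA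
  · rw [cellContent_empty] at hpos
    exact absurd hpos (lt_irrefl _)
  obtain ⟨r, hr0, hr⟩ := exists_between hpos
  obtain ⟨b, hb⟩ := exists_box_content_lt refiningCode_cubeCode f hr
  have hK : IsCompact {σ : ℕ → ℕ | ∀ i, σ i ≤ b i} := by
    have h : IsCompact (univ.pi fun i => Iic (b i)) := isCompact_univ_pi fun i =>
      (Set.finite_Iic (b i)).isCompact
    simpa [Set.pi] using h
  refine ⟨f '' {σ | ∀ i, σ i ≤ b i}, image_subset_range _ _, hK.image hf, ?_⟩
  suffices h : r ≤ 27 * cellContent cubeCode s (f '' {σ | ∀ i, σ i ≤ b i}) by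
    by_contra! h0
    rw [nonpos_iff_eq_zero.1 h0, mul_zero] at h
    exact hr0.not_ge h
  conv_rhs => rw [cellContent]
  rw [ENNReal.mul_iInf_of_ne (by norm_num) (by norm_num)]
  refine le_iInf fun U => ?_
  rw [ENNReal.mul_iInf_of_ne (by norm_num) (by norm_num)]
  refine le_iInf fun hU => ?_
  have hcover : f '' {σ | ∀ i, σ i ≤ b i} ⊆ ⋃ c ∈ U, cubeNhd c.1 c.2 := by
    intro x hx
    obtain ⟨n, hn⟩ := hU hx
    exact mem_biUnion hn (subset_cubeNhd _ _ rfl)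
  obtain ⟨n, hn⟩ := exists_image_subset_of_isOpen hf b
    (isOpen_biUnion fun c _ => isOpen_cubeNhd c.1 c.2) hcover
  refine (hb n).le.trans ?_
  let V : (Finset.Icc (-1 : Fin 3 → ℤ) 1) → Set (ℕ × (Fin 3 → ℤ)) :=
    fun e => {c | (c.1, c.2 - e.1) ∈ U}
  have hV : ∀ e, systemWeight s (V e) = systemWeight s U := by
    intro e
    unfold systemWeight
    rw [← ((Equiv.refl ℕ).prodCongr (Equiv.subRight e.1)).tsum_eq
      (fun c => U.indicator (fun c => cellWeight s c.1) c)]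
    rfl
  calc _ ≤ systemWeight s (⋃ e, V e) := by
        refine cellContent_le_systemWeight (hn.trans (iUnion₂_subset fun c hc x hx => ?_))
        obtain ⟨e, he, hxe⟩ := mem_iUnion₂.1 (cubeNhd_subset _ _ hx)
        refine ⟨c.1, mem_iUnion.2 ⟨⟨e, he⟩, ?_⟩⟩
        have hxe' : cubeCode c.1 x = c.2 + e := hxe
        simp only [V, Set.mem_ofPred_eq, hxe', add_sub_cancel_right]
        exact hc
    _ ≤ ∑' e, systemWeight s (V e) := systemWeight_iUnion_le V
    _ = 27 * systemWeight s U := by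
        rw [tsum_congr hV, tsum_fintype, Finset.sum_const, Finset.card_univ,
          Fintype.card_coe, card_neighbours]
        simp

end CubeNeighbourhoods

section FrostmanMeasure

/-- A finitely supported mass distribution on a compact set, as a probability measure. -/
lemma exists_probabilityMeasure_of_frostman {K : Set (Fin 3 → ℝ)}
    {f : (Fin 3 → ℝ) → ℝ≥0∞} (hsub : f.support ⊆ K)
    (h0 : ∑' x, f x ≠ 0) (htop : ∑' x, f x ≠ ⊤) :
    ∃ P : ProbabilityMeasure K, ∀ B : Set (Fin 3 → ℝ), MeasurableSet B →
      (P : Measure K) (Subtype.val ⁻¹' B) = (∑' x, f x)⁻¹ * ∑' x, B.indicator f x := by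
  classical
  let μ : Measure K := Measure.sum fun x : K => ((∑' x, f x)⁻¹ * f x) • Measure.dirac x
  have hμ : ∀ B : Set (Fin 3 → ℝ), MeasurableSet B →
      μ (Subtype.val ⁻¹' B) = (∑' x, f x)⁻¹ * ∑' x, B.indicator f x := by
    intro B hB
    have hm : MeasurableSet (Subtype.val ⁻¹' B : Set K) := measurable_subtype_coe hB
    rw [Measure.sum_apply _ hm, ← ENNReal.tsum_mul_left]
    have e : ∀ x : K, ((∑' x, f x)⁻¹ * f x) • Measure.dirac x (Subtype.val ⁻¹' B) =
        (fun x => (∑' x, f x)⁻¹ * B.indicator f x) x := by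
      intro x
      rw [Measure.dirac_apply' _ hm]
      by_cases hx : (x : Fin 3 → ℝ) ∈ B <;> simp [hx]
    simp only [Measure.smul_apply]
    rw [tsum_congr e]
    refine tsum_subtype_eq_of_support_subset (s := K)
      (f := fun x => (∑' x, f x)⁻¹ * B.indicator f x) fun x hx => hsub fun h => hx ?_
    by_cases hxB : x ∈ B <;> simp [hxB, h]
  have hprob : IsProbabilityMeasure μ := ⟨by
    have := hμ univ MeasurableSet.univ
    simp only [preimage_univ, indicator_univ] at this
    rw [this, ENNReal.inv_mul_cancel h0 htop]⟩
  exact ⟨⟨μ, hprob⟩, hμ⟩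

/-- **Frostman's lemma** for Borel subsets of three-space. -/
lemma exists_frostman_measure {t : ℝ} (ht : 0 < t) {A : Set (Fin 3 → ℝ)} (hA : MeasurableSet A)
    (hpos : 0 < μH[t] A) :
    ∃ μ : Measure (Fin 3 → ℝ), IsProbabilityMeasure μ ∧ μ Aᶜ = 0 ∧ ∃ C, 0 ≤ C ∧
      ∀ n i, μ {x | cubeCode n x = i} ≤ ENNReal.ofReal (C * 2 ^ (-(t * n))) := by
  have hApos : 0 < cellContent cubeCode t A := by
    rw [pos_iff_ne_zero]
    intro h
    exact hpos.ne' (hausdorffMeasure_eq_zero_of_cellContent_eq_zero fineCode_cubeCode ht h)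
  obtain ⟨K, hKA, hK, hKpos⟩ := exists_isCompact_cellContent_pos hA.analyticSet hApos
  obtain ⟨i, hi⟩ : ∃ i, 0 < cellContent cubeCode t (K ∩ {x | cubeCode 0 x = i}) := by
    by_contra! h
    refine hKpos.not_ge ?_
    have hU : K ⊆ ⋃ i, K ∩ {x | cubeCode 0 x = i} := fun x hx =>
      mem_iUnion.2 ⟨cubeCode 0 x, hx, rfl⟩
    refine (cellContent_mono hU).trans ((cellContent_iUnion_le _).trans ?_)
    simp [nonpos_iff_eq_zero.1 (h _)]
  set r := cellContent cubeCode t (K ∩ {x | cubeCode 0 x = i}) with hr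
  have hrtop : r ≠ ⊤ := ((cellContent_le_cellWeight inter_subset_right).trans_lt
    ENNReal.ofReal_lt_top).ne
  choose f hfin hsub hw hc using fun J : ℕ => exists_finite_frostman (s := t)
    refiningCode_cubeCode finite_image_cubeCode K (Nat.zero_le J) i
  have htot : ∀ J, ∑' x, f J x ≤ cellWeight t 0 := by
    intro J
    refine le_trans (le_of_eq (tsum_congr fun x => ?_)) (hw J 0 le_rfl (Nat.zero_le J) i)
    by_cases hx : f J x = 0
    · simp [hx, indicator_apply]
    · exact (indicator_of_mem (hsub J hx).2 _).symm
  choose P hP using fun J => exists_probabilityMeasure_of_frostman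
    ((hsub J).trans inter_subset_left) (hi.trans_le (hc J)).ne'
    ((htot J).trans_lt ENNReal.ofReal_lt_top).ne
  have : CompactSpace K := isCompact_iff_compactSpace.1 hK
  obtain ⟨Q, -, hQ⟩ := (isCompact_univ (X := ProbabilityMeasure K)).ultrafilter_le_nhds
    ((Filter.hyperfilter ℕ).map P) (by simp)
  have hlim : Filter.Tendsto P (Filter.hyperfilter ℕ) (nhds Q) := hQ
  refine ⟨(Q : Measure K).map Subtype.val,
    Measure.isProbabilityMeasure_map measurable_subtype_coe.aemeasurable, ?_, 27 * r⁻¹.toReal,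
    by positivity, fun n j => ?_⟩
  · rw [Measure.map_apply measurable_subtype_coe hA.compl]
    have : (Subtype.val ⁻¹' Aᶜ : Set K) = ∅ := by
      ext x
      simpa using hKA x.2
    rw [this, measure_empty]
  · rw [Measure.map_apply measurable_subtype_coe (measurableSet_cubeCode_eq n j)]
    calc (Q : Measure K) (Subtype.val ⁻¹' {x | cubeCode n x = j})
        ≤ (Q : Measure K) (Subtype.val ⁻¹' cubeNhd n j) :=
          measure_mono (preimage_mono (subset_cubeNhd n j))
      _ ≤ Filter.liminf (fun J => (P J : Measure K) (Subtype.val ⁻¹' cubeNhd n j))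
            (Filter.hyperfilter ℕ) :=
          ProbabilityMeasure.le_liminf_measure_open_of_tendsto hlim
            ((isOpen_cubeNhd n j).preimage continuous_subtype_val)
      _ ≤ ENNReal.ofReal (27 * r⁻¹.toReal * 2 ^ (-(t * n))) := by
          refine Filter.liminf_le_of_frequently_le' (Filter.Eventually.frequently ?_)
          refine Filter.Eventually.filter_mono Nat.hyperfilter_le_atTop ?_
          filter_upwards [Filter.eventually_ge_atTop n] with J hJ
          calc (P J : Measure K) (Subtype.val ⁻¹' cubeNhd n j)
              ≤ ∑ e ∈ Finset.Icc (-1 : Fin 3 → ℤ) 1,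
                  (P J : Measure K) (Subtype.val ⁻¹' {x | cubeCode n x = j + e}) := by
                refine (measure_mono (preimage_mono (cubeNhd_subset n j))).trans ?_
                rw [preimage_iUnion₂]
                exact measure_biUnion_finset_le _ _
            _ ≤ ∑ e ∈ Finset.Icc (-1 : Fin 3 → ℤ) 1, r⁻¹ * cellWeight t n := by
                refine Finset.sum_le_sum fun e _ => ?_
                rw [hP J _ (measurableSet_cubeCode_eq n _)]
                exact mul_le_mul' (ENNReal.inv_le_inv.2 (hc J)) (hw J n (Nat.zero_le n) hJ _)
            _ = ENNReal.ofReal (27 * r⁻¹.toReal * 2 ^ (-(t * n))) := by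
                rw [Finset.sum_const, card_neighbours, cellWeight,
                  ENNReal.ofReal_mul (by positivity), ENNReal.ofReal_mul (by norm_num),
                  ENNReal.ofReal_toReal (ENNReal.inv_ne_top.2 hi.ne')]
                simp [mul_assoc]

end FrostmanMeasure

section ExceptionalDirections

/-- Points lying in a slab of some thickness at most `2⁻ᵏ`, cut out of their level-`k` cube by the
map `p`, that carries too much mass. -/
def heavyUnion (μ : Measure (Fin 3 → ℝ)) (p : (Fin 3 → ℝ) → ℝ) (a : ℝ) (k : ℕ) : Set (Fin 3 → ℝ) :=
  ⋃ J, heavySet μ p a k J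

lemma monotone_heavySet (μ : Measure (Fin 3 → ℝ)) (p : (Fin 3 → ℝ) → ℝ) (a : ℝ) (k : ℕ) :
    Monotone (heavySet μ p a k) := by
  rintro J J' hJ x ⟨j, hkj, hjJ, h⟩
  exact ⟨j, hkj, hjJ.trans hJ, h⟩

lemma measurableSet_heavyUnion (μ : Measure (Fin 3 → ℝ)) {p : (Fin 3 → ℝ) → ℝ} (hp : Measurable p)
    (a : ℝ) (k : ℕ) : MeasurableSet (heavyUnion μ p a k) :=
  MeasurableSet.iUnion fun J => measurableSet_heavySet μ hp a k J

/-- Parameters for which the heavy slabs of level `k` carry large mass have small content. -/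
lemma exists_cellContent_heavyUnion_le {c s t C ε : ℝ} (hc : 0 < c) (hst : 3 - 2 * s < t)
    (ht : 0 ≤ t) (hs : s ≤ 1) (hC : 0 ≤ C) (hε : 0 ≤ ε) {ψ m : ℝ → ℝ} (hψ : NormCurve c ψ m)
    {μ : Measure (Fin 3 → ℝ)} [IsFiniteMeasure μ]
    (hμ : ∀ n i, μ {x | cubeCode n x = i} ≤ ENNReal.ofReal (C * 2 ^ (-(t * n)))) :
    ∃ K : ℝ≥0∞, K ≠ ⊤ ∧ ∀ k : ℕ, cellContent lineCode s {φ | φ ∈ Ico (0 : ℝ) 1 ∧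
      ENNReal.ofReal (2 ^ (-(ε / 12 * k))) < μ (heavyUnion μ (coneLin ψ φ) (t - 1 - ε) k)} ≤
        K * ENNReal.ofReal (2 ^ (-(ε / 12 * k))) := by
  obtain ⟨K, hK, l₀, hmain⟩ := exists_weighted_measure_heavySet_le hc hst ht hs hC hε
  refine ⟨ENNReal.ofReal K * μ univ, by finiteness, fun k => ?_⟩
  set δ : ℝ≥0∞ := ENNReal.ofReal (2 ^ (-(ε / 12 * k))) with hδ
  have hδ0 : δ ≠ 0 := (ENNReal.ofReal_pos.2 (by positivity)).ne'
  have hδtop : δ ≠ ⊤ := ENNReal.ofReal_ne_top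
  let S : ℕ → Set ℝ := fun J =>
    {φ | φ ∈ Ico (0 : ℝ) 1 ∧ δ < μ (heavySet μ (coneLin ψ φ) (t - 1 - ε) k J)}
  have hSmono : Monotone S := fun J J' hJ φ hφ =>
    ⟨hφ.1, hφ.2.trans_le (measure_mono (monotone_heavySet _ _ _ _ hJ))⟩
  have hSU : {φ | φ ∈ Ico (0 : ℝ) 1 ∧ δ < μ (heavyUnion μ (coneLin ψ φ) (t - 1 - ε) k)} ⊆
      ⋃ J, S J := by
    rintro φ ⟨hφ, h⟩
    rw [heavyUnion, (monotone_heavySet _ _ _ _).measure_iUnion] at h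
    obtain ⟨J, hJ⟩ := lt_iSup_iff.1 h
    exact mem_iUnion.2 ⟨J, hφ, hJ⟩
  refine (cellContent_mono hSU).trans ((cellContent_iUnion_of_monotone refiningCode_lineCode
    hSmono).trans (iSup_le fun J => ?_))
  obtain ⟨X, ν, hν, hX, hle⟩ := exists_frostmanWeights (S := S J) (fun φ hφ => hφ.1) s (J + l₀)
  refine hle.trans ?_
  have h1 : (∑ φ ∈ X, ENNReal.ofReal (ν φ)) * δ ≤
      ENNReal.ofReal (K * 2 ^ (-(ε / 6 * k))) * μ univ := by
    refine le_trans ?_ (hmain ψ m hψ μ inferInstance hμ k J X ν hν)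
    rw [Finset.sum_mul]
    exact Finset.sum_le_sum fun φ hφ => mul_le_mul' le_rfl (hX hφ).2.le
  have h2 : ENNReal.ofReal (K * 2 ^ (-(ε / 6 * k))) = ENNReal.ofReal K * (δ * δ) := by
    rw [hδ, ← ENNReal.ofReal_mul (by positivity), ENNReal.ofReal_mul hK,
      ← Real.rpow_add (by norm_num)]
    ring_nf
  rw [h2] at h1
  refine (ENNReal.mul_le_mul_iff_left hδ0 hδtop).1 (h1.trans (le_of_eq ?_))
  ring

lemma tsum_ofReal_two_rpow_neg_ne_top {η : ℝ} (hη : 0 < η) :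
    ∑' k : ℕ, ENNReal.ofReal (2 ^ (-(η * k))) ≠ ⊤ := by
  have e : ∀ k : ℕ, (2 : ℝ) ^ (-(η * k)) = ((2 : ℝ) ^ (-η)) ^ k := by
    intro k
    rw [← Real.rpow_natCast, ← Real.rpow_mul (by norm_num)]
    ring_nf
  have hs : Summable fun k : ℕ => (2 : ℝ) ^ (-(η * k)) := by
    simp only [e]
    refine summable_geometric_of_lt_one (by positivity) ?_
    exact Real.rpow_lt_one_of_one_lt_of_neg (by norm_num) (by linarith)
  exact hs.tsum_ofReal_ne_top

/-- The exceptional parameters form a set of dimension at most `(3 - t) / 2`. -/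
lemma dimH_frequently_heavyUnion_le {c t C ε : ℝ} (hc : 0 < c) (ht : 1 < t) (hC : 0 ≤ C)
    (hε : 0 < ε) {ψ m : ℝ → ℝ} (hψ : NormCurve c ψ m) {μ : Measure (Fin 3 → ℝ)} [IsFiniteMeasure μ]
    (hμ : ∀ n i, μ {x | cubeCode n x = i} ≤ ENNReal.ofReal (C * 2 ^ (-(t * n)))) :
    dimH {φ | φ ∈ Ico (0 : ℝ) 1 ∧ ∃ᶠ k : ℕ in Filter.atTop, ENNReal.ofReal (2 ^ (-(ε / 12 * k))) <
      μ (heavyUnion μ (coneLin ψ φ) (t - 1 - ε) k)} ≤ ENNReal.ofReal ((3 - t) / 2) := by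
  set E := {φ | φ ∈ Ico (0 : ℝ) 1 ∧ ∃ᶠ k : ℕ in Filter.atTop,
    ENNReal.ofReal (2 ^ (-(ε / 12 * k))) < μ (heavyUnion μ (coneLin ψ φ) (t - 1 - ε) k)} with hE
  have key : ∀ s : ℝ, 0 < s → (3 - t) / 2 < s → s ≤ 1 → dimH E ≤ ENNReal.ofReal s := by
    intro s hs0 hst hs1
    obtain ⟨K, hK, hcont⟩ := exists_cellContent_heavyUnion_le (s := s) hc (by linarith)
      (by linarith) hs1 hC hε.le hψ hμ
    set S : ℕ → Set ℝ := fun k => {φ | φ ∈ Ico (0 : ℝ) 1 ∧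
      ENNReal.ofReal (2 ^ (-(ε / 12 * k))) < μ (heavyUnion μ (coneLin ψ φ) (t - 1 - ε) k)} with hS
    have hzero : cellContent lineCode s E = 0 := by
      have hlim := ENNReal.tendsto_sum_nat_add (fun k : ℕ =>
        K * ENNReal.ofReal (2 ^ (-(ε / 12 * k)))) (by
          rw [ENNReal.tsum_mul_left]
          exact ENNReal.mul_ne_top hK (tsum_ofReal_two_rpow_neg_ne_top (by positivity)))
      refine le_antisymm (ge_of_tendsto' hlim fun n => ?_) zero_le
      have hsub : E ⊆ ⋃ k, S (k + n) := by
        rintro φ ⟨hφ, hfr⟩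
        obtain ⟨k, hk, h⟩ := Filter.frequently_atTop.1 hfr n
        refine mem_iUnion.2 ⟨k - n, hφ, ?_⟩
        rwa [Nat.sub_add_cancel hk]
      exact (cellContent_mono hsub).trans ((cellContent_iUnion_le _).trans
        (ENNReal.tsum_le_tsum fun k => hcont (k + n)))
    have hH := hausdorffMeasure_eq_zero_of_cellContent_eq_zero fineCode_lineCode hs0 hzero
    refine dimH_le_of_hausdorffMeasure_ne_top (d := s.toNNReal) ?_
    rw [Real.coe_toNNReal _ hs0.le, hH]
    exact ENNReal.zero_ne_top
  refine le_of_forall_gt_imp_ge_of_dense fun r hr => ?_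
  by_cases hr1 : 1 ≤ r
  · exact (key 1 one_pos (by linarith) le_rfl).trans (by simpa using hr1)
  · push Not at hr1
    have hrtop : r ≠ ⊤ := (hr1.trans ENNReal.one_lt_top).ne
    have h0 : 0 < r.toReal := ENNReal.toReal_pos (ne_bot_of_gt hr) hrtop
    have h1 : (3 - t) / 2 < r.toReal :=
      (ENNReal.ofReal_lt_ofReal_iff h0).1 (by rwa [ENNReal.ofReal_toReal hrtop])
    have h2 : r.toReal ≤ 1 := ENNReal.toReal_le_of_le_ofReal zero_le_one (by simpa using hr1.le)
    exact (key _ h0 h1 h2).trans (ENNReal.ofReal_toReal hrtop).le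

end ExceptionalDirections

section Fibres

/-- A measure on the line that is dominated by length on fine dyadic intervals is dominated by
length. -/
lemma le_smul_volume_of_floor_le {ν : Measure ℝ} {r : ℝ≥0∞} (hr0 : r ≠ 0) (hr : r ≠ ⊤) (k : ℕ)
    (h : ∀ j, k ≤ j → ∀ n : ℤ, ν {y | ⌊(2 : ℝ) ^ j * y⌋ = n} ≤ r * ENNReal.ofReal (1 / 2 ^ j)) :
    ν ≤ r • volume := by
  have hIcc : ∀ a b : ℝ, a ≤ b → ν (Icc a b) ≤ r * ENNReal.ofReal (b - a) := by
    intro a b hab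
    have hj : ∀ j, k ≤ j → ν (Icc a b) ≤ r * ENNReal.ofReal (b - a + 2 * (1 / 2) ^ j) := by
      intro j hkj
      have h2 : (0 : ℝ) < 2 ^ j := by positivity
      have hsub : Icc a b ⊆ ⋃ n ∈ Finset.Icc ⌊(2 : ℝ) ^ j * a⌋ ⌊(2 : ℝ) ^ j * b⌋,
          {y : ℝ | ⌊(2 : ℝ) ^ j * y⌋ = n} := by
        intro y hy
        refine mem_biUnion (x := ⌊(2 : ℝ) ^ j * y⌋) ?_ rfl
        rw [Finset.mem_coe, Finset.mem_Icc]
        exact ⟨Int.floor_le_floor (by gcongr; exact hy.1),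
          Int.floor_le_floor (by gcongr; exact hy.2)⟩
      have hfl : ⌊(2 : ℝ) ^ j * a⌋ ≤ ⌊(2 : ℝ) ^ j * b⌋ := Int.floor_le_floor (by gcongr)
      calc ν (Icc a b) ≤ ∑ n ∈ Finset.Icc ⌊(2 : ℝ) ^ j * a⌋ ⌊(2 : ℝ) ^ j * b⌋,
            ν {y | ⌊(2 : ℝ) ^ j * y⌋ = n} :=
            (measure_mono hsub).trans (measure_biUnion_finset_le _ _)
        _ ≤ ∑ n ∈ Finset.Icc ⌊(2 : ℝ) ^ j * a⌋ ⌊(2 : ℝ) ^ j * b⌋,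
            r * ENNReal.ofReal (1 / 2 ^ j) := Finset.sum_le_sum fun n _ => h j hkj n
        _ ≤ r * ENNReal.ofReal (b - a + 2 * (1 / 2) ^ j) := by
            rw [Finset.sum_const, nsmul_eq_mul, Int.card_Icc, mul_left_comm,
              ← ENNReal.ofReal_natCast, ← ENNReal.ofReal_mul (by positivity)]
            refine mul_le_mul' le_rfl (ENNReal.ofReal_le_ofReal ?_)
            have hc : (((⌊(2 : ℝ) ^ j * b⌋ + 1 - ⌊(2 : ℝ) ^ j * a⌋).toNat : ℕ) : ℝ) =
                ⌊(2 : ℝ) ^ j * b⌋ + 1 - ⌊(2 : ℝ) ^ j * a⌋ := by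
              have := Int.toNat_of_nonneg (a := ⌊(2 : ℝ) ^ j * b⌋ + 1 - ⌊(2 : ℝ) ^ j * a⌋)
                (by omega)
              exact_mod_cast congrArg (Int.cast : ℤ → ℝ) this
            rw [hc, mul_one_div, div_le_iff₀ h2, one_div, inv_pow, add_mul,
              mul_assoc, inv_mul_cancel₀ h2.ne']
            have h3 := Int.floor_le ((2 : ℝ) ^ j * b)
            have h4 := Int.lt_floor_add_one ((2 : ℝ) ^ j * a)
            linarith
    have hlim : Filter.Tendsto (fun j : ℕ => r * ENNReal.ofReal (b - a + 2 * (1 / 2) ^ j))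
        Filter.atTop (nhds (r * ENNReal.ofReal (b - a))) := by
      refine ENNReal.Tendsto.const_mul (ENNReal.tendsto_ofReal ?_) (Or.inr hr)
      have := ((tendsto_pow_atTop_nhds_zero_of_lt_one (r := (1 / 2 : ℝ)) (by norm_num)
        (by norm_num)).const_mul 2).const_add (b - a)
      simpa using this
    refine ge_of_tendsto hlim ?_
    filter_upwards [Filter.eventually_ge_atTop k] with j hj' using hj j hj'
  have hle : r⁻¹ • ν ≤ μH[1] := by
    refine Measure.le_hausdorffMeasure 1 _ 1 one_pos fun s hs => ?_
    rw [ENNReal.rpow_one, Measure.smul_apply, smul_eq_mul]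
    have hb : Bornology.IsBounded s := by
      rw [isBounded_iff_ediam_ne_top]
      exact (hs.trans_lt ENNReal.one_lt_top).ne
    rcases s.eq_empty_or_nonempty with rfl | hne
    · simp
    rw [Real.ediam_eq hb]
    have hsub := hb.subset_Icc_sInf_sSup
    calc r⁻¹ * ν s ≤ r⁻¹ * (r * ENNReal.ofReal (sSup s - sInf s)) := by
          refine mul_le_mul' le_rfl ((measure_mono hsub).trans (hIcc _ _ ?_))
          exact Real.sInf_le_sSup s hb.bddBelow hb.bddAbove
      _ = _ := by rw [← mul_assoc, ENNReal.inv_mul_cancel hr0 hr, one_mul]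
  rw [hausdorffMeasure_real] at hle
  intro B
  have := hle B
  rw [Measure.smul_apply, smul_eq_mul] at this ⊢
  calc ν B = r * (r⁻¹ * ν B) := by rw [← mul_assoc, ENNReal.mul_inv_cancel hr0 hr, one_mul]
    _ ≤ _ := mul_le_mul' le_rfl this

/-- **Mass distribution principle** for dyadic cubes. -/
lemma le_dimH_of_measure_cubeCode_le {κ : Measure (Fin 3 → ℝ)} {D : ℝ≥0∞} (hD : D ≠ ⊤) {a : ℝ}
    (ha : 0 < a) {k₀ : ℕ} (h : ∀ k, k₀ ≤ k → ∀ i, κ {x | cubeCode k x = i} ≤ D * cellWeight a k)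
    {S : Set (Fin 3 → ℝ)} (hS : κ S ≠ 0) : ENNReal.ofReal a ≤ dimH S := by
  have hball : ∀ k, k₀ ≤ k → ∀ s : Set (Fin 3 → ℝ), ediam s ≤ ENNReal.ofReal (1 / 2 ^ k) →
      κ s ≤ 27 * D * cellWeight a k := by
    intro k hk s hs
    rcases s.eq_empty_or_nonempty with rfl | ⟨x, hx⟩
    · simp
    have hsub : s ⊆ ⋃ e ∈ Finset.Icc (-1 : Fin 3 → ℤ) 1, {y | cubeCode k y = cubeCode k x + e} := by
      intro y hy
      refine mem_biUnion (x := cubeCode k y - cubeCode k x) ?_ (by simp)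
      have hd : ∀ j, |2 ^ k * y j - 2 ^ k * x j| ≤ 1 := by
        intro j
        have h1 := (edist_le_ediam_of_mem hy hx).trans hs
        rw [edist_dist, ENNReal.ofReal_le_ofReal_iff (by positivity)] at h1
        have h2 := (dist_le_pi_dist y x j).trans h1
        rw [Real.dist_eq, le_div_iff₀ (by positivity)] at h2
        rw [← mul_sub, abs_mul, abs_of_pos (by positivity : (0 : ℝ) < 2 ^ k), mul_comm]
        exact h2
      rw [Finset.mem_coe, Finset.mem_Icc]
      refine ⟨fun j => ?_, fun j => ?_⟩
      · have h1 : ⌊(2 : ℝ) ^ k * x j⌋ - 1 ≤ ⌊(2 : ℝ) ^ k * y j⌋ := by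
          rw [← Int.floor_sub_one]
          exact Int.floor_le_floor (by linarith [(abs_le.1 (hd j)).1])
        simp only [cubeCode, Pi.neg_apply, Pi.one_apply, Pi.sub_apply]
        linarith
      · have h1 : ⌊(2 : ℝ) ^ k * y j⌋ ≤ ⌊(2 : ℝ) ^ k * x j⌋ + 1 := by
          rw [← Int.floor_add_one]
          exact Int.floor_le_floor (by linarith [(abs_le.1 (hd j)).2])
        simp only [cubeCode, Pi.one_apply, Pi.sub_apply]
        linarith
    calc κ s ≤ ∑ e ∈ Finset.Icc (-1 : Fin 3 → ℤ) 1, κ {y | cubeCode k y = cubeCode k x + e} :=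
          (measure_mono hsub).trans (measure_biUnion_finset_le _ _)
      _ ≤ ∑ e ∈ Finset.Icc (-1 : Fin 3 → ℤ) 1, D * cellWeight a k :=
          Finset.sum_le_sum fun e _ => h k hk _
      _ = 27 * D * cellWeight a k := by
          rw [Finset.sum_const, card_neighbours]
          simp [mul_assoc]
  set M : ℝ≥0∞ := 27 * D * 2 ^ a + 1 with hM
  have hM0 : M ≠ 0 := by simp [hM]
  have hMtop : M ≠ ⊤ := by
    rw [hM]
    have : (2 : ℝ≥0∞) ^ a ≠ ⊤ := ENNReal.rpow_ne_top_of_nonneg ha.le (by norm_num)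
    finiteness
  have hle : M⁻¹ • κ ≤ μH[a] := by
    refine Measure.le_hausdorffMeasure a _ (ENNReal.ofReal (1 / 2 ^ k₀))
      (ENNReal.ofReal_pos.2 (by positivity)) fun s hs => ?_
    rw [Measure.smul_apply, smul_eq_mul, mul_comm, ← div_eq_mul_inv]
    refine ENNReal.div_le_of_le_mul ?_
    rcases eq_or_ne (ediam s) 0 with h0 | h0
    · have hlim : Filter.Tendsto (fun k => 27 * D * cellWeight a k) Filter.atTop
          (nhds (27 * D * 0)) :=
        ENNReal.Tendsto.const_mul (tendsto_cellWeight ha) (Or.inr (by finiteness))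
      rw [mul_zero] at hlim
      refine le_trans (ge_of_tendsto hlim ?_) zero_le
      filter_upwards [Filter.eventually_ge_atTop k₀] with k hk
      exact hball k hk s (by rw [h0]; exact zero_le)
    · have htop : ediam s ≠ ⊤ := (hs.trans_lt ENNReal.ofReal_lt_top).ne
      set d := (ediam s).toReal with hd
      have hds : ENNReal.ofReal d = ediam s := ENNReal.ofReal_toReal htop
      have hd0 : 0 < d := ENNReal.toReal_pos h0 htop
      have hdk : d ≤ (1 / 2) ^ k₀ := by
        rw [← hds, ENNReal.ofReal_le_ofReal_iff (by positivity)] at hs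
        simpa using hs
      obtain ⟨n, hn1, hn2⟩ := exists_nat_pow_near_of_lt_one hd0
        (hdk.trans (pow_le_one₀ (by norm_num) (by norm_num)))
        (by norm_num : (0 : ℝ) < 1 / 2) (by norm_num)
      have hkn : k₀ ≤ n := by
        have := (pow_lt_pow_iff_right_of_lt_one₀ (by norm_num : (0 : ℝ) < 1 / 2)
          (by norm_num)).1 (hn1.trans_le hdk)
        omega
      have hw : cellWeight a n ≤ 2 ^ a * ediam s ^ a := by
        rw [← ofReal_one_div_two_pow_rpow ha.le, ← ENNReal.mul_rpow_of_nonneg _ _ ha.le]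
        refine ENNReal.rpow_le_rpow ?_ ha.le
        rw [← hds, ← ENNReal.ofReal_ofNat 2, ← ENNReal.ofReal_mul (by norm_num)]
        refine ENNReal.ofReal_le_ofReal ?_
        rw [pow_succ] at hn1
        rw [← one_div_pow]
        linarith
      calc κ s ≤ 27 * D * cellWeight a n := hball n hkn s (by
            rw [← hds]
            exact ENNReal.ofReal_le_ofReal (by rwa [← one_div_pow]))
        _ ≤ 27 * D * (2 ^ a * ediam s ^ a) := mul_le_mul' le_rfl hw
        _ ≤ ediam s ^ a * M := by
            rw [hM, mul_comm (ediam s ^ a), ← mul_assoc]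
            exact mul_le_mul' le_self_add le_rfl
  have hpos : μH[a] S ≠ 0 := by
    refine (lt_of_lt_of_le ?_ (hle S)).ne'
    rw [Measure.smul_apply, smul_eq_mul, pos_iff_ne_zero]
    exact mul_ne_zero (ENNReal.inv_ne_zero.2 hMtop) hS
  refine le_dimH_of_hausdorffMeasure_ne_zero (d := a.toNNReal) ?_
  rwa [Real.coe_toNNReal _ ha.le]

end Fibres

section Fibres

/-- Disintegration: if the pieces of a measure have images with bounded densities, then the fibre
measures over a set of positive length give correspondingly small mass to the pieces. -/
lemma exists_fibre_measures {ι : Type*} [Countable ι] {μ : Measure (Fin 3 → ℝ)} [IsFiniteMeasure μ]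
    {p : (Fin 3 → ℝ) → ℝ} (hp : Measurable p) {G : Set (Fin 3 → ℝ)} (hG : MeasurableSet G)
    (hμG : μ G ≠ 0) {Q : ι → Set (Fin 3 → ℝ)} (hQm : ∀ i, MeasurableSet (Q i))
    (hQu : ⋃ i, Q i = univ) {r : ι → ℝ≥0∞}
    (hQ : ∀ i, (μ.restrict (G ∩ Q i)).map p ≤ r i • volume) :
    ∃ H : Set ℝ, 0 < volume H ∧ ∀ y ∈ H, ∃ κ : Measure (Fin 3 → ℝ), IsProbabilityMeasure κ ∧
      ∃ D : ℝ≥0∞, D ≠ ⊤ ∧ κ (G ∩ p ⁻¹' {y})ᶜ = 0 ∧ ∀ i, κ (Q i) ≤ D * r i := by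
  have hpx : Measurable fun x : Fin 3 → ℝ => (p x, x) := hp.prodMk measurable_id
  set ρ : Measure (ℝ × (Fin 3 → ℝ)) := (μ.restrict G).map (fun x => (p x, x)) with hρ
  have hρf : ρ.fst = (μ.restrict G).map p := by
    rw [Measure.fst, hρ, Measure.map_map measurable_fst hpx]
    rfl
  have hpiece : ∀ i, ∀ B : Set ℝ, MeasurableSet B → ρ (B ×ˢ Q i) ≤ r i * volume B := by
    intro i B hB
    have := hQ i B
    rw [Measure.map_apply hp hB, Measure.restrict_apply (hp hB), Measure.smul_apply, smul_eq_mul]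
      at this
    rw [hρ, Measure.map_apply hpx (hB.prod (hQm i)), Measure.restrict_apply (hpx (hB.prod (hQm i)))]
    refine le_trans (measure_mono ?_) this
    rintro x ⟨⟨h1, h2⟩, h3⟩
    exact ⟨h1, h3, h2⟩
  have hac : ρ.fst ≪ volume := by
    refine Measure.AbsolutelyContinuous.mk fun B hB hB0 => ?_
    rw [Measure.fst_apply hB]
    have hsub : (Prod.fst ⁻¹' B : Set (ℝ × (Fin 3 → ℝ))) ⊆ ⋃ i, B ×ˢ Q i := by
      rintro ⟨y, x⟩ hy
      obtain ⟨i, hi⟩ := mem_iUnion.1 (hQu ▸ mem_univ x)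
      exact mem_iUnion.2 ⟨i, hy, hi⟩
    refine measure_mono_null hsub (measure_iUnion_null fun i => ?_)
    simpa [hB0] using hpiece i B hB
  set f := ρ.fst.rnDeriv volume with hf
  have hfm : Measurable f := Measure.measurable_rnDeriv _ _
  have hwd : volume.withDensity f = ρ.fst := Measure.withDensity_rnDeriv_eq _ _ hac
  have hfQ : ∀ i, ∀ᵐ y, f y * ρ.condKernel y (Q i) ≤ r i := by
    intro i
    have hκm : Measurable fun y => ρ.condKernel y (Q i) := ρ.condKernel.measurable_coe (hQm i)
    refine ae_le_of_forall_setLIntegral_le_of_sigmaFinite (hfm.mul hκm) (g := fun _ => r i) ?_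
    intro B hB _
    rw [setLIntegral_const]
    refine le_trans (le_of_eq ?_) (hpiece i B hB)
    rw [← Measure.setLIntegral_condKernel_eq_measure_prod hB (hQm i), ← hwd,
      setLIntegral_withDensity_eq_setLIntegral_mul _ hfm hκm hB]
    rfl
  have hconc : ∀ᵐ y ∂ρ.fst, ρ.condKernel y (G ∩ p ⁻¹' {y})ᶜ = 0 := by
    have hS : MeasurableSet {z : ℝ × (Fin 3 → ℝ) | ¬ (z.2 ∈ G ∧ p z.2 = z.1)} :=
      ((measurable_snd hG).inter
        (measurableSet_eq_fun (hp.comp measurable_snd) measurable_fst)).compl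
    have h0 : ρ {z : ℝ × (Fin 3 → ℝ) | ¬ (z.2 ∈ G ∧ p z.2 = z.1)} = 0 := by
      rw [hρ, Measure.map_apply hpx hS, Measure.restrict_apply (hpx hS)]
      convert measure_empty (μ := μ)
      ext x
      simp
    rw [← Measure.lintegral_condKernel_mem hS, lintegral_eq_zero_iff] at h0
    · filter_upwards [h0] with y hy
      refine measure_mono_null ?_ hy
      intro x hx
      simpa using hx
    · exact ProbabilityTheory.Kernel.measurable_kernel_prodMk_left hS
  rw [← hwd, ae_withDensity_iff hfm] at hconc
  have hfin : ∀ᵐ y, f y < ⊤ := Measure.rnDeriv_lt_top _ _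
  have hall : ∀ᵐ y, (f y ≠ 0 → ρ.condKernel y (G ∩ p ⁻¹' {y})ᶜ = 0) ∧ f y < ⊤ ∧
      ∀ i, f y * ρ.condKernel y (Q i) ≤ r i := by
    filter_upwards [hconc, hfin, ae_all_iff.2 hfQ] with y h1 h2 h3 using ⟨h1, h2, h3⟩
  refine ⟨{y | f y ≠ 0 ∧ (f y ≠ 0 → ρ.condKernel y (G ∩ p ⁻¹' {y})ᶜ = 0) ∧ f y < ⊤ ∧
      ∀ i, f y * ρ.condKernel y (Q i) ≤ r i}, ?_, ?_⟩
  · rw [pos_iff_ne_zero]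
    intro h0
    have : ∀ᵐ y, f y = 0 := by
      have h0' := measure_eq_zero_iff_ae_notMem.1 h0
      filter_upwards [h0', hall] with y h1 h2
      by_contra h
      exact h1 ⟨h, h2⟩
    apply hμG
    have hu : ρ.fst univ = μ G := by
      rw [hρf, Measure.map_apply hp MeasurableSet.univ]; simp
    rw [← hu, ← hwd, withDensity_apply _ MeasurableSet.univ, lintegral_eq_zero_iff hfm]
    exact ae_restrict_of_ae this
  · rintro y ⟨h1, h2, h3, h4⟩
    refine ⟨ρ.condKernel y, inferInstance, (f y)⁻¹, ENNReal.inv_ne_top.2 h1, h2 h1, fun i => ?_⟩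
    rw [mul_comm, ← div_eq_mul_inv, ENNReal.le_div_iff_mul_le (Or.inl h1) (Or.inl h3.ne), mul_comm]
    exact h4 i

end Fibres

section FibreDimension

open Filter Topology

lemma map_restrict_le_of_disjoint_heavyUnion {μ : Measure (Fin 3 → ℝ)} {p : (Fin 3 → ℝ) → ℝ}
    (hp : Measurable p) {G : Set (Fin 3 → ℝ)} {a : ℝ} {k : ℕ}
    (hG : Disjoint G (heavyUnion μ p a k)) (i : Fin 3 → ℤ) :
    (μ.restrict (G ∩ {x | cubeCode k x = i})).map p ≤ cellWeight a k • volume := by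
  refine le_smul_volume_of_floor_le (ENNReal.ofReal_pos.2 (by positivity)).ne' ENNReal.ofReal_ne_top
    k fun j hkj n => ?_
  have hm : MeasurableSet {y : ℝ | ⌊(2 : ℝ) ^ j * y⌋ = n} :=
    measurable_floor_two_pow j (measurableSet_singleton n)
  rw [Measure.map_apply hp hm, Measure.restrict_apply (hp hm)]
  rcases (p ⁻¹' {y : ℝ | ⌊(2 : ℝ) ^ j * y⌋ = n} ∩ (G ∩ {x | cubeCode k x = i})).eq_empty_or_nonempty
    with he | ⟨x, hx1, hxG, hx2⟩
  · rw [he]; simp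
  · have hx : x ∉ heavySet μ p a k j := fun h =>
      disjoint_left.1 hG hxG (mem_iUnion.2 ⟨j, h⟩)
    have hle := not_lt.1 fun h => hx ⟨j, hkj, le_rfl, h⟩
    rw [cellWeight, ← ENNReal.ofReal_mul (by positivity)]
    refine le_trans (measure_mono ?_) hle
    rintro z ⟨hz1, -, hz2⟩
    exact ⟨Eq.trans hz2 (Eq.symm hx2), Eq.trans hz1 (Eq.symm hx1)⟩

/-- If the heavy slabs carry little mass at all large levels, then many fibres are large. -/
lemma volume_fibres_pos {μ : Measure (Fin 3 → ℝ)} [IsProbabilityMeasure μ] {A : Set (Fin 3 → ℝ)}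
    (hA : MeasurableSet A) (hμA : μ Aᶜ = 0) {p : (Fin 3 → ℝ) → ℝ} (hp : Measurable p) {t : ℝ}
    (h : ∀ N : ℕ, ∀ᶠ k : ℕ in atTop, μ (heavyUnion μ p (t - 1 - 1 / (N + 1)) k) ≤
      ENNReal.ofReal (2 ^ (-(1 / ((N : ℝ) + 1) / 12 * k)))) :
    0 < volume {y : ℝ | ENNReal.ofReal (t - 1) ≤ dimH (A ∩ p ⁻¹' {y})} := by
  obtain ⟨δ, hδ0, hδ⟩ := ENNReal.exists_pos_sum_of_countable' (one_ne_zero (α := ℝ≥0∞)) ℕ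
  have hK : ∀ N : ℕ, ∃ K : ℕ,
      ∑' k : ℕ, μ (heavyUnion μ p (t - 1 - 1 / ((N : ℝ) + 1)) (k + K)) ≤ δ N := by
    intro N
    have h1 := ENNReal.tendsto_sum_nat_add _
      (tsum_ofReal_two_rpow_neg_ne_top (η := 1 / ((N : ℝ) + 1) / 12) (by positivity))
    have h2 := h1.eventually (gt_mem_nhds (hδ0 N))
    obtain ⟨K, hK1, hK2⟩ := (h2.and (eventually_forall_ge_atTop.2 (h N))).exists
    exact ⟨K, (ENNReal.tsum_le_tsum fun k => hK2 (k + K) (Nat.le_add_left _ _)).trans hK1.le⟩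
  choose K hK using hK
  set U : Set (Fin 3 → ℝ) :=
    ⋃ N : ℕ, ⋃ k : ℕ, heavyUnion μ p (t - 1 - 1 / ((N : ℝ) + 1)) (k + K N) with hU
  have hUm : MeasurableSet U := MeasurableSet.iUnion fun N => MeasurableSet.iUnion fun k =>
    measurableSet_heavyUnion μ hp _ _
  have hμU : μ U < 1 := by
    refine lt_of_le_of_lt ((measure_iUnion_le _).trans (ENNReal.tsum_le_tsum fun N => ?_)) hδ
    exact (measure_iUnion_le _).trans (hK N)
  have hμG : μ (A \ U) ≠ 0 := by
    intro h0
    have hsub : (univ : Set (Fin 3 → ℝ)) ⊆ (A \ U ∪ Aᶜ) ∪ U := by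
      intro x _
      by_cases h1 : x ∈ U
      · exact Or.inr h1
      · by_cases h2 : x ∈ A
        · exact Or.inl (Or.inl ⟨h2, h1⟩)
        · exact Or.inl (Or.inr h2)
    have h1 := (measure_mono (μ := μ) hsub).trans
      ((measure_union_le _ _).trans (add_le_add_left (measure_union_le _ _) _))
    rw [h0, hμA, measure_univ, zero_add, zero_add] at h1
    exact absurd h1 (not_le.2 hμU)
  have hdisj : ∀ N k : ℕ,
      Disjoint (A \ U) (heavyUnion μ p (t - 1 - 1 / ((N : ℝ) + 1)) (k + K N)) := by
    intro N k
    rw [disjoint_left]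
    exact fun x hx hx' => hx.2 (mem_iUnion.2 ⟨N, mem_iUnion.2 ⟨k, hx'⟩⟩)
  let Q : ℕ × ℕ × (Fin 3 → ℤ) → Set (Fin 3 → ℝ) := fun q => {x | cubeCode (q.2.1 + K q.1) x = q.2.2}
  let r : ℕ × ℕ × (Fin 3 → ℤ) → ℝ≥0∞ :=
    fun q => cellWeight (t - 1 - 1 / ((q.1 : ℝ) + 1)) (q.2.1 + K q.1)
  have hQm : ∀ q, MeasurableSet (Q q) := fun q => measurableSet_cubeCode_eq _ _
  have hQu : ⋃ q, Q q = univ :=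
    eq_univ_of_forall fun x => mem_iUnion.2 ⟨(0, 0, cubeCode (0 + K 0) x), rfl⟩
  have hQr : ∀ q, (μ.restrict ((A \ U) ∩ Q q)).map p ≤ r q • volume := fun q =>
    map_restrict_le_of_disjoint_heavyUnion hp (hdisj q.1 q.2.1) q.2.2
  obtain ⟨H, hH, hfib⟩ := exists_fibre_measures hp (hA.diff hUm) hμG hQm hQu hQr
  refine hH.trans_le (measure_mono fun y hy => ?_)
  obtain ⟨κ, hκ, D, hD, hκ0, hκQ⟩ := hfib y hy
  have hne : κ (A ∩ p ⁻¹' {y}) ≠ 0 := by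
    intro h0
    have h1 : κ ((A \ U) ∩ p ⁻¹' {y}) = 0 :=
      measure_mono_null (inter_subset_inter_left _ sdiff_subset) h0
    have h2 := measure_union_null h1 hκ0
    rw [union_compl_self, measure_univ] at h2
    exact one_ne_zero h2
  have hlim : Tendsto (fun N : ℕ => ENNReal.ofReal (t - 1 - 1 / ((N : ℝ) + 1))) atTop
      (𝓝 (ENNReal.ofReal (t - 1))) := by
    refine (ENNReal.continuous_ofReal.tendsto _).comp ?_
    simpa using (tendsto_const_nhds (x := t - 1)).sub (tendsto_one_div_add_atTop_nhds_zero_nat (𝕜 := ℝ))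
  refine le_of_tendsto' hlim fun N => ?_
  rcases le_or_gt (t - 1 - 1 / ((N : ℝ) + 1)) 0 with ha | ha
  · rw [ENNReal.ofReal_of_nonpos ha]; exact zero_le
  refine le_dimH_of_measure_cubeCode_le (k₀ := K N) hD ha (fun k hk i => ?_) hne
  have := hκQ (N, k - K N, i)
  simp only [Q, r, Nat.sub_add_cancel hk] at this
  exact this

/-- The theorem in normalised coordinates. -/
theorem dimH_small_fibres_le {c t : ℝ} (hc : 0 < c) (ht : 1 < t) {ψ m : ℝ → ℝ}
    (hψ : NormCurve c ψ m) {A : Set (Fin 3 → ℝ)} (hA : MeasurableSet A) (hpos : 0 < μH[t] A) :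
    dimH {φ : ℝ | φ ∈ Ico (0 : ℝ) 1 ∧
      volume {y : ℝ | ENNReal.ofReal (t - 1) ≤ dimH (A ∩ coneLin ψ φ ⁻¹' {y})} = 0} ≤
        ENNReal.ofReal ((3 - t) / 2) := by
  obtain ⟨μ, hμ, hμA, C, hC, hfr⟩ := exists_frostman_measure (by linarith) hA hpos
  have hsub : {φ : ℝ | φ ∈ Ico (0 : ℝ) 1 ∧
      volume {y : ℝ | ENNReal.ofReal (t - 1) ≤ dimH (A ∩ coneLin ψ φ ⁻¹' {y})} = 0} ⊆
      ⋃ N : ℕ, {φ | φ ∈ Ico (0 : ℝ) 1 ∧ ∃ᶠ k : ℕ in atTop,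
        ENNReal.ofReal (2 ^ (-(1 / ((N : ℝ) + 1) / 12 * k))) <
          μ (heavyUnion μ (coneLin ψ φ) (t - 1 - 1 / ((N : ℝ) + 1)) k)} := by
    rintro φ ⟨hφ, h0⟩
    by_contra hcon
    refine (volume_fibres_pos hA hμA (continuous_coneLin ψ φ).measurable fun N => ?_).ne' h0
    have h1 : ¬ ∃ᶠ k : ℕ in atTop, ENNReal.ofReal (2 ^ (-(1 / ((N : ℝ) + 1) / 12 * k))) <
        μ (heavyUnion μ (coneLin ψ φ) (t - 1 - 1 / ((N : ℝ) + 1)) k) :=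
      fun h2 => hcon (mem_iUnion.2 ⟨N, hφ, h2⟩)
    rw [not_frequently] at h1
    exact h1.mono fun k hk => not_lt.1 hk
  refine (dimH_mono hsub).trans ?_
  rw [dimH_iUnion]
  exact iSup_le fun N => dimH_frequently_heavyUnion_le hc ht hC (by positivity) hψ hfr

end FibreDimension

section LocalGraph

open Filter Topology

lemma eventually_quad_of_hasStrictDerivAt {ψ m : ℝ → ℝ} (h : ∀ᶠ x in 𝓝 0, HasDerivAt ψ (m x) x)
    (hm : HasStrictDerivAt m 1 0) :
    ∀ᶠ r in 𝓝[>] (0 : ℝ), ∀ x ∈ Icc (-r) r, ∀ y ∈ Icc (-r) r,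
      1 / 4 * (y - x) ^ 2 ≤ ψ y - ψ x - m x * (y - x) ∧
        ψ y - ψ x - m x * (y - x) ≤ (y - x) ^ 2 := by
  obtain ⟨s, hs, happ⟩ := hm.hasStrictFDerivAt.approximates_deriv_on_nhds (c := 1 / 4)
    (Or.inr (by norm_num))
  obtain ⟨ε, hε, hball⟩ := Metric.mem_nhds_iff.1 (inter_mem h hs)
  filter_upwards [Ioo_mem_nhdsGT hε] with r hr x hx y hy
  have hmem : ∀ z ∈ Icc (-r) r, HasDerivAt ψ (m z) z ∧ z ∈ s := fun z hz =>
    hball (by rw [mem_ball_zero_iff, Real.norm_eq_abs]; exact (abs_le.2 hz).trans_lt hr.2)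
  have hsub : uIcc x y ⊆ Icc (-r) r := (convex_Icc (-r) r).ordConnected.uIcc_subset hx hy
  have hmv := (convex_uIcc x y).norm_image_sub_le_of_norm_hasDerivWithin_le
    (f := fun z => ψ z - m x * z - 1 / 2 * (z - x) ^ 2) (f' := fun z => m z - m x - (z - x))
    (C := 1 / 4 * |y - x|)
    (fun z hz => by
      have := ((hmem z (hsub hz)).1.sub ((hasDerivAt_id z).const_mul (m x))).sub
        ((((hasDerivAt_id z).sub_const x).pow 2).const_mul (1 / 2))
      refine (this.congr_deriv ?_).hasDerivWithinAt
      simp)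
    (fun z hz => by
      have := happ z (hmem z (hsub hz)).2 x (hmem x hx).2
      refine le_trans (le_of_eq_of_le ?_ this) ?_
      · simp
      · simp only [Real.norm_eq_abs, NNReal.coe_div, NNReal.coe_one, NNReal.coe_ofNat]
        exact mul_le_mul_of_nonneg_left (abs_sub_left_of_mem_uIcc hz) (by norm_num))
    left_mem_uIcc right_mem_uIcc
  rw [Real.norm_eq_abs, Real.norm_eq_abs, mul_assoc, abs_mul_abs_self] at hmv
  have := abs_le.1 hmv
  constructor <;> nlinarith

/-- A nondegenerate space curve, projectively reparametrised near a point as the graph of a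
uniformly convex function. -/
lemma exists_normCurve_reparam {α β δ : ℝ → ℝ} (hα : ContDiff ℝ 2 α) (hβ : ContDiff ℝ 2 β)
    (hδ : ContDiff ℝ 2 δ) {θ₀ : ℝ} (hα0 : α θ₀ = 1) (hβ0 : β θ₀ = 0) (hδ0 : δ θ₀ = 0)
    (hα1 : deriv α θ₀ = 0) (hβ1 : deriv β θ₀ = 1) (hδ1 : deriv δ θ₀ = 0)
    (hδ2 : deriv (deriv δ) θ₀ = 1) :
    ∃ r > 0, ∃ (ψ m h : ℝ → ℝ) (K : NNReal), NormCurve (1 / 4) ψ m ∧ LipschitzOnWith K h (Ico 0 1) ∧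
      ∀ᶠ θ in 𝓝 θ₀, 0 < α θ ∧ ∃ s ∈ Ico (0 : ℝ) 1, h s = θ ∧ β θ = α θ * (2 * r * s - r) ∧
        δ θ = α θ * (4 * r ^ 2 * ψ s) := by
  have hd : ∀ {f : ℝ → ℝ}, ContDiff ℝ 2 f → (∀ x, HasDerivAt f (deriv f x) x) ∧
      ContDiff ℝ 1 (deriv f) ∧ ∀ x, HasDerivAt (deriv f) (deriv (deriv f) x) x := by
    intro f hf
    have h1 : ContDiff ℝ 1 (deriv f) := ((contDiff_succ_iff_deriv (n := 1)).1 hf).2.2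
    exact ⟨fun x => (hf.differentiable (by norm_num) x).hasDerivAt, h1,
      fun x => (h1.differentiable (by norm_num) x).hasDerivAt⟩
  obtain ⟨dα, cα, ddα⟩ := hd hα
  obtain ⟨dβ, cβ, ddβ⟩ := hd hβ
  obtain ⟨dδ, cδ, ddδ⟩ := hd hδ
  set P : ℝ → ℝ := fun θ => deriv β θ * α θ - β θ * deriv α θ with hP
  set N : ℝ → ℝ := fun θ => deriv δ θ * α θ - δ θ * deriv α θ with hN
  have hα' : ContDiff ℝ 1 α := hα.of_le (by norm_num)
  have hPc : ContDiff ℝ 1 P := (cβ.mul hα').sub ((hβ.of_le (by norm_num)).mul cα)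
  have hNc : ContDiff ℝ 1 N := (cδ.mul hα').sub ((hδ.of_le (by norm_num)).mul cα)
  have hP0 : P θ₀ = 1 := by simp [hP, hα0, hβ1, hα1]
  have hN0 : N θ₀ = 0 := by simp [hN, hδ0, hδ1]
  set u : ℝ → ℝ := fun θ => β θ / α θ with hu
  set w : ℝ → ℝ := fun θ => δ θ / α θ with hw
  have hu0 : u θ₀ = 0 := by simp [hu, hβ0]
  have hw0 : w θ₀ = 0 := by simp [hw, hδ0]
  have hαne : α θ₀ ≠ 0 := by rw [hα0]; exact one_ne_zero
  have hPne : P θ₀ ≠ 0 := by rw [hP0]; exact one_ne_zero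
  have du : ∀ θ, α θ ≠ 0 → HasDerivAt u (P θ / α θ ^ 2) θ := fun θ h => (dβ θ).div (dα θ) h
  have dw : ∀ θ, α θ ≠ 0 → HasDerivAt w (N θ / α θ ^ 2) θ := fun θ h => (dδ θ).div (dα θ) h
  have hus : HasStrictDerivAt u 1 θ₀ := by
    refine (hβ.contDiffAt.div hα.contDiffAt hαne).hasStrictDerivAt' ?_ (by norm_num)
    have := du θ₀ hαne
    rwa [hP0, hα0, one_pow, div_one] at this
  have hqs : HasStrictDerivAt (fun θ => N θ / P θ) 1 θ₀ := by
    refine (hNc.contDiffAt.div hPc.contDiffAt hPne).hasStrictDerivAt' ?_ (by norm_num)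
    have dN : HasDerivAt N 1 θ₀ := by
      refine (((ddδ θ₀).mul (dα θ₀)).sub ((dδ θ₀).mul (ddα θ₀))).congr_deriv ?_
      simp [hδ2, hα0, hδ0, hδ1]
    refine (dN.div (hPc.differentiable (by norm_num) θ₀).hasDerivAt hPne).congr_deriv ?_
    simp [hN0, hP0]
  set g := hus.localInverse u 1 θ₀ one_ne_zero with hg
  have hgs : HasStrictDerivAt g 1 0 := by
    have := hus.to_localInverse one_ne_zero
    rwa [hu0, inv_one] at this
  have hgl : ∀ᶠ θ in 𝓝 θ₀, g (u θ) = θ :=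
    (hus.hasStrictFDerivAt_equiv one_ne_zero).eventually_left_inverse
  have hgr : ∀ᶠ φ in 𝓝 0, u (g φ) = φ := by
    have := (hus.hasStrictFDerivAt_equiv one_ne_zero).eventually_right_inverse
    rwa [hu0] at this
  have hg0 : g 0 = θ₀ := by simpa [hu0] using hgl.self_of_nhds
  have hgc : Tendsto g (𝓝 0) (𝓝 θ₀) := by
    have := hgs.hasDerivAt.continuousAt.tendsto
    rwa [hg0] at this
  obtain ⟨K, S, hS, hKS⟩ := hgs.hasStrictFDerivAt.exists_lipschitzOnWith
  have hψd : ∀ᶠ φ in 𝓝 0, HasDerivAt (fun φ => w (g φ)) (N (g φ) / P (g φ)) φ := by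
    have e1 := hgc.eventually (hα.continuous.continuousAt.eventually_ne hαne)
    have e2 := hgc.eventually (hPc.continuous.continuousAt.eventually_ne hPne)
    filter_upwards [e1, e2, hgr.eventually_nhds, eventually_mem_nhds_iff.2 hS] with φ h1 h2 h3 h4
    have hdg : HasDerivAt g (P (g φ) / α (g φ) ^ 2)⁻¹ φ :=
      HasDerivAt.of_local_left_inverse (hKS.continuousOn.continuousAt h4) (du _ h1)
        (div_ne_zero h2 (pow_ne_zero _ h1)) h3
    refine ((dw _ h1).comp φ hdg).congr_deriv ?_
    field_simp
  have hms : HasStrictDerivAt (fun φ => N (g φ) / P (g φ)) 1 0 := by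
    rw [← hg0] at hqs
    have := hqs.comp 0 hgs
    rwa [mul_one] at this
  obtain ⟨ε, hε, hεS⟩ := Metric.mem_nhds_iff.1 hS
  obtain ⟨r, hquad, hr⟩ := ((eventually_quad_of_hasStrictDerivAt hψd hms).and
    (Ioo_mem_nhdsGT hε)).exists
  have hr0 : 0 < r := hr.1
  have hIcc : ∀ s ∈ Icc (0 : ℝ) 1, 2 * r * s - r ∈ Icc (-r) r := fun s hs =>
    ⟨by nlinarith [hs.1], by nlinarith [hs.2]⟩
  have h0r : (0 : ℝ) ∈ Icc (-r) r := ⟨by linarith, hr0.le⟩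
  refine ⟨r, hr0, fun s => w (g (2 * r * s - r)) / (4 * r ^ 2),
    fun s => N (g (2 * r * s - r)) / P (g (2 * r * s - r)) / (2 * r),
    fun s => g (2 * r * s - r), K * (2 * r).toNNReal, ⟨?_, ?_, ?_⟩, ?_, ?_⟩
  · intro x hx y hy
    obtain ⟨h1, h2⟩ := hquad _ (hIcc x hx) _ (hIcc y hy)
    have e : ∀ X Y M : ℝ, Y / (4 * r ^ 2) - X / (4 * r ^ 2) - M / (2 * r) * (y - x) =
        (Y - X - M * (2 * r * y - r - (2 * r * x - r))) / (4 * r ^ 2) := by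
      intro X Y M; field_simp; ring
    simp only [e]
    rw [le_div_iff₀ (by positivity), div_le_iff₀ (by positivity)]
    constructor <;> nlinarith
  · intro x hx
    obtain ⟨h1, h2⟩ := hquad 0 h0r _ (hIcc x hx)
    simp only [hg0, hw0, hN0, zero_div, zero_mul, sub_zero] at h1 h2
    have hx' := hIcc x hx
    set X := 2 * r * x - r
    rw [abs_of_nonneg (div_nonneg (by nlinarith [sq_nonneg X]) (by positivity)),
      div_le_one (by positivity)]
    nlinarith [sq_le_sq' hx'.1 hx'.2]
  · intro x hx
    obtain ⟨h1, h2⟩ := hquad 0 h0r _ (hIcc x hx)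
    obtain ⟨h3, h4⟩ := hquad _ (hIcc x hx) 0 h0r
    simp only [hg0, hw0, hN0, zero_div, zero_mul, sub_zero, zero_sub] at h1 h2 h3 h4
    have hx' := hIcc x hx
    set X := 2 * r * x - r
    set M := N (g X) / P (g X)
    rw [abs_div, abs_of_pos (by positivity : 0 < 2 * r), div_le_one (by positivity)]
    have h5 : M * X ≤ 2 * X ^ 2 := by nlinarith
    have h6 : 0 ≤ M * X := by nlinarith [sq_nonneg X]
    rcases eq_or_ne X 0 with hX | hX
    · simp only [M, hX, hg0, hN0]; simp; exact hr0.le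
    have h7 : |M| * |X| ≤ 2 * |X| * |X| := by
      rw [← abs_mul, abs_of_nonneg h6, mul_assoc, abs_mul_abs_self]; nlinarith
    have h8 := le_of_mul_le_mul_right h7 (abs_pos.2 hX)
    linarith [abs_le.2 hx']
  · refine LipschitzOnWith.comp (g := g) (f := fun s => 2 * r * s - r) hKS ?_ ?_
    · refine LipschitzOnWith.of_dist_le_mul fun x _ y _ => ?_
      rw [Real.dist_eq, Real.dist_eq, Real.coe_toNNReal _ (by linarith)]
      have : 2 * r * x - r - (2 * r * y - r) = 2 * r * (x - y) := by ring
      rw [this, abs_mul, abs_of_pos (by positivity : 0 < 2 * r)]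
    · intro s hs
      refine hεS ?_
      rw [mem_ball_zero_iff, Real.norm_eq_abs]
      exact (abs_le.2 (hIcc s (Ico_subset_Icc_self hs))).trans_lt hr.2
  · have e1 := hα.continuous.continuousAt.eventually (lt_mem_nhds (hα0 ▸ one_pos : 0 < α θ₀))
    have e2 : ∀ᶠ θ in 𝓝 θ₀, u θ ∈ Ioo (-r) r :=
      hus.hasDerivAt.continuousAt.eventually (by
        rw [hu0]; exact Ioo_mem_nhds (by linarith) hr0)
    filter_upwards [e1, e2, hgl] with θ h1 h2 h3
    have hs : 2 * r * ((u θ + r) / (2 * r)) - r = u θ := by field_simp; ring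
    refine ⟨h1, (u θ + r) / (2 * r), ⟨?_, ?_⟩, ?_, ?_, ?_⟩
    · exact div_nonneg (by linarith [h2.1]) (by linarith)
    · rw [div_lt_one (by linarith)]; linarith [h2.2]
    · simp only [hs, h3]
    · rw [hs, hu]; field_simp
    · simp only [hs, h3, hw]; field_simp

end LocalGraph

section LinearChange

open Filter Topology

/-- The points of the line spanned by `γ θ` whose fibre meets `A` in dimension at least `t - 1`. -/
def largeFibres (γ : ℝ → E3) (A : Set E3) (t θ : ℝ) : Set E3 :=
  {y : E3 | y ∈ (Submodule.span ℝ {γ θ} : Submodule ℝ E3) ∧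
    ENNReal.ofReal (t - 1) ≤ dimH ({x : E3 | lineProj γ θ x = y} ∩ A)}

lemma hausdorffMeasure_largeFibres_pos {γ : ℝ → E3} {A : Set E3} {t θ α : ℝ} (hγ : ‖γ θ‖ = 1)
    (hα : 0 < α) (L : E3 ≃L[ℝ] (Fin 3 → ℝ)) {p : (Fin 3 → ℝ) → ℝ}
    (hp : ∀ x, ⟪x, γ θ⟫ = α * p (L x))
    (h : 0 < volume {y : ℝ | ENNReal.ofReal (t - 1) ≤ dimH (L '' A ∩ p ⁻¹' {y})}) :
    0 < μH[1] (largeFibres γ A t θ) := by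
  have hanti : AntilipschitzWith (α⁻¹).toNNReal (fun y : ℝ => (α * y) • γ θ) := by
    refine AntilipschitzWith.of_le_mul_dist fun x y => ?_
    rw [Real.coe_toNNReal _ (by positivity), dist_eq_norm, dist_eq_norm, ← sub_smul, norm_smul, hγ,
      mul_one, ← mul_sub, norm_mul, Real.norm_of_nonneg hα.le, inv_mul_cancel_left₀ hα.ne']
  have himg := hanti.hausdorffMeasure_preimage_le zero_le_one (largeFibres γ A t θ)
  rw [hausdorffMeasure_real] at himg
  rw [pos_iff_ne_zero]
  intro h0
  rw [h0, mul_zero] at himg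
  refine (h.trans_le (measure_mono ?_)).not_ge himg
  intro y hy
  refine ⟨Submodule.smul_mem _ _ (Submodule.mem_span_singleton_self _), ?_⟩
  have hset : L '' ({x : E3 | lineProj γ θ x = (α * y) • γ θ} ∩ A) = L '' A ∩ p ⁻¹' {y} := by
    have hγ0 : γ θ ≠ 0 := fun h => by simp [h] at hγ
    ext z
    simp only [mem_image, mem_inter_iff, mem_ofPred_eq, mem_preimage, mem_singleton_iff, lineProj]
    constructor
    · rintro ⟨x, ⟨hx, hxA⟩, rfl⟩
      have := smul_left_injective ℝ hγ0 hx
      simp only [hp] at this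
      exact ⟨⟨x, hxA, rfl⟩, mul_left_cancel₀ hα.ne' this⟩
    · rintro ⟨⟨x, hxA, rfl⟩, hx⟩
      exact ⟨x, ⟨by rw [hp, hx], hxA⟩, rfl⟩
  rw [← L.dimH_image, hset]
  exact hy

/-- Scaled coordinates with respect to the dual of a basis. -/
lemma exists_scaled_coordinates (v : Fin 3 → E3) (hv : LinearIndependent ℝ v) {r : ℝ} (hr : 0 < r) :
    ∃ L : E3 ≃L[ℝ] (Fin 3 → ℝ), ∀ x, L x =
      ![⟪x, v 0⟫ - r * ⟪x, v 1⟫, 2 * r * ⟪x, v 1⟫, 4 * r ^ 2 * ⟪x, v 2⟫] := by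
  let f : E3 →ₗ[ℝ] (Fin 3 → ℝ) :=
    { toFun := fun x => ![⟪x, v 0⟫ - r * ⟪x, v 1⟫, 2 * r * ⟪x, v 1⟫, 4 * r ^ 2 * ⟪x, v 2⟫]
      map_add' := fun x y => by
        ext i; fin_cases i <;> simp [inner_add_left] <;> ring
      map_smul' := fun c x => by
        ext i; fin_cases i <;> simp [inner_smul_left] <;> ring }
  have hspan : Submodule.span ℝ (range v) = ⊤ :=
    hv.span_eq_top_of_card_eq_finrank (by simp)
  have hinj : Function.Injective f := by
    refine (injective_iff_map_eq_zero f).2 fun x hx => ?_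
    have h1 : ⟪x, v 1⟫ = 0 := by
      have := congrFun hx 1
      simpa [f, hr.ne'] using this
    have h2 : ⟪x, v 2⟫ = 0 := by
      have := congrFun hx 2
      simpa [f, hr.ne'] using this
    have h0 : ⟪x, v 0⟫ = 0 := by
      have := congrFun hx 0
      simpa [f, h1] using this
    have hall : ∀ y : E3, ⟪x, y⟫ = 0 := by
      intro y
      have hy : y ∈ Submodule.span ℝ (range v) := hspan ▸ Submodule.mem_top
      induction hy using Submodule.span_induction with
      | mem y hy =>
        obtain ⟨i, rfl⟩ := hy
        fin_cases i
        exacts [h0, h1, h2]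
      | zero => simp
      | add y z _ _ h h' => rw [inner_add_right, h, h', add_zero]
      | smul c y _ h => rw [inner_smul_right, h, mul_zero]
    exact inner_self_eq_zero.1 (hall x)
  exact ⟨(f.linearEquivOfInjective hinj (by simp)).toContinuousLinearEquiv, fun x => rfl⟩

lemma exists_nhds_dimH_le {γ : ℝ → E3} (hγ : ContDiff ℝ 2 γ) {θ₀ t : ℝ} (ht : 1 < t)
    (hlin : LinearIndependent ℝ ![γ θ₀, deriv γ θ₀, deriv (deriv γ) θ₀])
    {A : Set E3} (hA : MeasurableSet A) (hpos : 0 < μH[t] A) :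
    ∃ W ∈ 𝓝 θ₀, dimH {θ | θ ∈ W ∧ ‖γ θ‖ = 1 ∧ μH[1] (largeFibres γ A t θ) = 0} ≤
      ENNReal.ofReal ((3 - t) / 2) := by
  set v : Fin 3 → E3 := ![γ θ₀, deriv γ θ₀, deriv (deriv γ) θ₀] with hv
  let B : Module.Basis (Fin 3) ℝ E3 := basisOfLinearIndependentOfCardEqFinrank hlin (by simp)
  have hB : ⇑B = v := coe_basisOfLinearIndependentOfCardEqFinrank _ _
  let ℓ : Fin 3 → E3 →L[ℝ] ℝ := fun i => LinearMap.toContinuousLinearMap (B.coord i)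
  have hℓ : ∀ i j, ℓ i (v j) = if j = i then 1 else 0 := by
    intro i j
    rw [← hB]
    simp [ℓ, Module.Basis.coord_apply, Finsupp.single_apply]
  have hγ1 : ContDiff ℝ 1 (deriv γ) := ((contDiff_succ_iff_deriv (n := 1)).1 hγ).2.2
  have hd : ∀ i, deriv (fun θ => ℓ i (γ θ)) = fun θ => ℓ i (deriv γ θ) := fun i => funext fun θ =>
    ((ℓ i).hasFDerivAt.comp_hasDerivAt θ (hγ.differentiable (by norm_num) θ).hasDerivAt).deriv
  have hdd : ∀ i, deriv (deriv fun θ => ℓ i (γ θ)) = fun θ => ℓ i (deriv (deriv γ) θ) := by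
    intro i
    rw [hd]
    exact funext fun θ =>
      ((ℓ i).hasFDerivAt.comp_hasDerivAt θ (hγ1.differentiable (by norm_num) θ).hasDerivAt).deriv
  have hc : ∀ i, ContDiff ℝ 2 fun θ => ℓ i (γ θ) := fun i => (ℓ i).contDiff.comp hγ
  obtain ⟨r, hr, ψ, m, h, K, hψ, hK, hev⟩ := exists_normCurve_reparam (θ₀ := θ₀) (hc 0) (hc 1) (hc 2)
    (by simpa [hv] using hℓ 0 0) (by simpa [hv] using hℓ 1 0) (by simpa [hv] using hℓ 2 0)
    (by rw [hd]; simpa [hv] using hℓ 0 1) (by rw [hd]; simpa [hv] using hℓ 1 1)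
    (by rw [hd]; simpa [hv] using hℓ 2 1) (by rw [hdd]; simpa [hv] using hℓ 2 2)
  obtain ⟨L, hL⟩ := exists_scaled_coordinates v hlin hr
  have hexp : ∀ θ, γ θ = ℓ 0 (γ θ) • v 0 + ℓ 1 (γ θ) • v 1 + ℓ 2 (γ θ) • v 2 := by
    intro θ
    have := B.sum_repr (γ θ)
    rw [Fin.sum_univ_three, hB] at this
    exact this.symm
  have hLA : MeasurableSet (L '' A) := L.toHomeomorph.measurableEmbedding.measurableSet_image.2 hA
  have hLpos : 0 < μH[t] (L '' A) := by
    rw [pos_iff_ne_zero]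
    intro h0
    have := L.symm.lipschitz.hausdorffMeasure_image_le (by linarith : 0 ≤ t) (L '' A)
    rw [h0, mul_zero, ← image_comp] at this
    simp only [Function.comp_def, L.symm_apply_apply, image_id'] at this
    exact hpos.not_ge this
  refine ⟨_, hev, ?_⟩
  refine (dimH_mono (t := h '' {φ : ℝ | φ ∈ Ico (0 : ℝ) 1 ∧
    volume {y : ℝ | ENNReal.ofReal (t - 1) ≤ dimH (L '' A ∩ coneLin ψ φ ⁻¹' {y})} = 0}) ?_).trans
    (((hK.mono fun φ hφ => hφ.1).dimH_image_le).trans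
      (dimH_small_fibres_le (by norm_num) ht hψ hLA hLpos))
  rintro θ ⟨⟨hα, s, hs, hhs, hβ, hδ⟩, hnorm, h0⟩
  refine ⟨s, ⟨hs, ?_⟩, hhs⟩
  by_contra hne
  refine (hausdorffMeasure_largeFibres_pos hnorm hα L (p := coneLin ψ s) (fun x => ?_)
    (pos_iff_ne_zero.2 hne)).ne' h0
  have hx := congrArg (fun y : E3 => ⟪x, y⟫) (hexp θ)
  simp only [inner_add_right, inner_smul_right, hβ, hδ] at hx
  rw [hx, hL]
  simp only [coneLin, Matrix.cons_val]
  ring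

end LinearChange

theorem fibres_of_dimension_at_least_t_sub_one_outside_small_exceptional_set
    -- the compact interval `I = [a, b]`
    (a b : ℝ) (hab : a ≤ b)
    -- `γ : I → S²` is a `C²` curve with `det(γ, γ', γ'') ≠ 0` on `I`
    (γ : ℝ → E3) (hγC2 : ContDiff ℝ 2 γ)
    (hsphere : ∀ θ ∈ Icc a b, ‖γ θ‖ = 1)
    (hnondeg : ∀ θ ∈ Icc a b,
      LinearIndependent ℝ ![γ θ, deriv γ θ, deriv (deriv γ) θ])
    (t : ℝ) (ht : 1 < t)
    (A : Set E3) (hA : MeasurableSet A) (hdimA : dimH A = ENNReal.ofReal t)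
    (hpos : 0 < μH[t] A) :
    ∃ E : Set ℝ, E ⊆ Icc a b ∧ dimH E ≤ ENNReal.ofReal ((3 - t) / 2) ∧
      ∀ θ ∈ Icc a b \ E,
        0 < μH[1] {y : E3 | y ∈ (Submodule.span ℝ {γ θ} : Submodule ℝ E3) ∧
          ENNReal.ofReal (t - 1) ≤ dimH ({x : E3 | lineProj γ θ x = y} ∩ A)} := by
  refine ⟨{θ | θ ∈ Icc a b ∧ μH[1] (largeFibres γ A t θ) = 0}, fun θ hθ => hθ.1, ?_, ?_⟩
  · by_contra hlt
    obtain ⟨θ₀, hθ₀, hlarge⟩ := exists_mem_nhdsWithin_lt_dimH_of_lt_dimH (not_le.1 hlt)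
    obtain ⟨W, hW, hdim⟩ := exists_nhds_dimH_le hγC2 ht (hnondeg θ₀ hθ₀.1) hA hpos
    refine (hlarge _ (inter_mem_nhdsWithin _ hW)).not_ge ((dimH_mono ?_).trans hdim)
    rintro θ ⟨⟨hθ, h0⟩, hθW⟩
    exact ⟨hθW, hsphere θ hθ, h0⟩
  · rintro θ ⟨hθ, hθE⟩
    exact pos_iff_ne_zero.2 fun h0 => hθE ⟨hθ, h0⟩
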